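/- Let α > 1 be a real number, let β be an irrational real algebraic number, let λ be a nonzero real algebraic number, and let ε > 0 be a real number. If there are infinitely many natural numbers n for which ‖λ·αⁿ + β‖ < 2^{−εn}, then α is transcendental. -/

import Mathlib

/-- The distance from a real number `x` to its nearest integer:
`‖x‖ = min {|x − m| : m ∈ ℤ}`. -/
noncomputable def distNearestInt (x : ℝ) : ℝ := ⨅ m : ℤ, |x - m|

noncomputable section

open MvPolynomial

/-- The Taylor expansion `f(X + Y)` as a polynomial in `Y` with coefficients in `R[X]`. -/
def taylorHom (σ R : Type*) [CommRing R] :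
    MvPolynomial σ R →ₐ[R] MvPolynomial σ (MvPolynomial σ R) :=
  aeval fun i => C (X i) + X i

/-- Divided partial derivatives. -/
def hasseD {σ R : Type*} [CommRing R] (i : σ →₀ ℕ) (f : MvPolynomial σ R) : MvPolynomial σ R :=
  coeff i (taylorHom σ R f)

/-- Translation of the variables by a point. -/
def shiftHom {σ R : Type*} [CommRing R] (x : σ → R) : MvPolynomial σ R →ₐ[R] MvPolynomial σ R :=
  aeval fun i => X i + C (x i)

section taylor
variable {σ τ R R' : Type*} [CommRing R] [CommRing R']

lemma hasseD_add (i : σ →₀ ℕ) (f g : MvPolynomial σ R) :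
    hasseD i (f + g) = hasseD i f + hasseD i g := by simp [hasseD]

lemma hasseD_sum {ι : Type*} (s : Finset ι) (i : σ →₀ ℕ) (f : ι → MvPolynomial σ R) :
    hasseD i (∑ b ∈ s, f b) = ∑ b ∈ s, hasseD i (f b) := by
  simp [hasseD, coeff_sum]

lemma taylorHom_map (φ : R →+* R') (f : MvPolynomial σ R) :
    taylorHom σ R' (map φ f) = map (map φ) (taylorHom σ R f) := by
  induction f using MvPolynomial.induction_on with
  | C a => simp [taylorHom, MvPolynomial.algebraMap_eq,
      IsScalarTower.algebraMap_apply R (MvPolynomial σ R) (MvPolynomial σ (MvPolynomial σ R)),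
      IsScalarTower.algebraMap_apply R' (MvPolynomial σ R') (MvPolynomial σ (MvPolynomial σ R'))]
  | add p q hp hq => simp [hp, hq]
  | mul_X p i hp => simp only [map_mul, hp]; simp [taylorHom]

lemma hasseD_map (φ : R →+* R') (i : σ →₀ ℕ) (f : MvPolynomial σ R) :
    hasseD i (map φ f) = map φ (hasseD i f) := by
  simp [hasseD, taylorHom_map, coeff_map]

lemma taylorHom_shift (x : σ → R) (f : MvPolynomial σ R) :
    taylorHom σ R (shiftHom x f) = map (shiftHom x).toRingHom (taylorHom σ R f) := by
  induction f using MvPolynomial.induction_on with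
  | C a => simp [taylorHom, shiftHom, MvPolynomial.algebraMap_eq,
      IsScalarTower.algebraMap_apply R (MvPolynomial σ R) (MvPolynomial σ (MvPolynomial σ R))]
  | add p q hp hq => simp [hp, hq]
  | mul_X p i hp =>
    simp only [map_mul, hp]
    simp [taylorHom, shiftHom, MvPolynomial.algebraMap_eq,
      IsScalarTower.algebraMap_apply R (MvPolynomial σ R) (MvPolynomial σ (MvPolynomial σ R))]
    ring

lemma hasseD_shift (x : σ → R) (i : σ →₀ ℕ) (f : MvPolynomial σ R) :
    hasseD i (shiftHom x f) = shiftHom x (hasseD i f) := by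
  simp [hasseD, taylorHom_shift, coeff_map]

lemma taylorHom_rename (e : σ → τ) (f : MvPolynomial σ R) :
    taylorHom τ R (rename e f) = rename e (map (rename e).toRingHom (taylorHom σ R f)) := by
  induction f using MvPolynomial.induction_on with
  | C a => simp [taylorHom, MvPolynomial.algebraMap_eq,
      IsScalarTower.algebraMap_apply R (MvPolynomial σ R) (MvPolynomial σ (MvPolynomial σ R)),
      IsScalarTower.algebraMap_apply R (MvPolynomial τ R) (MvPolynomial τ (MvPolynomial τ R))]
  | add p q hp hq => simp [hp, hq]
  | mul_X p i hp =>
    simp only [map_mul, hp]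
    simp [taylorHom]

lemma coeff_rename_mul_rename {υ : Type*} (e : σ → υ) (e' : τ → υ) (he : e.Injective)
    (he' : e'.Injective) (hd : ∀ a b, e a ≠ e' b) (p : MvPolynomial σ R) (q : MvPolynomial τ R)
    (i : σ →₀ ℕ) (j : τ →₀ ℕ) :
    coeff (i.mapDomain e + j.mapDomain e') (rename e p * rename e' q) = coeff i p * coeff j q := by
  classical
  have key : ∀ (i i' : σ →₀ ℕ) (j j' : τ →₀ ℕ), i.mapDomain e + j.mapDomain e' =
      i'.mapDomain e + j'.mapDomain e' → i = i' ∧ j = j' := by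
    intro i i' j j' h
    constructor
    · ext a
      have := DFunLike.congr_fun h (e a)
      simpa [Finsupp.mapDomain_apply he, Finsupp.mapDomain_of_notMem_range _ (e a)
        (by rintro ⟨b, hb⟩; exact hd a b hb.symm : e a ∉ Set.range e')] using this
    · ext a
      have := DFunLike.congr_fun h (e' a)
      simpa [Finsupp.mapDomain_apply he', Finsupp.mapDomain_of_notMem_range _ (e' a)
        (by rintro ⟨b, hb⟩; exact hd b a hb : e' a ∉ Set.range e)] using this
  induction p using MvPolynomial.induction_on' with
  | add p₁ p₂ h₁ h₂ => simp [add_mul, h₁, h₂]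
  | monomial u a =>
    induction q using MvPolynomial.induction_on' with
    | add p₁ p₂ h₁ h₂ => simp only [map_add, mul_add, coeff_add, h₁, h₂]
    | monomial w b =>
      simp only [rename_monomial, monomial_mul, coeff_monomial]
      by_cases h : u = i ∧ w = j
      · simp [h.1, h.2]
      · rw [if_neg (fun hh => h (key _ _ _ _ hh))]
        by_cases h1 : u = i
        · rw [if_neg (fun hw => h ⟨h1, hw⟩), mul_zero]
        · rw [if_neg h1, zero_mul]

lemma hasseD_rename_mul_rename {υ : Type*} (e : σ → υ) (e' : τ → υ) (he : e.Injective)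
    (he' : e'.Injective) (hd : ∀ a b, e a ≠ e' b) (p : MvPolynomial σ R) (q : MvPolynomial τ R)
    (i : σ →₀ ℕ) (j : τ →₀ ℕ) :
    hasseD (i.mapDomain e + j.mapDomain e') (rename e p * rename e' q) =
      rename e (hasseD i p) * rename e' (hasseD j q) := by
  simp only [hasseD, map_mul, taylorHom_rename]
  rw [coeff_rename_mul_rename e e' he he' hd, coeff_map, coeff_map]
  rfl

lemma shiftHom_rename (e : σ → τ) (x : τ → R) (f : MvPolynomial σ R) :
    shiftHom x (rename e f) = rename e (shiftHom (x ∘ e) f) := by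
  induction f using MvPolynomial.induction_on with
  | C a => simp [shiftHom, MvPolynomial.algebraMap_eq]
  | add p q hp hq => simp [hp, hq]
  | mul_X p i hp =>
    simp only [map_mul, hp]
    simp [shiftHom]

lemma taylorHom_monomial [Fintype σ] [DecidableEq σ] (m : σ →₀ ℕ) (c : R) :
    taylorHom σ R (monomial m c) = ∑ p ∈ Fintype.piFinset fun h => Finset.range (m h + 1),
      monomial (Finsupp.equivFunOnFinite.symm p)
        (monomial (m - Finsupp.equivFunOnFinite.symm p) (c * ∏ h, ((m h).choose (p h) : R))) := by
  classical
  have h1 : taylorHom σ R (monomial m c) =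
      C (C c) * ∏ h, (X h + C (X h)) ^ m h := by
    simp [taylorHom, aeval_monomial, Finsupp.prod_fintype, MvPolynomial.algebraMap_eq,
      IsScalarTower.algebraMap_apply R (MvPolynomial σ R) (MvPolynomial σ (MvPolynomial σ R)), add_comm]
  rw [h1]
  simp_rw [add_pow]
  rw [Finset.prod_univ_sum, Finset.mul_sum]
  refine Finset.sum_congr rfl fun p hp => ?_
  rw [Finset.prod_mul_distrib, Finset.prod_mul_distrib]
  have h2 : (∏ h, (X h : MvPolynomial σ (MvPolynomial σ R)) ^ p h) =
      monomial (Finsupp.equivFunOnFinite.symm p) 1 := by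
    rw [monomial_eq, Finsupp.prod_fintype] <;> simp
  have h3 : (∏ h, (C (X h) : MvPolynomial σ (MvPolynomial σ R)) ^ (m h - p h)) =
      C (monomial (m - Finsupp.equivFunOnFinite.symm p) 1) := by
    rw [monomial_eq, Finsupp.prod_fintype] <;> simp
  have h4 : (∏ h, (((m h).choose (p h) : ℕ) : MvPolynomial σ (MvPolynomial σ R))) =
      C (C (∏ h, ((m h).choose (p h) : R))) := by simp
  rw [h2, h3, h4, mul_comm (monomial _ _), mul_right_comm, ← C_mul, C_mul_monomial, mul_one,
    C_mul_monomial, mul_comm (monomial _ _), C_mul_monomial, mul_one, C_mul_monomial]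

lemma hasseD_monomial [Fintype σ] (i m : σ →₀ ℕ) (c : R) :
    hasseD i (monomial m c) = monomial (m - i) (c * ∏ h, ((m h).choose (i h) : R)) := by
  classical
  rw [hasseD, taylorHom_monomial, coeff_sum]
  simp only [coeff_monomial]
  by_cases hi : ∀ h, i h ≤ m h
  · rw [Finset.sum_eq_single (i : σ → ℕ)]
    · simp
    · intro b _ hb
      rw [if_neg]
      rintro rfl
      simp at hb
    · intro h
      exact absurd (by simpa [Nat.lt_succ_iff] using hi) h
  · push Not at hi
    obtain ⟨h, hh⟩ := hi
    rw [Finset.sum_eq_zero, Finset.prod_eq_zero (Finset.mem_univ h)]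
    · simp
    · simp [Nat.choose_eq_zero_of_lt hh]
    · intro p hp
      rw [if_neg]
      rintro rfl
      have := (Fintype.mem_piFinset.1 hp) h
      simp at this
      simp at hh
      omega

lemma coeff_hasseD [Fintype σ] (i n : σ →₀ ℕ) (f : MvPolynomial σ R) :
    coeff n (hasseD i f) = (∏ h, (((n + i) h).choose (i h) : R)) * coeff (n + i) f := by
  classical
  induction f using MvPolynomial.induction_on' with
  | add p q hp hq => simp [hasseD_add, mul_add, hp, hq]
  | monomial m c =>
    rw [hasseD_monomial, coeff_monomial, coeff_monomial]
    by_cases h : m = n + i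
    · subst h
      simp [mul_comm]
    · rw [if_neg h, mul_zero]
      split_ifs with h2
      · have : ∃ h, m h < i h := by
          by_contra hc
          push Not at hc
          apply h
          rw [← h2, tsub_add_cancel_of_le hc]
        obtain ⟨h, hh⟩ := this
        rw [Finset.prod_eq_zero (Finset.mem_univ h), mul_zero]
        simp [Nat.choose_eq_zero_of_lt hh]
      · rfl

end taylor

section wronskian

lemma coeff_prod_sum_of_natDegree_le {ι R : Type*} [CommRing R] (s : Finset ι)
    (f : ι → Polynomial R) (d : ι → ℕ) (h : ∀ b ∈ s, (f b).natDegree ≤ d b) :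
    (∏ b ∈ s, f b).coeff (∑ b ∈ s, d b) = ∏ b ∈ s, (f b).coeff (d b) := by
  classical
  induction s using Finset.induction_on with
  | empty => simp
  | insert a s ha ih =>
    rw [Finset.prod_insert ha, Finset.sum_insert ha, Finset.prod_insert ha,
      Polynomial.coeff_mul_add_eq_of_natDegree_le (h a (by simp)), ih fun b hb => h b (by simp [hb])]
    refine (Polynomial.natDegree_prod_le _ _).trans (Finset.sum_le_sum fun b hb => ?_)
    exact h b (by simp [hb])

/-- The Euler operator `T d/dT`. -/
def eulerD : Polynomial ℚ →ₗ[ℚ] Polynomial ℚ :=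
  (LinearMap.mulLeft ℚ Polynomial.X).comp Polynomial.derivative

lemma coeff_eulerD_pow (a : ℕ) (f : Polynomial ℚ) (j : ℕ) :
    ((eulerD ^ a) f).coeff j = (j : ℚ) ^ a * f.coeff j := by
  induction a with
  | zero => simp
  | succ a ih =>
    rw [pow_succ', Module.End.mul_apply]
    cases j with
    | zero => simp [eulerD]
    | succ j =>
      simp only [eulerD, LinearMap.comp_apply, LinearMap.mulLeft_apply, Polynomial.coeff_X_mul,
        Polynomial.coeff_derivative]
      rw [show (LinearMap.mulLeft ℚ Polynomial.X ∘ₗ Polynomial.derivative) = eulerD from rfl, ih]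
      push_cast
      ring

lemma natDegree_eulerD_pow_le (a : ℕ) (f : Polynomial ℚ) :
    ((eulerD ^ a) f).natDegree ≤ f.natDegree := by
  refine Polynomial.natDegree_le_iff_coeff_eq_zero.2 fun j hj => ?_
  rw [coeff_eulerD_pow, Polynomial.coeff_eq_zero_of_natDegree_lt hj, mul_zero]

lemma det_eulerD_ne_zero_of_injective {l : ℕ} (χ : Fin l → Polynomial ℚ) (h0 : ∀ b, χ b ≠ 0)
    (hinj : Function.Injective fun b => (χ b).natDegree) :
    (Matrix.of fun a b : Fin l => (eulerD ^ (a : ℕ)) (χ b)).det ≠ 0 := by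
  intro hdet
  have h1 := congrArg (fun p : Polynomial ℚ => p.coeff (∑ b, (χ b).natDegree)) hdet
  simp only [Matrix.det_apply, Polynomial.finsetSum_coeff, Polynomial.coeff_smul,
    Polynomial.coeff_zero, Matrix.of_apply] at h1
  have h2 : (Matrix.of fun a b : Fin l =>
      ((χ b).natDegree : ℚ) ^ (a : ℕ) * (χ b).leadingCoeff).det = 0 := by
    rw [Matrix.det_apply, ← h1]
    refine Finset.sum_congr rfl fun p _ => ?_
    congr 1
    rw [coeff_prod_sum_of_natDegree_le]
    · refine Finset.prod_congr rfl fun b _ => ?_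
      rw [coeff_eulerD_pow]
      rfl
    · intro b _
      exact natDegree_eulerD_pow_le _ _
  have h3 : (Matrix.of fun a b : Fin l =>
      ((χ b).natDegree : ℚ) ^ (a : ℕ) * (χ b).leadingCoeff) =
      (Matrix.vandermonde fun b => ((χ b).natDegree : ℚ)).transpose *
        Matrix.diagonal fun b => (χ b).leadingCoeff := by
    ext a b
    simp [Matrix.mul_diagonal, Matrix.vandermonde]
  rw [h3, Matrix.det_mul, Matrix.det_transpose, Matrix.det_diagonal] at h2
  rcases mul_eq_zero.1 h2 with h2 | h2
  · refine Matrix.det_vandermonde_ne_zero_iff.2 ?_ h2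
    intro b b' hb
    exact hinj (by simpa using hb)
  · obtain ⟨b, -, hb⟩ := Finset.prod_eq_zero_iff.1 h2
    exact h0 b (Polynomial.leadingCoeff_eq_zero.1 hb)

lemma exists_echelon {l : ℕ} (ψ : Fin l → Polynomial ℚ) (hψ : LinearIndependent ℚ ψ) :
    ∃ g : Matrix (Fin l) (Fin l) ℚ, g.det ≠ 0 ∧ (∀ b, ∑ c, g b c • ψ c ≠ 0) ∧
      Function.Injective fun b => (∑ c, g b c • ψ c).natDegree := by
  classical
  have hne : ∀ g : Matrix (Fin l) (Fin l) ℚ, g.det ≠ 0 → ∀ b, ∑ c, g b c • ψ c ≠ 0 := by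
    intro g hg b hb
    apply hg
    have := Fintype.linearIndependent_iff.1 hψ _ hb
    exact Matrix.det_eq_zero_of_row_eq_zero b this
  let deg : Matrix (Fin l) (Fin l) ℚ → ℕ := fun g => ∑ b, (∑ c, g b c • ψ c).natDegree
  obtain ⟨g, hg, hmin⟩ : ∃ g : Matrix (Fin l) (Fin l) ℚ, g.det ≠ 0 ∧
      ∀ g' : Matrix (Fin l) (Fin l) ℚ, g'.det ≠ 0 → deg g ≤ deg g' := by
    have hex : ∃ n, ∃ g : Matrix (Fin l) (Fin l) ℚ, g.det ≠ 0 ∧ deg g = n := ⟨_, 1, by simp, rfl⟩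
    obtain ⟨g, hg, hgn⟩ := Nat.find_spec hex
    refine ⟨g, hg, fun g' hg' => ?_⟩
    rw [hgn]
    exact Nat.find_min' hex ⟨g', hg', rfl⟩
  refine ⟨g, hg, hne g hg, ?_⟩
  intro a b hab
  by_contra hne'
  set χ : Fin l → Polynomial ℚ := fun b => ∑ c, g b c • ψ c with hχ
  let t : ℚ := -((χ a).leadingCoeff / (χ b).leadingCoeff)
  let g' := g.updateRow a (g a + t • g b)
  have hg' : g'.det ≠ 0 := by
    rw [Matrix.det_updateRow_add_smul_self _ hne']
    exact hg
  have hrow : ∑ c, g' a c • ψ c = χ a + t • χ b := by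
    simp only [g', Matrix.updateRow_self, hχ, Finset.smul_sum, ← Finset.sum_add_distrib]
    refine Finset.sum_congr rfl fun c _ => ?_
    simp [add_smul, mul_smul]
  have hlt : (∑ c, g' a c • ψ c).natDegree < (χ a).natDegree := by
    have h0 := hne g' hg' a
    rw [hrow] at h0 ⊢
    have hlb : (χ b).leadingCoeff ≠ 0 := Polynomial.leadingCoeff_ne_zero.2 (hne g hg b)
    have hdeg : (χ a + t • χ b).natDegree ≤ (χ a).natDegree := by
      refine (Polynomial.natDegree_add_le _ _).trans (max_le le_rfl ?_)
      refine (Polynomial.natDegree_smul_le _ _).trans (le_of_eq ?_)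
      exact hab.symm
    refine lt_of_le_of_ne hdeg fun heq => h0 ?_
    rw [← Polynomial.leadingCoeff_eq_zero, Polynomial.leadingCoeff, heq]
    rw [Polynomial.coeff_add, Polynomial.coeff_smul]
    have : (χ b).coeff (χ a).natDegree = (χ b).leadingCoeff := by
      rw [Polynomial.leadingCoeff]; congr 1
    rw [this, Polynomial.coeff_natDegree, smul_eq_mul]
    simp only [t]
    field_simp
    ring
  refine absurd (hmin g' hg') (not_le.2 ?_)
  refine Finset.sum_lt_sum (fun c _ => ?_) ⟨a, Finset.mem_univ _, hlt⟩
  by_cases hc : c = a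
  · subst hc; exact hlt.le
  · simp [g', Matrix.updateRow_ne hc]

lemma det_eulerD_ne_zero {l : ℕ} (ψ : Fin l → Polynomial ℚ) (hψ : LinearIndependent ℚ ψ) :
    (Matrix.of fun a b : Fin l => (eulerD ^ (a : ℕ)) (ψ b)).det ≠ 0 := by
  obtain ⟨g, -, h0, hinj⟩ := exists_echelon ψ hψ
  have h := det_eulerD_ne_zero_of_injective _ h0 hinj
  intro hdet
  apply h
  have : (Matrix.of fun a b : Fin l => (eulerD ^ (a : ℕ)) (∑ c, g b c • ψ c)) =
      (Matrix.of fun a b : Fin l => (eulerD ^ (a : ℕ)) (ψ b)) *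
        (g.map Polynomial.C).transpose := by
    ext1 a b
    simp only [Matrix.mul_apply, map_sum, map_smul, Matrix.of_apply, Matrix.transpose_apply,
      Matrix.map_apply]
    exact Finset.sum_congr rfl fun c _ => by rw [Polynomial.smul_eq_C_mul, mul_comm]
  rw [this, Matrix.det_mul, hdet, zero_mul]

lemma MultilinearMap.exists_ne_zero_of_mem_span {ι R M N : Type*} [Finite ι] [CommRing R]
    [AddCommGroup M] [Module R M] [AddCommGroup N] [Module R N]
    (f : MultilinearMap R (fun _ : ι => M) N) (T : ι → Set M) (v : ι → M)
    (hv : ∀ a, v a ∈ Submodule.span R (T a)) (hf : f v ≠ 0) :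
    ∃ w : ι → M, (∀ a, w a ∈ T a) ∧ f w ≠ 0 := by
  classical
  have := Fintype.ofFinite ι
  have key : ∀ s : Finset ι, ∃ w : ι → M, (∀ a ∈ s, w a ∈ T a) ∧ (∀ a ∉ s, w a = v a) ∧
      f w ≠ 0 := by
    intro s
    induction s using Finset.induction_on with
    | empty => exact ⟨v, by simp, by simp, hf⟩
    | insert b s hb ih =>
      obtain ⟨w, h1, h2, h3⟩ := ih
      have : ∃ t ∈ T b, f (Function.update w b t) ≠ 0 := by
        by_contra hc
        push Not at hc
        apply h3
        have : Submodule.span R (T b) ≤ LinearMap.ker (f.toLinearMap w b) :=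
          Submodule.span_le.2 fun t ht => by simpa using hc t ht
        have h4 := this (hv b)
        rw [← h2 b hb] at h4
        simpa using h4
      obtain ⟨t, ht, h5⟩ := this
      refine ⟨Function.update w b t, ?_, ?_, h5⟩
      · intro a ha
        by_cases hab : a = b
        · subst hab; simpa using ht
        · rw [Function.update_of_ne hab]
          exact h1 a (by simpa [hab] using ha)
      · intro a ha
        simp only [Finset.mem_insert, not_or] at ha
        rw [Function.update_of_ne ha.1]
        exact h2 a ha.2
  obtain ⟨w, h1, -, h3⟩ := key Finset.univ
  exact ⟨w, fun a => h1 a (Finset.mem_univ a), h3⟩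

/-- The operator multiplying the coefficient of `X ^ m` by `u m`. -/
def diagOp {σ : Type*} (f : MvPolynomial σ ℚ) : ((σ →₀ ℕ) → ℚ) →ₗ[ℚ] MvPolynomial σ ℚ where
  toFun u := ∑ m ∈ f.support, monomial m (u m * coeff m f)
  map_add' u w := by simp [add_mul, Finset.sum_add_distrib]
  map_smul' c u := by simp [Finset.smul_sum, smul_monomial, mul_assoc]

/-- Product of binomial coefficients. -/
def multichoose {σ : Type*} [Fintype σ] (i m : σ →₀ ℕ) : ℚ := ∏ h, ((m h).choose (i h) : ℚ)

lemma diagOp_multichoose {σ : Type*} [Fintype σ] (f : MvPolynomial σ ℚ) (i : σ →₀ ℕ) :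
    diagOp f (multichoose i) = monomial i 1 * hasseD i f := by
  conv_rhs => rw [f.as_sum]
  rw [hasseD_sum, Finset.mul_sum]
  refine Finset.sum_congr rfl fun m _ => ?_
  rw [hasseD_monomial, monomial_mul, one_mul, mul_comm]
  by_cases hi : i ≤ m
  · rw [add_tsub_cancel_of_le hi]; rfl
  · have : ∃ h, m h < i h := by
      by_contra hc
      push Not at hc
      exact hi hc
    obtain ⟨h, hh⟩ := this
    have h0 : ∏ h, ((m h).choose (i h) : ℚ) = 0 :=
      Finset.prod_eq_zero (Finset.mem_univ h) (by simp [Nat.choose_eq_zero_of_lt hh])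
    rw [multichoose, h0]
    simp

lemma weight_pow_mem_span {σ : Type*} [Fintype σ] (N : σ → ℕ) (a : ℕ) :
    (fun m : σ →₀ ℕ => ((∑ h, m h * N h : ℕ) : ℚ) ^ a) ∈
      Submodule.span ℚ (multichoose '' {i : σ →₀ ℕ | i.degree ≤ a}) := by
  classical
  induction a with
  | zero =>
    refine Submodule.subset_span ⟨0, by simp, ?_⟩
    ext m
    simp [multichoose]
  | succ a ih =>
    let W : (σ →₀ ℕ) → ℚ := fun m => ((∑ h, m h * N h : ℕ) : ℚ)
    let mulW : ((σ →₀ ℕ) → ℚ) →ₗ[ℚ] ((σ →₀ ℕ) → ℚ) := LinearMap.mulLeft ℚ W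
    have h1 : (fun m : σ →₀ ℕ => ((∑ h, m h * N h : ℕ) : ℚ) ^ (a + 1)) =
        mulW (fun m : σ →₀ ℕ => ((∑ h, m h * N h : ℕ) : ℚ) ^ a) := by
      ext m
      simp [mulW, W, pow_succ']
    rw [h1]
    suffices Submodule.span ℚ (multichoose '' {i : σ →₀ ℕ | i.degree ≤ a}) ≤
        (Submodule.span ℚ (multichoose '' {i : σ →₀ ℕ | i.degree ≤ a + 1})).comap mulW from this ih
    refine Submodule.span_le.2 ?_
    rintro _ ⟨i, hi, rfl⟩
    have h2 : mulW (multichoose i) = ∑ h, ((N h * i h : ℚ) • multichoose i +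
        (N h * (i h + 1) : ℚ) • multichoose (i + Finsupp.single h 1)) := by
      ext m
      simp only [mulW, W, LinearMap.mulLeft_apply, Pi.mul_apply, Finset.sum_apply, Pi.add_apply,
        Pi.smul_apply, smul_eq_mul]
      push_cast
      rw [Finset.sum_mul]
      refine Finset.sum_congr rfl fun h _ => ?_
      have h3 : multichoose (i + Finsupp.single h 1) m * (i h + 1) =
          multichoose i m * (m h - i h) := by
        rw [multichoose, multichoose, ← Finset.mul_prod_erase _ _ (Finset.mem_univ h),
          ← Finset.mul_prod_erase (a := h) _ (fun h => ((m h).choose (i h) : ℚ)) (Finset.mem_univ h)]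
        have h4 : ∏ x ∈ Finset.univ.erase h, ((m x).choose ((i + Finsupp.single h 1 : σ →₀ ℕ) x) : ℚ) =
            ∏ x ∈ Finset.univ.erase h, ((m x).choose (i x) : ℚ) := by
          refine Finset.prod_congr rfl fun x hx => ?_
          have : x ≠ h := (Finset.mem_erase.1 hx).1
          simp [this.symm]
        rw [h4]
        have h5 := Nat.choose_succ_right_eq (m h) (i h)
        have h6 : ((m h).choose (i h + 1) : ℚ) * (i h + 1) = (m h).choose (i h) * (m h - i h) := by
          rcases le_or_gt (i h) (m h) with hle | hlt
          · have := congrArg (Nat.cast (R := ℚ)) h5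
            push_cast [Nat.cast_sub hle] at this
            exact this
          · simp [Nat.choose_eq_zero_of_lt hlt, Nat.choose_eq_zero_of_lt (Nat.lt_succ_of_lt hlt)]
        simp only [Finsupp.add_apply, Finsupp.single_eq_same]
        linear_combination (∏ x ∈ Finset.univ.erase h, ((m x).choose (i x) : ℚ)) * h6
      linear_combination -(N h : ℚ) * h3
    rw [SetLike.mem_coe, Submodule.mem_comap, h2]
    refine Submodule.sum_mem _ fun h _ => Submodule.add_mem _ (Submodule.smul_mem _ _ ?_)
      (Submodule.smul_mem _ _ ?_)
    · exact Submodule.subset_span ⟨i, le_trans hi (Nat.le_succ a), rfl⟩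
    · refine Submodule.subset_span ⟨_, ?_, rfl⟩
      have : i.degree ≤ a := hi
      simp only [Set.mem_ofPred_eq, map_add, Finsupp.degree_single]
      omega

/-- Kronecker substitution. -/
def kroneckerHom {σ : Type*} (N : σ → ℕ) : MvPolynomial σ ℚ →ₐ[ℚ] Polynomial ℚ :=
  aeval fun h => Polynomial.X ^ N h

lemma kroneckerHom_monomial {σ : Type*} [Fintype σ] (N : σ → ℕ) (m : σ →₀ ℕ) (c : ℚ) :
    kroneckerHom N (monomial m c) = Polynomial.monomial (∑ h, m h * N h) c := by
  rw [kroneckerHom, aeval_monomial, Finsupp.prod_fintype _ _ (by simp)]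
  simp only [← pow_mul, Finset.prod_pow_eq_pow_sum]
  rw [← Polynomial.C_mul_X_pow_eq_monomial]
  congr 2
  exact Finset.sum_congr rfl fun h _ => mul_comm _ _

lemma kroneckerHom_diagOp {σ : Type*} [Fintype σ] (N : σ → ℕ) (a : ℕ) (f : MvPolynomial σ ℚ) :
    kroneckerHom N (diagOp f fun m => ((∑ h, m h * N h : ℕ) : ℚ) ^ a) =
      (eulerD ^ a) (kroneckerHom N f) := by
  conv_rhs => rw [f.as_sum]
  simp only [diagOp, LinearMap.coe_mk, AddHom.coe_mk, map_sum]
  refine Finset.sum_congr rfl fun m _ => ?_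
  ext j
  rw [kroneckerHom_monomial, kroneckerHom_monomial, coeff_eulerD_pow]
  simp only [Polynomial.coeff_monomial]
  split_ifs with h
  · rw [h]
  · simp

lemma exists_kroneckerHom_injective {σ : Type*} [Fintype σ] (B : ℕ) :
    ∃ N : σ → ℕ, ∀ f : MvPolynomial σ ℚ, (∀ m ∈ f.support, ∀ h, m h < B) →
      kroneckerHom N f = 0 → f = 0 := by
  classical
  let e := Fintype.equivFin σ
  refine ⟨fun h => B ^ (e h : ℕ), fun f hf h0 => ?_⟩
  ext m
  rw [coeff_zero]
  by_contra hm
  have hms : m ∈ f.support := by simpa using hm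
  have h1 := congrArg (fun p : Polynomial ℚ => p.coeff (∑ h, m h * B ^ (e h : ℕ))) h0
  simp only [Polynomial.coeff_zero] at h1
  rw [f.as_sum, map_sum, Polynomial.finsetSum_coeff, Finset.sum_eq_single m] at h1
  · rw [kroneckerHom_monomial, Polynomial.coeff_monomial, if_pos rfl] at h1
    exact hm h1
  · intro m' hm' hne
    rw [kroneckerHom_monomial, Polynomial.coeff_monomial, if_neg]
    intro heq
    apply hne
    have key : ∀ m : σ →₀ ℕ, (hm : ∀ h, m h < B) → ∑ h, m h * B ^ (e h : ℕ) =
        (finFunctionFinEquiv (fun j : Fin (Fintype.card σ) =>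
          (⟨m (e.symm j), hm _⟩ : Fin B)) : ℕ) := by
      intro m hm
      rw [finFunctionFinEquiv_apply, ← Equiv.sum_comp e]
      simp
    rw [key m' (hf m' hm'), key m (hf m hms)] at heq
    have h2 := finFunctionFinEquiv.injective (Fin.ext heq)
    ext h
    have h3 := congrFun h2 (e h)
    simpa using h3
  · intro h
    exact absurd hms h

/-- Generalized Wronskians: linearly independent polynomials have a nonvanishing determinant of
divided derivatives whose orders are at most the row index. -/
theorem exists_hasseD_det_ne_zero {σ : Type*} [Fintype σ] {l : ℕ} (φ : Fin l → MvPolynomial σ ℚ)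
    (hφ : LinearIndependent ℚ φ) :
    ∃ i : Fin l → σ →₀ ℕ, (∀ a, (i a).degree ≤ a) ∧
      (Matrix.of fun a b => hasseD (i a) (φ b)).det ≠ 0 := by
  classical
  obtain ⟨N, hN⟩ := exists_kroneckerHom_injective (σ := σ)
    ((Finset.univ.sup fun b => (φ b).support.sup fun m => m.degree) + 1)
  have hli : LinearIndependent ℚ fun b => kroneckerHom N (φ b) := by
    rw [Fintype.linearIndependent_iff] at hφ ⊢
    intro g hg
    apply hφ
    apply hN
    · intro m hm h
      have hm' : coeff m (∑ b, g b • φ b) ≠ 0 := by simpa using hm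
      rw [coeff_sum] at hm'
      obtain ⟨b, -, hb⟩ := Finset.exists_ne_zero_of_sum_ne_zero hm'
      have hb' : m ∈ (φ b).support := by
        rw [mem_support_iff]
        intro h
        simp [h] at hb
      refine Nat.lt_succ_of_le (le_trans (Finsupp.le_degree h m) ?_)
      exact le_trans (Finset.le_sup (f := fun m => m.degree) hb')
        (Finset.le_sup (f := fun b => (φ b).support.sup fun m => m.degree) (Finset.mem_univ b))
    · simpa using hg
  have hdet := det_eulerD_ne_zero _ hli
  let F : MultilinearMap ℚ (fun _ : Fin l => (σ →₀ ℕ) → ℚ) (MvPolynomial σ ℚ) :=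
    ((Matrix.detRowAlternating (R := MvPolynomial σ ℚ) (n := Fin l)).toMultilinearMap.restrictScalars
      ℚ).compLinearMap fun _ => LinearMap.pi fun b => diagOp (φ b)
  have hF : ∀ u, F u = (Matrix.of fun a b => diagOp (φ b) (u a)).det := fun u => rfl
  obtain ⟨w, hw, hw0⟩ := F.exists_ne_zero_of_mem_span
    (fun a => multichoose '' {i : σ →₀ ℕ | i.degree ≤ a})
    (fun a => fun m : σ →₀ ℕ => ((∑ h, m h * N h : ℕ) : ℚ) ^ (a : ℕ))
    (fun a => weight_pow_mem_span N a) (by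
      intro h0
      apply hdet
      rw [hF] at h0
      have := congrArg (kroneckerHom N) h0
      rw [map_zero, AlgHom.map_det] at this
      rw [← this]
      congr 1
      ext1 a b
      simp only [Matrix.of_apply, AlgHom.mapMatrix_apply, Matrix.map_apply, kroneckerHom_diagOp])
  choose i hi hiw using hw
  refine ⟨i, hi, fun h0 => hw0 ?_⟩
  rw [hF]
  have : (Matrix.of fun a b => diagOp (φ b) (w a)) = Matrix.of fun a b =>
      (fun a => (monomial (i a) 1 : MvPolynomial σ ℚ)) a *
        (Matrix.of fun a b => hasseD (i a) (φ b)) a b := by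
    ext1 a b
    simp [← hiw, diagOp_multichoose]
  rw [this, Matrix.det_mul_column, h0, mul_zero]

end wronskian

/-- The weighted length of a polynomial with respect to an absolute value. -/
def wl {σ R : Type*} [CommRing R] (v : AbsoluteValue R ℝ) (ρ : σ → ℝ) (f : MvPolynomial σ R) : ℝ :=
  ∑ m ∈ f.support, v (coeff m f) * m.prod fun i e => ρ i ^ e

section wl
variable {σ τ R R' : Type*} [CommRing R] [CommRing R'] (v : AbsoluteValue R ℝ) {ρ : σ → ℝ}

lemma finsuppProd_pow_nonneg (hρ : ∀ i, 0 ≤ ρ i) (m : σ →₀ ℕ) :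
    0 ≤ m.prod fun i e => ρ i ^ e :=
  Finset.prod_nonneg fun i _ => pow_nonneg (hρ i) _

lemma wl_nonneg (hρ : ∀ i, 0 ≤ ρ i) (f : MvPolynomial σ R) : 0 ≤ wl v ρ f :=
  Finset.sum_nonneg fun m _ => mul_nonneg (v.nonneg _) (finsuppProd_pow_nonneg hρ m)

lemma wl_eq_sum_of_subset {s : Finset (σ →₀ ℕ)} {f : MvPolynomial σ R} (h : f.support ⊆ s) :
    wl v ρ f = ∑ m ∈ s, v (coeff m f) * m.prod fun i e => ρ i ^ e := by
  refine Finset.sum_subset h fun m _ hm => ?_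
  rw [notMem_support_iff.1 hm]
  simp

lemma wl_add_le (hρ : ∀ i, 0 ≤ ρ i) (f g : MvPolynomial σ R) :
    wl v ρ (f + g) ≤ wl v ρ f + wl v ρ g := by
  classical
  rw [wl_eq_sum_of_subset v (support_add (p := f) (q := g)),
    wl_eq_sum_of_subset v (Finset.subset_union_left (s₁ := f.support) (s₂ := g.support)),
    wl_eq_sum_of_subset v (Finset.subset_union_right (s₁ := f.support) (s₂ := g.support)),
    ← Finset.sum_add_distrib]
  refine Finset.sum_le_sum fun m _ => ?_
  rw [← add_mul, coeff_add]
  exact mul_le_mul_of_nonneg_right (v.add_le _ _) (finsuppProd_pow_nonneg hρ m)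

lemma wl_zero : wl v ρ (0 : MvPolynomial σ R) = 0 := by simp [wl]

lemma wl_sum_le (hρ : ∀ i, 0 ≤ ρ i) {ι : Type*} (s : Finset ι) (f : ι → MvPolynomial σ R) :
    wl v ρ (∑ b ∈ s, f b) ≤ ∑ b ∈ s, wl v ρ (f b) := by
  classical
  induction s using Finset.induction_on with
  | empty => simp [wl_zero]
  | insert a s ha ih =>
    rw [Finset.sum_insert ha, Finset.sum_insert ha]
    exact (wl_add_le v hρ _ _).trans (by gcongr)

lemma wl_monomial (m : σ →₀ ℕ) (c : R) :
    wl v ρ (monomial m c) = v c * m.prod fun i e => ρ i ^ e := by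
  classical
  rw [wl_eq_sum_of_subset v (support_monomial_subset (s := m) (a := c))]
  simp

lemma wl_C (c : R) : wl v ρ (C c) = v c := by
  rw [← monomial_zero', wl_monomial]; simp

lemma wl_X [Nontrivial R] (i : σ) : wl v ρ (X i) = v 1 * ρ i := by
  rw [X, wl_monomial]; simp

lemma finsuppProd_pow_add (m n : σ →₀ ℕ) :
    ((m + n).prod fun i e => ρ i ^ e) =
      (m.prod fun i e => ρ i ^ e) * n.prod fun i e => ρ i ^ e := by
  classical
  exact Finsupp.prod_add_index' (by simp) (by intros; rw [pow_add])

lemma wl_mul_le (hρ : ∀ i, 0 ≤ ρ i) (f g : MvPolynomial σ R) :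
    wl v ρ (f * g) ≤ wl v ρ f * wl v ρ g := by
  conv_lhs => rw [f.as_sum, g.as_sum, Finset.sum_mul_sum]
  refine (wl_sum_le v hρ _ _).trans ?_
  rw [wl, wl, Finset.sum_mul_sum]
  refine Finset.sum_le_sum fun m _ => (wl_sum_le v hρ _ _).trans ?_
  refine Finset.sum_le_sum fun n _ => le_of_eq ?_
  rw [monomial_mul, wl_monomial, finsuppProd_pow_add, v.map_mul]
  ring

lemma wl_prod_le [IsDomain R] (hρ : ∀ i, 0 ≤ ρ i) {ι : Type*} (s : Finset ι)
    (f : ι → MvPolynomial σ R) : wl v ρ (∏ b ∈ s, f b) ≤ ∏ b ∈ s, wl v ρ (f b) := by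
  classical
  induction s using Finset.induction_on with
  | empty =>
    have := wl_C v (ρ := ρ) 1
    rw [C_1] at this
    simp [this]
  | insert a s ha ih =>
    rw [Finset.prod_insert ha, Finset.prod_insert ha]
    exact (wl_mul_le v hρ _ _).trans
      (mul_le_mul_of_nonneg_left ih (wl_nonneg v hρ _))

lemma wl_pow_le [IsDomain R] (hρ : ∀ i, 0 ≤ ρ i) (f : MvPolynomial σ R) (n : ℕ) :
    wl v ρ (f ^ n) ≤ wl v ρ f ^ n := by
  simpa using wl_prod_le v hρ (Finset.range n) fun _ => f

lemma coeff_mul_le_wl (hρ : ∀ i, 0 ≤ ρ i) (f : MvPolynomial σ R) (m : σ →₀ ℕ) :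
    v (coeff m f) * (m.prod fun i e => ρ i ^ e) ≤ wl v ρ f := by
  by_cases hm : m ∈ f.support
  · exact Finset.single_le_sum (f := fun m => v (coeff m f) * m.prod fun i e => ρ i ^ e)
      (fun m _ => mul_nonneg (v.nonneg _) (finsuppProd_pow_nonneg hρ m)) hm
  · rw [notMem_support_iff.1 hm]
    simpa using wl_nonneg v hρ f

lemma wl_aeval_le [IsDomain R] {ρ : τ → ℝ} (hρ : ∀ i, 0 ≤ ρ i) (g : σ → MvPolynomial τ R)
    (f : MvPolynomial σ R) : wl v ρ (aeval g f) ≤ wl v (fun i => wl v ρ (g i)) f := by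
  conv_lhs => rw [f.as_sum, map_sum]
  refine (wl_sum_le v hρ _ _).trans (Finset.sum_le_sum fun m _ => ?_)
  rw [aeval_monomial]
  refine (wl_mul_le v hρ _ _).trans ?_
  rw [MvPolynomial.algebraMap_eq, wl_C]
  refine mul_le_mul_of_nonneg_left ?_ (v.nonneg _)
  refine (wl_prod_le v hρ _ _).trans ?_
  exact Finset.prod_le_prod (fun i _ => wl_nonneg v hρ _) fun i _ => wl_pow_le v hρ _ _

lemma wl_mono {ρ' : σ → ℝ} (hρ : ∀ i, 0 ≤ ρ i) (h : ∀ i, ρ i ≤ ρ' i) (f : MvPolynomial σ R) :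
    wl v ρ f ≤ wl v ρ' f := by
  refine Finset.sum_le_sum fun m _ => mul_le_mul_of_nonneg_left ?_ (v.nonneg _)
  exact Finset.prod_le_prod (fun i _ => pow_nonneg (hρ i) _) fun i _ =>
    pow_le_pow_left₀ (hρ i) (h i) _

end wl

/-- The usual absolute value on the integers, with real values. -/
def intAbs : AbsoluteValue ℤ ℝ :=
  (AbsoluteValue.abs : AbsoluteValue ℝ ℝ).comp (f := Int.castRingHom ℝ) Int.cast_injective

@[simp] lemma intAbs_apply (z : ℤ) : intAbs z = |(z : ℝ)| := rfl

/-- Sum of the absolute values of the coefficients of an integer polynomial. -/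
abbrev intLen {σ : Type*} (f : MvPolynomial σ ℤ) : ℝ := wl intAbs (fun _ => 1) f

lemma abs_coeff_le_intLen {σ : Type*} (f : MvPolynomial σ ℤ) (m : σ →₀ ℕ) :
    |((coeff m f : ℤ) : ℝ)| ≤ intLen f := by
  have := coeff_mul_le_wl intAbs (ρ := fun _ : σ => (1 : ℝ)) (by simp) f m
  simpa using this

lemma card_support_le {σ R : Type*} [CommRing R] [Fintype σ] (f : MvPolynomial σ R) (r : σ → ℕ)
    (hf : ∀ h, degreeOf h f ≤ r h) : (f.support.card : ℝ) ≤ 2 ^ ∑ h, r h := by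
  classical
  have h1 : f.support.card ≤ (Fintype.piFinset fun h => Finset.range (r h + 1)).card := by
    refine Finset.card_le_card_of_injOn (fun m => (m : σ → ℕ)) (fun m hm => ?_)
      (fun m _ m' _ h => DFunLike.coe_injective h)
    simp only [Finset.mem_coe, Fintype.mem_piFinset, Finset.mem_range]
    intro h
    have := (degreeOf_le_iff.1 (hf h)) m hm
    omega
  have h2 : (Fintype.piFinset fun h => Finset.range (r h + 1)).card ≤ 2 ^ ∑ h, r h := by
    rw [Fintype.card_piFinset, ← Finset.prod_pow_eq_pow_sum]
    refine Finset.prod_le_prod' fun h _ => ?_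
    rw [Finset.card_range]
    exact Nat.lt_two_pow_self
  exact_mod_cast h1.trans h2

lemma intLen_le_of_coeff_le {σ : Type*} [Fintype σ] (f : MvPolynomial σ ℤ) (r : σ → ℕ) (H : ℝ)
    (hH : 0 ≤ H) (hf : ∀ h, degreeOf h f ≤ r h) (hc : ∀ m, |((coeff m f : ℤ) : ℝ)| ≤ H) :
    intLen f ≤ 2 ^ (∑ h, r h) * H := by
  refine (Finset.sum_le_card_nsmul _ _ H fun m _ => by simpa using hc m).trans ?_
  rw [nsmul_eq_mul]
  exact mul_le_mul_of_nonneg_right (card_support_le f r hf) hH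

lemma intLen_det_le {σ : Type*} {l : ℕ} (M : Matrix (Fin l) (Fin l) (MvPolynomial σ ℤ)) (H : ℝ)
    (h : ∀ a b, intLen (M a b) ≤ H) : intLen M.det ≤ (l * H) ^ l := by
  have hρ : ∀ i : σ, (0 : ℝ) ≤ (fun _ => 1) i := by simp
  rw [Matrix.det_apply]
  refine (wl_sum_le _ hρ _ _).trans ?_
  have h1 : ∀ p ∈ (Finset.univ : Finset (Equiv.Perm (Fin l))),
      wl intAbs (fun _ => 1) (Equiv.Perm.sign p • ∏ i, M (p i) i) ≤ H ^ l := by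
    intro p _
    have h2 : Equiv.Perm.sign p • ∏ i, M (p i) i =
        C ((Equiv.Perm.sign p : ℤˣ) : ℤ) * ∏ i, M (p i) i := by
      rw [Units.smul_def, zsmul_eq_mul]; simp
    rw [h2]
    refine (wl_mul_le _ hρ _ _).trans ?_
    have h3 : |(((Equiv.Perm.sign p : ℤˣ) : ℤ) : ℝ)| = 1 := by
      rcases Int.units_eq_one_or (Equiv.Perm.sign p) with h | h <;> simp [h]
    rw [wl_C, intAbs_apply, h3, one_mul]
    refine (wl_prod_le _ hρ _ _).trans ?_
    refine (Finset.prod_le_prod (fun i _ => wl_nonneg _ hρ _) fun i _ => h _ _).trans ?_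
    simp
  refine (Finset.sum_le_card_nsmul _ _ _ h1).trans ?_
  rw [Finset.card_univ, Fintype.card_perm, Fintype.card_fin, nsmul_eq_mul, mul_pow]
  rcases Nat.eq_zero_or_pos l with hl | hl
  · subst hl; simp
  have hH : 0 ≤ H := (wl_nonneg intAbs hρ _).trans (h ⟨0, hl⟩ ⟨0, hl⟩)
  refine mul_le_mul_of_nonneg_right ?_ (pow_nonneg hH _)
  exact_mod_cast Nat.factorial_le_pow l

lemma abs_coeff_hasseD_le {σ : Type*} [Fintype σ] (f : MvPolynomial σ ℤ) (r : σ → ℕ) (H : ℝ)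
    (hf : ∀ h, degreeOf h f ≤ r h) (hc : ∀ m, |((coeff m f : ℤ) : ℝ)| ≤ H) (i m : σ →₀ ℕ) :
    |((coeff m (hasseD i f) : ℤ) : ℝ)| ≤ 2 ^ (∑ h, r h) * H := by
  have hH : 0 ≤ H := (abs_nonneg _).trans (hc 0)
  rw [coeff_hasseD]
  by_cases hm : m + i ∈ f.support
  · push_cast
    rw [abs_mul]
    refine mul_le_mul ?_ (hc _) (abs_nonneg _) (by positivity)
    rw [abs_of_nonneg (Finset.prod_nonneg fun h _ => by positivity),
      ← Finset.prod_pow_eq_pow_sum]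
    refine Finset.prod_le_prod (fun h _ => by positivity) fun h _ => ?_
    have h1 := (degreeOf_le_iff.1 (hf h)) _ hm
    have h2 := (Nat.choose_le_two_pow ((m + i) h) (i h)).trans (Nat.pow_le_pow_right two_pos h1)
    exact_mod_cast h2
  · rw [notMem_support_iff.1 hm]
    simp
    positivity

lemma degreeOf_hasseD_le {σ R : Type*} [CommRing R] [Fintype σ] (f : MvPolynomial σ R) (i : σ →₀ ℕ)
    (h : σ) : degreeOf h (hasseD i f) ≤ degreeOf h f := by
  refine degreeOf_le_iff.2 fun m hm => ?_
  have h1 : m + i ∈ f.support := by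
    rw [mem_support_iff] at hm ⊢
    intro h0
    rw [coeff_hasseD, h0, mul_zero] at hm
    exact hm rfl
  have := (degreeOf_le_iff.1 (le_refl (degreeOf h f))) _ h1
  simp at this
  omega

lemma degreeOf_det_le {σ R : Type*} [CommRing R] {l : ℕ}
    (M : Matrix (Fin l) (Fin l) (MvPolynomial σ R)) (h : σ) (d : ℕ)
    (hM : ∀ a b, degreeOf h (M a b) ≤ d) : degreeOf h M.det ≤ l * d := by
  rw [Matrix.det_apply]
  refine (degreeOf_sum_le _ _ _).trans (Finset.sup_le fun p _ => ?_)
  have h2 : Equiv.Perm.sign p • ∏ i, M (p i) i =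
      C (((Equiv.Perm.sign p : ℤˣ) : ℤ) : R) * ∏ i, M (p i) i := by
    rw [Units.smul_def, zsmul_eq_mul]; simp
  rw [h2]
  refine (degreeOf_C_mul_le _ _ _).trans ((degreeOf_prod_le _ _ _).trans ?_)
  exact (Finset.sum_le_card_nsmul _ _ d fun i _ => hM _ _).trans (by simp)

/-- The weighted index of `f` at `x` is at least `θ`. -/
def IdxGe {σ : Type*} [Fintype σ] (x : σ → ℚ) (r : σ → ℕ) (θ : ℝ) (f : MvPolynomial σ ℚ) : Prop :=
  ∀ t, coeff t (shiftHom x f) ≠ 0 → θ ≤ ∑ h, (t h : ℝ) / r h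

namespace IdxGe
variable {σ : Type*} [Fintype σ] {x : σ → ℚ} {r : σ → ℕ} {θ θ' : ℝ} {f g : MvPolynomial σ ℚ}

lemma zero_le (f : MvPolynomial σ ℚ) : IdxGe x r 0 f := fun t _ =>
  Finset.sum_nonneg fun h _ => by positivity

lemma mono (hf : IdxGe x r θ f) (h : θ' ≤ θ) : IdxGe x r θ' f := fun t ht => h.trans (hf t ht)

lemma sum {ι : Type*} {s : Finset ι} {f : ι → MvPolynomial σ ℚ} (h : ∀ b ∈ s, IdxGe x r θ (f b)) :
    IdxGe x r θ (∑ b ∈ s, f b) := by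
  intro t ht
  rw [map_sum, coeff_sum] at ht
  obtain ⟨b, hb, hb'⟩ := Finset.exists_ne_zero_of_sum_ne_zero ht
  exact h b hb t hb'

lemma mul (hf : IdxGe x r θ f) (hg : IdxGe x r θ' g) : IdxGe x r (θ + θ') (f * g) := by
  classical
  intro t ht
  rw [map_mul, coeff_mul] at ht
  obtain ⟨⟨a, b⟩, hab, h⟩ := Finset.exists_ne_zero_of_sum_ne_zero ht
  have h1 := hf a (left_ne_zero_of_mul h)
  have h2 := hg b (right_ne_zero_of_mul h)
  rw [← Finset.HasAntidiagonal.mem_antidiagonal.1 hab]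
  simp only [Finsupp.add_apply, Nat.cast_add, add_div, Finset.sum_add_distrib]
  exact add_le_add h1 h2

lemma prod {ι : Type*} {s : Finset ι} {f : ι → MvPolynomial σ ℚ} {δ : ι → ℝ}
    (h : ∀ b ∈ s, IdxGe x r (δ b) (f b)) : IdxGe x r (∑ b ∈ s, δ b) (∏ b ∈ s, f b) := by
  classical
  induction s using Finset.induction_on with
  | empty => simpa using zero_le 1
  | insert a s ha ih =>
    rw [Finset.sum_insert ha, Finset.prod_insert ha]
    exact (h a (by simp)).mul (ih fun b hb => h b (by simp [hb]))

lemma det {l : ℕ} {M : Matrix (Fin l) (Fin l) (MvPolynomial σ ℚ)} {δ : Fin l → ℝ}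
    (h : ∀ a b, IdxGe x r (δ b) (M a b)) : IdxGe x r (∑ b, δ b) M.det := by
  rw [Matrix.det_apply]
  refine sum fun p _ => ?_
  have h2 : Equiv.Perm.sign p • ∏ i, M (p i) i =
      C (((Equiv.Perm.sign p : ℤˣ) : ℤ) : ℚ) * ∏ i, M (p i) i := by
    rw [Units.smul_def, zsmul_eq_mul]; simp
  rw [h2, ← zero_add (∑ b, δ b)]
  exact (zero_le _).mul (prod fun b _ => h _ _)

lemma hasseD (hf : IdxGe x r θ f) (i : σ →₀ ℕ) :
    IdxGe x r (θ - ∑ h, (i h : ℝ) / r h) (hasseD i f) := by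
  intro t ht
  rw [← hasseD_shift, coeff_hasseD] at ht
  have := hf _ (right_ne_zero_of_mul ht)
  simp only [Finsupp.add_apply, Nat.cast_add, add_div, Finset.sum_add_distrib] at this
  linarith

end IdxGe

/-- A polynomial in one variable, as an element of `R[X]`. -/
def finOneHom (R : Type*) [CommRing R] : MvPolynomial (Fin 1) R →ₐ[R] Polynomial R :=
  aeval fun _ => Polynomial.X

lemma coeff_finOneHom {R : Type*} [CommRing R] (f : MvPolynomial (Fin 1) R) (j : ℕ) :
    (finOneHom R f).coeff j = coeff (Finsupp.single 0 j) f := by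
  classical
  induction f using MvPolynomial.induction_on' with
  | add p q hp hq => simp [hp, hq]
  | monomial m c =>
    rw [finOneHom, aeval_monomial, Finsupp.prod_fintype _ _ (by simp), coeff_monomial]
    simp only [Finset.univ_unique, Finset.prod_singleton, Polynomial.algebraMap_eq,
      Polynomial.coeff_C_mul_X_pow]
    have : m = Finsupp.single 0 j ↔ j = m 0 := by
      constructor
      · rintro rfl; simp
      · rintro rfl; refine Finsupp.ext fun a => ?_; rw [Subsingleton.elim a 0]; simp
    simp only [this]
    congr 1

lemma finOneHom_shift (x : Fin 1 → ℚ) (f : MvPolynomial (Fin 1) ℚ) :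
    finOneHom ℚ (shiftHom x f) = Polynomial.taylor (x 0) (finOneHom ℚ f) := by
  induction f using MvPolynomial.induction_on with
  | C a => simp [finOneHom, shiftHom]
  | add p q hp hq => simp [hp, hq]
  | mul_X p i hp =>
    rw [Subsingleton.elim i 0]
    simp only [map_mul, hp, Polynomial.taylor_mul]
    simp [finOneHom, shiftHom]

lemma isPrimitive_den_mul_X_sub_num (x : ℚ) :
    (Polynomial.C (x.den : ℤ) * Polynomial.X - Polynomial.C x.num).IsPrimitive := by
  intro r hr
  rw [Polynomial.C_dvd_iff_dvd_coeff] at hr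
  have h0 := hr 0
  have h1 := hr 1
  simp at h0
  rw [Polynomial.coeff_sub, Polynomial.coeff_C_mul_X, Polynomial.coeff_C] at h1
  simp only [if_true, one_ne_zero, if_false, sub_zero] at h1
  have hc : IsCoprime x.num (x.den : ℤ) := by
    rw [Int.isCoprime_iff_gcd_eq_one]; exact x.reduced
  exact hc.isUnit_of_dvd' h0 h1

lemma exists_coeff_shift_ne_zero_den_pow_le (x : Fin 1 → ℚ) (g : MvPolynomial (Fin 1) ℤ)
    (hg : g ≠ 0) (H : ℝ) (hH : ∀ m, |((coeff m g : ℤ) : ℝ)| ≤ H) :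
    ∃ t : Fin 1 →₀ ℕ, coeff t (shiftHom x (map (Int.castRingHom ℚ) g)) ≠ 0 ∧
      ((x 0).den : ℝ) ^ (t 0) ≤ H := by
  set P : Polynomial ℤ := finOneHom ℤ g with hP
  have hmap : finOneHom ℚ (map (Int.castRingHom ℚ) g) = P.map (Int.castRingHom ℚ) := by
    ext j
    rw [coeff_finOneHom, Polynomial.coeff_map, coeff_finOneHom, coeff_map]
  have hP0 : P ≠ 0 := by
    obtain ⟨m, hm⟩ := ne_zero_iff.1 hg
    intro h0
    apply hm
    have : m = Finsupp.single 0 (m 0) := by refine Finsupp.ext fun a => ?_; rw [Subsingleton.elim a 0]; simp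
    rw [this, ← coeff_finOneHom, ← hP, h0, Polynomial.coeff_zero]
  have hPQ : P.map (Int.castRingHom ℚ) ≠ 0 := by
    rwa [Ne, Polynomial.map_eq_zero_iff (RingHom.injective_int _)]
  obtain ⟨Q, hQ, hnd⟩ := Polynomial.exists_eq_pow_rootMultiplicity_mul_and_not_dvd
    (P.map (Int.castRingHom ℚ)) hPQ (x 0)
  set t := Polynomial.rootMultiplicity (x 0) (P.map (Int.castRingHom ℚ)) with ht
  refine ⟨Finsupp.single 0 t, ?_, ?_⟩
  · rw [← coeff_finOneHom, finOneHom_shift, hmap, hQ, Polynomial.taylor_mul, Polynomial.taylor_pow]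
    rw [show Polynomial.taylor (x 0) (Polynomial.X - Polynomial.C (x 0)) = Polynomial.X by simp]
    have := Polynomial.coeff_X_pow_mul (Polynomial.taylor (x 0) Q) t 0
    rw [zero_add] at this
    rw [this, Polynomial.taylor_coeff_zero]
    intro h0
    exact hnd (Polynomial.dvd_iff_isRoot.2 h0)
  · set L : Polynomial ℤ := Polynomial.C ((x 0).den : ℤ) * Polynomial.X - Polynomial.C (x 0).num
    have hLp : (L ^ t).IsPrimitive := by
      have hL := isPrimitive_den_mul_X_sub_num (x 0)
      generalize t = t
      induction t with
      | zero => simp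
      | succ t ih => rw [pow_succ]; exact ih.mul hL
    have hden : ((x 0).den : ℚ) ≠ 0 := by exact_mod_cast (x 0).den_nz
    have hLQ : L.map (Int.castRingHom ℚ) =
        Polynomial.C ((x 0).den : ℚ) * (Polynomial.X - Polynomial.C (x 0)) := by
      simp only [L, Polynomial.map_sub, Polynomial.map_mul, Polynomial.map_C, Polynomial.map_X,
        mul_sub, ← Polynomial.C_mul]
      congr 2
      simp only [eq_intCast]
      exact (Rat.den_mul_eq_num (x 0)).symm
    have hdvd : L ^ t ∣ P := by
      refine Polynomial.IsPrimitive.dvd_of_fraction_map_dvd_fraction_map (K := ℚ) hLp ?_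
      change (L ^ t).map (Int.castRingHom ℚ) ∣ P.map (Int.castRingHom ℚ)
      rw [Polynomial.map_pow, hLQ, mul_pow, ← Polynomial.C_pow]
      refine (IsUnit.mul_left_dvd ?_).2 ⟨Q, hQ⟩
      exact Polynomial.isUnit_C.2 (IsUnit.mk0 _ (pow_ne_zero _ hden))
    obtain ⟨Q', hQ'⟩ := hdvd
    have hlc : P.leadingCoeff = ((x 0).den : ℤ) ^ t * Q'.leadingCoeff := by
      rw [hQ', Polynomial.leadingCoeff_mul, Polynomial.leadingCoeff_pow]
      congr 2
      simp only [L]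
      rw [sub_eq_add_neg, ← Polynomial.C_neg,
        Polynomial.leadingCoeff_linear (by exact_mod_cast (x 0).den_nz)]
    have hq0 : Q'.leadingCoeff ≠ 0 := by
      intro h0
      rw [h0, mul_zero, Polynomial.leadingCoeff_eq_zero] at hlc
      exact hP0 hlc
    have h1 : |((P.leadingCoeff : ℤ) : ℝ)| ≤ H := by
      rw [Polynomial.leadingCoeff, hP, coeff_finOneHom]
      exact hH _
    refine le_trans ?_ h1
    rw [hlc]
    push_cast
    rw [abs_mul, abs_of_nonneg (by positivity : (0 : ℝ) ≤ ((x 0).den : ℝ) ^ t)]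
    have h2 : (1 : ℝ) ≤ |(Q'.leadingCoeff : ℝ)| := by
      exact_mod_cast Int.one_le_abs hq0
    have h3 : (0 : ℝ) ≤ ((x 0).den : ℝ) ^ t := by positivity
    simpa using mul_le_mul_of_nonneg_left h2 h3

lemma sum_max_zero_sub_div_ge (l r : ℕ) (Θ : ℝ) (h0 : 0 ≤ Θ) (h1 : Θ ≤ 1) (hr : 0 < r)
    (hl : l ≤ r + 1) : l * Θ ^ 2 / 4 ≤ ∑ b : Fin l, max 0 (Θ - (b : ℕ) / (r : ℝ)) := by
  rw [Fin.sum_univ_eq_sum_range (fun b : ℕ => max 0 (Θ - (b : ℝ) / (r : ℝ)))]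
  set K := ⌈(l : ℝ) * Θ / 2⌉₊ with hK
  have hr' : (1 : ℝ) ≤ r := by exact_mod_cast hr
  have hl' : (l : ℝ) ≤ r + 1 := by exact_mod_cast hl
  have hK1 : (l : ℝ) * Θ / 2 ≤ K := Nat.le_ceil _
  have hK2 : (K : ℝ) < l * Θ / 2 + 1 := Nat.ceil_lt_add_one (by positivity)
  have hKl : K ≤ l := by
    rw [hK, Nat.ceil_le]
    have : (0 : ℝ) ≤ l := by positivity
    nlinarith
  have hsub : Finset.range K ⊆ Finset.range l := Finset.range_subset_range.2 hKl
  refine le_trans ?_ (Finset.sum_le_sum_of_subset_of_nonneg hsub fun b _ _ => le_max_left _ _)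
  refine le_trans ?_ (Finset.sum_le_sum fun b _ => le_max_right _ _)
  have hsum : ∀ K : ℕ, ∑ b ∈ Finset.range K, (Θ - (b : ℝ) / r) = K * Θ - K * (K - 1) / (2 * r) := by
    intro K
    induction K with
    | zero => simp
    | succ K ih => rw [Finset.sum_range_succ, ih]; push_cast; field_simp; ring
  rw [hsum]
  have h3 : ((K : ℝ) - 1) / r ≤ Θ := by
    rw [div_le_iff₀ (by linarith)]
    nlinarith
  have h4 : (K : ℝ) * (K - 1) / (2 * r) = K * (((K : ℝ) - 1) / r) / 2 := by
    field_simp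
  rw [h4]
  have hK0 : (0 : ℝ) ≤ K := by positivity
  nlinarith [mul_le_mul_of_nonneg_left h3 hK0, mul_le_mul_of_nonneg_right hK1 h0]

lemma eq_sum_rename_coeff {n : ℕ} (f : MvPolynomial (Fin (n + 1)) ℚ) (d : ℕ)
    (hd : degreeOf 0 f ≤ d) : f = ∑ j ∈ Finset.range (d + 1),
      rename Fin.succ ((finSuccEquiv ℚ n f).coeff j) * X 0 ^ j := by
  apply (finSuccEquiv ℚ n).injective
  rw [map_sum]
  conv_lhs => rw [Polynomial.as_sum_range' (finSuccEquiv ℚ n f) (d + 1)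
    (by rw [natDegree_finSuccEquiv]; omega)]
  refine Finset.sum_congr rfl fun j _ => ?_
  have hC : ∀ p : MvPolynomial (Fin n) ℚ, finSuccEquiv ℚ n (rename Fin.succ p) = Polynomial.C p := by
    intro p
    induction p using MvPolynomial.induction_on with
    | C a => simp [finSuccEquiv_apply]
    | add p q hp hq => simp [hp, hq]
    | mul_X p i hp => simp [hp, finSuccEquiv_X_succ]
  rw [map_mul, map_pow, finSuccEquiv_X_zero, hC, Polynomial.C_mul_X_pow_eq_monomial]

lemma exists_rank_decomposition {n : ℕ} (f : MvPolynomial (Fin (n + 1)) ℚ) (d : ℕ)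
    (hd : degreeOf 0 f ≤ d) : ∃ (l : ℕ) (φ : Fin l → MvPolynomial (Fin n) ℚ)
      (ψ : Fin l → MvPolynomial (Fin 1) ℚ), l ≤ d + 1 ∧ LinearIndependent ℚ φ ∧
        LinearIndependent ℚ ψ ∧
        f = ∑ b, rename Fin.succ (φ b) * rename (fun _ => 0) (ψ b) := by
  classical
  let F : Fin (d + 1) → MvPolynomial (Fin n) ℚ := fun j => (finSuccEquiv ℚ n f).coeff j
  have hF : f = ∑ j : Fin (d + 1), rename Fin.succ (F j) * X 0 ^ (j : ℕ) := by
    rw [Fin.sum_univ_eq_sum_range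
      (fun j => rename Fin.succ ((finSuccEquiv ℚ n f).coeff j) * X 0 ^ j)]
    exact eq_sum_rename_coeff f d hd
  let V := Submodule.span ℚ (Set.range F)
  have hfin : FiniteDimensional ℚ V := FiniteDimensional.span_of_finite ℚ (Set.finite_range F)
  have hmem : ∀ j, F j ∈ V := fun j => Submodule.subset_span ⟨j, rfl⟩
  let B := Module.finBasis ℚ V
  have hsum : ∀ j, F j = ∑ b, B.repr ⟨F j, hmem j⟩ b • (B b : MvPolynomial (Fin n) ℚ) := by
    intro j
    have := congrArg V.subtype (B.sum_repr ⟨F j, hmem j⟩)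
    rw [map_sum] at this
    exact this.symm
  refine ⟨Module.finrank ℚ V, fun b => (B b : MvPolynomial (Fin n) ℚ),
    fun b => ∑ j : Fin (d + 1), monomial (Finsupp.single 0 (j : ℕ)) (B.repr ⟨F j, hmem j⟩ b),
    ?_, ?_, ?_, ?_⟩
  · have h1 := finrank_range_le_card (R := ℚ) F
    rw [Fintype.card_fin] at h1
    exact h1
  · exact B.linearIndependent.map' V.subtype (Submodule.ker_subtype V)
  · rw [Fintype.linearIndependent_iff]
    intro g hg
    let G : V →ₗ[ℚ] ℚ := B.constr ℚ g
    have hG : ∀ j, G ⟨F j, hmem j⟩ = 0 := by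
      intro j
      have h1 := congrArg (coeff (Finsupp.single 0 (j : ℕ))) hg
      rw [coeff_sum, coeff_zero] at h1
      rw [← B.sum_repr ⟨F j, hmem j⟩, map_sum, ← h1]
      refine Finset.sum_congr rfl fun b _ => ?_
      rw [map_smul, Module.Basis.constr_basis, coeff_smul, coeff_sum]
      rw [Finset.sum_eq_single j]
      · simp [mul_comm]
      · intro j' _ hj'
        rw [coeff_monomial, if_neg]
        intro h
        exact hj' (Fin.ext (Finsupp.single_injective _ h))
      · simp
    have hG0 : ∀ y (hy : y ∈ V), G ⟨y, hy⟩ = 0 := by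
      intro y hy
      induction hy using Submodule.span_induction with
      | mem y h => obtain ⟨j, rfl⟩ := h; exact hG j
      | zero => exact map_zero G
      | add y z hy hz h1 h2 =>
        have := map_add G ⟨y, hy⟩ ⟨z, hz⟩
        rw [h1, h2, add_zero] at this
        exact this
      | smul a y hy h1 =>
        have := map_smul G a ⟨y, hy⟩
        rw [h1, smul_zero] at this
        exact this
    intro b
    have := hG0 _ (B b).2
    rwa [Subtype.coe_eta, Module.Basis.constr_basis] at this
  · conv_lhs => rw [hF]
    conv_lhs =>
      enter [2, j]
      rw [hsum j]
    simp only [map_sum, Finset.sum_mul, Finset.mul_sum, map_smul]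
    rw [Finset.sum_comm]
    refine Finset.sum_congr rfl fun b _ => Finset.sum_congr rfl fun j _ => ?_
    rw [rename_monomial, Finsupp.mapDomain_single, smul_mul_assoc, ← mul_smul_comm]
    congr 1
    rw [X_pow_eq_monomial, smul_monomial]
    simp

lemma shiftHom_eq_zero {σ : Type*} {x : σ → ℚ} {f : MvPolynomial σ ℚ} (h : shiftHom x f = 0) :
    f = 0 := by
  have key : ∀ f : MvPolynomial σ ℚ, shiftHom (-x) (shiftHom x f) = f := by
    intro f
    induction f using MvPolynomial.induction_on with
    | C a => simp [shiftHom]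
    | add p q hp hq => simp [hp, hq]
    | mul_X p i hp => simp only [map_mul, hp]; simp [shiftHom]
  rw [← key f, h, map_zero]

lemma exists_int_multiple {σ τ υ : Type*} (e : σ → υ) (e' : τ → υ) (he : e.Injective)
    (he' : e'.Injective) (hd : ∀ a b, e a ≠ e' b) (W : MvPolynomial υ ℤ) (U : MvPolynomial σ ℚ)
    (V : MvPolynomial τ ℚ) (hW : map (Int.castRingHom ℚ) W = rename e U * rename e' V)
    (hV : V ≠ 0) : ∃ (U' : MvPolynomial σ ℤ) (c : ℚ), c ≠ 0 ∧
      map (Int.castRingHom ℚ) U' = C c * U ∧ (∀ m, ∃ m', coeff m U' = coeff m' W) ∧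
      ∀ h, degreeOf h U' ≤ degreeOf (e h) W := by
  classical
  obtain ⟨s, hs⟩ := ne_zero_iff.1 hV
  have hc : ∀ m, ((coeff (m.mapDomain e + s.mapDomain e') W : ℤ) : ℚ) = coeff m U * coeff s V := by
    intro m
    rw [← coeff_rename_mul_rename e e' he he' hd, ← hW, coeff_map]
    rfl
  let U' : MvPolynomial σ ℤ :=
    ∑ m ∈ U.support, monomial m (coeff (m.mapDomain e + s.mapDomain e') W)
  have hU' : ∀ m, coeff m U' = coeff (m.mapDomain e + s.mapDomain e') W := by
    intro m
    simp only [U', coeff_sum, coeff_monomial, Finset.sum_ite_eq']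
    split_ifs with h
    · rfl
    · have := hc m
      rw [notMem_support_iff.1 h, zero_mul] at this
      exact_mod_cast this.symm
  refine ⟨U', coeff s V, hs, ?_, fun m => ⟨_, hU' m⟩, fun h => ?_⟩
  · ext m
    rw [coeff_map, hU', coeff_C_mul, mul_comm]
    exact hc m
  · refine degreeOf_le_iff.2 fun m hm => ?_
    have h1 : m.mapDomain e + s.mapDomain e' ∈ W.support := by
      rwa [mem_support_iff, ← hU', ← mem_support_iff]
    have h2 := degreeOf_le_iff.1 (le_refl (degreeOf (e h) W)) _ h1
    simp only [Finsupp.add_apply, Finsupp.mapDomain_apply he] at h2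
    omega

lemma mapDomain_succ_add_zero_apply_zero {n : ℕ} (t : Fin n →₀ ℕ) (t' : Fin 1 →₀ ℕ) :
    (t.mapDomain Fin.succ + t'.mapDomain (fun _ => (0 : Fin (n + 1))) : Fin (n + 1) →₀ ℕ) 0 =
      t' 0 := by
  rw [Finsupp.add_apply, Finsupp.mapDomain_of_notMem_range, zero_add]
  · exact Finsupp.mapDomain_apply (f := fun _ : Fin 1 => (0 : Fin (n + 1)))
      (fun a b _ => Subsingleton.elim a b) t' 0
  · simp

lemma mapDomain_succ_add_zero_apply_succ {n : ℕ} (t : Fin n →₀ ℕ) (t' : Fin 1 →₀ ℕ) (h : Fin n) :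
    (t.mapDomain Fin.succ + t'.mapDomain (fun _ => (0 : Fin (n + 1))) : Fin (n + 1) →₀ ℕ) h.succ =
      t h := by
  rw [Finsupp.add_apply, Finsupp.mapDomain_apply (Fin.succ_injective n),
    Finsupp.mapDomain_of_notMem_range, add_zero]
  rintro ⟨b, hb⟩
  exact Fin.succ_ne_zero h hb.symm

lemma exists_wronskian_factor {n : ℕ} (f : MvPolynomial (Fin (n + 1)) ℤ) (hf : f ≠ 0) (d : ℕ)
    (hd : degreeOf 0 f ≤ d) : ∃ (l : ℕ) (i : Fin l → Fin n →₀ ℕ) (j : Fin l → Fin 1 →₀ ℕ)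
      (U : MvPolynomial (Fin n) ℚ) (V : MvPolynomial (Fin 1) ℚ),
      0 < l ∧ l ≤ d + 1 ∧ (∀ a, (i a).degree ≤ a) ∧ (∀ a, (j a).degree ≤ a) ∧ U ≠ 0 ∧ V ≠ 0 ∧
      map (Int.castRingHom ℚ) (Matrix.of fun a a' =>
        hasseD ((i a).mapDomain Fin.succ + (j a').mapDomain fun _ => 0) f).det =
        rename Fin.succ U * rename (fun _ => 0) V := by
  have hinj : Function.Injective (fun _ : Fin 1 => (0 : Fin (n + 1))) := fun a b _ =>
    Subsingleton.elim a b
  have hne : ∀ (a : Fin n) (b : Fin 1), Fin.succ a ≠ (fun _ : Fin 1 => (0 : Fin (n + 1))) b :=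
    fun a b => Fin.succ_ne_zero a
  have hdeg : degreeOf 0 (map (Int.castRingHom ℚ) f) ≤ d := by
    refine le_trans (degreeOf_le_iff.2 fun m hm => ?_) hd
    refine degreeOf_le_iff.1 (le_refl (degreeOf 0 f)) m ?_
    rw [mem_support_iff, coeff_map] at hm
    rw [mem_support_iff]
    intro h
    simp [h] at hm
  obtain ⟨l, φ, ψ, hl, hφ, hψ, hdec⟩ := exists_rank_decomposition (map (Int.castRingHom ℚ) f) d hdeg
  obtain ⟨i, hi, hU⟩ := exists_hasseD_det_ne_zero φ hφ
  obtain ⟨j, hj, hV⟩ := exists_hasseD_det_ne_zero ψ hψ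
  refine ⟨l, i, j, _, _, ?_, hl, hi, hj, hU, hV, ?_⟩
  · rcases Nat.eq_zero_or_pos l with rfl | h
    · exfalso
      rw [Finset.univ_eq_empty, Finset.sum_empty] at hdec
      exact hf (map_injective _ Int.cast_injective (by rw [hdec, map_zero]))
    · exact h
  · rw [RingHom.map_det, AlgHom.map_det, AlgHom.map_det, ← Matrix.det_transpose (AlgHom.mapMatrix
      (rename fun _ => 0) _), ← Matrix.det_mul]
    congr 1
    ext1 a a'
    rw [Matrix.mul_apply]
    simp only [RingHom.mapMatrix_apply, Matrix.map_apply, Matrix.of_apply, AlgHom.mapMatrix_apply,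
      Matrix.transpose_apply]
    rw [← hasseD_map, hdec, hasseD_sum]
    exact Finset.sum_congr rfl fun b _ =>
      hasseD_rename_mul_rename _ _ (Fin.succ_injective n) hinj hne _ _ _ _

/-- Roth's lemma: an integer polynomial with small coefficients has small index at a rational point
with large denominators, when the degrees decrease fast. -/
theorem roth_index (n : ℕ) : ∀ θ : ℝ, 0 < θ → ∃ ω : ℝ, 0 < ω ∧ ∀ (r : Fin n → ℕ) (x : Fin n → ℚ)
    (R : ℝ) (f : MvPolynomial (Fin n) ℤ), (∀ h, 0 < r h) →
    (∀ h h', h < h' → (r h : ℝ) ≤ ω * r h') → (∀ h, R ≤ r h * Real.log (x h).den) →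
    (∀ h, (r h : ℝ) ≤ ω * R) → 0 ≤ R → f ≠ 0 → (∀ h, degreeOf h f ≤ r h) →
    (∀ m, |((coeff m f : ℤ) : ℝ)| ≤ Real.exp (ω * R)) →
    ¬ IdxGe x r θ (map (Int.castRingHom ℚ) f) := by
  induction n with
  | zero =>
    intro θ hθ
    refine ⟨1, one_pos, fun r x R f _ _ _ _ _ hf _ _ hidx => ?_⟩
    have h1 : shiftHom x (map (Int.castRingHom ℚ) f) ≠ 0 := fun h =>
      hf (map_injective _ Int.cast_injective (by rw [shiftHom_eq_zero h, map_zero]))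
    obtain ⟨t, ht⟩ := ne_zero_iff.1 h1
    have := hidx t ht
    simp only [Finset.univ_eq_empty, Finset.sum_empty] at this
    linarith
  | succ n ih =>
    intro θ hθ
    set θ1 := min θ 1 with hθ1
    have hpos_θ₁ : 0 < θ1 := lt_min hθ one_pos
    have hle_θ₁ : θ1 ≤ 1 := min_le_right _ _
    set ε := θ1 ^ 2 / 64 with hε
    have hεpos : 0 < ε := by positivity
    obtain ⟨ω', hω', H⟩ := ih ε hεpos
    set ω0 := min ω' (ε / 2) with hω0
    have hpos_ω₀ : 0 < ω0 := lt_min hω' (by positivity)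
    have hω0' : ω0 ≤ ω' := min_le_left _ _
    have hω0ε : ω0 ≤ ε / 2 := min_le_right _ _
    refine ⟨min (ω0 / (2 * n + 4)) (θ1 / 2), lt_min (by positivity) (by positivity), ?_⟩
    intro r x R f hr hord hden hrR hR hf hdeg hcoef hidx
    set ω := min (ω0 / (2 * n + 4)) (θ1 / 2) with hω
    have hωpos : 0 < ω := lt_min (by positivity) (by positivity)
    have hω1 : ω * (2 * n + 4) ≤ ω0 := by
      rw [← le_div_iff₀ (by positivity)]; exact min_le_left _ _
    have hωω0 : ω ≤ ω0 := by nlinarith [(Nat.cast_nonneg n : (0:ℝ) ≤ n)]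
    have hωθ : ω ≤ θ1 / 2 := min_le_right _ _
    have hRpos : 0 < R := by
      have h1 := hrR 0
      have h2 : (0 : ℝ) < r 0 := by exact_mod_cast hr 0
      by_contra h
      nlinarith
    obtain ⟨l, i, j, U, V, hl0, hl, hi, hj, hU, hV, hW⟩ := exists_wronskian_factor f hf (r 0) (hdeg 0)
    set M : Matrix (Fin l) (Fin l) (MvPolynomial (Fin (n + 1)) ℤ) := Matrix.of fun a a' =>
      hasseD ((i a).mapDomain Fin.succ + (j a').mapDomain fun _ => 0) f with hM
    have hinj : Function.Injective (fun _ : Fin 1 => (0 : Fin (n + 1))) := fun a b _ =>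
      Subsingleton.elim a b
    have hne : ∀ (a : Fin n) (b : Fin 1), Fin.succ a ≠ (fun _ : Fin 1 => (0 : Fin (n + 1))) b :=
      fun a b => Fin.succ_ne_zero a
    have hlR : (0 : ℝ) < l := by exact_mod_cast hl0
    have hlr : (l : ℝ) ≤ r 0 + 1 := by exact_mod_cast hl
    -- size of the determinant
    have hWlen : ∀ m, |((coeff m M.det : ℤ) : ℝ)| ≤ Real.exp (l * ω0 * R) := by
      intro m
      refine (abs_coeff_le_intLen _ m).trans ?_
      have hE : ∀ a b, intLen (M a b) ≤ 2 ^ (∑ h, r h) * (2 ^ (∑ h, r h) * Real.exp (ω * R)) := by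
        intro a b
        refine intLen_le_of_coeff_le _ r _ (by positivity)
          (fun h => (degreeOf_hasseD_le f _ h).trans (hdeg h)) fun m => ?_
        exact abs_coeff_hasseD_le f r _ hdeg hcoef _ m
      refine (intLen_det_le M _ hE).trans ?_
      have h2 : (2 : ℝ) ^ (∑ h, r h) ≤ Real.exp ((n + 1) * ω * R) := by
        have h3 : (2 : ℝ) ≤ Real.exp 1 := by
          have := Real.add_one_le_exp (1 : ℝ); linarith
        have h4 : (2 : ℝ) ^ (∑ h, r h) ≤ Real.exp 1 ^ (∑ h, r h) := by gcongr
        refine h4.trans ?_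
        rw [← Real.exp_nat_mul, mul_one]
        refine Real.exp_le_exp.2 ?_
        push_cast
        calc ∑ h, (r h : ℝ) ≤ ∑ h : Fin (n + 1), ω * R := Finset.sum_le_sum fun h _ => hrR h
          _ = _ := by simp; ring
      have h5 : (l : ℝ) ≤ Real.exp (ω * R) := by
        have := Real.add_one_le_exp (r 0 : ℝ)
        have h6 := Real.exp_le_exp.2 (hrR 0)
        linarith
      have h7 : l * (2 ^ (∑ h, r h) * (2 ^ (∑ h, r h) * Real.exp (ω * R))) ≤
          Real.exp (ω0 * R) := by
        calc _ ≤ Real.exp (ω * R) * (Real.exp ((n + 1) * ω * R) *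
              (Real.exp ((n + 1) * ω * R) * Real.exp (ω * R))) := by gcongr
          _ = Real.exp (ω * (2 * n + 4) * R) := by
            rw [← Real.exp_add, ← Real.exp_add, ← Real.exp_add]; ring_nf
          _ ≤ _ := Real.exp_le_exp.2 (by gcongr)
      calc _ ≤ Real.exp (ω0 * R) ^ l := by gcongr
        _ = _ := by rw [← Real.exp_nat_mul]; ring_nf
    -- integral multiples of the factors
    obtain ⟨U', cU, hcU, hU', hUc, hUd⟩ := exists_int_multiple Fin.succ (fun _ : Fin 1 => 0)
      (Fin.succ_injective n) hinj hne M.det U V hW hV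
    obtain ⟨V', cV, hcV, hV', hVc, -⟩ := exists_int_multiple (fun _ : Fin 1 => 0) Fin.succ
      hinj (Fin.succ_injective n) (fun a b => (hne b a).symm) M.det V U (by rw [hW, mul_comm]) hU
    have hU'0 : U' ≠ 0 := by
      rintro rfl
      rw [map_zero] at hU'
      exact mul_ne_zero (fun h => hcU (C_injective _ _ (by rw [h, map_zero]))) hU hU'.symm
    have hV'0 : V' ≠ 0 := by
      rintro rfl
      rw [map_zero] at hV'
      exact mul_ne_zero (fun h => hcV (C_injective _ _ (by rw [h, map_zero]))) hV hV'.symm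
    -- the factor in the remaining variables
    have hUidx := H (fun h => l * r h.succ) (fun h => x h.succ) (l * R) U'
      (fun h => Nat.mul_pos hl0 (hr _))
      (fun h h' hh => by
        have := hord h.succ h'.succ (Fin.succ_lt_succ_iff.2 hh)
        push_cast
        calc (l : ℝ) * r h.succ ≤ l * (ω * r h'.succ) := by gcongr
          _ ≤ l * (ω' * r h'.succ) := by gcongr; exact hωω0.trans hω0'
          _ = _ := by ring)
      (fun h => by
        have := hden h.succ
        push_cast
        calc (l : ℝ) * R ≤ l * (r h.succ * Real.log (x h.succ).den) := by gcongr
          _ = _ := by ring)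
      (fun h => by
        have := hrR h.succ
        push_cast
        calc (l : ℝ) * r h.succ ≤ l * (ω * R) := by gcongr
          _ ≤ l * (ω' * R) := by gcongr; exact hωω0.trans hω0'
          _ = _ := by ring)
      (by positivity) hU'0
      (fun h => (hUd h).trans (degreeOf_det_le M _ _ fun a b =>
        (degreeOf_hasseD_le f _ _).trans (hdeg _)))
      (fun m => by
        obtain ⟨m', hm'⟩ := hUc m
        rw [hm']
        refine (hWlen m').trans (Real.exp_le_exp.2 ?_)
        calc (l : ℝ) * ω0 * R = ω0 * (l * R) := by ring
          _ ≤ ω' * (l * R) := by gcongr)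
    unfold IdxGe at hUidx
    push Not at hUidx
    obtain ⟨t, ht, htε⟩ := hUidx
    obtain ⟨t', ht', htq⟩ := exists_coeff_shift_ne_zero_den_pow_le (fun _ : Fin 1 => x 0) V' hV'0
      (Real.exp (l * ω0 * R)) (fun m => by
        obtain ⟨m', hm'⟩ := hVc m
        rw [hm']
        exact hWlen m')
    have htr : (t' 0 : ℝ) / r 0 ≤ l * ω0 := by
      have hr0 : (0 : ℝ) < r 0 := by exact_mod_cast hr 0
      rw [div_le_iff₀ hr0]
      have hd0 : (0 : ℝ) < (x 0).den := by exact_mod_cast (x 0).den_pos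
      have h1 := Real.log_le_log (by positivity) htq
      rw [Real.log_exp, Real.log_pow] at h1
      have h2 := hden 0
      have h3 : (t' 0 : ℝ) * R ≤ l * ω0 * r 0 * R := by
        calc (t' 0 : ℝ) * R ≤ t' 0 * (r 0 * Real.log (x 0).den) := by gcongr
          _ = r 0 * (t' 0 * Real.log (x 0).den) := by ring
          _ ≤ r 0 * (l * ω0 * R) := by gcongr
          _ = _ := by ring
      exact le_of_mul_le_mul_right h3 hRpos
    -- index of the determinant from below
    have hdet : IdxGe x r (∑ b : Fin l, max 0 (θ1 - ω - (b : ℕ) / (r 0 : ℝ)))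
        (map (Int.castRingHom ℚ) M.det) := by
      rw [RingHom.map_det]
      refine IdxGe.det fun a a' => ?_
      rcases le_total (θ1 - ω - (a' : ℕ) / (r 0 : ℝ)) 0 with hc | hc
      · rw [max_eq_left hc]; exact IdxGe.zero_le _
      · rw [max_eq_right hc]
        simp only [RingHom.mapMatrix_apply, Matrix.map_apply, hM, Matrix.of_apply]
        rw [← hasseD_map]
        refine (hidx.hasseD _).mono ?_
        rw [Fin.sum_univ_succ]
        have hr0 : (0 : ℝ) < r 0 := by exact_mod_cast hr 0
        rw [mapDomain_succ_add_zero_apply_zero]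
        simp only [mapDomain_succ_add_zero_apply_succ]
        have hj0 : j a' 0 ≤ a' := by
          refine le_trans ?_ (hj a')
          rw [Finsupp.degree_eq_sum]; simp
        have hi0 : ∑ h, (i a h : ℝ) / r h.succ ≤ ω := by
          have h1 : ∀ h : Fin n, (i a h : ℝ) / r h.succ ≤ i a h * (ω / r 0) := by
            intro h
            rw [div_eq_mul_inv]
            have hrh : (0 : ℝ) < r h.succ := by exact_mod_cast hr _
            gcongr
            rw [inv_le_iff_one_le_mul₀ hrh, div_mul_eq_mul_div, le_div_iff₀ hr0, one_mul]
            exact hord 0 h.succ (Fin.succ_pos h)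
          refine (Finset.sum_le_sum fun h _ => h1 h).trans ?_
          rw [← Finset.sum_mul]
          have h2 : (∑ h, (i a h : ℝ)) ≤ r 0 := by
            have := hi a
            rw [Finsupp.degree_eq_sum] at this
            have h3 : ∑ h, i a h ≤ r 0 := by have := a.2; omega
            exact_mod_cast h3
          calc (∑ h, (i a h : ℝ)) * (ω / r 0) ≤ r 0 * (ω / r 0) := by gcongr
            _ = ω := by field_simp
        have h4 : (j a' 0 : ℝ) / r 0 ≤ (a' : ℕ) / r 0 := by gcongr
        have h5 : θ1 ≤ θ := min_le_left _ _
        linarith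
    have hcoef0 : coeff (t.mapDomain Fin.succ + t'.mapDomain fun _ => 0)
        (shiftHom x (map (Int.castRingHom ℚ) M.det)) ≠ 0 := by
      rw [hW, map_mul, shiftHom_rename, shiftHom_rename,
        coeff_rename_mul_rename _ _ (Fin.succ_injective n) hinj hne]
      rw [hU', map_mul] at ht
      rw [hV', map_mul] at ht'
      have hCC : ∀ (τ : Type) (y : τ → ℚ) (c : ℚ), shiftHom y (C c) = C c := by
        intro τ y c; simp [shiftHom]
      rw [hCC, coeff_C_mul] at ht ht'
      exact mul_ne_zero (right_ne_zero_of_mul ht) (right_ne_zero_of_mul ht')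
    have hfin := hdet _ hcoef0
    rw [Fin.sum_univ_succ] at hfin
    rw [mapDomain_succ_add_zero_apply_zero] at hfin
    simp only [mapDomain_succ_add_zero_apply_succ] at hfin
    have hlow := sum_max_zero_sub_div_ge l (r 0) (θ1 - ω) (by linarith) (by linarith) (hr 0) hl
    have hup : ∑ h, (t h : ℝ) / r h.succ < l * ε := by
      have h1 : ∑ h, (t h : ℝ) / r h.succ = l * ∑ h, (t h : ℝ) / ((l * r h.succ : ℕ) : ℝ) := by
        rw [Finset.mul_sum]
        refine Finset.sum_congr rfl fun h _ => ?_
        push_cast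
        field_simp
      rw [h1]
      exact mul_lt_mul_of_pos_left htε hlR
    have h6 : (l : ℝ) * (θ1 - ω) ^ 2 / 4 ≥ l * (4 * ε) := by
      have : (θ1 / 2) ^ 2 ≤ (θ1 - ω) ^ 2 := by gcongr; linarith
      rw [hε]
      nlinarith
    nlinarith

attribute [local instance] Matrix.seminormedAddCommGroup in
open NumberField in
lemma exists_basis_repr_le_house (K : Type*) [Field K] [NumberField K] :
    ∃ C : ℝ, 1 ≤ C ∧ ∀ (x : 𝓞 K) (i : Module.Free.ChooseBasisIndex ℤ (𝓞 K)),
      |((RingOfIntegers.basis K).repr x i : ℝ)| ≤ C * house (x : K) := by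
  classical
  obtain ⟨C, hC⟩ : ∃ C : ℝ, ∀ (x : 𝓞 K) (i : K →+* ℂ),
      ‖(((integralBasis K).reindex (equivReindex K).symm).repr x i : ℂ)‖ ≤
      C * house (algebraMap (𝓞 K) K x) := ⟨_, house.basis_repr_norm_le_const_mul_house K⟩
  refine ⟨max C 1, le_max_right _ _, fun x i => ?_⟩
  have h1 := hC x ((equivReindex K).symm i)
  rw [Module.Basis.repr_reindex_apply, Equiv.symm_symm, Equiv.apply_symm_apply,
    integralBasis_repr_apply] at h1
  simp only [eq_intCast, Rat.cast_intCast, Complex.norm_intCast] at h1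
  refine h1.trans ?_
  gcongr
  · exact house_nonneg _
  · exact le_max_left _ _

attribute [local instance] Matrix.seminormedAddCommGroup in
open NumberField in
/-- Siegel's lemma for rational integer unknowns and algebraic integer coefficients. -/
lemma exists_int_solution (K : Type*) [Field K] [NumberField K] :
    ∃ C : ℝ, 1 ≤ C ∧ ∀ (α β : Type) [Fintype α] [Fintype β] (E : α → β → K) (A : ℝ), 1 ≤ A →
      (∀ a b, IsIntegral ℤ (E a b)) → (∀ a b, house (E a b) ≤ A) → 0 < Fintype.card β →
      2 * (Module.finrank ℚ K * Fintype.card α) ≤ Fintype.card β →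
      ∃ p : β → ℤ, p ≠ 0 ∧ (∀ a, ∑ b, (p b : K) * E a b = 0) ∧
        ∀ b, |(p b : ℝ)| ≤ Fintype.card β * (C * A) := by
  classical
  obtain ⟨C, hC1, hC⟩ := exists_basis_repr_le_house K
  refine ⟨C, hC1, fun α β _ _ E A hA hEint hE hβ hcard => ?_⟩
  set B := RingOfIntegers.basis K
  have hβ1 : (1 : ℝ) ≤ Fintype.card β := by exact_mod_cast hβ
  have hbase : (1 : ℝ) ≤ Fintype.card β * (C * A) := by
    have h2 : 1 ≤ C * A := by nlinarith
    nlinarith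
  rcases Nat.eq_zero_or_pos (Fintype.card α) with h0 | h0
  · have := Fintype.card_eq_zero_iff.1 h0
    have : Nonempty β := Fintype.card_pos_iff.1 hβ
    refine ⟨fun _ => 1, fun h => by simpa using congrFun h (Classical.arbitrary β),
      fun a => isEmptyElim a, fun b => by simpa using hbase⟩
  let E' : α → β → 𝓞 K := fun a b => ⟨E a b, hEint a b⟩
  let Mx : Matrix (α × Module.Free.ChooseBasisIndex ℤ (𝓞 K)) β ℤ :=
    Matrix.of fun ai b => B.repr (E' ai.1 b) ai.2
  have hd : Fintype.card (Module.Free.ChooseBasisIndex ℤ (𝓞 K)) = Module.finrank ℚ K := by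
    rw [← Module.finrank_eq_card_chooseBasisIndex, RingOfIntegers.rank]
  have hdpos : 0 < Module.finrank ℚ K := Module.finrank_pos
  have hα : Fintype.card (α × Module.Free.ChooseBasisIndex ℤ (𝓞 K)) =
      Module.finrank ℚ K * Fintype.card α := by rw [Fintype.card_prod, hd, mul_comm]
  have hpos : 0 < Module.finrank ℚ K * Fintype.card α := Nat.mul_pos hdpos h0
  obtain ⟨p, hp0, hp, hpn⟩ := Int.Matrix.exists_ne_zero_int_vec_norm_le Mx (by omega) (by omega)
  refine ⟨p, hp0, fun a => ?_, fun b => ?_⟩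
  · have h1 : ∑ b, p b • E' a b = 0 := by
      apply B.repr.injective
      rw [map_zero, map_sum]
      ext i
      have := congrFun hp (a, i)
      simp only [Matrix.mulVec, dotProduct, Mx, Matrix.of_apply, Pi.zero_apply] at this
      rw [Finsupp.coe_finsetSum, Finset.sum_apply, Finsupp.zero_apply, ← this]
      refine Finset.sum_congr rfl fun b _ => ?_
      rw [map_zsmul, Finsupp.smul_apply, smul_eq_mul, mul_comm]
    have h2 := congrArg (algebraMap (𝓞 K) K) h1
    rw [map_sum, map_zero] at h2
    rw [← h2]
    refine Finset.sum_congr rfl fun b _ => ?_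
    rw [zsmul_eq_mul, map_mul, map_intCast]
    rfl
  · have h1 : |(p b : ℝ)| ≤ ‖p‖ := by
      have := norm_le_pi_norm p b
      rwa [Int.norm_eq_abs] at this
    have hM : max 1 ‖Mx‖ ≤ C * A := by
      refine max_le (by nlinarith) ?_
      rw [Matrix.norm_le_iff (by nlinarith)]
      intro ai b
      rw [Int.norm_eq_abs]
      refine (hC _ _).trans ?_
      have : house (E ai.1 b) ≤ A := hE _ _
      gcongr
      exact this
    refine h1.trans (hpn.trans ?_)
    have hexp : ((Fintype.card (α × Module.Free.ChooseBasisIndex ℤ (𝓞 K)) : ℕ) : ℝ) /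
        ((Fintype.card β : ℕ) - (Fintype.card (α × Module.Free.ChooseBasisIndex ℤ (𝓞 K)) : ℕ)) ≤ 1 := by
      have h3 : 2 * ((Fintype.card (α × Module.Free.ChooseBasisIndex ℤ (𝓞 K)) : ℕ) : ℝ) ≤
          (Fintype.card β : ℕ) := by rw [hα]; exact_mod_cast hcard
      have h4 : (0 : ℝ) < (Fintype.card (α × Module.Free.ChooseBasisIndex ℤ (𝓞 K)) : ℕ) := by
        rw [hα]; exact_mod_cast hpos
      rw [div_le_one (by linarith)]
      linarith
    have hb1 : (1 : ℝ) ≤ Fintype.card β * max 1 ‖Mx‖ := by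
      have : (1 : ℝ) ≤ max 1 ‖Mx‖ := le_max_left _ _
      nlinarith
    refine (Real.rpow_le_rpow_of_exponent_le hb1 hexp).trans ?_
    rw [Real.rpow_one]
    gcongr

lemma sum_piFinset_sq_le {ι X : Type*} [Fintype ι] [DecidableEq ι] (t : ι → Finset X)
    (f : ι → X → ℝ) (hsum : ∀ i, ∑ x ∈ t i, f i x = 0) (B : ℝ) (hB : ∀ i, ∀ x ∈ t i, |f i x| ≤ B) :
    ∑ p ∈ Fintype.piFinset t, (∑ i, f i (p i)) ^ 2 ≤
      Fintype.card ι * B ^ 2 * (Fintype.piFinset t).card := by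
  have h1 : ∀ i j, i ≠ j → ∑ p ∈ Fintype.piFinset t, f i (p i) * f j (p j) = 0 := by
    intro i j hij
    let g : ι → X → ℝ := fun l x => if l = i then f i x else if l = j then f j x else 1
    have h2 : ∀ p : ι → X, f i (p i) * f j (p j) = ∏ l, g l (p l) := by
      intro p
      rw [← Finset.mul_prod_erase _ _ (Finset.mem_univ i),
        ← Finset.mul_prod_erase _ _ (Finset.mem_erase.2 ⟨hij.symm, Finset.mem_univ j⟩),
        Finset.prod_eq_one]
      · simp [g, hij.symm]
      · intro l hl
        simp only [Finset.mem_erase, Finset.mem_univ, and_true] at hl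
        simp [g, hl.1, hl.2]
    rw [Finset.sum_congr rfl fun p _ => h2 p, ← Finset.prod_univ_sum]
    refine Finset.prod_eq_zero (Finset.mem_univ i) ?_
    simpa [g] using hsum i
  have h3 : ∑ p ∈ Fintype.piFinset t, (∑ i, f i (p i)) ^ 2 =
      ∑ i, ∑ p ∈ Fintype.piFinset t, f i (p i) ^ 2 := by
    simp only [sq, Finset.sum_mul_sum]
    rw [Finset.sum_comm]
    refine Finset.sum_congr rfl fun i _ => ?_
    rw [Finset.sum_comm]
    exact Finset.sum_eq_single i (fun j _ hj => h1 i j hj.symm) (by simp)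
  rw [h3]
  have h4 : ∀ i, ∑ p ∈ Fintype.piFinset t, f i (p i) ^ 2 ≤ (Fintype.piFinset t).card * B ^ 2 := by
    intro i
    rw [← nsmul_eq_mul]
    refine Finset.sum_le_card_nsmul _ _ _ fun p hp => ?_
    have := hB i (p i) (Fintype.mem_piFinset.1 hp i)
    rw [← sq_abs]
    gcongr
  refine (Finset.sum_le_sum fun i _ => h4 i).trans (le_of_eq ?_)
  simp only [Finset.sum_const, Finset.card_univ, nsmul_eq_mul]
  ring

lemma card_filter_lt_sum_le {ι X : Type*} [Fintype ι] [DecidableEq ι] (t : ι → Finset X)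
    (f : ι → X → ℝ) (hsum : ∀ i, ∑ x ∈ t i, f i x = 0) (B : ℝ) (hB : ∀ i, ∀ x ∈ t i, |f i x| ≤ B)
    (ε : ℝ) (hε : 0 < ε) :
    (((Fintype.piFinset t).filter fun p => Fintype.card ι * ε < ∑ i, f i (p i)).card : ℝ) *
      (Fintype.card ι * ε ^ 2) ≤ B ^ 2 * (Fintype.piFinset t).card := by
  rcases Nat.eq_zero_or_pos (Fintype.card ι) with h0 | h0
  · rw [h0]; simp; positivity
  have hk : (0 : ℝ) < Fintype.card ι := by exact_mod_cast h0
  have h1 := sum_piFinset_sq_le t f hsum B hB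
  have h2 : (((Fintype.piFinset t).filter fun p => Fintype.card ι * ε < ∑ i, f i (p i)).card : ℝ) *
      (Fintype.card ι * ε) ^ 2 ≤ ∑ p ∈ Fintype.piFinset t, (∑ i, f i (p i)) ^ 2 := by
    rw [← nsmul_eq_mul]
    refine (Finset.card_nsmul_le_sum _ _ _ fun p hp => ?_).trans
      (Finset.sum_le_sum_of_subset_of_nonneg (Finset.filter_subset _ _) fun p _ _ => sq_nonneg _)
    have := (Finset.mem_filter.1 hp).2
    gcongr
  have h3 := h2.trans h1
  refine le_of_mul_le_mul_left ?_ hk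
  calc _ = _ := by ring
    _ ≤ _ := h3
    _ = _ := by ring

lemma sum_piAntidiag_apply {M : ℕ} (hM : 0 < M) (c : Fin M → ℝ) (r : ℕ) :
    ∑ a ∈ Finset.piAntidiag (Finset.univ : Finset (Fin M)) r, ∑ i, c i * a i =
      ((∑ i, c i) / M) * r * (Finset.piAntidiag (Finset.univ : Finset (Fin M)) r).card := by
  set A := Finset.piAntidiag (Finset.univ : Finset (Fin M)) r with hA
  have hsym : ∀ i j, ∑ a ∈ A, (a i : ℝ) = ∑ a ∈ A, (a j : ℝ) := by
    intro i j
    refine Finset.sum_nbij' (fun a => a ∘ Equiv.swap i j) (fun a => a ∘ Equiv.swap i j) ?_ ?_ ?_ ?_ ?_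
    · intro a ha
      simp only [hA, Finset.mem_piAntidiag, Finset.mem_univ, implies_true, and_true] at ha ⊢
      rw [← ha]
      exact Equiv.sum_comp (Equiv.swap i j) a
    · intro a ha
      simp only [hA, Finset.mem_piAntidiag, Finset.mem_univ, implies_true, and_true] at ha ⊢
      rw [← ha]
      exact Equiv.sum_comp (Equiv.swap i j) a
    · intro a _; ext l; simp
    · intro a _; ext l; simp
    · intro a _; simp
  have htot : ∑ i, ∑ a ∈ A, (a i : ℝ) = r * A.card := by
    rw [Finset.sum_comm, mul_comm, ← nsmul_eq_mul, Finset.sum_eq_card_nsmul]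
    intro a ha
    have := (Finset.mem_piAntidiag.1 ha).1
    exact_mod_cast this
  have hone : ∀ i, ∑ a ∈ A, (a i : ℝ) = r * A.card / M := by
    intro i
    rw [eq_div_iff (by positivity), ← htot, Finset.sum_congr rfl fun j _ => hsym j i]
    simp [mul_comm]
  rw [Finset.sum_comm]
  simp only [← Finset.mul_sum, hone]
  rw [← Finset.sum_mul]
  ring

/-- Counting of exponents with large weight. -/
lemma card_heavy_le {M k : ℕ} (hM : 0 < M) (c : Fin M → ℝ) (r : Fin k → ℕ) (hr : ∀ h, 0 < r h)
    (B : ℝ) (hB : ∀ i, |c i| ≤ B) (ε : ℝ) (hε : 0 < ε) :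
    (((Fintype.piFinset fun h => Finset.piAntidiag (Finset.univ : Finset (Fin M)) (r h)).filter
      fun p => k * ((∑ i, c i) / M + ε) < ∑ h, ∑ i, c i * p h i / r h).card : ℝ) * (k * ε ^ 2) ≤
      (2 * B) ^ 2 *
      (Fintype.piFinset fun h => Finset.piAntidiag (Finset.univ : Finset (Fin M)) (r h)).card := by
  have hM' : (0 : ℝ) < M := by exact_mod_cast hM
  have hμ : |(∑ i, c i) / M| ≤ B := by
    rw [abs_div, abs_of_pos hM', div_le_iff₀ hM']
    refine (Finset.abs_sum_le_sum_abs _ _).trans ((Finset.sum_le_sum fun i _ => hB i).trans ?_)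
    simp [mul_comm]
  have key := card_filter_lt_sum_le
    (fun h => Finset.piAntidiag (Finset.univ : Finset (Fin M)) (r h))
    (fun h a => ∑ i, c i * a i / r h - (∑ i, c i) / M) (fun h => ?_) (2 * B) (fun h a ha => ?_) ε hε
  · rw [Fintype.card_fin] at key
    refine le_trans (le_of_eq ?_) key
    congr 3
    refine Finset.filter_congr fun p _ => ?_
    rw [Finset.sum_sub_distrib]
    simp only [Finset.sum_const, Finset.card_univ, Fintype.card_fin, nsmul_eq_mul]
    constructor <;> intro h <;> linarith
  · have hrh : (r h : ℝ) ≠ 0 := by exact_mod_cast (hr h).ne'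
    rw [Finset.sum_sub_distrib]
    simp only [← Finset.sum_div]
    rw [sum_piAntidiag_apply hM]
    simp only [Finset.sum_const, nsmul_eq_mul]
    field_simp
    ring
  · have hrh : (0 : ℝ) < r h := by exact_mod_cast (hr h)
    have hs : (∑ i, (a i : ℝ)) = r h := by exact_mod_cast (Finset.mem_piAntidiag.1 ha).1
    have h1 : |∑ i, c i * a i / r h| ≤ B := by
      rw [← Finset.sum_div, abs_div, abs_of_pos hrh, div_le_iff₀ hrh, ← hs, Finset.mul_sum]
      refine (Finset.abs_sum_le_sum_abs _ _).trans (Finset.sum_le_sum fun i _ => ?_)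
      rw [abs_mul, abs_of_nonneg (a := (a i : ℝ)) (Nat.cast_nonneg (a i))]
      exact mul_le_mul_of_nonneg_right (hB i) (Nat.cast_nonneg _)
    calc _ ≤ |∑ i, c i * a i / r h| + |(∑ i, c i) / M| := abs_sub _ _
      _ ≤ _ := by linarith

/-- Block weights on variables indexed by pairs: every variable has the degree of its block. -/
def blockWeight (k M : ℕ) (hi : Fin k × Fin M) : Fin k → ℕ := Pi.single hi.1 1

lemma weight_blockWeight {k M : ℕ} (d : Fin k × Fin M →₀ ℕ) (h : Fin k) :
    Finsupp.weight (blockWeight k M) d h = ∑ i, d (h, i) := by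
  rw [Finsupp.weight_apply, Finsupp.sum_fintype _ _ (by simp), Finset.sum_apply,
    Fintype.sum_prod_type, Finset.sum_eq_single h]
  · simp [blockWeight]
  · intro h' _ hh
    simp [blockWeight, hh.symm]
  · simp

lemma isWeightedHomogeneous_aeval {σ τ N R : Type*} [CommRing R] [AddCommMonoid N]
    {w : σ → N} {w' : τ → N} {m : N} (g : σ → MvPolynomial τ R)
    (hg : ∀ i, IsWeightedHomogeneous w' (g i) (w i)) {f : MvPolynomial σ R}
    (hf : IsWeightedHomogeneous w f m) : IsWeightedHomogeneous w' (aeval g f) m := by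
  conv => arg 2; rw [f.as_sum, map_sum]
  refine IsWeightedHomogeneous.sum _ _ _ fun d hd => ?_
  rw [aeval_monomial]
  have h1 : Finsupp.weight w d = m := hf (mem_support_iff.1 hd)
  have h2 : IsWeightedHomogeneous w' (d.prod fun i e => g i ^ e) m := by
    rw [← h1, Finsupp.weight_apply]
    exact IsWeightedHomogeneous.prod _ _ _ fun i _ => (hg i).pow _
  simpa using (isWeightedHomogeneous_C w' (coeff d f)).mul h2

lemma isWeightedHomogeneous_linear {k M : ℕ} {R : Type*} [CommRing R] (L : Matrix (Fin M) (Fin M) R)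
    (hi : Fin k × Fin M) : IsWeightedHomogeneous (blockWeight k M)
      (∑ j, C (L hi.2 j) * X (hi.1, j) : MvPolynomial (Fin k × Fin M) R) (blockWeight k M hi) := by
  refine IsWeightedHomogeneous.sum _ _ _ fun j _ => ?_
  have h1 := (isWeightedHomogeneous_C (blockWeight k M) (L hi.2 j)).mul
    (isWeightedHomogeneous_X R (blockWeight k M) (hi.1, j))
  rw [zero_add] at h1
  exact h1

/-- The substitution of the linear forms with coefficient matrix `L` in each block. -/
def blockSubst (k : ℕ) {M : ℕ} {R : Type*} [CommRing R] (L : Matrix (Fin M) (Fin M) R) :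
    MvPolynomial (Fin k × Fin M) R →ₐ[R] MvPolynomial (Fin k × Fin M) R :=
  aeval fun hi => ∑ j, C (L hi.2 j) * X (hi.1, j)

lemma blockSubst_blockSubst (k : ℕ) {M : ℕ} {R : Type*} [CommRing R] (L L' : Matrix (Fin M) (Fin M) R)
    (f : MvPolynomial (Fin k × Fin M) R) :
    blockSubst k L (blockSubst k L' f) = blockSubst k (L' * L) f := by
  rw [← AlgHom.comp_apply]
  congr 1
  refine algHom_ext fun hi => ?_
  simp only [AlgHom.comp_apply, blockSubst, aeval_X, map_sum, map_mul, Finset.mul_sum,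
    Matrix.mul_apply, Finset.sum_mul, aeval_C, algebraMap_eq]
  rw [Finset.sum_comm]
  simp only [mul_assoc]

lemma blockSubst_one (k : ℕ) {M : ℕ} {R : Type*} [CommRing R] (f : MvPolynomial (Fin k × Fin M) R) :
    blockSubst k 1 f = f := by
  have : blockSubst k (1 : Matrix (Fin M) (Fin M) R) = AlgHom.id R _ := by
    refine algHom_ext fun hi => ?_
    simp only [blockSubst, aeval_X, AlgHom.id_apply]
    rw [Finset.sum_eq_single hi.2]
    · simp
    · intro j _ hj; simp [hj.symm]
    · simp
  rw [this]; rfl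

lemma blockSubst_map {k M : ℕ} {R R' : Type*} [CommRing R] [CommRing R'] (φ : R →+* R')
    (L : Matrix (Fin M) (Fin M) R) (f : MvPolynomial (Fin k × Fin M) R) :
    map φ (blockSubst k L f) = blockSubst k (L.map φ) (map φ f) := by
  induction f using MvPolynomial.induction_on with
  | C a => simp [blockSubst]
  | add p q hp hq => simp [hp, hq]
  | mul_X p i hp => simp only [map_mul, hp, map_X]; simp [blockSubst]

lemma AbsoluteValue.intCast_le {K : Type*} [Field K] (v : AbsoluteValue K ℝ) (z : ℤ) :
    v (z : K) ≤ |(z : ℝ)| := by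
  have hn : ∀ n : ℕ, v (n : K) ≤ n := by
    intro n
    induction n with
    | zero => simp
    | succ n ih =>
      push_cast
      exact (v.add_le _ _).trans (by rw [v.map_one]; linarith)
  rcases Int.eq_nat_or_neg z with ⟨n, rfl | rfl⟩
  · simpa using hn n
  · simpa using hn n

lemma prod_blockPow_le {k M : ℕ} (C : ℝ) (r : Fin k → ℕ) (d : Fin k × Fin M →₀ ℕ)
    (hd : ∀ h, ∑ i, d (h, i) = r h) : (d.prod fun _ e => C ^ e) = C ^ ∑ h, r h := by
  rw [Finsupp.prod_fintype _ _ (by simp), Finset.prod_pow_eq_pow_sum, Fintype.sum_prod_type]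
  simp only [hd]

lemma wl_const_le {k M : ℕ} {R : Type*} [CommRing R] (v : AbsoluteValue R ℝ) (C : ℝ) (r : Fin k → ℕ)
    (f : MvPolynomial (Fin k × Fin M) R) (hf : IsWeightedHomogeneous (blockWeight k M) f r) :
    wl v (fun _ => C) f = wl v (fun _ => 1) f * C ^ ∑ h, r h := by
  unfold wl
  rw [Finset.sum_mul]
  refine Finset.sum_congr rfl fun d hd => ?_
  have hw : ∀ h, ∑ i, d (h, i) = r h := fun h => by
    rw [← weight_blockWeight, hf (mem_support_iff.1 hd)]
  rw [prod_blockPow_le C r d hw]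
  simp

lemma wl_map_int_le {σ K : Type*} [Field K] (v : AbsoluteValue K ℝ) (P : MvPolynomial σ ℤ) :
    wl v (fun _ => 1) (map (Int.castRingHom K) P) ≤ intLen P := by
  classical
  have h1 : (map (Int.castRingHom K) P).support ⊆ P.support := support_map_subset _ _
  unfold intLen wl
  refine (Finset.sum_le_sum_of_subset_of_nonneg h1 fun m _ _ => by
    simp [v.nonneg]).trans (Finset.sum_le_sum fun m _ => ?_)
  rw [coeff_map]
  simpa using v.intCast_le (coeff m P)

lemma wl_linear_le {k M : ℕ} {R : Type*} [CommRing R] (v : AbsoluteValue R ℝ)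
    [IsDomain R] (L : Matrix (Fin M) (Fin M) R) (hi : Fin k × Fin M) :
    wl v (fun _ => 1) (∑ j, C (L hi.2 j) * X (hi.1, j) : MvPolynomial (Fin k × Fin M) R) ≤
      ∑ j, v (L hi.2 j) := by
  refine (wl_sum_le v (by simp) _ _).trans (Finset.sum_le_sum fun j _ => ?_)
  refine (wl_mul_le v (by simp) _ _).trans ?_
  rw [wl_C, wl_X]
  simp

lemma wl_blockSubst_le {k M : ℕ} {R : Type*} [CommRing R] [IsDomain R] (v : AbsoluteValue R ℝ)
    (L : Matrix (Fin M) (Fin M) R) (B : ℝ) (hB : ∀ i, ∑ j, v (L i j) ≤ B) (r : Fin k → ℕ)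
    (f : MvPolynomial (Fin k × Fin M) R) (hf : IsWeightedHomogeneous (blockWeight k M) f r) :
    wl v (fun _ => 1) (blockSubst k L f) ≤ wl v (fun _ => 1) f * B ^ ∑ h, r h := by
  refine (wl_aeval_le v (by simp) _ f).trans ?_
  rw [← wl_const_le v B r f hf]
  exact wl_mono v (fun i => wl_nonneg v (by simp) _) (fun hi => (wl_linear_le v L hi).trans (hB _)) f

lemma exists_int_mul_isIntegral {K : Type*} [Field K] [NumberField K] {ι : Type*} [Finite ι]
    (x : ι → K) : ∃ D : ℤ, D ≠ 0 ∧ ∀ i, IsIntegral ℤ ((D : K) * x i) := by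
  classical
  have := Fintype.ofFinite ι
  have h1 : ∀ i, ∃ D : ℤ, D ≠ 0 ∧ IsIntegral ℤ ((D : K) * x i) := by
    intro i
    have halg : IsAlgebraic ℤ (x i) :=
      (IsFractionRing.isAlgebraic_iff ℤ ℚ K).2 (Algebra.IsAlgebraic.isAlgebraic (x i))
    obtain ⟨D, hD, h⟩ := halg.exists_integral_multiple
    exact ⟨D, hD, by simpa using h⟩
  choose D hD h using h1
  refine ⟨∏ i, D i, Finset.prod_ne_zero_iff.2 fun i _ => hD i, fun i => ?_⟩
  rw [← Finset.mul_prod_erase _ _ (Finset.mem_univ i)]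
  push_cast
  rw [mul_comm (D i : K), mul_assoc]
  refine IsIntegral.mul ?_ (h i)
  exact IsIntegral.prod _ fun j _ => isIntegral_intCast (D j)

/-- The exponent vector attached to a family of exponents for the blocks. -/
def blockExp {k M : ℕ} (p : Fin k → Fin M → ℕ) : Fin k × Fin M →₀ ℕ :=
  Finsupp.equivFunOnFinite.symm fun hi => p hi.1 hi.2

@[simp] lemma blockExp_apply {k M : ℕ} (p : Fin k → Fin M → ℕ) (hi : Fin k × Fin M) :
    blockExp p hi = p hi.1 hi.2 := rfl

lemma blockExp_injective {k M : ℕ} : Function.Injective (blockExp : (Fin k → Fin M → ℕ) → _) := by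
  intro p q h
  ext h' i
  exact DFunLike.congr_fun h (h', i)

/-- Exponents of block degrees `r`. -/
def blockExps {k : ℕ} (M : ℕ) (r : Fin k → ℕ) : Finset (Fin k → Fin M → ℕ) :=
  Fintype.piFinset fun h => Finset.piAntidiag Finset.univ (r h)

lemma mem_blockExps {k M : ℕ} {r : Fin k → ℕ} {p : Fin k → Fin M → ℕ} :
    p ∈ blockExps M r ↔ ∀ h, ∑ i, p h i = r h := by
  simp [blockExps, Fintype.mem_piFinset, Finset.mem_piAntidiag]

lemma exists_blockExp {k M : ℕ} {r : Fin k → ℕ} {d : Fin k × Fin M →₀ ℕ}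
    (hd : Finsupp.weight (blockWeight k M) d = r) : ∃ p ∈ blockExps M r, blockExp p = d := by
  refine ⟨fun h i => d (h, i), mem_blockExps.2 fun h => ?_, ?_⟩
  · rw [← weight_blockWeight, hd]
  · ext hi; simp

lemma weight_blockExp {k M : ℕ} {r : Fin k → ℕ} {p : Fin k → Fin M → ℕ} (hp : p ∈ blockExps M r) :
    Finsupp.weight (blockWeight k M) (blockExp p) = r := by
  ext h
  rw [weight_blockWeight]
  exact mem_blockExps.1 hp h

lemma card_blockExps_le {k M : ℕ} (r : Fin k → ℕ) :
    ((blockExps M r).card : ℝ) ≤ (2 ^ M) ^ ∑ h, r h := by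
  classical
  have h1 : (blockExps M r).card ≤ (Fintype.piFinset fun h =>
      Fintype.piFinset fun _ : Fin M => Finset.range (r h + 1)).card := by
    refine Finset.card_le_card fun p hp => ?_
    simp only [Fintype.mem_piFinset, Finset.mem_range]
    intro h i
    have h2 := mem_blockExps.1 hp h
    have h3 := Finset.single_le_sum (f := p h) (fun _ _ => Nat.zero_le _) (Finset.mem_univ i)
    omega
  simp only [Fintype.card_piFinset, Finset.card_range, Finset.prod_const, Finset.card_univ,
    Fintype.card_fin] at h1
  have h2 : ∏ h, (r h + 1) ^ M ≤ (2 ^ M) ^ ∑ h, r h := by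
    rw [← Finset.prod_pow_eq_pow_sum]
    refine Finset.prod_le_prod' fun h _ => ?_
    rw [← pow_mul, mul_comm M, pow_mul]
    exact Nat.pow_le_pow_left Nat.lt_two_pow_self M
  exact_mod_cast h1.trans h2

lemma blockExps_nonempty {k M : ℕ} (hM : 0 < M) (r : Fin k → ℕ) : (blockExps M r).Nonempty :=
  ⟨fun h => Pi.single ⟨0, hM⟩ (r h), mem_blockExps.2 fun h => by simp⟩

open NumberField in
/-- The auxiliary polynomial. -/
theorem exists_auxiliary_polynomial {K : Type*} [Field K] [NumberField K] {S : Type} [Fintype S]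
    (v : S → AbsoluteValue K ℝ) {M : ℕ} (hM : 0 < M) (L : S → Matrix (Fin M) (Fin M) K)
    (hL : ∀ s, (L s).det ≠ 0) (c : S → Fin M → ℝ) (ε : ℝ) (hε : 0 < ε) :
    ∃ k : ℕ, 0 < k ∧ ∃ B : ℝ, 1 ≤ B ∧ ∀ r : Fin k → ℕ, (∀ h, 0 < r h) →
      ∃ P : MvPolynomial (Fin k × Fin M) ℤ, P ≠ 0 ∧
        IsWeightedHomogeneous (blockWeight k M) P r ∧ intLen P ≤ B ^ (∑ h, r h) ∧
        ∀ s, ∃ Q : MvPolynomial (Fin k × Fin M) K,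
          IsWeightedHomogeneous (blockWeight k M) Q r ∧
          map (Int.castRingHom K) P = blockSubst k (L s) Q ∧
          wl (v s) (fun _ => 1) Q ≤ B ^ (∑ h, r h) ∧
          ∀ a, coeff a Q ≠ 0 → ∑ h, ∑ i, c s i * a (h, i) / r h ≤ k * ((∑ i, c s i) / M + ε) := by
  classical
  obtain ⟨CS, hCS1, hCS⟩ := exists_int_solution K
  obtain ⟨D, hD0, hD⟩ := exists_int_mul_isIntegral
    (fun x : S × Fin M × Fin M => (L x.1)⁻¹ x.2.1 x.2.2)
  let lin : S → Matrix (Fin M) (Fin M) (𝓞 K) := fun s => Matrix.of fun i j =>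
    ⟨(D : K) * (L s)⁻¹ i j, hD (s, i, j)⟩
  have hlin : ∀ s, (lin s).map (algebraMap (𝓞 K) K) = (D : K) • (L s)⁻¹ := by
    intro s; ext i j; rfl
  -- bounds for the forms
  let vφ : (K →+* ℂ) → AbsoluteValue (𝓞 K) ℝ := fun φ =>
    (NormedField.toAbsoluteValue ℂ).comp (f := φ.comp (algebraMap (𝓞 K) K))
      (φ.injective.comp RingOfIntegers.coe_injective)
  obtain ⟨C0, hC0⟩ := Finite.exists_le fun x : S × (K →+* ℂ) × Fin M =>
    ∑ j, vφ x.2.1 (lin x.1 x.2.2 j)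
  obtain ⟨C1, hC1⟩ := Finite.exists_le fun x : S × Fin M => ∑ j, v x.1 ((L x.1)⁻¹ x.2 j)
  obtain ⟨Bc, hBc⟩ := Finite.exists_le fun x : S × Fin M => |c x.1 x.2|
  set A0 := max C0 1 with hA0
  set A1 := max C1 1 with hA1
  have hA0' : 1 ≤ A0 := le_max_right _ _
  have hA1' : 1 ≤ A1 := le_max_right _ _
  set d := Module.finrank ℚ K with hd
  obtain ⟨k0, hk0⟩ := exists_nat_ge (2 * d * Fintype.card S * (2 * Bc) ^ 2 / ε ^ 2)
  set k := k0 + 1 with hk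
  have hkε : 2 * d * Fintype.card S * (2 * Bc) ^ 2 ≤ k * ε ^ 2 := by
    rw [div_le_iff₀ (by positivity)] at hk0
    refine hk0.trans ?_
    gcongr
    exact_mod_cast Nat.le_succ k0
  set B := 2 ^ M * (2 ^ M * CS * A0) * A1 with hB
  have h2M : (1 : ℝ) ≤ 2 ^ M := one_le_pow₀ one_le_two
  have hB1 : 2 ^ M * (2 ^ M * CS * A0) ≤ B := by
    rw [hB]; exact le_mul_of_one_le_right (by positivity) hA1'
  refine ⟨k, Nat.succ_pos _, B, ?_, fun r hr => ?_⟩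
  · refine le_trans ?_ hB1
    have h3 : 1 ≤ 2 ^ M * CS := one_le_mul_of_one_le_of_one_le h2M hCS1
    exact one_le_mul_of_one_le_of_one_le h2M (one_le_mul_of_one_le_of_one_le h3 hA0')
  set N := ∑ h, r h with hN
  have hN1 : 1 ≤ N := by
    have := Finset.single_le_sum (f := r) (fun _ _ => Nat.zero_le _) (Finset.mem_univ (0 : Fin k))
    have h2 := hr 0
    omega
  let bad : S → Finset (Fin k → Fin M → ℕ) := fun s => (blockExps M r).filter fun p =>
    k * ((∑ i, c s i) / M + ε) < ∑ h, ∑ i, c s i * p h i / r h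
  have hbad : ∀ s, ((bad s).card : ℝ) * (k * ε ^ 2) ≤ (2 * Bc) ^ 2 * (blockExps M r).card :=
    fun s => card_heavy_le hM (c s) r hr Bc (fun i => hBc (s, i)) ε hε
  have hcard : 2 * (d * Fintype.card (Σ s, ↥(bad s))) ≤ Fintype.card ↥(blockExps M r) := by
    rw [Fintype.card_sigma]
    simp only [Fintype.card_coe]
    have hkp : (0 : ℝ) < k * ε ^ 2 := by positivity
    have h1 : (2 * (d * ∑ s, ((bad s).card : ℝ))) * (k * ε ^ 2) ≤
        (blockExps M r).card * (k * ε ^ 2) := by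
      calc (2 * (d * ∑ s, ((bad s).card : ℝ))) * (k * ε ^ 2) =
          2 * d * ∑ s, ((bad s).card : ℝ) * (k * ε ^ 2) := by rw [← Finset.sum_mul]; ring
        _ ≤ 2 * d * ∑ s : S, (2 * Bc) ^ 2 * ((blockExps M r).card : ℝ) := by
          exact mul_le_mul_of_nonneg_left (Finset.sum_le_sum fun s _ => hbad s) (by positivity)
        _ = (2 * d * Fintype.card S * (2 * Bc) ^ 2) * (blockExps M r).card := by
          simp; ring
        _ ≤ (k * ε ^ 2) * (blockExps M r).card := by gcongr
        _ = _ := by ring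
    have h2 := le_of_mul_le_mul_right h1 hkp
    exact_mod_cast h2
  -- the linear system
  let E : (Σ s, ↥(bad s)) → ↥(blockExps M r) → K := fun a b =>
    algebraMap (𝓞 K) K (coeff (blockExp a.2.1) (blockSubst k (lin a.1) (monomial (blockExp b.1) 1)))
  obtain ⟨p, hp0, hp, hpb⟩ := hCS _ _ E (A0 ^ N) (one_le_pow₀ hA0')
    (fun a b => RingOfIntegers.isIntegral_coe _)
    (fun a b => by
      rw [house_eq_sup']
      have : ∀ φ : K →+* ℂ, (‖φ (E a b)‖₊ : ℝ) ≤ A0 ^ N := by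
        intro φ
        have h1 : (‖φ (E a b)‖₊ : ℝ) = vφ φ (coeff (blockExp a.2.1)
          (blockSubst k (lin a.1) (monomial (blockExp b.1) 1))) := rfl
        rw [h1]
        have h2 := coeff_mul_le_wl (vφ φ) (ρ := fun _ => 1) (by simp)
          (blockSubst k (lin a.1) (monomial (blockExp b.1) 1)) (blockExp a.2.1)
        have h3 := wl_blockSubst_le (vφ φ) (lin a.1) A0
          (fun i => (hC0 (a.1, φ, i)).trans (le_max_left _ _)) r (monomial (blockExp b.1) 1)
          (isWeightedHomogeneous_monomial _ _ _ (weight_blockExp b.2))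
        rw [wl_monomial] at h3
        simp only [one_pow, Finsupp.prod, Finset.prod_const_one, mul_one] at h2 h3
        rw [(vφ φ).map_one, one_mul] at h3
        exact h2.trans h3
      obtain ⟨φ, _, hφ⟩ := Finset.exists_mem_eq_sup' (Finset.univ_nonempty (α := K →+* ℂ))
        (fun φ => ‖φ (E a b)‖₊)
      rw [hφ]
      exact this φ)
    (by rw [Fintype.card_coe]; exact Finset.card_pos.2 (blockExps_nonempty hM r)) hcard
  rw [Fintype.card_coe] at hpb
  let P : MvPolynomial (Fin k × Fin M) ℤ := ∑ b : ↥(blockExps M r), monomial (blockExp b.1) (p b)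
  have hPc : ∀ b : ↥(blockExps M r), coeff (blockExp b.1) P = p b := by
    intro b
    simp only [P, coeff_sum, coeff_monomial]
    rw [Finset.sum_eq_single b]
    · simp
    · intro b' _ hb'
      rw [if_neg]
      exact fun h => hb' (Subtype.ext (blockExp_injective h))
    · simp
  have hPh : IsWeightedHomogeneous (blockWeight k M) P r := by
    refine IsWeightedHomogeneous.sum _ _ _ fun b _ => ?_
    exact isWeightedHomogeneous_monomial _ _ _ (weight_blockExp b.2)
  have hPlen : intLen P ≤ (2 ^ M * (2 ^ M * CS * A0)) ^ N := by
    refine (wl_sum_le intAbs (by simp) _ _).trans ?_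
    have h1 : ∀ b ∈ (Finset.univ : Finset ↥(blockExps M r)),
        wl intAbs (fun _ => 1) (monomial (blockExp b.1) (p b)) ≤
        (2 ^ M) ^ N * (CS * A0 ^ N) := by
      intro b _
      rw [wl_monomial]
      simp only [one_pow, Finsupp.prod, Finset.prod_const_one, mul_one, intAbs_apply]
      refine (hpb b).trans ?_
      gcongr
      exact card_blockExps_le r
    refine (Finset.sum_le_card_nsmul _ _ _ h1).trans ?_
    rw [Finset.card_univ, Fintype.card_coe, nsmul_eq_mul, mul_pow, mul_pow, mul_pow]
    have h3 : CS ≤ CS ^ N := le_self_pow₀ hCS1 (by omega)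
    have h4 := card_blockExps_le (M := M) r
    rw [mul_assoc ((2 ^ M) ^ N)]
    gcongr
  refine ⟨P, ?_, hPh, hPlen.trans (by gcongr), fun s => ?_⟩
  · intro h0
    refine hp0 (funext fun b => ?_)
    rw [← hPc, h0, coeff_zero]; rfl
  have hPK : IsWeightedHomogeneous (blockWeight k M) (map (Int.castRingHom K) P) r := by
    intro m hm
    refine hPh (fun h => hm ?_)
    rw [coeff_map, h, map_zero]
  have hQh : IsWeightedHomogeneous (blockWeight k M)
      (blockSubst k (L s)⁻¹ (map (Int.castRingHom K) P)) r :=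
    isWeightedHomogeneous_aeval _ (isWeightedHomogeneous_linear _) hPK
  refine ⟨blockSubst k (L s)⁻¹ (map (Int.castRingHom K) P), hQh, ?_, ?_, ?_⟩
  · rw [blockSubst_blockSubst, Matrix.nonsing_inv_mul _ (isUnit_iff_ne_zero.2 (hL s)), blockSubst_one]
  · refine (wl_blockSubst_le (v s) _ A1 (fun i => (hC1 (s, i)).trans (le_max_left _ _)) r _ hPK).trans ?_
    rw [hB, mul_pow _ A1]
    gcongr
    exact (wl_map_int_le (v s) P).trans hPlen
  · intro a ha
    obtain ⟨q, hq, rfl⟩ := exists_blockExp (hQh ha)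
    by_contra hcon
    push Not at hcon
    have hqb : q ∈ bad s := Finset.mem_filter.2 ⟨hq, hcon⟩
    have h1 := hp ⟨s, q, hqb⟩
    refine ha ?_
    have hDN : ((D : K) ^ N) ≠ 0 := pow_ne_zero _ (by exact_mod_cast hD0)
    -- scaling the matrix scales homogeneous polynomials
    have hscale : blockSubst k ((D : K) • (L s)⁻¹) (map (Int.castRingHom K) P) =
        C ((D : K) ^ N) * blockSubst k (L s)⁻¹ (map (Int.castRingHom K) P) := by
      have hg : ∀ m ∈ (map (Int.castRingHom K) P).support, blockSubst k ((D : K) • (L s)⁻¹)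
          (monomial m (coeff m (map (Int.castRingHom K) P))) = C ((D : K) ^ N) *
          blockSubst k (L s)⁻¹ (monomial m (coeff m (map (Int.castRingHom K) P))) := by
        intro m hm
        simp only [blockSubst, aeval_monomial]
        have h5 : ∀ hi : Fin k × Fin M, (∑ j, C (((D : K) • (L s)⁻¹) hi.2 j) * X (hi.1, j) :
            MvPolynomial (Fin k × Fin M) K) = C (D : K) * ∑ j, C ((L s)⁻¹ hi.2 j) * X (hi.1, j) := by
          intro hi
          rw [Finset.mul_sum]
          refine Finset.sum_congr rfl fun j _ => ?_
          rw [Matrix.smul_apply, smul_eq_mul, C_mul, mul_assoc]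
        simp only [h5, mul_pow]
        rw [Finsupp.prod_mul]
        have h6 : (m.prod fun _ e => (C (D : K) : MvPolynomial (Fin k × Fin M) K) ^ e) =
            C ((D : K) ^ N) := by
          have h7 : ∀ h, ∑ i, m (h, i) = r h := fun h => by
            rw [← weight_blockWeight, hPK (mem_support_iff.1 hm)]
          rw [Finsupp.prod_fintype _ _ (by simp), Finset.prod_pow_eq_pow_sum, Fintype.sum_prod_type]
          simp only [h7]
          rw [C_pow]
        rw [h6]
        ring
      conv_lhs => rw [(map (Int.castRingHom K) P).as_sum, map_sum]
      conv_rhs => rw [(map (Int.castRingHom K) P).as_sum, map_sum, Finset.mul_sum]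
      exact Finset.sum_congr rfl hg
    have h2 := congrArg (coeff (blockExp q)) hscale
    rw [coeff_C_mul] at h2
    have h3 : coeff (blockExp q) (blockSubst k ((D : K) • (L s)⁻¹) (map (Int.castRingHom K) P)) = 0 := by
      rw [← h1, ← hlin, map_sum, map_sum, coeff_sum]
      refine Finset.sum_congr rfl fun b _ => ?_
      have h8 : (map (Int.castRingHom K)) (monomial (blockExp b.1) (p b)) =
          C ((p b : K)) * map (algebraMap (𝓞 K) K) (monomial (blockExp b.1) 1) := by
        rw [map_monomial, map_monomial, C_mul_monomial, map_one, mul_one]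
        rfl
      rw [h8, map_mul, ← blockSubst_map]
      have h9 : blockSubst k ((lin s).map (algebraMap (𝓞 K) K)) (C (p b : K)) = C (p b : K) := by
        simp [blockSubst]
      rw [h9, coeff_C_mul, coeff_map]
    rw [h3] at h2
    exact (mul_eq_zero.1 h2.symm).resolve_left hDN

/-- Substitution of `∑ j, Y j • w j + Y last • e` in each block. -/
def spanSubst {k m : ℕ} (R : Type*) [CommRing R] (w : Fin k → Fin m → Fin (m + 1) → ℤ)
    (e : Fin k → Fin (m + 1) → ℤ) :
    MvPolynomial (Fin k × Fin (m + 1)) R →ₐ[R] MvPolynomial (Fin k × Fin (m + 1)) R :=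
  aeval fun hi => (∑ j : Fin m, C ((w hi.1 j hi.2 : ℤ) : R) * X (hi.1, j.castSucc)) +
    C ((e hi.1 hi.2 : ℤ) : R) * X (hi.1, Fin.last m)

lemma spanSubst_map {k m : ℕ} {R R' : Type*} [CommRing R] [CommRing R'] (φ : R →+* R')
    (w : Fin k → Fin m → Fin (m + 1) → ℤ) (e : Fin k → Fin (m + 1) → ℤ)
    (f : MvPolynomial (Fin k × Fin (m + 1)) R) :
    map φ (spanSubst R w e f) = spanSubst R' w e (map φ f) := by
  induction f using MvPolynomial.induction_on with
  | C a => simp [spanSubst]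
  | add p q hp hq => simp [hp, hq]
  | mul_X p i hp => simp only [map_mul, hp, map_X]; simp [spanSubst]

lemma spanSubst_blockSubst {k m : ℕ} {K : Type*} [Field K] (w : Fin k → Fin m → Fin (m + 1) → ℤ)
    (e : Fin k → Fin (m + 1) → ℤ) (L : Matrix (Fin (m + 1)) (Fin (m + 1)) K)
    (f : MvPolynomial (Fin k × Fin (m + 1)) K) :
    spanSubst K w e (blockSubst k L f) = aeval (fun hi : Fin k × Fin (m + 1) =>
      (∑ j : Fin m, C (∑ i, L hi.2 i * (w hi.1 j i : ℤ)) * X (hi.1, j.castSucc)) +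
      C (∑ i, L hi.2 i * (e hi.1 i : ℤ)) * X (hi.1, Fin.last m)) f := by
  refine AlgHom.congr_fun (φ₁ := (spanSubst K w e).comp (blockSubst k L)) ?_ f
  refine algHom_ext fun hi => ?_
  simp only [AlgHom.comp_apply, blockSubst, spanSubst, aeval_X, map_sum, map_mul, aeval_C,
    algebraMap_eq, mul_add, Finset.sum_add_distrib, Finset.mul_sum, Finset.sum_mul]
  rw [Finset.sum_comm]
  simp only [mul_assoc]

lemma prod_exp_pow {k M : ℕ} (A : ℝ) (n r : Fin k → ℕ) (R : ℕ) (hr : ∀ h, 0 < r h)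
    (hnr : ∀ h, n h * r h = R) (c : Fin M → ℝ) (a : Fin k × Fin M →₀ ℕ)
    (ha : ∀ h, ∑ i, a (h, i) = r h) :
    (a.prod fun hi e => (A * Real.exp (n hi.1 * c hi.2)) ^ e) =
      A ^ (∑ h, r h) * Real.exp (R * ∑ h, ∑ i, c i * a (h, i) / r h) := by
  simp only [mul_pow]
  rw [Finsupp.prod_mul, prod_blockPow_le A r a ha]
  have h0 : (a.prod fun hi e => Real.exp (n hi.1 * c hi.2) ^ e) =
      ∏ hi, Real.exp (n hi.1 * c hi.2) ^ a hi :=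
    Finsupp.prod_fintype _ _ fun _ => pow_zero _
  rw [h0]
  simp only [← Real.exp_nat_mul]
  rw [← Real.exp_sum, Fintype.sum_prod_type, Finset.mul_sum]
  refine congrArg (fun x => A ^ (∑ h, r h) * Real.exp x) ?_
  refine Finset.sum_congr rfl fun h _ => ?_
  rw [Finset.mul_sum]
  refine Finset.sum_congr rfl fun i _ => ?_
  have h1 : (r h : ℝ) ≠ 0 := by exact_mod_cast (hr h).ne'
  have h2 : (n h : ℝ) * r h = R := by exact_mod_cast hnr h
  rw [← h2]
  field_simp

/-- The auxiliary polynomial vanishes to high order along the subspaces spanned by the small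
points. -/
theorem exists_polynomial_vanishing {K : Type*} [Field K] [NumberField K] {S : Type} [Fintype S]
    [Nonempty S]
    (v : S → AbsoluteValue K ℝ) (hprod : ∀ z : ℤ, z ≠ 0 → 1 ≤ ∏ s, v s (z : K)) {m : ℕ}
    (L : S → Matrix (Fin (m + 1)) (Fin (m + 1)) K) (hL : ∀ s, (L s).det ≠ 0)
    (c : S → Fin (m + 1) → ℝ) (hc : ∑ s, ∑ i, c s i < 0) :
    ∃ k : ℕ, 0 < k ∧ ∃ B : ℝ, 1 ≤ B ∧ ∃ θ : ℝ, 0 < θ ∧ ∃ n0 : ℕ,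
      ∀ (n r : Fin k → ℕ) (R : ℕ), (∀ h, 0 < r h) → (∀ h, n0 ≤ n h) → (∀ h, n h * r h = R) →
      ∀ (w : Fin k → Fin m → Fin (m + 1) → ℤ) (e : Fin k → Fin (m + 1) → ℤ),
      (∀ h i, |e h i| ≤ 1) →
      (∀ s h i j, v s (∑ i', L s i i' * (w h j i' : ℤ)) ≤ Real.exp (n h * c s i)) →
      ∃ P : MvPolynomial (Fin k × Fin (m + 1)) ℤ, P ≠ 0 ∧
        IsWeightedHomogeneous (blockWeight k (m + 1)) P r ∧ intLen P ≤ B ^ (∑ h, r h) ∧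
        ∀ t, coeff t (spanSubst ℤ w e P) ≠ 0 → θ ≤ ∑ h, (t (h, Fin.last m) : ℝ) / r h := by
  classical
  set δ : ℝ := -(∑ s, ∑ i, c s i) / (m + 1) with hδ
  have hδ0 : 0 < δ := by
    rw [hδ]; exact div_pos (by linarith) (by positivity)
  have hS : (0 : ℝ) < Fintype.card S := by exact_mod_cast Fintype.card_pos
  set ε : ℝ := δ / (4 * Fintype.card S) with hε
  have hε0 : 0 < ε := by positivity
  obtain ⟨k, hk, B, hB, H⟩ := exists_auxiliary_polynomial v (Nat.succ_pos m) L hL c ε hε0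
  obtain ⟨Bc', hBc'⟩ := Finite.exists_le fun x : S × Fin (m + 1) => |c x.1 x.2|
  obtain ⟨CL', hCL'⟩ := Finite.exists_le fun x : S × Fin (m + 1) => ∑ i', v x.1 (L x.1 x.2 i')
  set Bc := max Bc' 1
  have hBc1 : 1 ≤ Bc := le_max_right _ _
  set CL := max CL' 1
  have hCL1 : 1 ≤ CL := le_max_right _ _
  set A : ℝ := m + CL with hA
  have hA1 : 1 ≤ A := by rw [hA]; linarith [(Nat.cast_nonneg m : (0 : ℝ) ≤ m)]
  set D := A * B with hD
  have hD1 : 1 ≤ D := by nlinarith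
  set θ : ℝ := k * (δ / (4 * Bc * Fintype.card S)) with hθ
  have hk' : (0 : ℝ) < k := by exact_mod_cast hk
  have hθ0 : 0 < θ := by positivity
  obtain ⟨n1, hn1⟩ := exists_nat_gt (4 * (Fintype.card S * Real.log D) / δ)
  refine ⟨k, hk, B, hB, θ, hθ0, n1 + 1, fun n r R hr hn hnr w e he hw => ?_⟩
  obtain ⟨P, hP0, hPh, hPl, hPQ⟩ := H r hr
  refine ⟨P, hP0, hPh, hPl, fun t ht => ?_⟩
  by_contra hcon
  push Not at hcon
  set z := coeff t (spanSubst ℤ w e P) with hz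
  set N := ∑ h, r h with hN
  set τ := ∑ h, (t (h, Fin.last m) : ℝ) / r h with hτ
  -- the weights
  let ρ : Fin k × Fin (m + 1) → ℝ := fun hi =>
    if hi.2 = Fin.last m then Real.exp (n hi.1 * (-Bc)) else 1
  have hρ : ∀ hi, 0 ≤ ρ hi := by
    intro hi; simp only [ρ]; split_ifs <;> positivity
  have hρt : (t.prod fun hi e => ρ hi ^ e) = Real.exp (-(R * Bc * τ)) := by
    rw [Finsupp.prod_fintype _ _ (by simp), Fintype.prod_prod_type]
    have h1 : ∀ h, ∏ i, ρ (h, i) ^ t (h, i) = Real.exp (-(R * Bc * (t (h, Fin.last m) / r h))) := by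
      intro h
      rw [Finset.prod_eq_single (Fin.last m)]
      · simp only [ρ, if_true]
        rw [← Real.exp_nat_mul]
        congr 1
        have h1 : (r h : ℝ) ≠ 0 := by exact_mod_cast (hr h).ne'
        have h2 : (n h : ℝ) * r h = R := by exact_mod_cast hnr h
        rw [← h2]
        field_simp
      · intro i _ hi
        simp [ρ, hi]
      · simp
    simp only [h1]
    rw [← Real.exp_sum, Finset.sum_neg_distrib, ← Finset.mul_sum]
  have key : ∀ s, v s (z : K) ≤
      D ^ N * Real.exp (R * (k * ((∑ i, c s i) / (m + 1) + ε)) + R * Bc * τ) := by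
    intro s
    obtain ⟨Q, hQh, hPQs, hQl, hQa⟩ := hPQ s
    have h1 : (z : K) = coeff t (spanSubst K w e (blockSubst k (L s) Q)) := by
      rw [← hPQs, ← spanSubst_map, coeff_map]; rfl
    have h2 := coeff_mul_le_wl (v s) hρ (spanSubst K w e (blockSubst k (L s) Q)) t
    rw [← h1, hρt, spanSubst_blockSubst] at h2
    have h3 := h2.trans (wl_aeval_le (v s) hρ _ Q)
    have h4 : ∀ hi : Fin k × Fin (m + 1), wl (v s) ρ
        ((∑ j : Fin m, C (∑ i, L s hi.2 i * (w hi.1 j i : ℤ)) * X (hi.1, j.castSucc)) +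
          C (∑ i, L s hi.2 i * (e hi.1 i : ℤ)) * X (hi.1, Fin.last m)) ≤
        A * Real.exp (n hi.1 * c s hi.2) := by
      intro hi
      refine (wl_add_le (v s) hρ _ _).trans ?_
      rw [hA, add_mul]
      refine add_le_add ?_ ?_
      · refine (wl_sum_le (v s) hρ _ _).trans ?_
        refine (Finset.sum_le_card_nsmul _ _ (Real.exp (n hi.1 * c s hi.2)) fun j _ => ?_).trans ?_
        · refine (wl_mul_le (v s) hρ _ _).trans ?_
          rw [wl_C, wl_X, (v s).map_one]
          have : ρ (hi.1, j.castSucc) = 1 := by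
            simp [ρ, Fin.castSucc_ne_last]
          rw [this, mul_one, mul_one]
          exact hw s hi.1 hi.2 j
        · simp
      · refine (wl_mul_le (v s) hρ _ _).trans ?_
        rw [wl_C, wl_X, (v s).map_one, one_mul]
        have h5 : v s (∑ i, L s hi.2 i * (e hi.1 i : ℤ)) ≤ CL := by
          refine (v s).sum_le _ _ |>.trans ?_
          refine le_trans (Finset.sum_le_sum fun i _ => ?_)
            ((hCL' (s, hi.2)).trans (le_max_left _ _))
          rw [(v s).map_mul]
          refine mul_le_of_le_one_right ((v s).nonneg _) (((v s).intCast_le _).trans ?_)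
          exact_mod_cast he hi.1 i
        have h6 : ρ (hi.1, Fin.last m) ≤ Real.exp (n hi.1 * c s hi.2) := by
          simp only [ρ, if_true]
          refine Real.exp_le_exp.2 ?_
          have := (abs_le.1 ((hBc' (s, hi.2)).trans (le_max_left _ 1))).1
          exact mul_le_mul_of_nonneg_left this (Nat.cast_nonneg _)
        exact mul_le_mul h5 h6 (hρ _) (by linarith)
    have h5 := h3.trans (wl_mono (v s) (fun hi => wl_nonneg (v s) hρ _) h4 Q)
    have h6 : wl (v s) (fun hi : Fin k × Fin (m + 1) => A * Real.exp (n hi.1 * c s hi.2)) Q ≤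
        wl (v s) (fun _ => 1) Q *
          (A ^ N * Real.exp (R * (k * ((∑ i, c s i) / (m + 1) + ε)))) := by
      unfold wl
      rw [Finset.sum_mul]
      refine Finset.sum_le_sum fun a ha => ?_
      have ha' := mem_support_iff.1 ha
      have hw : ∀ h, ∑ i, a (h, i) = r h := fun h => by rw [← weight_blockWeight, hQh ha']
      rw [prod_exp_pow A n r R hr hnr (c s) a hw]
      simp only [one_pow, Finsupp.prod, Finset.prod_const_one, mul_one]
      have := hQa a ha'
      push_cast at this
      have hv := (v s).nonneg (coeff a Q)
      gcongr
    have h7 : v s (z : K) * Real.exp (-(R * Bc * τ)) ≤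
        B ^ N * (A ^ N * Real.exp (R * (k * ((∑ i, c s i) / (m + 1) + ε)))) := by
      refine h5.trans (h6.trans ?_)
      gcongr
    rw [Real.exp_neg, ← div_eq_mul_inv, div_le_iff₀ (Real.exp_pos _)] at h7
    refine h7.trans (le_of_eq ?_)
    rw [Real.exp_add, hD, mul_pow]
    ring
  have h1 := hprod z ht
  have h2 := h1.trans (Finset.prod_le_prod (fun s _ => (v s).nonneg _) fun s _ => key s)
  have hDexp : D ^ N = Real.exp (N * Real.log D) := by
    rw [← Real.log_pow, Real.exp_log (by positivity)]
  simp only [hDexp, ← Real.exp_add] at h2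
  rw [← Real.exp_sum, Real.one_le_exp_iff] at h2
  have h3 : ∑ s, (N * Real.log D + (R * (k * ((∑ i, c s i) / (m + 1) + ε)) + R * Bc * τ)) =
      Fintype.card S * (N * Real.log D) + R * k * (-δ + Fintype.card S * ε) +
        Fintype.card S * R * Bc * τ := by
    have : ∀ s, (N * Real.log D + (R * (k * ((∑ i, c s i) / (m + 1) + ε)) + R * Bc * τ)) =
      N * Real.log D + R * k * ε + R * Bc * τ + (R * k / (m + 1)) * ∑ i, c s i := by
      intro s; ring
    simp only [this]
    rw [Finset.sum_add_distrib, ← Finset.mul_sum]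
    simp only [Finset.sum_const, Finset.card_univ, nsmul_eq_mul]
    have h4 : ∑ s, ∑ i, c s i = -δ * (m + 1) := by rw [hδ]; field_simp
    rw [h4]
    field_simp
    ring
  rw [h3] at h2
  have hSε : Fintype.card S * ε = δ / 4 := by rw [hε]; field_simp
  have hR0 : (0 : ℝ) < R := by
    have h0 := hnr ⟨0, hk⟩
    have h1 := hr ⟨0, hk⟩
    have h2 := hn ⟨0, hk⟩
    have : 0 < R := by rw [← h0]; exact Nat.mul_pos (by omega) h1
    exact_mod_cast this
  have hSτ : Fintype.card S * R * Bc * τ ≤ R * k * (δ / 4) := by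
    calc Fintype.card S * R * Bc * τ ≤ Fintype.card S * R * Bc * θ := by gcongr
      _ = R * k * (δ / 4) := by rw [hθ]; field_simp
  have hNR : (N : ℝ) * (n1 + 1) ≤ k * R := by
    have h1 : ∀ h, r h * (n1 + 1) ≤ R := fun h => by
      rw [← hnr h, mul_comm]; exact Nat.mul_le_mul_right _ (hn h)
    have h2 : N * (n1 + 1) ≤ k * R := by
      rw [hN, Finset.sum_mul]
      refine (Finset.sum_le_card_nsmul _ _ R fun h _ => h1 h).trans ?_
      simp
    exact_mod_cast h2
  have hlogD : 0 ≤ Real.log D := Real.log_nonneg hD1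
  rw [div_lt_iff₀ hδ0] at hn1
  have h5 : Fintype.card S * (N * Real.log D) ≤ R * k * (δ / 4) := by
    have hN0 : (0 : ℝ) ≤ N := Nat.cast_nonneg _
    nlinarith [mul_le_mul_of_nonneg_left hn1.le hN0, mul_le_mul_of_nonneg_right hNR hδ0.le]
  rw [hSε] at h2
  have : 0 < (R : ℝ) * k * δ := by positivity
  nlinarith

/-- The part of an exponent supported outside the two distinguished variables of each block. -/
def restExp {k M : ℕ} (a b : Fin k → Fin M) : (Fin k × Fin M →₀ ℕ) →+ (Fin k × Fin M →₀ ℕ) where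
  toFun m := Finsupp.equivFunOnFinite.symm fun hi => if hi.2 = a hi.1 ∨ hi.2 = b hi.1 then 0 else m hi
  map_zero' := by ext; simp
  map_add' m m' := by ext hi; by_cases h : hi.2 = a hi.1 ∨ hi.2 = b hi.1 <;> simp [h]

/-- The exponents of the first distinguished variable of each block. -/
def mainExp {k M : ℕ} (a : Fin k → Fin M) : (Fin k × Fin M →₀ ℕ) →+ (Fin k →₀ ℕ) where
  toFun m := Finsupp.equivFunOnFinite.symm fun h => m (h, a h)
  map_zero' := by ext; simp
  map_add' m m' := by ext; simp

lemma restExp_apply {k M : ℕ} (a b : Fin k → Fin M) (m : Fin k × Fin M →₀ ℕ) (hi) :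
    restExp a b m hi = if hi.2 = a hi.1 ∨ hi.2 = b hi.1 then 0 else m hi := rfl

lemma mainExp_apply {k M : ℕ} (a : Fin k → Fin M) (m : Fin k × Fin M →₀ ℕ) (h) :
    mainExp a m h = m (h, a h) := rfl

/-- Dehomogenisation with respect to the second distinguished variable of each block, keeping the
first ones as coefficients. -/
def dehom {k M : ℕ} (R : Type*) [CommRing R] (a b : Fin k → Fin M) :
    MvPolynomial (Fin k × Fin M) ℤ →ₐ[ℤ] MvPolynomial (Fin k × Fin M) (MvPolynomial (Fin k) R) :=
  aeval fun hi => if hi.2 = a hi.1 then C (X hi.1) else if hi.2 = b hi.1 then 1 else X hi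

lemma dehom_monomial {k M : ℕ} {R : Type*} [CommRing R] {a b : Fin k → Fin M}
    (hab : ∀ h, a h ≠ b h) (m : Fin k × Fin M →₀ ℕ) (c : ℤ) :
    dehom R a b (monomial m c) = monomial (restExp a b m) (monomial (mainExp a m) (c : R)) := by
  have key : dehom R a b (monomial m 1) = monomial (restExp a b m) (monomial (mainExp a m) 1) := by
    induction m using Finsupp.induction_linear with
    | zero => simp [dehom]
    | add f g hf hg =>
      rw [← one_mul (1 : ℤ), ← monomial_mul, map_mul, hf, hg, monomial_mul, monomial_mul,
        map_add, map_add]; simp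
    | single hi e =>
      obtain ⟨h, i⟩ := hi
      have h0 : (monomial (Finsupp.single (h, i) e) (1 : ℤ)) = X (h, i) ^ e := by
        rw [X_pow_eq_monomial]
      rw [h0, map_pow, dehom, aeval_X]
      by_cases h1 : i = a h
      · have e1 : restExp a b (Finsupp.single (h, i) e) = 0 := by
          ext ⟨h', i'⟩
          rw [restExp_apply, Finsupp.single_apply]
          by_cases h2 : (h, i) = (h', i')
          · cases h2; simp [h1]
          · simp [h2]
        have e2 : mainExp a (Finsupp.single (h, i) e) = Finsupp.single h e := by
          ext h'
          rw [mainExp_apply, Finsupp.single_apply, Finsupp.single_apply]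
          by_cases h2 : h = h'
          · cases h2; simp [h1]
          · simp [h2]
        rw [e1, e2, if_pos h1, ← C_pow, X_pow_eq_monomial]; rfl
      · have e2 : mainExp a (Finsupp.single (h, i) e) = 0 := by
          ext h'
          rw [mainExp_apply, Finsupp.single_apply, if_neg]
          · rfl
          · intro h2; cases h2; exact h1 rfl
        by_cases h3 : i = b h
        · have e1 : restExp a b (Finsupp.single (h, i) e) = 0 := by
            ext ⟨h', i'⟩
            rw [restExp_apply, Finsupp.single_apply]
            by_cases h2 : (h, i) = (h', i')
            · cases h2; simp [h3]
            · simp [h2]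
          rw [e1, e2]; simp [h3, (hab h).symm]
        · have e1 : restExp a b (Finsupp.single (h, i) e) = Finsupp.single (h, i) e := by
            ext ⟨h', i'⟩
            rw [restExp_apply, Finsupp.single_apply]
            by_cases h2 : (h, i) = (h', i')
            · cases h2; simp [h3, h1]
            · simp [h2]
          rw [e1, e2, if_neg h1, if_neg h3, X_pow_eq_monomial]; rfl
  have : monomial m c = c • monomial m (1 : ℤ) := by rw [smul_monomial]; simp
  rw [this, map_zsmul, key, ← map_zsmul, ← map_zsmul]; simp

lemma coeff_dehom {k M : ℕ} {R : Type*} [CommRing R] {a b : Fin k → Fin M}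
    (hab : ∀ h, a h ≠ b h) (P : MvPolynomial (Fin k × Fin M) ℤ) (μ s) :
    coeff s (coeff μ (dehom R a b P)) =
      ∑ m ∈ P.support, if restExp a b m = μ ∧ mainExp a m = s then ((coeff m P : ℤ) : R) else 0 := by
  conv_lhs => rw [P.as_sum]
  rw [map_sum, coeff_sum, coeff_sum]
  refine Finset.sum_congr rfl fun m _ => ?_
  rw [dehom_monomial hab, coeff_monomial]
  by_cases h1 : restExp a b m = μ
  · simp [h1, coeff_monomial]
  · simp [h1]

lemma map_dehom {k M : ℕ} (R : Type*) [CommRing R] {a b : Fin k → Fin M} (P) :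
    map (map (Int.castRingHom R)) (dehom ℤ a b P) = dehom R a b P := by
  induction P using MvPolynomial.induction_on with
  | C a => simp [dehom]
  | add p q hp hq => simp [hp, hq]
  | mul_X p i hp =>
    simp only [map_mul, hp]
    congr 1
    simp only [dehom, aeval_X]
    split_ifs <;> simp

lemma exp_eq_of_homogeneous {k M : ℕ} {a b : Fin k → Fin M} {r : Fin k → ℕ}
    {m m' : Fin k × Fin M →₀ ℕ} (hm : ∀ h, ∑ i, m (h, i) = r h) (hm' : ∀ h, ∑ i, m' (h, i) = r h)
    (h1 : restExp a b m = restExp a b m') (h2 : mainExp a m = mainExp a m') : m = m' := by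
  have key : ∀ h i, i ≠ b h → m (h, i) = m' (h, i) := by
    intro h i hi
    by_cases hia : i = a h
    · subst hia; exact DFunLike.congr_fun h2 h
    · have := DFunLike.congr_fun h1 (h, i)
      simpa [restExp_apply, hi, hia] using this
  ext ⟨h, i⟩
  by_cases hi : i = b h
  · subst hi
    have e := (hm h).trans (hm' h).symm
    rw [← Finset.add_sum_erase _ _ (Finset.mem_univ (b h)),
      ← Finset.add_sum_erase _ _ (Finset.mem_univ (b h)),
      Finset.sum_congr rfl fun i hi => key h i (Finset.ne_of_mem_erase hi)] at e
    omega
  · exact key h i hi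

lemma coeff_dehom_eq {k M : ℕ} {a b : Fin k → Fin M} (hab : ∀ h, a h ≠ b h) {r : Fin k → ℕ}
    {P : MvPolynomial (Fin k × Fin M) ℤ} (hP : IsWeightedHomogeneous (blockWeight k M) P r)
    {m} (hm : m ∈ P.support) :
    coeff (mainExp a m) (coeff (restExp a b m) (dehom ℤ a b P)) = coeff m P := by
  rw [coeff_dehom hab, Finset.sum_eq_single m]
  · simp
  · intro m' hm' hne
    rw [if_neg]
    rintro ⟨h1, h2⟩
    refine hne (exp_eq_of_homogeneous (r := r) ?_ ?_ h1 h2)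
    · intro h; rw [← weight_blockWeight, hP (mem_support_iff.1 hm')]
    · intro h; rw [← weight_blockWeight, hP (mem_support_iff.1 hm)]
  · intro h; exact absurd hm h

lemma exists_of_coeff_dehom_ne_zero {k M : ℕ} {a b : Fin k → Fin M} (hab : ∀ h, a h ≠ b h)
    {P : MvPolynomial (Fin k × Fin M) ℤ} {μ s}
    (h : coeff s (coeff μ (dehom ℤ a b P)) ≠ 0) :
    ∃ m ∈ P.support, restExp a b m = μ ∧ mainExp a m = s := by
  rw [coeff_dehom hab] at h
  obtain ⟨m, hm, hne⟩ := Finset.exists_ne_zero_of_sum_ne_zero h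
  refine ⟨m, hm, ?_⟩
  by_contra hcon
  exact hne (if_neg hcon)

/-- The shift `y ↦ y + x - (linear forms in the remaining variables)`. -/
def fullShift {k M : ℕ} (x : Fin k → ℚ)
    (l : Fin k → MvPolynomial (Fin k × Fin M) (MvPolynomial (Fin k) ℚ)) :
    MvPolynomial (Fin k × Fin M) (MvPolynomial (Fin k) ℚ) →+*
      MvPolynomial (Fin k × Fin M) (MvPolynomial (Fin k) ℚ) :=
  eval₂Hom (eval₂Hom (C.comp C) fun h => C (X h + C (x h)) - l h) X

lemma coeff_fullShift {k M : ℕ} (x : Fin k → ℚ)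
    (l : Fin k → MvPolynomial (Fin k × Fin M) (MvPolynomial (Fin k) ℚ))
    (hl : ∀ h, constantCoeff (l h) = 0) (G) (μ)
    (hμ : ∀ ν ∈ G.support, μ.degree ≤ ν.degree) :
    coeff μ (fullShift x l G) = shiftHom x (coeff μ G) := by
  have h0 : ∀ p : MvPolynomial (Fin k) ℚ,
      constantCoeff (fullShift x l (C p)) = shiftHom x p := by
    intro p
    simp only [fullShift, coe_eval₂Hom, eval₂_C]
    induction p using MvPolynomial.induction_on with
    | C a => simp [shiftHom]
    | add p q hp hq => rw [eval₂_add, map_add, map_add, hp, hq]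
    | mul_X p i hp => rw [eval₂_mul, map_mul, map_mul, hp, eval₂_X]; simp [hl, shiftHom]
  conv_lhs => rw [G.as_sum]
  rw [map_sum, coeff_sum]
  have h1 : ∀ ν ∈ G.support, coeff μ (fullShift x l (monomial ν (coeff ν G))) =
      if ν = μ then shiftHom x (coeff ν G) else 0 := by
    intro ν hν
    have e1 : monomial ν (coeff ν G) = monomial ν 1 * C (coeff ν G) := by
      rw [mul_comm, C_mul_monomial, mul_one]
    have e2 : fullShift x l (monomial ν 1) = monomial ν 1 := by
      simp only [fullShift, coe_eval₂Hom, eval₂_monomial, map_one, one_mul]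
      rw [monomial_eq]; simp
    rw [e1, map_mul, e2, coeff_monomial_mul']
    by_cases h2 : ν ≤ μ
    · have h3 : ν = μ := by
        have h4 := hμ ν hν
        obtain ⟨d, rfl⟩ := le_iff_exists_add.1 h2
        rw [map_add] at h4
        have : d = 0 := by
          rw [← Finsupp.degree_eq_zero_iff]; omega
        rw [this, add_zero]
      subst h3
      rw [if_pos le_rfl, if_pos rfl, tsub_self, one_mul, ← h0]; rfl
    · rw [if_neg h2, if_neg]
      rintro rfl; exact h2 le_rfl
  rw [Finset.sum_congr rfl h1, Finset.sum_ite_eq']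
  split_ifs with h
  · rfl
  · rw [notMem_support_iff.1 h, map_zero]

/-- The linear forms in the auxiliary variables that are subtracted in `fullShift`. -/
def elimForm {k M : ℕ} (a b : Fin k → Fin M) (q : Fin k → Fin M → ℚ) (h : Fin k) :
    MvPolynomial (Fin k × Fin M) (MvPolynomial (Fin k) ℚ) :=
  ∑ i, if i = a h ∨ i = b h then 0 else C (C (q h i)) * X (h, i)

/-- Coordinates with respect to the vectors spanning the hyperplane. -/
def elimCoord {k m : ℕ} (a b : Fin k → Fin (m + 1)) (κ : Fin k → Fin m → Fin (m + 1) → ℚ)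
    (h : Fin k) (j : Fin m) : MvPolynomial (Fin k × Fin (m + 1)) (MvPolynomial (Fin k) ℚ) :=
  ∑ i, if i = a h then 0 else C (C (κ h j i)) * (if i = b h then 1 else X (h, i))

/-- The substitution taking the coordinates of `spanSubst` back to the original variables. -/
def elimSubst {k m : ℕ} (a b : Fin k → Fin (m + 1)) (κ : Fin k → Fin m → Fin (m + 1) → ℚ) :
    MvPolynomial (Fin k × Fin (m + 1)) ℤ →ₐ[ℤ]
      MvPolynomial (Fin k × Fin (m + 1)) (MvPolynomial (Fin k) ℚ) :=
  aeval fun hj => Fin.lastCases (C (X hj.1)) (fun j => elimCoord a b κ hj.1 j) hj.2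

lemma elimSubst_spanSubst_X {k m : ℕ} (a b : Fin k → Fin (m + 1))
    (w : Fin k → Fin m → Fin (m + 1) → ℤ) (κ : Fin k → Fin m → Fin (m + 1) → ℚ) (h i) :
    elimSubst a b κ (spanSubst ℤ w (fun h => Pi.single (a h) 1) (X (h, i))) =
      (∑ j, (w h j i : MvPolynomial (Fin k × Fin (m + 1)) (MvPolynomial (Fin k) ℚ)) *
        elimCoord a b κ h j) + if i = a h then C (X h) else 0 := by
  rw [spanSubst, aeval_X, map_add, map_sum, elimSubst]
  have h1 : ∀ j : Fin m, (aeval fun hj : Fin k × Fin (m + 1) => (Fin.lastCases (C (X hj.1))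
      (fun j => elimCoord a b κ hj.1 j) hj.2 :
        MvPolynomial (Fin k × Fin (m + 1)) (MvPolynomial (Fin k) ℚ)))
      (C (w h j i : ℤ) * X (h, j.castSucc)) =
      (w h j i : MvPolynomial (Fin k × Fin (m + 1)) (MvPolynomial (Fin k) ℚ)) *
        elimCoord a b κ h j := by
    intro j
    rw [map_mul, aeval_X, aeval_C]
    simp
  have h2 : (aeval fun hj : Fin k × Fin (m + 1) => (Fin.lastCases (C (X hj.1))
      (fun j => elimCoord a b κ hj.1 j) hj.2 :
        MvPolynomial (Fin k × Fin (m + 1)) (MvPolynomial (Fin k) ℚ)))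
      (C ((Pi.single (a h) 1 : Fin (m + 1) → ℤ) i) * X (h, Fin.last m)) =
      if i = a h then C (X h) else 0 := by
    rw [map_mul, aeval_X, aeval_C]
    by_cases hia : i = a h
    · subst hia; simp
    · simp [hia]
  simp only [Int.cast_id]
  rw [Finset.sum_congr rfl fun j _ => h1 j, h2]

lemma fullShift_dehom {k m : ℕ} (a b : Fin k → Fin (m + 1)) (hab : ∀ h, a h ≠ b h)
    (w : Fin k → Fin m → Fin (m + 1) → ℤ) (q : Fin k → Fin (m + 1) → ℚ)
    (κ : Fin k → Fin m → Fin (m + 1) → ℚ)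
    (hκ : ∀ h i i', i ≠ a h → ∑ j, κ h j i * (w h j i' : ℚ) =
      (if i' = i then 1 else 0) - (if i' = a h then q h i else 0)) (p) :
    fullShift (fun h => -q h (b h)) (elimForm a b q) (dehom ℚ a b p) =
      elimSubst a b κ (spanSubst ℤ w (fun h => Pi.single (a h) 1) p) := by
  have hX : ∀ hi, fullShift (fun h => -q h (b h)) (elimForm a b q) (dehom ℚ a b (X hi)) =
      elimSubst a b κ (spanSubst ℤ w (fun h => Pi.single (a h) 1) (X hi)) := by
    rintro ⟨h, i⟩
    rw [elimSubst_spanSubst_X]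
    have e2 : ∑ j, (w h j i : MvPolynomial (Fin k × Fin (m + 1)) (MvPolynomial (Fin k) ℚ)) *
        elimCoord a b κ h j =
        ∑ i', if i' = a h then 0 else
          C (C ((if i = i' then 1 else 0) - (if i = a h then q h i' else 0))) *
            (if i' = b h then 1 else X (h, i')) := by
      simp only [elimCoord, Finset.mul_sum]
      rw [Finset.sum_comm]
      refine Finset.sum_congr rfl fun i' _ => ?_
      by_cases hi' : i' = a h
      · simp [hi']
      · simp only [if_neg hi']
        rw [← hκ h i' i hi']
        simp only [map_sum, Finset.sum_mul, map_mul]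
        refine Finset.sum_congr rfl fun j _ => ?_
        simp only [map_intCast]; ring
    rw [e2, dehom, aeval_X]
    by_cases hia : i = a h
    · subst hia
      rw [if_pos rfl, if_pos rfl, fullShift, coe_eval₂Hom, eval₂_C, coe_eval₂Hom, eval₂_X, elimForm]
      have e3 : ∀ i', (if i' = a h then (0 : MvPolynomial (Fin k × Fin (m + 1)) (MvPolynomial (Fin k) ℚ))
          else C (C ((if a h = i' then 1 else 0) - (if a h = a h then q h i' else 0))) *
            (if i' = b h then 1 else X (h, i'))) =
          (if i' = b h then - C (C (q h i')) else 0) -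
            (if i' = a h ∨ i' = b h then 0 else C (C (q h i')) * X (h, i')) := by
        intro i'
        by_cases h1 : i' = a h
        · subst h1; simp [hab h]
        · by_cases h2 : i' = b h
          · subst h2; simp [hab h, h1]
          · simp [h1, h2, Ne.symm h1]; ring
      rw [Finset.sum_congr rfl fun i' _ => e3 i', Finset.sum_sub_distrib]
      simp only [Finset.sum_ite_eq', Finset.mem_univ, if_true, map_add, map_neg]
      ring
    · have e3 : ∀ i', (if i' = a h then (0 : MvPolynomial (Fin k × Fin (m + 1)) (MvPolynomial (Fin k) ℚ))
          else C (C ((if i = i' then 1 else 0) - (if i = a h then q h i' else 0))) *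
            (if i' = b h then 1 else X (h, i'))) =
          if i = i' then (if i = b h then 1 else X (h, i)) else 0 := by
        intro i'
        by_cases h1 : i = i'
        · subst h1; simp [hia]
        · simp [h1, hia]
      rw [Finset.sum_congr rfl fun i' _ => e3 i']
      simp only [Finset.sum_ite_eq, Finset.mem_univ, if_true, if_neg hia, add_zero]
      split_ifs
      · exact map_one _
      · rw [fullShift, coe_eval₂Hom, eval₂_X]
  induction p using MvPolynomial.induction_on with
  | C z => simp [dehom, spanSubst, elimSubst]
  | add p q hp hq => rw [map_add, map_add, map_add, map_add, hp, hq]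
  | mul_X p hi hp => rw [map_mul, map_mul, map_mul, map_mul, hp, hX]

/-- All monomials occurring in the coefficients are equal to a given one. -/
def PureCoeff {σ τ R : Type*} [CommRing R] (s₀ : τ →₀ ℕ) (G : MvPolynomial σ (MvPolynomial τ R)) :
    Prop := ∀ μ s, coeff s (coeff μ G) ≠ 0 → s = s₀

lemma PureCoeff.mul {σ τ R : Type*} [CommRing R] {s₀ s₁ : τ →₀ ℕ}
    {G G' : MvPolynomial σ (MvPolynomial τ R)} (h : PureCoeff s₀ G) (h' : PureCoeff s₁ G') :
    PureCoeff (s₀ + s₁) (G * G') := by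
  classical
  intro μ s hne
  rw [coeff_mul, coeff_sum] at hne
  obtain ⟨x, -, hx⟩ := Finset.exists_ne_zero_of_sum_ne_zero hne
  rw [coeff_mul] at hx
  obtain ⟨y, hy, hxy⟩ := Finset.exists_ne_zero_of_sum_ne_zero hx
  rw [← h _ _ (left_ne_zero_of_mul hxy), ← h' _ _ (right_ne_zero_of_mul hxy)]
  exact (Finset.HasAntidiagonal.mem_antidiagonal.1 hy).symm

lemma pureCoeff_C_C {σ τ R : Type*} [CommRing R] (x : R) :
    PureCoeff (0 : τ →₀ ℕ) (C (C x) : MvPolynomial σ (MvPolynomial τ R)) := by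
  classical
  intro μ s hne
  rw [coeff_C] at hne
  split_ifs at hne with h1
  · rw [coeff_C] at hne
    by_contra hs
    exact hne (if_neg (Ne.symm hs))
  · simp at hne

lemma pureCoeff_C_X {σ τ R : Type*} [CommRing R] (h : τ) :
    PureCoeff (Finsupp.single h 1) (C (X h) : MvPolynomial σ (MvPolynomial τ R)) := by
  classical
  intro μ s hne
  rw [coeff_C] at hne
  split_ifs at hne with h1
  · rw [coeff_X] at hne
    by_contra hs
    exact hne (if_neg (Ne.symm hs))
  · simp at hne

lemma pureCoeff_X {σ τ R : Type*} [CommRing R] (i : σ) :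
    PureCoeff (0 : τ →₀ ℕ) (X i : MvPolynomial σ (MvPolynomial τ R)) := by
  classical
  intro μ s hne
  rw [coeff_X] at hne
  split_ifs at hne with h1
  · rw [coeff_one] at hne
    by_contra hs
    exact hne (if_neg (Ne.symm hs))
  · simp at hne

lemma PureCoeff.sum {σ τ R ι : Type*} [CommRing R] {s₀ : τ →₀ ℕ} {A : Finset ι}
    {G : ι → MvPolynomial σ (MvPolynomial τ R)} (h : ∀ i ∈ A, PureCoeff s₀ (G i)) :
    PureCoeff s₀ (∑ i ∈ A, G i) := by
  intro μ s hne
  rw [coeff_sum, coeff_sum] at hne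
  obtain ⟨x, hx, hne⟩ := Finset.exists_ne_zero_of_sum_ne_zero hne
  exact h x hx μ s hne

lemma PureCoeff.pow {σ τ R : Type*} [CommRing R] {s₀ : τ →₀ ℕ}
    {G : MvPolynomial σ (MvPolynomial τ R)} (h : PureCoeff s₀ G) (e : ℕ) :
    PureCoeff (e • s₀) (G ^ e) := by
  induction e with
  | zero => simpa using pureCoeff_C_C (1 : R)
  | succ e ih => rw [pow_succ, succ_nsmul]; exact ih.mul h

lemma coeff_elimSubst_monomial {k m : ℕ} (a b : Fin k → Fin (m + 1))
    (κ : Fin k → Fin m → Fin (m + 1) → ℚ) (t : Fin k × Fin (m + 1) →₀ ℕ) (z : ℤ) (μ s)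
    (hne : coeff s (coeff μ (elimSubst a b κ (monomial t z))) ≠ 0) (h : Fin k) :
    s h = t (h, Fin.last m) := by
  have e0 : monomial t z = C z * monomial t 1 := by rw [C_mul_monomial, mul_one]
  have e1 : PureCoeff (mainExp (fun _ => Fin.last m) t) (elimSubst a b κ (monomial t 1)) := by
    clear hne e0
    induction t using Finsupp.induction_linear with
    | zero => simpa using pureCoeff_C_C (1 : ℚ)
    | add f g hf hg =>
      rw [← one_mul (1 : ℤ), ← monomial_mul, map_mul, map_add]
      exact hf.mul hg
    | single hi e =>
      rw [← X_pow_eq_monomial, map_pow, elimSubst, aeval_X]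
      obtain ⟨h, i⟩ := hi
      refine Fin.lastCases ?_ (fun j => ?_) i
      · have : mainExp (fun _ => Fin.last m) (Finsupp.single (h, Fin.last m) e) =
            e • Finsupp.single h 1 := by
          ext h'
          rw [mainExp_apply, Finsupp.single_apply, Finsupp.smul_apply, Finsupp.single_apply]
          by_cases h2 : h = h' <;> simp [h2]
        rw [this]
        simp only [Fin.lastCases_last]
        exact (pureCoeff_C_X h).pow e
      · have : mainExp (fun _ => Fin.last m) (Finsupp.single (h, j.castSucc) e) =
            e • (0 : Fin k →₀ ℕ) := by
          ext h'
          rw [mainExp_apply, Finsupp.single_apply, if_neg]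
          · simp
          · intro h2; exact Fin.castSucc_ne_last j (Prod.mk.inj h2).2
        rw [this]
        simp only [Fin.lastCases_castSucc]
        refine PureCoeff.pow (PureCoeff.sum fun i _ => ?_) e
        split_ifs
        · simpa using pureCoeff_C_C (0 : ℚ)
        · simpa using pureCoeff_C_C (κ h j i)
        · simpa using (pureCoeff_C_C (κ h j i)).mul (pureCoeff_X _)
  have e2 : PureCoeff (mainExp (fun _ => Fin.last m) t) (elimSubst a b κ (monomial t z)) := by
    rw [e0, map_mul]
    have h3 : elimSubst a b κ (C z) = C (C (z : ℚ)) := by simp [elimSubst]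
    rw [h3]
    simpa using (pureCoeff_C_C (z : ℚ)).mul e1
  rw [e2 μ s hne, mainExp_apply]

/-- Elimination: from a multihomogeneous polynomial vanishing to high order along a product of
hyperplanes to a polynomial with one variable per block and large index at a rational point. -/
theorem exists_one_variable_per_block {k m : ℕ} (a b : Fin k → Fin (m + 1)) (hab : ∀ h, a h ≠ b h)
    (w : Fin k → Fin m → Fin (m + 1) → ℤ) (q : Fin k → Fin (m + 1) → ℚ)
    (κ : Fin k → Fin m → Fin (m + 1) → ℚ)
    (hκ : ∀ h i i', i ≠ a h → ∑ j, κ h j i * (w h j i' : ℚ) =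
      (if i' = i then 1 else 0) - (if i' = a h then q h i else 0))
    (r : Fin k → ℕ) (P : MvPolynomial (Fin k × Fin (m + 1)) ℤ) (hP0 : P ≠ 0)
    (hP : IsWeightedHomogeneous (blockWeight k (m + 1)) P r) (H θ : ℝ)
    (hH : ∀ t, |((coeff t P : ℤ) : ℝ)| ≤ H)
    (hθ : ∀ t, coeff t (spanSubst ℤ w (fun h => Pi.single (a h) 1) P) ≠ 0 →
      θ ≤ ∑ h, (t (h, Fin.last m) : ℝ) / r h) :
    ∃ f : MvPolynomial (Fin k) ℤ, f ≠ 0 ∧ (∀ h, degreeOf h f ≤ r h) ∧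
      (∀ t, |((coeff t f : ℤ) : ℝ)| ≤ H) ∧
      IdxGe (fun h => -q h (b h)) r θ (map (Int.castRingHom ℚ) f) := by
  classical
  have hD0 : dehom ℤ a b P ≠ 0 := by
    obtain ⟨m0, hm0⟩ := support_nonempty.2 hP0
    intro h
    have := coeff_dehom_eq hab hP hm0
    rw [h, coeff_zero, coeff_zero] at this
    exact mem_support_iff.1 hm0 this.symm
  obtain ⟨μ, hμ, hmin⟩ := Finset.exists_min_image (dehom ℤ a b P).support (fun ν => ν.degree)
    (support_nonempty.2 hD0)
  have hH0 : 0 ≤ H := (abs_nonneg _).trans (hH 0)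
  refine ⟨coeff μ (dehom ℤ a b P), mem_support_iff.1 hμ, fun h => ?_, fun t => ?_, ?_⟩
  · rw [degreeOf_le_iff]
    intro s hs
    obtain ⟨m, hm, -, rfl⟩ := exists_of_coeff_dehom_ne_zero hab (mem_support_iff.1 hs)
    rw [mainExp_apply]
    have : ∑ i, m (h, i) = r h := by rw [← weight_blockWeight, hP (mem_support_iff.1 hm)]
    rw [← this]
    exact Finset.single_le_sum (f := fun i => m (h, i)) (fun _ _ => Nat.zero_le _)
      (Finset.mem_univ (a h))
  · by_cases h0 : coeff t (coeff μ (dehom ℤ a b P)) = 0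
    · rw [h0]; simpa using hH0
    · obtain ⟨m, hm, rfl, rfl⟩ := exists_of_coeff_dehom_ne_zero hab h0
      rw [coeff_dehom_eq hab hP hm]
      exact hH m
  · intro s hs
    have h1 : shiftHom (fun h => -q h (b h)) (map (Int.castRingHom ℚ) (coeff μ (dehom ℤ a b P))) =
        coeff μ (elimSubst a b κ (spanSubst ℤ w (fun h => Pi.single (a h) 1) P)) := by
      rw [← fullShift_dehom a b hab w q κ hκ, coeff_fullShift, ← map_dehom ℚ, coeff_map]
      · intro h
        simp only [elimForm, map_sum]
        refine Finset.sum_eq_zero fun i _ => ?_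
        split_ifs <;> simp
      · intro ν hν
        rw [← map_dehom ℚ] at hν
        exact hmin ν (support_map_subset _ _ hν)
    rw [h1] at hs
    set F := spanSubst ℤ w (fun h => Pi.single (a h) 1) P with hF
    rw [F.as_sum, map_sum, coeff_sum, coeff_sum] at hs
    obtain ⟨t, ht, hne⟩ := Finset.exists_ne_zero_of_sum_ne_zero hs
    have h2 := hθ t (mem_support_iff.1 ht)
    refine h2.trans (le_of_eq ?_)
    refine Finset.sum_congr rfl fun h _ => ?_
    rw [coeff_elimSubst_monomial a b κ t _ μ s hne h]

end

noncomputable section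

/-- Expansion of a determinant along its first row. -/
lemma det_cons_eq_sum {R : Type*} [CommRing R] {m : ℕ} (w : Fin m → Fin (m + 1) → R)
    (x : Fin (m + 1) → R) :
    (Matrix.of (Fin.cons x w : Fin (m + 1) → Fin (m + 1) → R)).det =
      ∑ i, x i * (Matrix.of (Fin.cons (Pi.single i 1) w : Fin (m + 1) → Fin (m + 1) → R)).det := by
  have key : ∀ y : Fin (m + 1) → R,
      (Matrix.of (Fin.cons y w : Fin (m + 1) → Fin (m + 1) → R)).det =
      ∑ i, y i * ((-1) ^ (i : ℕ) * ((Matrix.of w).submatrix id i.succAbove).det) := by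
    intro y
    rw [Matrix.det_succ_row_zero]
    refine Finset.sum_congr rfl fun i _ => ?_
    have : (Matrix.of (Fin.cons y w : Fin (m + 1) → Fin (m + 1) → R)).submatrix Fin.succ i.succAbove
        = (Matrix.of w).submatrix id i.succAbove := by ext a b; simp
    rw [this]; simp; ring
  rw [key]
  refine Finset.sum_congr rfl fun i _ => ?_
  rw [key, Finset.sum_eq_single i]
  · simp
  · intro j _ hj; simp [Pi.single_eq_of_ne hj]
  · simp

lemma intCast_det_cons {R : Type*} [CommRing R] {m : ℕ} (w : Fin m → Fin (m + 1) → ℤ) (i) :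
    (((Matrix.of (Fin.cons (Pi.single i 1) w : Fin (m + 1) → Fin (m + 1) → ℤ)).det : ℤ) : R) =
      (Matrix.of (Fin.cons (Pi.single i 1) (fun j i => (w j i : R)) :
        Fin (m + 1) → Fin (m + 1) → R)).det := by
  rw [Int.cast_det]
  congr 1
  ext a b
  refine Fin.cases ?_ (fun j => ?_) a
  · by_cases h : b = i
    · subst h; simp
    · simp [Pi.single_eq_of_ne h]
  · simp

/-- The primitive normal vector of a hyperplane. -/
theorem exists_primitive_normal {m : ℕ} (w : Fin m → Fin (m + 1) → ℤ)
    (hw : LinearIndependent ℚ (fun j i => (w j i : ℚ))) :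
    ∃ (u : Fin (m + 1) → ℤ) (γ : ℤ), γ ≠ 0 ∧ (∃ y : Fin (m + 1) → ℤ, ∑ i, y i * u i = 1) ∧
      (∀ i, γ * u i =
        (Matrix.of (Fin.cons (Pi.single i 1) w : Fin (m + 1) → Fin (m + 1) → ℤ)).det) ∧
      (∀ j, ∑ i, u i * w j i = 0) ∧
      ∀ x : Fin (m + 1) → ℚ, ∑ i, (u i : ℚ) * x i = 0 →
        ∃ κ : Fin m → ℚ, ∀ i, ∑ j, κ j * (w j i : ℚ) = x i := by
  classical
  set g : Fin (m + 1) → ℤ := fun i =>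
    (Matrix.of (Fin.cons (Pi.single i 1) w : Fin (m + 1) → Fin (m + 1) → ℤ)).det with hg
  have hgw : ∀ j, ∑ i, g i * w j i = 0 := by
    intro j
    have := det_cons_eq_sum w (w j)
    rw [Matrix.det_zero_of_row_eq (i := 0) (j := j.succ) (Fin.succ_ne_zero j).symm] at this
    · rw [this]; exact Finset.sum_congr rfl fun i _ => mul_comm _ _
    · ext i; simp
  have hgQ : ∀ x : Fin (m + 1) → ℚ, (Matrix.of (Fin.cons x (fun j i => (w j i : ℚ)) :
      Fin (m + 1) → Fin (m + 1) → ℚ)).det = ∑ i, x i * (g i : ℚ) := by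
    intro x
    rw [det_cons_eq_sum]
    refine Finset.sum_congr rfl fun i _ => ?_
    rw [hg, intCast_det_cons]
  have hspan : ∀ x : Fin (m + 1) → ℚ, ∑ i, x i * (g i : ℚ) = 0 →
      ∃ κ : Fin m → ℚ, ∀ i, ∑ j, κ j * (w j i : ℚ) = x i := by
    intro x hx
    rw [← hgQ] at hx
    have h1 : ¬ LinearIndependent ℚ (Fin.cons x (fun j i => (w j i : ℚ)) :
        Fin (m + 1) → Fin (m + 1) → ℚ) := by
      intro h
      have := (Matrix.linearIndependent_rows_iff_isUnit (A := Matrix.of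
        (Fin.cons x (fun j i => (w j i : ℚ)) : Fin (m + 1) → Fin (m + 1) → ℚ))).1 h
      rw [Matrix.isUnit_iff_isUnit_det, hx] at this
      exact not_isUnit_zero this
    rw [linearIndependent_finCons] at h1
    have h2 : x ∈ Submodule.span ℚ (Set.range fun j i => (w j i : ℚ)) := by
      by_contra h; exact h1 ⟨hw, h⟩
    obtain ⟨κ, hκ⟩ := (Submodule.mem_span_range_iff_exists_fun ℚ).1 h2
    refine ⟨κ, fun i => ?_⟩
    rw [← hκ]; simp
  have hg0 : g ≠ 0 := by
    intro h0
    have h1 : Submodule.span ℚ (Set.range fun j i => (w j i : ℚ)) = ⊤ := by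
      rw [eq_top_iff]
      intro x _
      obtain ⟨κ, hκ⟩ := hspan x (by simp [h0])
      refine (Submodule.mem_span_range_iff_exists_fun ℚ).2 ⟨κ, ?_⟩
      ext i; rw [← hκ]; simp
    have h2 := finrank_span_eq_card hw
    rw [h1, finrank_top] at h2
    simp at h2
  obtain ⟨d, hd⟩ := (IsPrincipalIdealRing.principal (Ideal.span (Set.range g))).principal
  have hdvd : ∀ i, d ∣ g i := fun i => by
    have : g i ∈ Ideal.span (Set.range g) := Ideal.subset_span ⟨i, rfl⟩
    rw [hd] at this
    exact Ideal.mem_span_singleton.1 this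
  have hdm : d ∈ Ideal.span (Set.range g) := by
    rw [hd]; exact Submodule.mem_span_singleton_self d
  obtain ⟨y, hy⟩ := Ideal.mem_span_range_iff_exists_fun.1 hdm
  have hd0 : d ≠ 0 := by
    rintro rfl
    exact hg0 (funext fun i => zero_dvd_iff.1 (hdvd i))
  choose u hu using hdvd
  refine ⟨u, d, hd0, ⟨y, ?_⟩, fun i => (hu i).symm, fun j => ?_, fun x hx => hspan x ?_⟩
  · apply mul_left_cancel₀ hd0
    rw [Finset.mul_sum, mul_one]
    refine Eq.trans (Finset.sum_congr rfl fun i _ => ?_) hy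
    rw [hu i]; ring
  · apply mul_left_cancel₀ hd0
    rw [Finset.mul_sum, mul_zero, ← hgw j]
    refine Finset.sum_congr rfl fun i _ => ?_
    rw [hu i, mul_assoc]
  · have : ∑ i, x i * (g i : ℚ) = d * ∑ i, (u i : ℚ) * x i := by
      rw [Finset.mul_sum]
      refine Finset.sum_congr rfl fun i _ => ?_
      rw [hu i]; push_cast; ring
    rw [this, hx, mul_zero]

/-- Cramer bound: coordinates of the normal vector with respect to the linear forms. -/
lemma normal_coord_le {K : Type*} [Field K] (v : AbsoluteValue K ℝ) {m : ℕ}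
    (w : Fin m → Fin (m + 1) → ℤ) (u : Fin (m + 1) → ℤ) (γ : ℤ)
    (hγ : ∀ i, γ * u i =
        (Matrix.of (Fin.cons (Pi.single i 1) w : Fin (m + 1) → Fin (m + 1) → ℤ)).det)
    (L : Matrix (Fin (m + 1)) (Fin (m + 1)) K) (hL : L.det ≠ 0) (E : Fin (m + 1) → ℝ)
    (hE : ∀ i, 0 < E i) (hw : ∀ i j, v (∑ i', L i i' * (w j i' : ℤ)) ≤ E i) (i : Fin (m + 1)) :
    v L.det * (v (γ : K) * v (∑ i', (u i' : K) * L⁻¹ i' i) * E i) ≤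
      (m + 1).factorial * ∏ i, E i := by
  classical
  set N : Matrix (Fin (m + 1)) (Fin (m + 1)) K :=
    Matrix.of (Fin.cons (fun i' => L⁻¹ i' i) (fun j i => (w j i : K)) :
      Fin (m + 1) → Fin (m + 1) → K) with hN
  have h1 : (γ : K) * ∑ i', (u i' : K) * L⁻¹ i' i = N.det := by
    rw [hN, det_cons_eq_sum, Finset.mul_sum]
    refine Finset.sum_congr rfl fun i' _ => ?_
    rw [← intCast_det_cons, ← hγ i']
    push_cast; ring
  have hLu : IsUnit L.det := isUnit_iff_ne_zero.2 hL
  have hrow0 : ∀ i', (N * L.transpose) 0 i' = if i' = i then 1 else 0 := by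
    intro i'
    have h2 : (L * L⁻¹) i' i = if i' = i then 1 else 0 := by
      rw [Matrix.mul_nonsing_inv _ hLu, Matrix.one_apply]
    rw [← h2, Matrix.mul_apply, Matrix.mul_apply]
    refine Finset.sum_congr rfl fun a _ => ?_
    simp [hN, mul_comm]
  have hrows : ∀ j : Fin m, ∀ i', (N * L.transpose) j.succ i' = ∑ a, L i' a * (w j a : ℤ) := by
    intro j i'
    rw [Matrix.mul_apply]
    refine Finset.sum_congr rfl fun a _ => ?_
    simp [hN, mul_comm]
  have h2 : v L.det * (v (γ : K) * v (∑ i', (u i' : K) * L⁻¹ i' i) * E i) =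
      v (N * L.transpose).det * E i := by
    rw [Matrix.det_mul, Matrix.det_transpose, ← h1, v.map_mul, v.map_mul]; ring
  rw [h2, Matrix.det_apply]
  have h3 : ∀ σ : Equiv.Perm (Fin (m + 1)),
      v (Equiv.Perm.sign σ • ∏ i', (N * L.transpose) (σ i') i') * E i ≤ ∏ i, E i := by
    intro σ
    have h4 : v (Equiv.Perm.sign σ • ∏ i', (N * L.transpose) (σ i') i') =
        ∏ i', v ((N * L.transpose) (σ i') i') := by
      rcases Int.units_eq_one_or (Equiv.Perm.sign σ) with h | h <;> rw [h] <;>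
        simp [map_prod]
    have h5 : E i = ∏ i', if σ i' = 0 then E i else 1 := by
      rw [Finset.prod_eq_single (σ.symm 0)]
      · simp
      · intro b _ hb
        rw [if_neg]
        intro h; exact hb (by rw [← h]; simp)
      · simp
    rw [h4, h5, ← Finset.prod_mul_distrib]
    refine Finset.prod_le_prod (fun i' _ => ?_) fun i' _ => ?_
    · have := hE i
      split_ifs <;> simp [v.nonneg, mul_nonneg, this.le]
    · obtain h0 | ⟨j, hj⟩ := Fin.eq_zero_or_eq_succ (σ i')
      · rw [if_pos h0, h0, hrow0]
        split_ifs with h6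
        · rw [h6]; simp
        · simpa using (hE i').le
      · rw [hj, if_neg (Fin.succ_ne_zero j), mul_one, hrows]
        exact hw i' j
  calc _ ≤ (∑ σ : Equiv.Perm (Fin (m + 1)),
      v (Equiv.Perm.sign σ • ∏ i', (N * L.transpose) (σ i') i')) * E i :=
        mul_le_mul_of_nonneg_right (v.sum_le _ _) (hE i).le
    _ ≤ ∑ σ : Equiv.Perm (Fin (m + 1)), ∏ i, E i := by
        rw [Finset.sum_mul]; exact Finset.sum_le_sum fun σ _ => h3 σ
    _ = _ := by simp [Fintype.card_perm]

/-- A common denominator for finitely many rational numbers. -/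
lemma exists_int_mul_rat {ι : Type*} [Finite ι] (f : ι → ℚ) :
    ∃ D : ℤ, D ≠ 0 ∧ ∃ g : ι → ℤ, ∀ i, (g i : ℚ) = D * f i := by
  obtain ⟨D, hD⟩ := IsLocalization.exist_integer_multiples_of_finite (nonZeroDivisors ℤ) f
  choose g hg using hD
  refine ⟨D, nonZeroDivisors.coe_ne_zero D, g, fun i => ?_⟩
  have := hg i
  simpa [Submonoid.smul_def] using this

/-- An absolute value of a nonzero integer is bounded below in terms of its size. -/
lemma one_le_pow_mul_of_prod {K : Type*} [Field K] {S : Type} [Fintype S]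
    (v : S → AbsoluteValue K ℝ) (hprod : ∀ z : ℤ, z ≠ 0 → 1 ≤ ∏ s, v s (z : K)) (s : S)
    (z : ℤ) (hz : z ≠ 0) : 1 ≤ |(z : ℝ)| ^ (Fintype.card S - 1) * v s (z : K) := by
  classical
  refine (hprod z hz).trans ?_
  rw [← Finset.mul_prod_erase _ _ (Finset.mem_univ s), mul_comm]
  refine mul_le_mul_of_nonneg_right ?_ ((v s).nonneg _)
  refine (Finset.prod_le_prod (fun _ _ => (v _).nonneg _) fun s' _ => (v s').intCast_le z).trans ?_
  rw [Finset.prod_const, Finset.card_erase_of_mem (Finset.mem_univ s), Finset.card_univ]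

/-- Liouville-type lower bound for integral linear combinations. -/
theorem exists_liouville {K : Type*} [Field K] [NumberField K] {S : Type} [Fintype S]
    (v : S → AbsoluteValue K ℝ) (hprod : ∀ z : ℤ, z ≠ 0 → 1 ≤ ∏ s, v s (z : K)) (s : S)
    {ι : Type} [Fintype ι] (x : ι → K) :
    ∃ T : ℝ, 1 ≤ T ∧ ∀ H : ℝ, 1 ≤ H → ∀ h : ι → ℤ, (∀ i, |(h i : ℝ)| ≤ H) →
      ∑ i, (h i : K) * x i ≠ 0 → 1 ≤ T * H ^ T * v s (∑ i, (h i : K) * x i) := by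
  classical
  set d := Module.finrank ℚ K
  have hd : 0 < d := Module.finrank_pos
  let b : Module.Basis (Fin d) ℚ K := Module.finBasis ℚ K
  obtain ⟨D, hD, G, hG⟩ := exists_int_mul_rat (fun p : ι × Fin d × Fin d =>
    Algebra.leftMulMatrix b (x p.1) p.2.1 p.2.2)
  set l : Fin d := ⟨0, hd⟩
  set C : ℝ := 1 + ∑ p, |(G p : ℝ)| with hC
  have hC1 : 1 ≤ C := by
    rw [hC]
    linarith [Finset.sum_nonneg (s := Finset.univ)
      fun (p : ι × Fin d × Fin d) _ => abs_nonneg (G p : ℝ)]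
  set Bv : ℝ := ∑ k, v s (b k) with hBv
  have hBv0 : 0 ≤ Bv := Finset.sum_nonneg fun _ _ => (v s).nonneg _
  have hbl : 0 < v s (b l) := (v s).pos (b.ne_zero l)
  set T1 : ℝ := (d.factorial * C ^ d) ^ (Fintype.card S - 1) * (|(D : ℝ)| * (d.factorial * C ^ d * Bv)) /
    v s (b l) with hT1
  have hT10 : 0 ≤ T1 := by positivity
  set e : ℕ := d * (Fintype.card S - 1) + d
  refine ⟨max 1 (max T1 e), le_max_left _ _, fun H hH h hh hne => ?_⟩
  set y := ∑ i, (h i : K) * x i with hy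
  let Z : Matrix (Fin d) (Fin d) ℤ := fun j k => ∑ i, h i * G (i, j, k)
  have hZ : Z.map (Int.cast : ℤ → ℚ) = (D : ℚ) • Algebra.leftMulMatrix b y := by
    ext j k
    rw [hy, map_sum, Matrix.map_apply]
    have h1 : ∀ i, Algebra.leftMulMatrix b ((h i : K) * x i) =
        (h i : ℚ) • Algebra.leftMulMatrix b (x i) := by
      intro i
      rw [← map_smul]; congr 1
      rw [Algebra.smul_def]; simp
    simp only [h1, Matrix.smul_apply, Matrix.sum_apply, Z, smul_eq_mul,
      Finset.mul_sum]
    push_cast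
    refine Finset.sum_congr rfl fun i _ => ?_
    rw [hG]; ring
  have hZb : ∀ j k, |(Z j k : ℝ)| ≤ C * H := by
    intro j k
    simp only [Z]
    push_cast
    refine (Finset.abs_sum_le_sum_abs _ _).trans ?_
    calc ∑ i, |(h i : ℝ) * G (i, j, k)| ≤ ∑ i, |(G (i, j, k) : ℝ)| * H := by
          refine Finset.sum_le_sum fun i _ => ?_
          rw [abs_mul, mul_comm]; exact mul_le_mul_of_nonneg_left (hh i) (abs_nonneg _)
      _ = (∑ i, |(G (i, j, k) : ℝ)|) * H := by rw [Finset.sum_mul]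
      _ ≤ C * H := by
          refine mul_le_mul_of_nonneg_right ?_ (by linarith)
          have : ∑ i, |(G (i, j, k) : ℝ)| ≤ ∑ p, |(G p : ℝ)| := by
            rw [Fintype.sum_prod_type]
            refine Finset.sum_le_sum fun i _ => ?_
            exact Finset.single_le_sum (f := fun p : Fin d × Fin d => |(G (i, p) : ℝ)|)
              (fun _ _ => abs_nonneg _) (Finset.mem_univ (j, k))
          linarith
  have hCH : 1 ≤ C * H := by nlinarith
  have hdet : ∀ A : Matrix (Fin d) (Fin d) ℤ, (∀ j k, |(A j k : ℝ)| ≤ C * H) →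
      |(A.det : ℝ)| ≤ d.factorial * C ^ d * H ^ d := by
    intro A hA
    have := Matrix.det_le (A := A.map (Int.cast : ℤ → ℝ)) (abv := AbsoluteValue.abs) (x := C * H)
      (by intro i j; simpa using hA i j)
    have h2 : (A.map (Int.cast : ℤ → ℝ)).det = (A.det : ℝ) := by rw [Int.cast_det]
    rw [h2] at this
    simpa [mul_pow, mul_assoc] using this
  have hz0 : Z.det ≠ 0 := by
    intro h0
    have h1 : ((Z.det : ℤ) : ℚ) = ((D : ℚ) • Algebra.leftMulMatrix b y).det := by
      rw [← hZ, Int.cast_det]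
    have h2 : IsUnit (Algebra.leftMulMatrix b y) :=
      (isUnit_iff_ne_zero.2 hne).map (Algebra.leftMulMatrix b)
    rw [Matrix.isUnit_iff_isUnit_det, isUnit_iff_ne_zero] at h2
    rw [h0, Matrix.det_smul] at h1
    have hD' : (D : ℚ) ≠ 0 := by exact_mod_cast hD
    exact mul_ne_zero (pow_ne_zero _ hD') h2 (by simpa using h1.symm)
  have hyb : ∀ k, (D : K) * y * b k = ∑ j, (Z j k : K) * b j := by
    intro k
    have h1 : y * b k = ∑ j, Algebra.leftMulMatrix b y j k • b j := by
      rw [← b.sum_repr (y * b k)]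
      simp [Algebra.leftMulMatrix_eq_repr_mul]
    rw [mul_assoc, h1, Finset.mul_sum]
    refine Finset.sum_congr rfl fun j _ => ?_
    have h2 : ((Z j k : ℤ) : ℚ) = D * Algebra.leftMulMatrix b y j k := by
      have := congrFun (congrFun hZ j) k
      simpa using this
    have h3 : ((Z j k : ℤ) : K) = algebraMap ℚ K (D * Algebra.leftMulMatrix b y j k) := by
      rw [← h2]; simp
    rw [h3, Algebra.smul_def, map_mul]; simp [mul_assoc]
  set y' := ∑ k, (Z.adjugate k l : K) * b k with hy'
  have hyy : (D : K) * y * y' = (Z.det : K) * b l := by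
    rw [hy', Finset.mul_sum]
    calc ∑ k, (D : K) * y * ((Z.adjugate k l : K) * b k)
        = ∑ k, ∑ j, ((Z j k * Z.adjugate k l : ℤ) : K) * b j := by
          refine Finset.sum_congr rfl fun k _ => ?_
          rw [mul_left_comm, hyb, Finset.mul_sum]
          refine Finset.sum_congr rfl fun j _ => ?_
          push_cast; ring
      _ = ∑ j, (((Z * Z.adjugate) j l : ℤ) : K) * b j := by
          rw [Finset.sum_comm]
          refine Finset.sum_congr rfl fun j _ => ?_
          rw [Matrix.mul_apply]; push_cast; rw [Finset.sum_mul]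
      _ = _ := by
          rw [Matrix.mul_adjugate]
          rw [Finset.sum_eq_single l]
          · simp
          · intro j _ hj; simp [Matrix.one_apply_ne hj]
          · simp
  have hadj : ∀ k, |(Z.adjugate k l : ℝ)| ≤ d.factorial * C ^ d * H ^ d := by
    intro k
    rw [Matrix.adjugate_apply]
    refine hdet _ fun i j => ?_
    by_cases hi : i = l
    · subst hi
      rw [Matrix.updateRow_self]
      by_cases hj : j = k
      · subst hj; simpa using hCH
      · rw [Pi.single_eq_of_ne hj]; simp; linarith
    · rw [Matrix.updateRow_ne hi]; exact hZb i j
  have hy'b : v s y' ≤ d.factorial * C ^ d * H ^ d * Bv := by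
    refine ((v s).sum_le _ _).trans ?_
    rw [hBv, Finset.mul_sum]
    refine Finset.sum_le_sum fun k _ => ?_
    rw [(v s).map_mul]
    exact mul_le_mul_of_nonneg_right (((v s).intCast_le _).trans (hadj k)) ((v s).nonneg _)
  have h1 := one_le_pow_mul_of_prod v hprod s Z.det hz0
  have h2 : v s (Z.det : K) * v s (b l) ≤ |(D : ℝ)| * v s y * (d.factorial * C ^ d * H ^ d * Bv) := by
    rw [← (v s).map_mul, ← hyy, (v s).map_mul, (v s).map_mul]
    have := (v s).nonneg y
    refine mul_le_mul ?_ hy'b ((v s).nonneg _) (by positivity)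
    exact mul_le_mul_of_nonneg_right ((v s).intCast_le _) this
  have h3 : 1 ≤ T1 * H ^ e * v s y := by
    have h4 : v s (b l) ≤ (d.factorial * C ^ d * H ^ d) ^ (Fintype.card S - 1) *
        (|(D : ℝ)| * v s y * (d.factorial * C ^ d * H ^ d * Bv)) := by
      calc v s (b l) ≤ (|(Z.det : ℝ)| ^ (Fintype.card S - 1) * v s (Z.det : K)) * v s (b l) :=
            le_mul_of_one_le_left hbl.le h1
        _ = |(Z.det : ℝ)| ^ (Fintype.card S - 1) * (v s (Z.det : K) * v s (b l)) := by ring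
        _ ≤ _ := by
            refine mul_le_mul (pow_le_pow_left₀ (abs_nonneg _) (hdet Z hZb) _) h2 ?_ (by positivity)
            exact mul_nonneg ((v s).nonneg _) hbl.le
    rw [← div_le_div_iff_of_pos_right hbl, div_self hbl.ne'] at h4
    refine h4.trans (le_of_eq ?_)
    rw [hT1, pow_add, pow_mul, mul_pow]
    field_simp
  have hvy := (v s).nonneg y
  refine h3.trans (mul_le_mul_of_nonneg_right ?_ hvy)
  refine mul_le_mul ((le_max_left _ _).trans (le_max_right _ _)) ?_ (by positivity) (by positivity)
  rw [← Real.rpow_natCast]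
  exact Real.rpow_le_rpow_of_exponent_le hH ((le_max_right _ _).trans (le_max_right _ _))

lemma Set.Infinite.exists_infinite_fiber {α β : Type*} [Finite β] {A : Set α} (hA : A.Infinite)
    (f : α → β) : ∃ y, {a | a ∈ A ∧ f a = y}.Infinite := by
  by_contra h
  push Not at h
  refine hA ((Set.finite_iUnion h).subset fun a ha => ?_)
  exact Set.mem_iUnion.2 ⟨f a, ha, rfl⟩

/-- If the primitive normals of the hyperplanes spanned by the small points are not too large,
then infinitely many of these hyperplanes coincide with a fixed one. -/
theorem exists_common_normal {K : Type*} [Field K] [NumberField K] {S : Type} [Fintype S]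
    (v : S → AbsoluteValue K ℝ) (hprod : ∀ z : ℤ, z ≠ 0 → 1 ≤ ∏ s, v s (z : K)) {m : ℕ}
    (L : S → Matrix (Fin (m + 1)) (Fin (m + 1)) K) (hL : ∀ s, (L s).det ≠ 0)
    (c : S → Fin (m + 1) → ℝ) (hc : ∑ s, ∑ i, c s i < 0) :
    ∃ η : ℝ, 0 < η ∧ ∀ A : Set ℕ, A.Infinite →
      ∀ (w : ℕ → Fin m → Fin (m + 1) → ℤ) (u : ℕ → Fin (m + 1) → ℤ) (γ : ℕ → ℤ),
      (∀ n ∈ A, γ n ≠ 0) → (∀ n ∈ A, u n ≠ 0) →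
      (∀ n ∈ A, ∀ i, γ n * u n i =
        (Matrix.of (Fin.cons (Pi.single i 1) (w n) : Fin (m + 1) → Fin (m + 1) → ℤ)).det) →
      (∀ n ∈ A, ∀ i, |(u n i : ℝ)| ≤ Real.exp (η * n)) →
      (∀ n ∈ A, ∀ s i j, v s (∑ i', L s i i' * (w n j i' : ℤ)) ≤ Real.exp (n * c s i)) →
      ∃ n₀ ∈ A, {n | n ∈ A ∧ ∀ j, ∑ i, u n₀ i * w n j i = 0}.Infinite := by
  classical
  have hS : Nonempty S := by
    by_contra h
    rw [not_nonempty_iff] at h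
    simp at hc
  have hS0 : (0 : ℝ) < Fintype.card S := by exact_mod_cast Fintype.card_pos
  set δ := -∑ s, ∑ i, c s i with hδ
  have hδ0 : 0 < δ := by linarith
  choose T' hT'1 hT' using fun p : S × Fin (m + 1) =>
    exists_liouville v hprod p.1 (fun i' => (L p.1)⁻¹ i' p.2)
  obtain ⟨T, hT⟩ := Finite.exists_le T'
  have hT1 : 1 ≤ T := (hT'1 (hS.some, 0)).trans (hT _)
  set η : ℝ := δ / (2 * (Fintype.card S * T)) with hη
  have hη0 : 0 < η := by positivity
  refine ⟨η, hη0, fun A hA w u γ hγ0 hu0 hγ hub hw => ?_⟩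
  let a : ℕ → S → Fin (m + 1) → K := fun n s i => ∑ i', (u n i' : K) * (L s)⁻¹ i' i
  obtain ⟨Z, hZ⟩ := hA.exists_infinite_fiber
    (fun n => Finset.univ.filter fun p : S × Fin (m + 1) => a n p.1 p.2 ≠ 0)
  obtain ⟨n₀, hn₀A, hn₀Z⟩ := hZ.nonempty
  have hZiff : ∀ n ∈ {n | n ∈ A ∧ (Finset.univ.filter fun p : S × Fin (m + 1) =>
      a n p.1 p.2 ≠ 0) = Z}, ∀ s i, (s, i) ∈ Z ↔ a n s i ≠ 0 := by
    rintro n ⟨-, rfl⟩ s i; simp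
  -- expansion
  have hexp : ∀ n s i', (u n i' : K) = ∑ i, a n s i * L s i i' := by
    intro n s i'
    have h1 := Matrix.nonsing_inv_mul (L s) (isUnit_iff_ne_zero.2 (hL s))
    simp only [a, Finset.sum_mul]
    rw [Finset.sum_comm]
    have h2 : ∀ y, ∑ i, (u n y : K) * (L s)⁻¹ y i * L s i i' = (u n y : K) * (if y = i' then 1 else 0) := by
      intro y
      rw [← Matrix.one_apply, ← h1, Matrix.mul_apply, Finset.mul_sum]
      simp [mul_assoc]
    simp [h2]
  have hne : ∀ s, ∃ i, (s, i) ∈ Z ∧ ∀ i', (s, i') ∈ Z → c s i' ≤ c s i := by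
    intro s
    have h1 : (Finset.univ.filter fun i => (s, i) ∈ Z).Nonempty := by
      by_contra h
      rw [Finset.not_nonempty_iff_eq_empty, Finset.filter_eq_empty_iff] at h
      refine hu0 n₀ hn₀A (funext fun i' => ?_)
      have h2 := hexp n₀ s i'
      rw [Finset.sum_eq_zero] at h2
      · exact_mod_cast h2
      · intro i _
        have := h (Finset.mem_univ i)
        rw [hZiff n₀ ⟨hn₀A, hn₀Z⟩, not_not] at this
        rw [this, zero_mul]
    obtain ⟨i, hi, hmax⟩ := Finset.exists_max_image _ (c s) h1
    refine ⟨i, by simpa using hi, fun i' hi' => hmax i' (by simpa using hi')⟩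
  choose I hIZ hImax using hne
  set Cu : ℝ := ∏ s, ∑ i, v s (a n₀ s i) with hCu
  have hCu0 : 0 ≤ Cu := Finset.prod_nonneg fun s _ => Finset.sum_nonneg fun i _ => (v s).nonneg _
  set Dt : ℝ := ∏ s, v s (L s).det with hDt
  have hDt0 : 0 < Dt := Finset.prod_pos fun s _ => (v s).pos (hL s)
  set F : ℝ := ((m + 1).factorial * T) ^ Fintype.card S with hF
  have hF0 : 0 < F := by positivity
  have hsmall : ∀ n ∈ {n | n ∈ A ∧ (Finset.univ.filter fun p : S × Fin (m + 1) =>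
      a n p.1 p.2 ≠ 0) = Z}, Dt * ∏ s, Real.exp (n * c s (I s)) ≤ F * Real.exp (-(n * (δ / 2))) := by
    intro n hn
    have h1 : ∀ s, v s (L s).det * v s (γ n : K) * Real.exp (n * c s (I s)) ≤
        (m + 1).factorial * T * (Real.exp (T * (η * n)) * Real.exp (n * ∑ i, c s i)) := by
      intro s
      have h2 := normal_coord_le (v s) (w n) (u n) (γ n) (hγ n hn.1) (L s) (hL s)
        (fun i => Real.exp (n * c s i)) (fun i => Real.exp_pos _) (hw n hn.1 s) (I s)
      have h3 := hT' (s, I s) (Real.exp (η * n)) (Real.one_le_exp (by positivity)) (u n)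
        (hub n hn.1) ((hZiff n hn s (I s)).1 (hIZ s))
      have h4 : 1 ≤ T * Real.exp (T * (η * n)) * v s (a n s (I s)) := by
        refine h3.trans (mul_le_mul_of_nonneg_right ?_ ((v s).nonneg _))
        rw [← Real.exp_mul, mul_comm (η * n)]
        refine mul_le_mul (hT _) (Real.exp_le_exp.2 ?_) (Real.exp_pos _).le (by linarith)
        exact mul_le_mul_of_nonneg_right (hT _) (by positivity)
      rw [← Real.exp_sum, ← Finset.mul_sum] at h2
      have h5 : 0 ≤ v s (L s).det * v s (γ n : K) * Real.exp (n * c s (I s)) := by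
        have := (v s).nonneg (L s).det; have := (v s).nonneg (γ n : K); positivity
      calc v s (L s).det * v s (γ n : K) * Real.exp (n * c s (I s))
          ≤ v s (L s).det * v s (γ n : K) * Real.exp (n * c s (I s)) *
            (T * Real.exp (T * (η * n)) * v s (a n s (I s))) := le_mul_of_one_le_right h5 h4
        _ = (T * Real.exp (T * (η * n))) * (v s (L s).det * (v s (γ n : K) *
              v s (a n s (I s)) * Real.exp (n * c s (I s)))) := by ring
        _ ≤ (T * Real.exp (T * (η * n))) * ((m + 1).factorial * Real.exp (n * ∑ i, c s i)) :=
            mul_le_mul_of_nonneg_left h2 (by positivity)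
        _ = _ := by ring
    have h6 := Finset.prod_le_prod (s := Finset.univ) (fun s _ => by
      have := (v s).nonneg (L s).det; have := (v s).nonneg (γ n : K); positivity) fun s _ => h1 s
    rw [Finset.prod_mul_distrib, Finset.prod_mul_distrib] at h6
    have h7 := hprod (γ n) (hγ0 n hn.1)
    have h8 : 0 ≤ ∏ s, Real.exp (n * c s (I s)) := Finset.prod_nonneg fun _ _ => (Real.exp_pos _).le
    have h9 : Dt * ∏ s, Real.exp (n * c s (I s)) ≤
        (∏ s, v s (L s).det) * (∏ s, v s (γ n : K)) * ∏ s, Real.exp (n * c s (I s)) := by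
      refine mul_le_mul_of_nonneg_right (le_mul_of_one_le_right hDt0.le h7) h8
    refine (h9.trans h6).trans (le_of_eq ?_)
    rw [Finset.prod_mul_distrib, Finset.prod_const, Finset.card_univ, ← hF]
    congr 1
    rw [Finset.prod_mul_distrib, Finset.prod_const, Finset.card_univ, ← Real.exp_sum,
      ← Real.exp_nat_mul, ← Real.exp_add, ← Finset.mul_sum]
    congr 1
    have : ∑ s, ∑ i, c s i = -δ := by rw [hδ]; ring
    rw [this, hη]
    field_simp
    ring
  obtain ⟨N, hN⟩ : ∃ N : ℕ, ∀ n : ℕ, N ≤ n → Cu * F / Dt * Real.exp (-(n * (δ / 2))) < 1 := by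
    have h1 : Filter.Tendsto (fun n : ℕ => Cu * F / Dt * Real.exp (-(n * (δ / 2)))) Filter.atTop
        (nhds (Cu * F / Dt * 0)) := by
      refine Filter.Tendsto.const_mul _ ?_
      refine Real.tendsto_exp_neg_atTop_nhds_zero.comp ?_
      exact tendsto_natCast_atTop_atTop.atTop_mul_const (by positivity)
    rw [mul_zero] at h1
    exact Filter.eventually_atTop.1 (h1.eventually_lt_const one_pos)
  refine ⟨n₀, hn₀A, ?_⟩
  refine (hZ.sdiff (Set.finite_lt_nat N)).mono ?_
  rintro n ⟨hn, hnN⟩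
  simp only [Set.mem_ofPred_eq, not_lt] at hnN
  refine ⟨hn.1, fun j => ?_⟩
  by_contra hcon
  have h1 := hprod _ hcon
  have h2 : ∀ s, v s ((∑ i, u n₀ i * w n j i : ℤ) : K) ≤
      (∑ i, v s (a n₀ s i)) * Real.exp (n * c s (I s)) := by
    intro s
    have h3 : ((∑ i, u n₀ i * w n j i : ℤ) : K) =
        ∑ i, a n₀ s i * ∑ i', L s i i' * (w n j i' : ℤ) := by
      push_cast
      simp only [hexp n₀ s, Finset.sum_mul, Finset.mul_sum]
      rw [Finset.sum_comm]
      simp [mul_assoc]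
    rw [h3, Finset.sum_mul]
    refine ((v s).sum_le _ _).trans (Finset.sum_le_sum fun i _ => ?_)
    rw [(v s).map_mul]
    by_cases hi : (s, i) ∈ Z
    · refine mul_le_mul_of_nonneg_left ((hw n hn.1 s i j).trans (Real.exp_le_exp.2 ?_))
        ((v s).nonneg _)
      exact mul_le_mul_of_nonneg_left (hImax s i hi) (Nat.cast_nonneg _)
    · rw [hZiff n₀ ⟨hn₀A, hn₀Z⟩, not_not] at hi
      simp [hi]
  have h3 := h1.trans (Finset.prod_le_prod (fun s _ => (v s).nonneg _) fun s _ => h2 s)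
  rw [Finset.prod_mul_distrib, ← hCu] at h3
  have h4 := hsmall n hn
  have h5 : ∏ s, Real.exp (n * c s (I s)) ≤ F * Real.exp (-(n * (δ / 2))) / Dt := by
    rw [le_div_iff₀ hDt0, mul_comm]; exact h4
  have h6 := h3.trans (mul_le_mul_of_nonneg_left h5 hCu0)
  have h7 := hN n hnN
  have : Cu * (F * Real.exp (-(n * (δ / 2))) / Dt) = Cu * F / Dt * Real.exp (-(n * (δ / 2))) := by
    ring
  linarith

end

noncomputable section

open MvPolynomial

/-- Some ratio of coordinates of a primitive vector has large denominator. -/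
lemma exists_large_den {m : ℕ} (hm : 0 < m) (u y : Fin (m + 1) → ℤ) (hy : ∑ i, y i * u i = 1)
    (a : Fin (m + 1)) (ha : u a ≠ 0) :
    ∃ b, b ≠ a ∧ Real.log |(u a : ℝ)| ≤ m * Real.log ((u b : ℚ) / u a).den := by
  classical
  have haQ : (u a : ℚ) ≠ 0 := by exact_mod_cast ha
  set Q : ℕ := ∏ b ∈ Finset.univ.erase a, ((u b : ℚ) / u a).den with hQ
  have hdvd : ∀ b, u a ∣ (Q : ℤ) * u b := by
    intro b
    by_cases hb : b = a
    · subst hb; exact dvd_mul_left _ _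
    · obtain ⟨Q', hQ'⟩ : ((u b : ℚ) / u a).den ∣ Q :=
        Finset.dvd_prod_of_mem _ (Finset.mem_erase.2 ⟨hb, Finset.mem_univ _⟩)
      refine ⟨Q' * ((u b : ℚ) / u a).num, ?_⟩
      have h1 : (((u b : ℚ) / u a).den : ℚ) * ((u b : ℚ) / u a) = ((u b : ℚ) / u a).num :=
        Rat.den_mul_eq_num _
      have h2 : ((Q : ℤ) * u b : ℚ) = u a * (Q' * ((u b : ℚ) / u a).num) := by
        rw [← h1, hQ']; push_cast; field_simp
      exact_mod_cast h2
  have hdQ : u a ∣ (Q : ℤ) := by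
    have : (Q : ℤ) = ∑ i, y i * ((Q : ℤ) * u i) := by
      have h1 : ∑ i, y i * ((Q : ℤ) * u i) = Q * ∑ i, y i * u i := by
        rw [Finset.mul_sum]
        exact Finset.sum_congr rfl fun i _ => by ring
      rw [h1, hy, mul_one]
    rw [this]
    exact Finset.dvd_sum fun i _ => (hdvd i).mul_left _
  have hQ0 : 0 < Q := Finset.prod_pos fun b _ => Rat.den_pos _
  have hle : |(u a : ℝ)| ≤ Q := by
    have := Int.le_of_dvd (by exact_mod_cast hQ0) ((abs_dvd _ _).2 hdQ)
    exact_mod_cast this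
  have hlog : Real.log |(u a : ℝ)| ≤ ∑ b ∈ Finset.univ.erase a, Real.log ((u b : ℚ) / u a).den := by
    have h1 : (0 : ℝ) < |(u a : ℝ)| := abs_pos.2 (by exact_mod_cast ha)
    refine (Real.log_le_log h1 hle).trans (le_of_eq ?_)
    rw [hQ]; push_cast
    rw [Real.log_prod]
    intro b _
    exact_mod_cast Rat.den_ne_zero _
  have hcard : (Finset.univ.erase a).card = m := by
    rw [Finset.card_erase_of_mem (Finset.mem_univ a)]; simp
  have hne : (Finset.univ.erase a).Nonempty := by
    rw [← Finset.card_pos, hcard]; exact hm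
  have hm' : (0 : ℝ) < m := by exact_mod_cast hm
  obtain ⟨b, hb, hle⟩ := Finset.exists_le_of_sum_le (s := Finset.univ.erase a)
    (f := fun _ => Real.log |(u a : ℝ)| / m)
    (g := fun b => Real.log ((u b : ℚ) / u a).den) hne (by
      rw [Finset.sum_const, hcard, nsmul_eq_mul, mul_div_cancel₀ _ hm'.ne']; exact hlog)
  refine ⟨b, Finset.ne_of_mem_erase hb, ?_⟩
  rw [div_le_iff₀ hm'] at hle
  linarith

lemma Set.Infinite.exists_lacunary {A : Set ℕ} (hA : A.Infinite) {ω : ℝ} (hω : 0 < ω) (N k : ℕ) :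
    ∃ n : Fin k → ℕ, (∀ h, n h ∈ A ∧ N ≤ n h) ∧ ∀ h h', h < h' → (n h' : ℝ) ≤ ω * n h := by
  induction k with
  | zero => exact ⟨Fin.elim0, fun h => h.elim0, fun h => h.elim0⟩
  | succ k ih =>
    obtain ⟨n, hn, hnn⟩ := ih
    obtain ⟨B, hB⟩ := _root_.Finite.exists_le n
    obtain ⟨N', hN'⟩ := exists_nat_ge (B / ω)
    obtain ⟨x, hxA, hx⟩ := hA.exists_gt (N + N')
    refine ⟨Fin.cons x n, fun h => ?_, fun h h' hlt => ?_⟩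
    · refine Fin.cases ⟨by simpa using hxA, by simp; omega⟩ (fun h => by simpa using hn h) h
    · obtain ⟨j', rfl⟩ := Fin.exists_succ_eq.2 (Fin.ne_zero_of_lt hlt)
      obtain rfl | ⟨j, rfl⟩ := Fin.eq_zero_or_eq_succ h
      · simp only [Fin.cons_succ, Fin.cons_zero]
        rw [div_le_iff₀ hω] at hN'
        have h1 : (n j' : ℝ) ≤ B := by exact_mod_cast hB j'
        have h2 : (N' : ℝ) ≤ x := by exact_mod_cast (by omega : N' ≤ x)
        nlinarith
      · simp only [Fin.cons_succ]
        exact hnn j j' (Fin.succ_lt_succ_iff.1 hlt)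

/-- The case where the points span hyperplanes. -/
theorem exists_hyperplane_of_span {K : Type*} [Field K] [NumberField K] {S : Type} [Fintype S]
    (v : S → AbsoluteValue K ℝ) (hprod : ∀ z : ℤ, z ≠ 0 → 1 ≤ ∏ s, v s (z : K)) {m : ℕ}
    (L : S → Matrix (Fin (m + 1)) (Fin (m + 1)) K) (hL : ∀ s, (L s).det ≠ 0)
    (c : S → Fin (m + 1) → ℝ) (hc : ∑ s, ∑ i, c s i < 0) (A : Set ℕ) (hA : A.Infinite)
    (w : ℕ → Fin m → Fin (m + 1) → ℤ)
    (hwi : ∀ n ∈ A, LinearIndependent ℚ (fun j i => (w n j i : ℚ)))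
    (hw : ∀ n ∈ A, ∀ s i j, v s (∑ i', L s i i' * (w n j i' : ℤ)) ≤ Real.exp (n * c s i)) :
    ∃ u : Fin (m + 1) → ℤ, u ≠ 0 ∧ {n | n ∈ A ∧ ∀ j, ∑ i, u i * w n j i = 0}.Infinite := by
  classical
  obtain rfl | hm := Nat.eq_zero_or_pos m
  · refine ⟨1, one_ne_zero, hA.mono fun n hn => ⟨hn, fun j => j.elim0⟩⟩
  have hS : Nonempty S := by
    by_contra h
    rw [not_nonempty_iff] at h
    simp at hc
  obtain ⟨η, hη, hcommon⟩ := exists_common_normal v hprod L hL c hc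
  have hex := fun n : ℕ => if hn : n ∈ A then
    (let ⟨u, γ, h⟩ := exists_primitive_normal (w n) (hwi n hn); ⟨u, γ, fun _ => h⟩ :
      ∃ (u : Fin (m + 1) → ℤ) (γ : ℤ), n ∈ A → _) else ⟨0, 0, fun h => absurd h hn⟩
  choose u γ hu using hex
  have hu0 : ∀ n ∈ A, u n ≠ 0 := by
    intro n hn h0
    obtain ⟨y, hy⟩ := (hu n hn).2.1
    simp [h0] at hy
  by_cases hA1 : {n | n ∈ A ∧ ∀ i, |(u n i : ℝ)| ≤ Real.exp (η * n)}.Infinite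
  · obtain ⟨n₀, hn₀, hinf⟩ := hcommon _ hA1 w u γ (fun n hn => (hu n hn.1).1)
      (fun n hn => hu0 n hn.1) (fun n hn => (hu n hn.1).2.2.1) (fun n hn => hn.2)
      (fun n hn => hw n hn.1)
    exact ⟨u n₀, hu0 n₀ hn₀.1, hinf.mono fun n hn => ⟨hn.1.1, hn.2⟩⟩
  exfalso
  have hA2 := hA.sdiff (Set.not_infinite.1 hA1)
  set A2 := A \ {n | n ∈ A ∧ ∀ i, |(u n i : ℝ)| ≤ Real.exp (η * n)} with hA2def
  -- choose the coordinates
  have hab : ∀ n, ∃ a b : Fin (m + 1), n ∈ A2 → (a ≠ b ∧ u n a ≠ 0 ∧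
      η * n / m ≤ Real.log ((u n b : ℚ) / u n a).den) := by
    intro n
    by_cases hn : n ∈ A2
    · obtain ⟨i, hi⟩ : ∃ i, Real.exp (η * n) < |(u n i : ℝ)| := by
        by_contra h
        push Not at h
        exact hn.2 ⟨hn.1, h⟩
      have hi0 : u n i ≠ 0 := by
        intro h0
        rw [h0] at hi
        simp at hi
        linarith [Real.exp_pos (η * n)]
      obtain ⟨y, hy⟩ := (hu n hn.1).2.1
      obtain ⟨b, hb, hlog⟩ := exists_large_den hm (u n) y hy i hi0
      refine ⟨i, b, fun _ => ⟨hb.symm, hi0, ?_⟩⟩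
      have h1 := Real.log_lt_log (Real.exp_pos _) hi
      rw [Real.log_exp] at h1
      rw [div_le_iff₀ (by exact_mod_cast hm)]
      linarith
    · exact ⟨0, 0, fun h => absurd h hn⟩
  choose a b hab using hab
  obtain ⟨k, hk, B, hB, θ, hθ, N0, hpoly⟩ := exists_polynomial_vanishing v hprod L hL c hc
  obtain ⟨ω, hω, hroth⟩ := roth_index k θ hθ
  have hm' : (0 : ℝ) < m := by exact_mod_cast hm
  have hk' : (0 : ℝ) < k := by exact_mod_cast hk
  have hlogB : 0 ≤ Real.log B := Real.log_nonneg hB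
  obtain ⟨N1, hN1⟩ := exists_nat_ge (m / (ω * η))
  obtain ⟨N2, hN2⟩ := exists_nat_ge (k * Real.log B * m / (ω * η))
  obtain ⟨n, hn, hlac⟩ := hA2.exists_lacunary hω (N0 + N1 + N2 + 1) k
  have hnpos : ∀ h, 0 < n h := fun h => by have := (hn h).2; omega
  set R : ℕ := ∏ h, n h with hR
  have hRpos : 0 < R := Finset.prod_pos fun h _ => hnpos h
  have hdvd : ∀ h, n h ∣ R := fun h => Finset.dvd_prod_of_mem _ (Finset.mem_univ h)
  choose r hr using hdvd
  have hrpos : ∀ h, 0 < r h := fun h => by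
    rcases Nat.eq_zero_or_pos (r h) with h0 | h0
    · have := hr h; rw [h0, mul_zero] at this; omega
    · exact h0
  have hrR : ∀ h, (n h : ℝ) * r h = R := fun h => by exact_mod_cast (hr h).symm
  have hn0 : ∀ h, (0 : ℝ) < n h := fun h => by exact_mod_cast hnpos h
  have hr0 : ∀ h, (0 : ℝ) < r h := fun h => by exact_mod_cast hrpos h
  have hR0 : (0 : ℝ) < R := by exact_mod_cast hRpos
  have hwκ : ∀ h, ∀ i, ∃ κ : Fin m → ℚ, i ≠ a (n h) → ∀ i', ∑ j, κ j * (w (n h) j i' : ℚ) =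
      (if i' = i then 1 else 0) - (if i' = a (n h) then (u (n h) i : ℚ) / u (n h) (a (n h)) else 0) := by
    intro h i
    by_cases hi : i = a (n h)
    · exact ⟨0, fun h => absurd hi h⟩
    · have hua : (u (n h) (a (n h)) : ℚ) ≠ 0 := by exact_mod_cast (hab _ (hn h).1).2.1
      obtain ⟨κ, hκ⟩ := (hu (n h) (hn h).1.1).2.2.2.2 (fun i' => (if i' = i then 1 else 0) -
        (if i' = a (n h) then (u (n h) i : ℚ) / u (n h) (a (n h)) else 0)) (by
          simp only [mul_sub, Finset.sum_sub_distrib, mul_ite, mul_one, mul_zero,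
            Finset.sum_ite_eq', Finset.mem_univ, if_true]
          field_simp; ring)
      exact ⟨κ, fun _ => hκ⟩
  choose κ hκ using hwκ
  obtain ⟨P, hP0, hPh, hPl, hPv⟩ := hpoly n r R hrpos (fun h => by have := (hn h).2; omega)
    (fun h => (hr h).symm) (fun h => w (n h)) (fun h => Pi.single (a (n h)) 1)
    (fun h i => by
      by_cases hi : i = a (n h)
      · subst hi; simp
      · simp [Pi.single_eq_of_ne hi])
    (fun s h i j => hw (n h) (hn h).1.1 s i j)
  obtain ⟨f, hf0, hfd, hfc, hfi⟩ := exists_one_variable_per_block (fun h => a (n h))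
    (fun h => b (n h)) (fun h => (hab _ (hn h).1).1) (fun h => w (n h))
    (fun h i => (u (n h) i : ℚ) / u (n h) (a (n h))) (fun h j i => κ h i j)
    (fun h i i' hi => hκ h i hi i') r P hP0 hPh (B ^ ∑ h, r h) θ
    (fun t => (abs_coeff_le_intLen P t).trans hPl) hPv
  refine hroth r _ (R * η / m) f hrpos ?_ ?_ ?_ (by positivity) hf0 hfd ?_ hfi
  · intro h h' hlt
    have h1 := hlac h h' hlt
    have e1 : (r h : ℝ) = R / n h := by rw [← hrR h]; field_simp [(hn0 h).ne']
    have e2 : (r h' : ℝ) = R / n h' := by rw [← hrR h']; field_simp [(hn0 h').ne']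
    rw [e1, e2, div_le_iff₀ (hn0 h), mul_comm ω, mul_assoc, div_mul_eq_mul_div,
      le_div_iff₀ (hn0 h')]
    exact mul_le_mul_of_nonneg_left h1 hR0.le
  · intro h
    have h1 := (hab _ (hn h).1).2.2
    simp only [Rat.neg_den]
    have h2 : (R : ℝ) * η / m = r h * (η * n h / m) := by rw [← hrR h]; ring
    rw [h2]
    exact mul_le_mul_of_nonneg_left h1 (hr0 h).le
  · intro h
    have h1 : (N1 : ℝ) ≤ n h := by exact_mod_cast (by have := (hn h).2; omega : N1 ≤ n h)
    have h2 := hN1.trans h1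
    rw [div_le_iff₀ (by positivity)] at h2
    rw [← hrR h]
    have : ω * ((n h : ℝ) * r h * η / m) = r h * (n h * (ω * η) / m) := by ring
    rw [this]
    refine le_mul_of_one_le_right (hr0 h).le ?_
    rwa [le_div_iff₀ hm', one_mul]
  · intro t
    refine (hfc t).trans ?_
    have h3 : B ^ (∑ h, r h) = Real.exp ((∑ h, (r h : ℝ)) * Real.log B) := by
      rw [← Nat.cast_sum, ← Real.log_pow, Real.exp_log (by positivity)]
    rw [h3]
    refine Real.exp_le_exp.2 ?_
    have h4 : ∀ h, (r h : ℝ) * (k * Real.log B) ≤ ω * (R * η / m) := by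
      intro h
      have h1 : (N2 : ℝ) ≤ n h := by exact_mod_cast (by have := (hn h).2; omega : N2 ≤ n h)
      have h2 := hN2.trans h1
      rw [div_le_iff₀ (by positivity)] at h2
      rw [← hrR h]
      have : ω * ((n h : ℝ) * r h * η / m) = r h * (n h * (ω * η) / m) := by ring
      rw [this]
      refine mul_le_mul_of_nonneg_left ?_ (hr0 h).le
      rw [le_div_iff₀ hm']
      exact h2
    have h5 := Finset.sum_le_sum (s := Finset.univ) fun h _ => h4 h
    rw [← Finset.sum_mul, Finset.sum_const, Finset.card_univ, Fintype.card_fin, nsmul_eq_mul] at h5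
    have h6 : (∑ h, (r h : ℝ)) * (k * Real.log B) = k * ((∑ h, (r h : ℝ)) * Real.log B) := by ring
    rw [h6] at h5
    exact le_of_mul_le_mul_left h5 hk'

end

noncomputable section

lemma norm_mulVec_le {N M : ℕ} (A : Matrix (Fin M) (Fin N) ℝ) :
    ∃ C : ℝ, 0 < C ∧ ∀ x, ‖A.mulVec x‖ ≤ C * ‖x‖ := by
  refine ⟨∑ i, ∑ j, |A i j| + 1, by positivity, fun x => ?_⟩
  refine (pi_norm_le_iff_of_nonneg (by positivity)).2 fun i => ?_
  rw [Matrix.mulVec, dotProduct, Real.norm_eq_abs]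
  calc |∑ j, A i j * x j| ≤ ∑ j, |A i j| * ‖x‖ := by
        refine (Finset.abs_sum_le_sum_abs _ _).trans (Finset.sum_le_sum fun j _ => ?_)
        rw [abs_mul]
        exact mul_le_mul_of_nonneg_left (norm_le_pi_norm x j) (abs_nonneg _)
    _ = (∑ j, |A i j|) * ‖x‖ := by rw [Finset.sum_mul]
    _ ≤ _ := by
        refine mul_le_mul_of_nonneg_right ?_ (norm_nonneg _)
        have := Finset.single_le_sum (f := fun i => ∑ j, |A i j|)
          (fun i _ => by positivity) (Finset.mem_univ i)
        linarith [show ∑ j, |A i j| ≤ ∑ i, ∑ j, |A i j| from this]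

/-- An invertible real matrix is bounded below. -/
lemma exists_norm_le_mulVec {N : ℕ} (A : Matrix (Fin N) (Fin N) ℝ) (hA : A.det ≠ 0) :
    ∃ C : ℝ, 0 < C ∧ ∀ x, ‖x‖ ≤ C * ‖A.mulVec x‖ := by
  obtain ⟨C, hC, h⟩ := norm_mulVec_le A⁻¹
  refine ⟨C, hC, fun x => ?_⟩
  have := h (A.mulVec x)
  rwa [Matrix.mulVec_mulVec, Matrix.nonsing_inv_mul _ (isUnit_iff_ne_zero.2 hA),
    Matrix.one_mulVec] at this

lemma finite_norm_mulVec_le {N : ℕ} (A : Matrix (Fin N) (Fin N) ℝ) (hA : A.det ≠ 0) (B : ℝ) :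
    {z : Fin N → ℤ | ‖A.mulVec fun i => (z i : ℝ)‖ ≤ B}.Finite := by
  obtain ⟨C, hC, h⟩ := exists_norm_le_mulVec A hA
  refine (Set.finite_Icc (fun _ => -⌈C * B⌉ : Fin N → ℤ) fun _ => ⌈C * B⌉).subset ?_
  intro z hz
  rw [Set.mem_ofPred_eq] at hz
  have h1 : ∀ i, |(z i : ℝ)| ≤ C * B := fun i =>
    (norm_le_pi_norm (fun i => (z i : ℝ)) i).trans
      ((h _).trans (mul_le_mul_of_nonneg_left hz hC.le))
  constructor
  · intro i
    have := (abs_le.1 ((h1 i).trans (Int.le_ceil _))).1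
    exact_mod_cast this
  · intro i
    have := (abs_le.1 ((h1 i).trans (Int.le_ceil _))).2
    exact_mod_cast this

/-- Lattice reduction for the supremum norm: a unimodular change of variables and a permutation of
the rows make `A` essentially lower and upper triangular at the same time. -/
theorem exists_lattice_reduction (N : ℕ) : ∃ C : ℝ, 1 ≤ C ∧
    ∀ A : Matrix (Fin N) (Fin N) ℝ, A.det ≠ 0 →
    ∃ U : Matrix (Fin N) (Fin N) ℤ, IsUnit U.det ∧ ∃ π : Equiv.Perm (Fin N), ∃ r : Fin N → ℝ,
      (∀ i, 0 < r i) ∧ (∀ i j, i ≤ j → r i ≤ C * r j) ∧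
      (∀ i j, |(A * U.map (Int.cast : ℤ → ℝ)) (π i) j| ≤ C * min (r i) (r j)) ∧
      ∏ i, r i = |A.det| ∧
      ∀ y : Fin N → ℤ, ∀ k, y k ≠ 0 →
        r k ≤ C * ‖(A * U.map (Int.cast : ℤ → ℝ)).mulVec fun i => (y i : ℝ)‖ := by
  classical
  induction N with
  | zero =>
    refine ⟨1, le_rfl, fun A _ => ⟨1, by simp, 1, 1, fun i => i.elim0, fun i => i.elim0,
      fun i => i.elim0, by simp, fun y k => k.elim0⟩⟩
  | succ N ih =>
    obtain ⟨C, hC, ih⟩ := ih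
    refine ⟨4 * C ^ 3, by nlinarith [one_le_pow₀ hC (n := 3)], fun A hA => ?_⟩
    -- the shortest vector belonging to a basis
    let nrm : Matrix (Fin (N + 1)) (Fin (N + 1)) ℤ → ℝ := fun W =>
      ‖A.mulVec fun i => (W i 0 : ℝ)‖
    obtain ⟨U₁, hU₁, hmin⟩ : ∃ U₁ : Matrix (Fin (N + 1)) (Fin (N + 1)) ℤ, IsUnit U₁.det ∧
        ∀ W : Matrix (Fin (N + 1)) (Fin (N + 1)) ℤ, IsUnit W.det → nrm U₁ ≤ nrm W := by
      have hfin : {z : Fin (N + 1) → ℤ | (∃ W : Matrix (Fin (N + 1)) (Fin (N + 1)) ℤ,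
          IsUnit W.det ∧ z = fun i => W i 0) ∧
          ‖A.mulVec fun i => (z i : ℝ)‖ ≤ nrm 1}.Finite :=
        (finite_norm_mulVec_le A hA (nrm 1)).subset fun z hz => hz.2
      obtain ⟨z, ⟨⟨W, hW, rfl⟩, hz⟩, hz'⟩ := Set.exists_min_image _
        (fun z : Fin (N + 1) → ℤ => ‖A.mulVec fun i => (z i : ℝ)‖) hfin
        ⟨fun i => (1 : Matrix (Fin (N + 1)) (Fin (N + 1)) ℤ) i 0, ⟨1, by simp, rfl⟩, le_rfl⟩
      refine ⟨W, hW, fun W' hW' => ?_⟩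
      by_cases h : nrm W' ≤ nrm 1
      · exact hz' (fun i => W' i 0) ⟨⟨W', hW', rfl⟩, h⟩
      · exact hz.trans (not_le.1 h).le
    obtain ⟨p, -, hp⟩ := Finset.exists_max_image Finset.univ
      (fun i => |(A * U₁.map (Int.cast : ℤ → ℝ)) i 0|) ⟨0, Finset.mem_univ _⟩
    set A₁ : Matrix (Fin (N + 1)) (Fin (N + 1)) ℝ :=
      (A * U₁.map (Int.cast : ℤ → ℝ)).submatrix (Equiv.swap 0 p) id with hA₁
    have hcol : ∀ i, |A₁ i 0| ≤ |A₁ 0 0| := by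
      intro i
      simp only [hA₁, Matrix.submatrix_apply, id, Equiv.swap_apply_left]
      exact hp _ (Finset.mem_univ _)
    have hdetU : ∀ W : Matrix (Fin (N + 1)) (Fin (N + 1)) ℤ, IsUnit W.det →
        |(W.map (Int.cast : ℤ → ℝ)).det| = 1 := by
      intro W hW
      have h1 : (W.map (Int.cast : ℤ → ℝ)).det = ((W.det : ℤ) : ℝ) := (Int.cast_det W).symm
      rw [h1]
      rcases Int.isUnit_iff.1 hW with h | h <;> rw [h] <;> simp
    have hdetA₁ : |A₁.det| = |A.det| := by
      rw [hA₁, Matrix.det_permute, Matrix.det_mul, abs_mul, abs_mul, hdetU U₁ hU₁, mul_one]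
      have : |((Equiv.Perm.sign (Equiv.swap 0 p) : ℤ) : ℝ)| = 1 := by
        rcases Int.units_eq_one_or (Equiv.Perm.sign (Equiv.swap 0 p)) with h | h <;> rw [h] <;> simp
      rw [this, one_mul]
    have hA₁0 : A₁.det ≠ 0 := by
      rw [← abs_pos, hdetA₁, abs_pos]; exact hA
    have hpiv : A₁ 0 0 ≠ 0 := by
      intro h
      refine hA₁0 (Matrix.det_eq_zero_of_column_eq_zero 0 fun i => ?_)
      have := hcol i
      rw [h, abs_zero] at this
      exact abs_nonpos_iff.1 this
    set r₀ : ℝ := |A₁ 0 0| with hr₀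
    have hr₀0 : 0 < r₀ := abs_pos.2 hpiv
    set l : Fin (N + 1) → ℝ := fun i => A₁ i 0 / A₁ 0 0 with hl
    have hl1 : ∀ i, |l i| ≤ 1 := fun i => by
      rw [hl, abs_div]; exact div_le_one_of_le₀ (hcol i) (abs_nonneg _)
    have hlA : ∀ i, A₁ i 0 = l i * A₁ 0 0 := fun i => by rw [hl]; field_simp
    set A' : Matrix (Fin N) (Fin N) ℝ :=
      Matrix.of fun i k => A₁ i.succ k.succ - l i.succ * A₁ 0 k.succ with hA'
    have hdetA' : A₁.det = A₁ 0 0 * A'.det := by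
      set A₂ : Matrix (Fin (N + 1)) (Fin (N + 1)) ℝ :=
        Matrix.of fun i j => if i = 0 then A₁ 0 j else A₁ i j - l i * A₁ 0 j with hA₂
      have h1 : A₁.det = A₂.det := by
        refine Matrix.det_eq_of_forall_row_eq_smul_add_const
          (fun i => if i = 0 then 0 else l i) 0 (by simp) fun i j => ?_
        by_cases hi : i = 0
        · subst hi; simp [hA₂]
        · simp [hA₂, hi]
      rw [h1, Matrix.det_succ_column_zero, Fin.sum_univ_succ]
      have h2 : ∀ i : Fin N, A₂ i.succ 0 = 0 := fun i => by
        simp [hA₂, Fin.succ_ne_zero, hlA i.succ]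
      simp only [h2, mul_zero, zero_mul, Finset.sum_const_zero, add_zero]
      have h3 : A₂.submatrix (Fin.succAbove 0) Fin.succ = A' := by
        ext i j; simp [hA₂, hA', Fin.succ_ne_zero]
      rw [h3]; simp [hA₂]
    have hA'0 : A'.det ≠ 0 := by
      intro h; rw [h, mul_zero] at hdetA'; exact hA₁0 hdetA'
    obtain ⟨U', hU', π', r', hr'0, hr'mono, hr'le, hr'prod, hr'low⟩ := ih A' hA'0
    set c : Fin N → ℤ := fun j => round ((∑ k : Fin N, A₁ 0 k.succ * (U' k j : ℝ)) / A₁ 0 0) with hc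
    set E : Matrix (Fin (N + 1)) (Fin (N + 1)) ℤ :=
      Matrix.of (Fin.cons (Fin.cons 1 fun j => - c j) fun i => Fin.cons 0 (U' i)) with hE
    have hEdet : E.det = U'.det := by
      rw [Matrix.det_succ_column_zero, Fin.sum_univ_succ]
      have h2 : ∀ i : Fin N, E i.succ 0 = 0 := fun i => by simp [hE]
      simp only [h2, mul_zero, zero_mul, Finset.sum_const_zero, add_zero]
      have h3 : E.submatrix (Fin.succAbove 0) Fin.succ = U' := by
        ext i j; simp [hE]
      rw [h3]; simp [hE]
    set U := U₁ * E with hU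
    have hUdet : IsUnit U.det := by
      rw [hU, Matrix.det_mul, hEdet]; exact hU₁.mul hU'
    set T : Matrix (Fin (N + 1)) (Fin (N + 1)) ℝ := A₁ * E.map (Int.cast : ℤ → ℝ) with hT
    have hTU : ∀ i j, (A * U.map (Int.cast : ℤ → ℝ)) (Equiv.swap 0 p i) j = T i j := by
      intro i j
      have h1 : U.map (Int.cast : ℤ → ℝ) =
          U₁.map (Int.cast : ℤ → ℝ) * E.map (Int.cast : ℤ → ℝ) := by
        rw [hU]; exact Matrix.map_mul (f := Int.castRingHom ℝ)
      rw [h1, ← Matrix.mul_assoc, hT, hA₁, Matrix.mul_apply, Matrix.mul_apply]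
      rfl
    have hTi0 : ∀ i, T i 0 = A₁ i 0 := by
      intro i
      rw [hT, Matrix.mul_apply, Fin.sum_univ_succ]
      simp [hE]
    have hTij : ∀ i j, T i (Fin.succ j) =
        - c j * A₁ i 0 + ∑ k : Fin N, A₁ i k.succ * (U' k j : ℝ) := by
      intro i j
      rw [hT, Matrix.mul_apply, Fin.sum_univ_succ]
      simp [hE, mul_comm]
    have hT0j : ∀ j, |T 0 (Fin.succ j)| ≤ r₀ / 2 := by
      intro j
      have h1 : T 0 (Fin.succ j) =
          A₁ 0 0 * ((∑ k : Fin N, A₁ 0 k.succ * (U' k j : ℝ)) / A₁ 0 0 - c j) := by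
        rw [hTij]; field_simp; ring
      rw [h1, abs_mul, ← hr₀]
      have := abs_sub_round ((∑ k : Fin N, A₁ 0 k.succ * (U' k j : ℝ)) / A₁ 0 0)
      nlinarith
    have hTss : ∀ i j, T (Fin.succ i) (Fin.succ j) =
        (A' * U'.map (Int.cast : ℤ → ℝ)) i j + l i.succ * T 0 (Fin.succ j) := by
      intro i j
      rw [hTij, hTij, Matrix.mul_apply, hlA i.succ]
      simp only [hA', Matrix.of_apply, Matrix.map_apply, sub_mul, Finset.sum_sub_distrib, mul_add,
        Finset.mul_sum, mul_assoc]
      ring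
    have hminT : ∀ j, ∃ i, r₀ ≤ |T i j| := by
      intro j
      by_contra! hlt
      set W : Matrix (Fin (N + 1)) (Fin (N + 1)) ℤ := U.submatrix id (Equiv.swap 0 j) with hW
      have hWdet : IsUnit W.det := by
        rw [hW, Matrix.det_permute']
        exact (Units.isUnit _).mul hUdet
      have h1 : nrm W < r₀ := by
        refine (pi_norm_lt_iff hr₀0).2 fun i => ?_
        have h2 : (A.mulVec fun i => (W i 0 : ℝ)) i = T (Equiv.swap 0 p i) j := by
          rw [← hTU, Equiv.swap_apply_self, Matrix.mul_apply, Matrix.mulVec, dotProduct]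
          simp [hW]
        rw [h2]
        exact hlt _
      have h2 : r₀ ≤ nrm U₁ := by
        have h3 : (A.mulVec fun i => (U₁ i 0 : ℝ)) p = A₁ 0 0 := by
          rw [hA₁, Matrix.submatrix_apply, Equiv.swap_apply_left, Matrix.mul_apply, Matrix.mulVec,
            dotProduct]
          rfl
        rw [hr₀, ← h3]
        exact norm_le_pi_norm (A.mulVec fun i => (U₁ i 0 : ℝ)) p
      linarith [hmin W hWdet]
    have hr0r' : ∀ k, r₀ ≤ 2 * C ^ 2 * r' k := by
      intro k
      have : NeZero N := ⟨by rintro rfl; exact k.elim0⟩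
      obtain ⟨i, hi⟩ := hminT (Fin.succ 0)
      obtain rfl | ⟨i, rfl⟩ := Fin.eq_zero_or_eq_succ i
      · linarith [hT0j 0]
      · rw [hTss] at hi
        have h1 := hr'le (π'.symm i) 0
        rw [Equiv.apply_symm_apply] at h1
        have h2 : C * min (r' (π'.symm i)) (r' 0) ≤ C * (C * r' k) :=
          mul_le_mul_of_nonneg_left ((min_le_right _ _).trans (hr'mono 0 k (Fin.zero_le _)))
            (by linarith)
        have h3 : |l i.succ * T 0 (Fin.succ 0)| ≤ r₀ / 2 := by
          rw [abs_mul]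
          calc _ ≤ 1 * (r₀ / 2) := mul_le_mul (hl1 _) (hT0j 0) (abs_nonneg _) zero_le_one
            _ = _ := one_mul _
        have h4 := abs_add_le ((A' * U'.map (Int.cast : ℤ → ℝ)) i 0) (l i.succ * T 0 (Fin.succ 0))
        nlinarith
    have hC0 : 0 < C := by linarith
    have hC2 : 2 * C ^ 2 ≤ 4 * C ^ 3 := by nlinarith [pow_pos hC0 2]
    have hC1 : 1 ≤ 4 * C ^ 3 := by nlinarith [one_le_pow₀ hC (n := 3)]
    refine ⟨U, hUdet, (Equiv.Perm.decomposeFin.symm (0, π')).trans (Equiv.swap 0 p), Fin.cons r₀ r',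
      ?_, ?_, ?_, ?_, ?_⟩
    · refine Fin.cases hr₀0 fun i => by simpa using hr'0 i
    · intro i j hij
      obtain rfl | ⟨i, rfl⟩ := Fin.eq_zero_or_eq_succ i
      · obtain rfl | ⟨j, rfl⟩ := Fin.eq_zero_or_eq_succ j
        · simp only [Fin.cons_zero]; nlinarith
        · simp only [Fin.cons_zero, Fin.cons_succ]
          exact (hr0r' j).trans (mul_le_mul_of_nonneg_right hC2 (hr'0 j).le)
      · obtain ⟨j, rfl⟩ := Fin.exists_succ_eq.2
          (Fin.ne_zero_of_lt (lt_of_lt_of_le (Fin.succ_pos i) hij))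
        simp only [Fin.cons_succ]
        refine (hr'mono i j (Fin.succ_le_succ_iff.1 hij)).trans
          (mul_le_mul_of_nonneg_right ?_ (hr'0 j).le)
        nlinarith [one_le_pow₀ hC (n := 2), mul_le_mul_of_nonneg_left (one_le_pow₀ hC (n := 2)) hC0.le]
    · intro i j
      rw [Equiv.trans_apply, hTU]
      obtain rfl | ⟨i, rfl⟩ := Fin.eq_zero_or_eq_succ i
      · rw [Equiv.Perm.decomposeFin_symm_apply_zero]
        obtain rfl | ⟨j, rfl⟩ := Fin.eq_zero_or_eq_succ j
        · rw [hTi0]; simp only [Fin.cons_zero, min_self]; nlinarith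
        · simp only [Fin.cons_zero, Fin.cons_succ]
          have h1 := hT0j j
          have h2 := hr0r' j
          have h3 : r₀ ≤ 4 * C ^ 3 * min r₀ (r' j) := by
            rw [mul_min_of_nonneg _ _ (by linarith)]
            exact le_min (by nlinarith) (h2.trans (mul_le_mul_of_nonneg_right hC2 (hr'0 j).le))
          linarith
      · rw [Equiv.Perm.decomposeFin_symm_apply_succ, Equiv.swap_self, Equiv.refl_apply]
        have h2 := hr0r' i
        obtain rfl | ⟨j, rfl⟩ := Fin.eq_zero_or_eq_succ j
        · rw [hTi0]; simp only [Fin.cons_zero, Fin.cons_succ]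
          refine (hcol _).trans ?_
          rw [mul_min_of_nonneg _ _ (by linarith)]
          exact le_min (h2.trans (mul_le_mul_of_nonneg_right hC2 (hr'0 i).le)) (by nlinarith)
        · simp only [Fin.cons_succ]
          rw [hTss]
          have h3 : |l (π' i).succ * T 0 (Fin.succ j)| ≤ r₀ / 2 := by
            rw [abs_mul]
            calc _ ≤ 1 * (r₀ / 2) := mul_le_mul (hl1 _) (hT0j j) (abs_nonneg _) zero_le_one
              _ = _ := one_mul _
          have h4 := abs_add_le ((A' * U'.map (Int.cast : ℤ → ℝ)) (π' i) j)
            (l (π' i).succ * T 0 (Fin.succ j))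
          have h5 : r₀ ≤ 2 * C ^ 2 * min (r' i) (r' j) := by
            rw [mul_min_of_nonneg _ _ (by positivity)]
            exact le_min (hr0r' i) (hr0r' j)
          have h6 := hr'le i j
          have h7 : 0 < min (r' i) (r' j) := lt_min (hr'0 i) (hr'0 j)
          have h8 : C + C ^ 2 ≤ 4 * C ^ 3 := by
            nlinarith [mul_le_mul_of_nonneg_left hC hC0.le]
          have h9 := mul_le_mul_of_nonneg_right h8 h7.le
          linarith
    · rw [Fin.prod_univ_succ]
      simp only [Fin.cons_zero, Fin.cons_succ]
      rw [hr'prod, ← hdetA₁, hdetA', abs_mul]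
    · intro y k hk
      set t : Fin (N + 1) → ℝ := T.mulVec fun i => (y i : ℝ) with ht
      have hnt : ∀ i, |t i| ≤ ‖(A * U.map (Int.cast : ℤ → ℝ)).mulVec fun i => (y i : ℝ)‖ := by
        intro i
        have h1 : t i = ((A * U.map (Int.cast : ℤ → ℝ)).mulVec fun i => (y i : ℝ))
            (Equiv.swap 0 p i) := by
          simp only [ht, Matrix.mulVec, dotProduct, hTU]
        rw [h1]
        exact norm_le_pi_norm ((A * U.map (Int.cast : ℤ → ℝ)).mulVec fun i => (y i : ℝ)) _
      set X := ‖(A * U.map (Int.cast : ℤ → ℝ)).mulVec fun i => (y i : ℝ)‖ with hX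
      have hX0 : 0 ≤ X := norm_nonneg _
      have hlow : ∀ k : Fin N, y k.succ ≠ 0 → r' k ≤ C * (2 * X) := by
        intro k hk
        refine (hr'low (fun i => y i.succ) k hk).trans (mul_le_mul_of_nonneg_left ?_ (by linarith))
        refine (pi_norm_le_iff_of_nonneg (by linarith)).2 fun i => ?_
        have h1 : ((A' * U'.map (Int.cast : ℤ → ℝ)).mulVec fun i => (y i.succ : ℝ)) i =
            t i.succ - l i.succ * t 0 := by
          simp only [ht, Matrix.mulVec, dotProduct, Fin.sum_univ_succ, hTss, hTi0, hlA i.succ]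
          rw [mul_add, Finset.mul_sum]
          have : ∀ j : Fin N, ((A' * U'.map (Int.cast : ℤ → ℝ)) i j + l i.succ * T 0 j.succ) *
              (y j.succ : ℝ) = (A' * U'.map (Int.cast : ℤ → ℝ)) i j * (y j.succ : ℝ) +
                l i.succ * (T 0 j.succ * (y j.succ : ℝ)) := fun j => by ring
          simp only [this, Finset.sum_add_distrib]
          ring
        rw [h1, Real.norm_eq_abs]
        have h2 : |l i.succ * t 0| ≤ X := by
          rw [abs_mul]
          calc _ ≤ 1 * X := mul_le_mul (hl1 _) (hnt 0) (abs_nonneg _) zero_le_one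
            _ = _ := one_mul _
        have h3 := abs_sub (t i.succ) (l i.succ * t 0)
        linarith [hnt i.succ]
      obtain rfl | ⟨k, rfl⟩ := Fin.eq_zero_or_eq_succ k
      · simp only [Fin.cons_zero]
        by_cases hy : ∃ k : Fin N, y k.succ ≠ 0
        · obtain ⟨k', hk'⟩ := hy
          calc r₀ ≤ 2 * C ^ 2 * r' k' := hr0r' k'
            _ ≤ 2 * C ^ 2 * (C * (2 * X)) :=
              mul_le_mul_of_nonneg_left (hlow k' hk') (by positivity)
            _ = 4 * C ^ 3 * X := by ring
        · push Not at hy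
          have h1 : t 0 = A₁ 0 0 * y 0 := by
            simp only [ht, Matrix.mulVec, dotProduct, Fin.sum_univ_succ, hTi0, hy]
            simp
          have h2 : r₀ ≤ |t 0| := by
            rw [h1, abs_mul]
            have : (1 : ℝ) ≤ |(y 0 : ℝ)| := by exact_mod_cast Int.one_le_abs hk
            nlinarith
          nlinarith [hnt 0]
      · simp only [Fin.cons_succ]
        have h1 := hlow k hk
        have h2 : 2 * C ≤ 4 * C ^ 3 := by
          nlinarith [mul_le_mul_of_nonneg_left (one_le_pow₀ hC (n := 2)) hC0.le]
        nlinarith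

/-- The increasing enumeration of a `p`-subset of `Fin N`. -/
abbrev subEmb {N p : ℕ} (s : Set.powersetCard (Fin N) p) : Fin p ↪o Fin N :=
  Set.powersetCard.ofFinEmbEquiv.symm s

/-- The expansion of an alternating form in a basis. -/
lemma alternating_eq_sum {R : Type*} [CommRing R] {M : Type*} [AddCommGroup M] [Module R M]
    {N p : ℕ} (b : Module.Basis (Fin N) R M) (g : M [⋀^Fin p]→ₗ[R] R) (x : Fin p → M) :
    g x = ∑ s : Set.powersetCard (Fin N) p,
      (Matrix.of fun i j => b.repr (x i) (subEmb s j)).det * g (fun i => b (subEmb s i)) := by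
  have h1 : g x = exteriorPower.alternatingMapLinearEquiv g (exteriorPower.ιMulti R p x) := by
    rw [exteriorPower.alternatingMapLinearEquiv_apply_ιMulti]
  rw [h1]
  conv_lhs => rw [← (b.exteriorPower p).sum_repr (exteriorPower.ιMulti R p x)]
  rw [map_sum]
  refine Finset.sum_congr rfl fun s _ => ?_
  rw [map_smul, exteriorPower.basis_repr_apply, exteriorPower.ιMultiDual_apply_ιMulti, smul_eq_mul,
    exteriorPower.basis_apply]
  congr 1
  rw [exteriorPower.ιMulti_family, exteriorPower.alternatingMapLinearEquiv_apply_ιMulti]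
  rfl

/-- The matrix of minors of size `p`. -/
def compound {R : Type*} [CommRing R] {N : ℕ} (p : ℕ) (A : Matrix (Fin N) (Fin N) R) :
    Matrix (Set.powersetCard (Fin N) p) (Set.powersetCard (Fin N) p) R :=
  Matrix.of fun s t => (A.submatrix (subEmb s) (subEmb t)).det

lemma compound_mul {R : Type*} [CommRing R] {N : ℕ} (p : ℕ) (A B : Matrix (Fin N) (Fin N) R) :
    compound p (A * B) = compound p A * compound p B := by
  ext s t
  have h := alternating_eq_sum (Pi.basisFun R (Fin N))
    ((Matrix.detRowAlternating (n := Fin p) (R := R)).compLinearMap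
      (A.submatrix (subEmb s) id).mulVecLin) (fun j k => B k (subEmb t j))
  rw [Matrix.mul_apply]
  have h1 : compound p (A * B) s t = ((Matrix.detRowAlternating (n := Fin p) (R := R)).compLinearMap
      (A.submatrix (subEmb s) id).mulVecLin) (fun j k => B k (subEmb t j)) := by
    rw [AlternatingMap.compLinearMap_apply]
    rw [compound, Matrix.of_apply, ← Matrix.det_transpose]
    rfl
  rw [h1, h]
  refine Finset.sum_congr rfl fun u _ => ?_
  rw [mul_comm]
  congr 1
  · rw [AlternatingMap.compLinearMap_apply, compound, Matrix.of_apply, ← Matrix.det_transpose]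
    change Matrix.det _ = Matrix.det _
    congr 1
    ext i j
    simp [Matrix.mulVec_single, Pi.basisFun_apply]
  · rw [compound, Matrix.of_apply, ← Matrix.det_transpose]
    rfl

lemma compound_one {R : Type*} [CommRing R] {N : ℕ} (p : ℕ) :
    compound p (1 : Matrix (Fin N) (Fin N) R) = 1 := by
  ext s t
  have h := exteriorPower.ιMultiDual_apply_ιMulti R p (Pi.basisFun R (Fin N)) s
    (fun i => Pi.basisFun R (Fin N) (subEmb t i))
  have h2 : exteriorPower.ιMulti R p (fun i => Pi.basisFun R (Fin N) (subEmb t i)) =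
    exteriorPower.ιMulti_family R p (Pi.basisFun R (Fin N)) t := rfl
  have h3 : compound p (1 : Matrix (Fin N) (Fin N) R) s t =
      (Matrix.of fun i j => (Pi.basisFun R (Fin N)).coord (subEmb s j)
        (Pi.basisFun R (Fin N) (subEmb t i))).det := by
    rw [compound, Matrix.of_apply, ← Matrix.det_transpose]
    congr 1
    ext i j
    simp [Matrix.one_apply, Pi.single_apply]
  rw [h3, ← h, h2]
  by_cases hst : s = t
  · subst hst; rw [exteriorPower.ιMultiDual_apply_diag]; simp
  · rw [exteriorPower.ιMultiDual_apply_nondiag _ _ _ _ _ hst, Matrix.one_apply_ne hst]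

lemma compound_det_ne_zero {F : Type*} [Field F] {N : ℕ} (p : ℕ) (A : Matrix (Fin N) (Fin N) F)
    (hA : A.det ≠ 0) : (compound p A).det ≠ 0 := by
  have h := congrArg Matrix.det (compound_mul p A A⁻¹)
  rw [Matrix.mul_nonsing_inv _ (isUnit_iff_ne_zero.2 hA), compound_one, Matrix.det_one,
    Matrix.det_mul] at h
  exact left_ne_zero_of_mul (h ▸ one_ne_zero)

lemma compound_map {R R' : Type*} [CommRing R] [CommRing R'] (f : R →+* R') {N : ℕ} (p : ℕ)
    (A : Matrix (Fin N) (Fin N) R) : compound p (A.map f) = (compound p A).map f := by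
  ext s t
  rw [compound, Matrix.of_apply, Matrix.map_apply, compound, Matrix.of_apply, RingHom.map_det]
  rfl

/-- A version of `exists_hyperplane_of_span` for an arbitrary index type. -/
theorem exists_hyperplane_of_span' {K : Type*} [Field K] [NumberField K] {S : Type} [Fintype S]
    (v : S → AbsoluteValue K ℝ) (hprod : ∀ z : ℤ, z ≠ 0 → 1 ≤ ∏ s, v s (z : K))
    {I : Type*} [Fintype I] [DecidableEq I] (i₀ : I)
    (L : S → Matrix I I K) (hL : ∀ s, (L s).det ≠ 0)
    (c : S → I → ℝ) (hc : ∑ s, ∑ i, c s i < 0) (A : Set ℕ) (hA : A.Infinite)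
    (w : ℕ → I → I → ℤ)
    (hwi : ∀ n ∈ A, LinearIndependent ℚ (fun j i => (w n j i : ℚ)))
    (hw : ∀ n ∈ A, ∀ s i j, j ≠ i₀ → v s (∑ i', L s i i' * (w n j i' : ℤ)) ≤ Real.exp (n * c s i)) :
    ∃ u : I → ℤ, u ≠ 0 ∧ {n | n ∈ A ∧ ∀ j, j ≠ i₀ → ∑ i, u i * w n j i = 0}.Infinite := by
  obtain ⟨m, hm⟩ : ∃ m, Fintype.card I = m + 1 := by
    have : Nonempty I := ⟨i₀⟩
    exact Nat.exists_eq_succ_of_ne_zero Fintype.card_ne_zero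
  let e₀ : Fin (m + 1) ≃ I := (Fintype.equivFinOfCardEq hm).symm
  let e : Fin (m + 1) ≃ I := (Equiv.swap (Fin.last m) (e₀.symm i₀)).trans e₀
  have he : e (Fin.last m) = i₀ := by simp [e]
  have he' : ∀ j : Fin m, e j.castSucc ≠ i₀ := fun j h => by
    rw [← he] at h
    exact (Fin.castSucc_lt_last j).ne (e.injective h)
  obtain ⟨u, hu, hinf⟩ := exists_hyperplane_of_span v hprod (fun s => (L s).submatrix e e)
    (fun s => by rw [Matrix.det_submatrix_equiv_self]; exact hL s) (fun s i => c s (e i))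
    (by simpa only [Equiv.sum_comp e] using hc) A hA (fun n j i => w n (e j.castSucc) (e i))
    (fun n hn => by
      have h1 : LinearIndependent ℚ (fun (j : Fin m) i => (w n (e j.castSucc) i : ℚ)) :=
        (hwi n hn).comp (fun j : Fin m => e j.castSucc)
          (e.injective.comp (Fin.castSucc_injective m))
      exact h1.map' (LinearMap.funLeft ℚ ℚ e) (LinearMap.ker_eq_bot.2
        (LinearMap.funLeft_injective_of_surjective ℚ ℚ e e.surjective)))
    (fun n hn s i j => by
      have := hw n hn s (e i) (e j.castSucc) (he' j)
      rw [← e.sum_comp] at this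
      exact this)
  refine ⟨u ∘ e.symm, fun h => hu ?_, hinf.mono fun n hn => ⟨hn.1, fun j hj => ?_⟩⟩
  · funext i
    have := congrFun h (e i)
    simpa using this
  · obtain ⟨j', rfl⟩ := e.surjective j
    have hj' : j' ≠ Fin.last m := fun h => hj (h ▸ he)
    obtain ⟨j, rfl⟩ := Fin.exists_castSucc_eq.2 hj'
    have := hn.2 j
    rw [← e.sum_comp]
    simpa using this

lemma AbsoluteValue.sum_le_of_nonarch {K : Type*} [Field K] (v : AbsoluteValue K ℝ)
    (hv : IsNonarchimedean v) {ι : Type*} (s : Finset ι) (f : ι → K) {B : ℝ} (hB : 0 ≤ B)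
    (h : ∀ i ∈ s, v (f i) ≤ B) : v (∑ i ∈ s, f i) ≤ B := by
  classical
  induction s using Finset.induction_on with
  | empty => simpa using hB
  | insert a s ha ih =>
    rw [Finset.sum_insert ha]
    exact (hv _ _).trans (max_le (h a (Finset.mem_insert_self _ _))
      (ih fun i hi => h i (Finset.mem_insert_of_mem hi)))

lemma AbsoluteValue.intCast_le_one {K : Type*} [Field K] (v : AbsoluteValue K ℝ)
    (hv : IsNonarchimedean v) (z : ℤ) : v (z : K) ≤ 1 := by
  have h : ∀ n : ℕ, v (n : K) ≤ 1 := fun n => by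
    have := v.sum_le_of_nonarch hv (Finset.range n) (fun _ => (1 : K)) zero_le_one
      (fun i _ => by rw [v.map_one])
    simpa using this
  obtain ⟨n, rfl | rfl⟩ := z.eq_nat_or_neg
  · exact_mod_cast h n
  · rw [Int.cast_neg, v.map_neg]; exact_mod_cast h n

lemma AbsoluteValue.det_le_of_nonarch {K : Type*} [Field K] (v : AbsoluteValue K ℝ)
    (hv : IsNonarchimedean v) {p : ℕ} (M : Matrix (Fin p) (Fin p) K) (x : Fin p → ℝ)
    (h : ∀ i j, v (M i j) ≤ x i) : v M.det ≤ ∏ i, x i := by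
  have hx : ∀ i, 0 ≤ x i := fun i => (v.nonneg _).trans (h i i)
  rw [Matrix.det_apply]
  refine v.sum_le_of_nonarch hv _ _ (Finset.prod_nonneg fun i _ => hx i) fun σ _ => ?_
  rw [v.map_units_int_smul, map_prod]
  calc ∏ i, v (M (σ i) i) ≤ ∏ i, x (σ i) :=
        Finset.prod_le_prod (fun _ _ => v.nonneg _) fun i _ => h _ _
    _ = ∏ i, x i := Equiv.prod_comp σ x

lemma abs_det_le_mul_prod {p : ℕ} (M : Matrix (Fin p) (Fin p) ℝ) (x y : Fin p → ℝ)
    (h : ∀ i j, |M i j| ≤ x i * y j) : |M.det| ≤ p.factorial * ((∏ i, x i) * ∏ i, y i) := by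
  rw [Matrix.det_apply]
  have hs : ∀ σ : Equiv.Perm (Fin p), |Equiv.Perm.sign σ • ∏ i, M (σ i) i| ≤
      (∏ i, x i) * ∏ i, y i := by
    intro σ
    have : |Equiv.Perm.sign σ • ∏ i, M (σ i) i| = ∏ i, |M (σ i) i| := by
      rw [← Finset.abs_prod]
      rcases Int.units_eq_one_or (Equiv.Perm.sign σ) with h | h <;> rw [h] <;> simp
    rw [this]
    calc ∏ i, |M (σ i) i| ≤ ∏ i, (x (σ i) * y i) :=
          Finset.prod_le_prod (fun _ _ => abs_nonneg _) fun i _ => h _ _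
      _ = _ := by rw [Finset.prod_mul_distrib, Equiv.prod_comp σ x]
  refine (Finset.abs_sum_le_sum_abs _ _).trans ((Finset.sum_le_sum fun σ _ => hs σ).trans ?_)
  rw [Finset.sum_const, nsmul_eq_mul, Finset.card_univ, Fintype.card_perm, Fintype.card_fin]

lemma sum_subEmb {N p : ℕ} (s : Set.powersetCard (Fin N) p) (f : Fin N → ℝ) :
    ∑ i, f (subEmb s i) = ∑ i ∈ s.1, f i := by
  have h : Finset.univ.map (subEmb s).toEmbedding = s.1 := by
    ext i
    have := Set.powersetCard.mem_range_ofFinEmbEquiv_symm_iff_mem s i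
    simp only [Finset.mem_map, Finset.mem_univ, true_and]
    exact this
  rw [← h, Finset.sum_map]
  rfl

/-- Every element belongs to the same number of `p`-subsets. -/
lemma sum_powersetCard_sum {N p : ℕ} (hp : 0 < p) (f : Fin N → ℝ) :
    ∑ s : Set.powersetCard (Fin N) p, ∑ i, f (subEmb s i) =
      (N - 1).choose (p - 1) * ∑ i, f i := by
  classical
  simp only [sum_subEmb]
  have h1 : ∀ s : Set.powersetCard (Fin N) p, ∑ i ∈ s.1, f i = ∑ i, if i ∈ s.1 then f i else 0 :=
    fun s => by simp
  simp only [h1]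
  rw [Finset.sum_comm, Finset.mul_sum]
  refine Finset.sum_congr rfl fun i _ => ?_
  rw [← Finset.sum_filter, Finset.sum_const, nsmul_eq_mul]
  congr 2
  have h2 := Finset.card_filter_powersetCard_subset {i} (Finset.univ : Finset (Fin N)) p
    (Finset.subset_univ _) (by rw [Finset.card_singleton]; exact hp)
  rw [Finset.card_univ, Fintype.card_fin, Finset.card_singleton] at h2
  rw [← h2]
  refine Finset.card_bij (fun s _ => s.1) ?_ ?_ ?_
  · intro s hs
    simp only [Finset.mem_filter, Finset.mem_univ, true_and] at hs
    simp only [Finset.mem_filter, Finset.mem_powersetCard, Finset.singleton_subset_iff]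
    exact ⟨⟨Finset.subset_univ _, s.2⟩, hs⟩
  · intro s _ t _ h
    exact Subtype.ext h
  · intro s hs
    simp only [Finset.mem_filter, Finset.mem_powersetCard, Finset.singleton_subset_iff] at hs
    exact ⟨⟨s, hs.1.2⟩, by simpa using hs.2, rfl⟩

lemma Set.Infinite.exists_cluster {A : Set ℕ} (hA : A.Infinite) {N : ℕ} (f : ℕ → Fin N → ℝ)
    (K : ℝ) (hf : ∀ n ∈ A, ∀ k, |f n k| ≤ K) :
    ∃ γ : Fin N → ℝ, ∀ η > 0, {n | n ∈ A ∧ ∀ k, |f n k - γ k| < η}.Infinite := by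
  have hcpt : IsCompact (Set.Icc (fun _ => -K : Fin N → ℝ) fun _ => K) := isCompact_Icc
  have hne : (Filter.atTop ⊓ Filter.principal A).NeBot := by
    exact Filter.frequently_mem_iff_neBot.1 (Nat.frequently_atTop_iff_infinite.2 hA)
  obtain ⟨γ, -, hγ⟩ := hcpt.exists_mapClusterPt (u := f) (f := Filter.atTop ⊓ Filter.principal A) (by
    rw [Filter.map_le_iff_le_comap, Filter.comap_principal, Filter.le_principal_iff]
    change ∀ᶠ n in Filter.atTop ⊓ Filter.principal A, f n ∈ Set.Icc (fun _ => -K : Fin N → ℝ) fun _ => K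
    rw [Filter.eventually_inf_principal]
    exact Filter.Eventually.of_forall fun n hn =>
      ⟨fun k => (abs_le.1 (hf n hn k)).1, fun k => (abs_le.1 (hf n hn k)).2⟩)
  refine ⟨γ, fun η hη => ?_⟩
  have h1 := hγ.frequently (Metric.ball_mem_nhds γ hη)
  rw [Filter.frequently_inf_principal, Nat.frequently_atTop_iff_infinite] at h1
  refine h1.mono fun n hn => ⟨hn.1, fun k => ?_⟩
  exact (dist_le_pi_dist (f n) γ k).trans_lt hn.2

/-- A linear form on the exterior power which vanishes on all but one of the vectors `D_s` yields a
linear form vanishing on the span of the complementary columns of `D`. -/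
lemma exists_linear_form_of_alternating {N p : ℕ} (hp : 0 < p)
    (h : Set.powersetCard (Fin N) p → ℤ) (hh : h ≠ 0) :
    ∃ u : Fin N → ℤ, u ≠ 0 ∧ ∀ (J : Set.powersetCard (Fin N) p) (D : Matrix (Fin N) (Fin N) ℤ),
      D.det ≠ 0 → (∀ J', J' ≠ J → ∑ I, h I * compound p D I J' = 0) →
      ∀ y : Fin N → ℤ, (∀ k ∈ J.1, y k = 0) → ∑ i, u i * D.mulVec y i = 0 := by
  classical
  obtain ⟨I₀, hI₀⟩ := Function.ne_iff.1 hh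
  have : NeZero p := ⟨hp.ne'⟩
  let g : (Fin N → ℚ) [⋀^Fin p]→ₗ[ℚ] ℚ := ∑ I, (h I : ℚ) •
    (Matrix.detRowAlternating (n := Fin p) (R := ℚ)).compLinearMap
      (LinearMap.funLeft ℚ ℚ (subEmb I))
  have hg : ∀ x, g x = ∑ I, (h I : ℚ) * (Matrix.of fun i j => x i (subEmb I j)).det := by
    intro x
    have h1 : ∀ t : Finset (Set.powersetCard (Fin N) p), (∑ I ∈ t, (h I : ℚ) •
        (Matrix.detRowAlternating (n := Fin p) (R := ℚ)).compLinearMap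
          (LinearMap.funLeft ℚ ℚ (subEmb I))) x =
        ∑ I ∈ t, (h I : ℚ) * (Matrix.of fun i j => x i (subEmb I j)).det := by
      intro t
      induction t using Finset.induction_on with
      | empty => simp
      | insert a t ha ih =>
        rw [Finset.sum_insert ha, Finset.sum_insert ha, AlternatingMap.add_apply, ih]
        rfl
    exact h1 Finset.univ
  have hgD : ∀ (D : Matrix (Fin N) (Fin N) ℤ) J, g (fun j i => (D i (subEmb J j) : ℚ)) =
      ((∑ I, h I * compound p D I J : ℤ) : ℚ) := by
    intro D J
    rw [hg, Int.cast_sum]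
    refine Finset.sum_congr rfl fun I _ => ?_
    rw [Int.cast_mul, compound, Matrix.of_apply, Int.cast_det, ← Matrix.det_transpose]
    rfl
  let e₀ : Fin p → Fin N → ℚ := fun i => Pi.single (subEmb I₀ i) 1
  have hge₀ : g e₀ = h I₀ := by
    have h1 := hgD 1 I₀
    rw [compound_one] at h1
    simp only [Matrix.one_apply, mul_ite, mul_one, mul_zero, Finset.sum_ite_eq', Finset.mem_univ,
      if_true] at h1
    rw [← h1]
    congr 1
    funext i k
    simp [e₀, Pi.single_apply]
  let φ : (Fin N → ℚ) →ₗ[ℚ] ℚ := g.toMultilinearMap.toLinearMap e₀ 0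
  obtain ⟨d, hd, u, hu⟩ := exists_int_mul_rat (fun k => φ (Pi.single k 1))
  refine ⟨u, fun h0 => ?_, fun J D hD hvan y hy => ?_⟩
  · have h1 := hu (subEmb I₀ 0)
    have h2 : φ (Pi.single (subEmb I₀ 0) 1) = h I₀ := by
      rw [← hge₀]
      change g (Function.update e₀ 0 (e₀ 0)) = _
      rw [Function.update_eq_self]
    rw [h2, h0] at h1
    simp only [Pi.zero_apply, Int.cast_zero] at h1
    have h3 : (h I₀ : ℚ) ≠ 0 := by exact_mod_cast hI₀
    have h4 : (d : ℚ) ≠ 0 := by exact_mod_cast hd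
    exact mul_ne_zero h4 h3 h1.symm
  · have hli : LinearIndependent ℚ (fun k i => (D i k : ℚ)) := by
      have h1 : (D.map (Int.cast : ℤ → ℚ)).det ≠ 0 := by
        have h2 : (D.map (Int.cast : ℤ → ℚ)).det = ((D.det : ℤ) : ℚ) := (Int.cast_det D).symm
        rw [h2]; exact_mod_cast hD
      exact Matrix.linearIndependent_cols_of_det_ne_zero h1
    let b : Module.Basis (Fin N) ℚ (Fin N → ℚ) :=
      basisOfLinearIndependentOfCardEqFinrank' _ hli (by simp)
    have hb : ∀ k, b k = fun i => (D i k : ℚ) := fun k => by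
      simp only [b, coe_basisOfLinearIndependentOfCardEqFinrank']
    set x : Fin N → ℚ := fun i => (D.mulVec y i : ℚ) with hx
    have hxb : x = ∑ k, (y k : ℚ) • b k := by
      funext i
      simp only [hx, hb, Finset.sum_apply, Pi.smul_apply, smul_eq_mul, Matrix.mulVec, dotProduct]
      push_cast
      exact Finset.sum_congr rfl fun k _ => mul_comm _ _
    have hrepr : ∀ k ∈ J.1, b.repr x k = 0 := by
      intro k hk
      rw [hxb, b.repr_sum_self, hy k hk, Int.cast_zero]
    have hφx : φ x = 0 := by
      change g (Function.update e₀ 0 x) = 0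
      rw [alternating_eq_sum b]
      refine Finset.sum_eq_zero fun s _ => ?_
      by_cases hs : s = J
      · subst hs
        rw [Matrix.det_eq_zero_of_row_eq_zero 0, zero_mul]
        intro j
        rw [Matrix.of_apply, Function.update_self]
        exact hrepr _ ((Set.powersetCard.mem_range_ofFinEmbEquiv_symm_iff_mem s _).1 ⟨j, rfl⟩)
      · have h1 := hgD D s
        rw [hvan s hs, Int.cast_zero] at h1
        simp only [hb]
        rw [h1, mul_zero]
    have h2 : ((∑ i, u i * D.mulVec y i : ℤ) : ℚ) = d * φ x := by
      have h3 : x = ∑ i, x i • Pi.single i (1 : ℚ) := by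
        funext j; simp [Finset.sum_apply, Pi.single_apply]
      conv_rhs => rw [h3]
      rw [map_sum, Finset.mul_sum, Int.cast_sum]
      refine Finset.sum_congr rfl fun i _ => ?_
      rw [map_smul, smul_eq_mul, Int.cast_mul, hu]
      ring
    rw [hφx, mul_zero] at h2
    exact_mod_cast h2

/-- The exponential size of the determinant of a lattice defined by non-archimedean conditions. -/
lemma det_lower_bound {K : Type*} [Field K] [NumberField K]
    {S : Type} [Fintype S] (v : S → AbsoluteValue K ℝ) (hv : ∀ s, IsNonarchimedean (v s))
    (hprod : ∀ z : ℤ, z ≠ 0 → 1 ≤ |(z : ℝ)| * ∏ s, v s (z : K)) {N : ℕ}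
    (L : S → Matrix (Fin N) (Fin N) K) (hL : ∀ s, (L s).det ≠ 0) (d : S → Fin N → ℝ) :
    ∃ C : ℝ, 0 < C ∧ ∀ (n : ℕ) (B : Matrix (Fin N) (Fin N) ℤ), B.det ≠ 0 →
      (∀ s i j, v s (∑ k, L s i k * (B k j : ℤ)) ≤ Real.exp (n * d s i)) →
      C * Real.exp (-(n * ∑ s, ∑ i, d s i)) ≤ |((B.det : ℤ) : ℝ)| := by
  refine ⟨∏ s, v s (L s).det, Finset.prod_pos fun s _ => (v s).pos (hL s), fun n B hB h => ?_⟩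
  have h1 : ∀ s, v s (L s).det * v s ((B.det : ℤ) : K) ≤ Real.exp (n * ∑ i, d s i) := by
    intro s
    have h2 := (v s).det_le_of_nonarch (hv s) (L s * B.map (Int.cast : ℤ → K))
      (fun i => Real.exp (n * d s i)) (fun i j => by rw [Matrix.mul_apply]; exact h s i j)
    rw [Matrix.det_mul, (v s).map_mul, ← Real.exp_sum, ← Finset.mul_sum] at h2
    rwa [Int.cast_det]
  have h2 : (∏ s, v s (L s).det) * ∏ s, v s ((B.det : ℤ) : K) ≤ Real.exp (n * ∑ s, ∑ i, d s i) := by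
    rw [← Finset.prod_mul_distrib, Finset.mul_sum, Real.exp_sum]
    exact Finset.prod_le_prod (fun s _ => mul_nonneg ((v s).nonneg _) ((v s).nonneg _))
      fun s _ => h1 s
  have h3 := hprod _ hB
  have h4 : 0 ≤ ∏ s, v s (L s).det := Finset.prod_nonneg fun s _ => (v s).nonneg _
  rw [Real.exp_neg, ← div_eq_mul_inv, div_le_iff₀ (Real.exp_pos _)]
  calc ∏ s, v s (L s).det ≤ (∏ s, v s (L s).det) *
        (|((B.det : ℤ) : ℝ)| * ∏ s, v s ((B.det : ℤ) : K)) := le_mul_of_one_le_right h4 h3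
    _ = |((B.det : ℤ) : ℝ)| * ((∏ s, v s (L s).det) * ∏ s, v s ((B.det : ℤ) : K)) := by ring
    _ ≤ _ := mul_le_mul_of_nonneg_left h2 (abs_nonneg _)

/-- The logarithms of the diagonal entries of a reduced lattice are of linear growth. -/
lemma exists_log_bound {N : ℕ} (C₀ : ℝ) (hC₀ : 1 ≤ C₀) (Λ : Matrix (Fin N) (Fin N) ℝ)
    (hΛ : Λ.det ≠ 0) (c : Fin N → ℝ) (δ P : ℝ) :
    ∃ X : ℝ, ∀ (n : ℕ) (D : Matrix (Fin N) (Fin N) ℤ) (r : Fin N → ℝ), 0 < n → D.det ≠ 0 →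
      (∀ k, 0 < r k) → (∀ i k, |Real.exp (-(n * c i)) * (Λ * D.map (Int.cast : ℤ → ℝ)) i k| ≤ C₀ * r k) →
      |∑ k, Real.log (r k) - n * δ| ≤ P → ∀ k, |Real.log (r k) / n| ≤ X := by
  obtain ⟨CΛ, hCΛ, hΛb⟩ := exists_norm_le_mulVec Λ hΛ
  obtain ⟨cm', hcm'⟩ := _root_.Finite.exists_le c
  set cm := max cm' 0
  have hcm : ∀ i, c i ≤ cm := fun i => (hcm' i).trans (le_max_left _ _)
  have hcm0 : 0 ≤ cm := le_max_right _ _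
  set Y : ℝ := cm + |Real.log (CΛ * C₀)| with hY
  have hY0 : 0 ≤ Y := by positivity
  refine ⟨Y + |δ| + |P| + N * Y, fun n D r hn hD hr hle hsum k => ?_⟩
  have hn1 : (1 : ℝ) ≤ n := by exact_mod_cast hn
  have hlow : ∀ k, -(n * Y) ≤ Real.log (r k) := by
    intro k
    have hz : ∃ i, 1 ≤ |(D i k : ℝ)| := by
      by_contra! h
      refine hD (Matrix.det_eq_zero_of_column_eq_zero k fun i => ?_)
      have := h i
      rw [← Int.cast_abs] at this
      exact Int.abs_lt_one_iff.1 (by exact_mod_cast this)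
    obtain ⟨i, hi⟩ := hz
    have h1 : 1 ≤ ‖fun i => (D i k : ℝ)‖ := hi.trans (norm_le_pi_norm (fun i => (D i k : ℝ)) i)
    have h2 : 1 ≤ CΛ * ‖Λ.mulVec fun i => (D i k : ℝ)‖ := h1.trans (hΛb _)
    have h3 : ∀ i, |Λ.mulVec (fun i => (D i k : ℝ)) i| ≤ Real.exp (n * cm) * (C₀ * r k) := by
      intro i
      have h4 := hle i k
      rw [abs_mul, abs_of_pos (Real.exp_pos _), Real.exp_neg, inv_mul_le_iff₀ (Real.exp_pos _)] at h4
      refine (le_of_eq ?_).trans (h4.trans (mul_le_mul_of_nonneg_right ?_ ?_))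
      · rfl
      · exact Real.exp_le_exp.2 (mul_le_mul_of_nonneg_left (hcm i) (by linarith))
      · exact mul_nonneg (by linarith) (hr k).le
    have h5 : ‖Λ.mulVec fun i => (D i k : ℝ)‖ ≤ Real.exp (n * cm) * (C₀ * r k) :=
      (pi_norm_le_iff_of_nonneg (mul_nonneg (Real.exp_pos _).le
        (mul_nonneg (by linarith) (hr k).le))).2 h3
    have h6 : 1 ≤ (CΛ * C₀) * Real.exp (n * cm) * r k := by
      calc 1 ≤ CΛ * ‖Λ.mulVec fun i => (D i k : ℝ)‖ := h2
        _ ≤ CΛ * (Real.exp (n * cm) * (C₀ * r k)) := mul_le_mul_of_nonneg_left h5 hCΛ.le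
        _ = _ := by ring
    have h7 : 0 < CΛ * C₀ := by positivity
    have h8 := Real.log_nonneg h6
    rw [Real.log_mul (by positivity) (hr k).ne', Real.log_mul h7.ne' (Real.exp_pos _).ne',
      Real.log_exp] at h8
    have h9 := le_abs_self (Real.log (CΛ * C₀))
    have h10 : |Real.log (CΛ * C₀)| ≤ n * |Real.log (CΛ * C₀)| :=
      le_mul_of_one_le_left (abs_nonneg _) hn1
    rw [hY, mul_add]
    linarith
  have hup : Real.log (r k) ≤ n * (|δ| + |P| + N * Y) := by
    have h1 : ∑ j, Real.log (r j) = Real.log (r k) + ∑ j ∈ Finset.univ.erase k, Real.log (r j) :=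
      (Finset.add_sum_erase _ _ (Finset.mem_univ k)).symm
    have h2 : -(N * (n * Y)) ≤ ∑ j ∈ Finset.univ.erase k, Real.log (r j) := by
      calc -(N * (n * Y)) ≤ ∑ j ∈ Finset.univ.erase k, -(n * Y) := by
            rw [Finset.sum_const, nsmul_eq_mul, Finset.card_erase_of_mem (Finset.mem_univ k),
              Finset.card_univ, Fintype.card_fin, mul_neg, neg_le_neg_iff]
            refine mul_le_mul_of_nonneg_right ?_ (by positivity)
            exact_mod_cast Nat.sub_le _ _
        _ ≤ _ := Finset.sum_le_sum fun j _ => hlow j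
    have h3 := (abs_le.1 hsum).2
    have h4 : (n : ℝ) * δ ≤ n * |δ| := mul_le_mul_of_nonneg_left (le_abs_self _) (by linarith)
    have h5 : P ≤ n * |P| := (le_abs_self P).trans (le_mul_of_one_le_left (abs_nonneg _) hn1)
    have h6 : (n : ℝ) * (|δ| + |P| + N * Y) = n * |δ| + n * |P| + N * (n * Y) := by ring
    linarith
  have hn0 : (0 : ℝ) < n := by linarith
  rw [abs_le]
  constructor
  · rw [le_div_iff₀ hn0]
    have : -(Y + |δ| + |P| + N * Y) * n ≤ -(n * Y) := by
      have : 0 ≤ (|δ| + |P| + N * Y) * n := by positivity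
      linarith
    linarith [hlow k]
  · rw [div_le_iff₀ hn0]
    have : 0 ≤ Y * n := by positivity
    linarith

lemma exists_gap {N : ℕ} (γ : Fin N → ℝ) (hγ : 0 < ∑ k, γ k) :
    ∃ p : ℕ, 0 < p ∧ ∃ J : Set.powersetCard (Fin N) p, ∃ g : ℝ, 0 < g ∧ (∀ k ∈ J.1, g ≤ γ k) ∧
      ∀ I : Set.powersetCard (Fin N) p, I ≠ J → ∑ k ∈ I.1, γ k ≤ ∑ k ∈ J.1, γ k - g := by
  classical
  set J := Finset.univ.filter fun k => 0 < γ k with hJ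
  have hne : J.Nonempty := by
    obtain ⟨k, -, hk⟩ := Finset.exists_lt_of_sum_lt (s := Finset.univ) (f := fun _ : Fin N => (0 : ℝ))
      (g := γ) (by simpa using hγ)
    exact ⟨k, by simpa [hJ] using hk⟩
  obtain ⟨k₀, hk₀, hmin⟩ := J.exists_min_image γ hne
  have hpos : ∀ k ∈ J, 0 < γ k := fun k hk => by simpa [hJ] using hk
  refine ⟨J.card, hne.card_pos, ⟨J, rfl⟩, γ k₀, hpos _ hk₀, hmin, fun I hI => ?_⟩
  obtain ⟨a, haJ, haI⟩ := (Set.powersetCard.exists_mem_notMem_iff_ne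
    (⟨J, rfl⟩ : Set.powersetCard (Fin N) J.card) I).1 hI.symm
  have haJ' : a ∈ J := haJ
  have haI' : a ∉ I.1 := haI
  have h1 : ∑ k ∈ I.1, γ k ≤ ∑ k ∈ I.1 ∩ J, γ k := by
    rw [← Finset.sum_inter_add_sum_sdiff I.1 J]
    have : ∑ k ∈ I.1 \ J, γ k ≤ 0 := Finset.sum_nonpos fun k hk => by
      have := (Finset.mem_sdiff.1 hk).2
      simpa [hJ] using this
    linarith
  have h2 : ∑ k ∈ I.1 ∩ J, γ k ≤ ∑ k ∈ J.erase a, γ k :=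
    Finset.sum_le_sum_of_subset_of_nonneg
      (fun k hk => Finset.mem_erase.2 ⟨fun h => haI' (h ▸ (Finset.mem_inter.1 hk).1),
        (Finset.mem_inter.1 hk).2⟩)
      fun k hk _ => (hpos k (Finset.mem_of_mem_erase hk)).le
  have h3 := Finset.add_sum_erase J γ haJ'
  have h4 := hmin a haJ'
  change _ ≤ ∑ k ∈ J, γ k - γ k₀
  linarith

lemma compound_abs_le {N : ℕ} (p : ℕ) (M : Matrix (Fin N) (Fin N) ℝ) (x y : Fin N → ℝ)
    (h : ∀ i j, |M i j| ≤ x i * y j) (I J : Set.powersetCard (Fin N) p) :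
    |compound p M I J| ≤ p.factorial * ((∏ a, x (subEmb I a)) * ∏ a, y (subEmb J a)) :=
  abs_det_le_mul_prod _ (fun a => x (subEmb I a)) (fun a => y (subEmb J a)) fun _ _ => h _ _

lemma compound_abs_le_exp {N : ℕ} (p : ℕ) (M : Matrix (Fin N) (Fin N) ℝ) (x y : Fin N → ℝ) {t C₀ : ℝ}
    (h : ∀ i j, |M i j| ≤ C₀ * Real.exp (t * x i) * Real.exp (t * y j))
    (I J : Set.powersetCard (Fin N) p) :
    |compound p M I J| ≤ (p.factorial * C₀ ^ p) *
      Real.exp (t * (∑ a, x (subEmb I a) + ∑ a, y (subEmb J a))) := by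
  refine (compound_abs_le p M _ _ h I J).trans_eq ?_
  rw [Finset.prod_mul_distrib, Finset.prod_const, Finset.card_univ, Fintype.card_fin,
    ← Real.exp_sum, ← Real.exp_sum, ← Finset.mul_sum, ← Finset.mul_sum, mul_add, Real.exp_add]
  ring

lemma sum_comp_eq_of_forall_mem {N p : ℕ} (I J : Set.powersetCard (Fin N) p)
    (σ : Equiv.Perm (Fin N)) (h : ∀ a, σ (subEmb I a) ∈ J.1) (f : Fin N → ℝ) :
    ∑ a, f (σ (subEmb I a)) = ∑ k ∈ J.1, f k := by
  classical
  have hinj : Function.Injective fun a => σ (subEmb I a) :=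
    σ.injective.comp (subEmb I).injective
  have h1 : Finset.univ.image (fun a => σ (subEmb I a)) = J.1 := by
    refine Finset.eq_of_subset_of_card_le (fun k hk => ?_) ?_
    · obtain ⟨a, -, rfl⟩ := Finset.mem_image.1 hk
      exact h a
    · rw [Finset.card_image_of_injective _ hinj,
        Finset.card_univ, Fintype.card_fin]
      exact J.2.le
  rw [← h1, Finset.sum_image fun a _ b _ hab => hinj hab]

/-- The subspace theorem for lattices: if the lattice points `B n y` lie in a box of volume
smaller than the determinant by an exponential factor, they lie on one hyperplane for infinitely
many `n`. -/
theorem exists_form_of_lattice_points {K : Type*} [Field K] [NumberField K] (φ : K →+* ℂ)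
    {S : Type} [Fintype S] (v : S → AbsoluteValue K ℝ) (hv : ∀ s, IsNonarchimedean (v s))
    (hprod : ∀ z : ℤ, z ≠ 0 → 1 ≤ |(z : ℝ)| * ∏ s, v s (z : K)) {N : ℕ}
    (Λ₀ : Matrix (Fin N) (Fin N) K) (Λ : Matrix (Fin N) (Fin N) ℝ)
    (hΛ : ∀ i j, φ (Λ₀ i j) = (Λ i j : ℂ)) (hΛdet : Λ.det ≠ 0)
    (L : S → Matrix (Fin N) (Fin N) K) (hL : ∀ s, (L s).det ≠ 0) (c : Fin N → ℝ)
    (d : S → Fin N → ℝ) (hc : ∑ i, c i + ∑ s, ∑ i, d s i < 0) (A : Set ℕ) (hA : A.Infinite)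
    (B : ℕ → Matrix (Fin N) (Fin N) ℤ) (hBdet : ∀ n ∈ A, (B n).det ≠ 0)
    (hB : ∀ n ∈ A, ∀ s i j, v s (∑ k, L s i k * (B n k j : ℤ)) ≤ Real.exp (n * d s i))
    (C : ℝ) (hdet : ∀ n ∈ A, |(((B n).det : ℤ) : ℝ)| ≤ C * Real.exp (-(n * ∑ s, ∑ i, d s i))) :
    ∃ u : Fin N → ℤ, u ≠ 0 ∧ {n | n ∈ A ∧ ∀ y : Fin N → ℤ,
      (∀ i, |∑ j, Λ i j * ((B n).mulVec y j : ℤ)| ≤ Real.exp (n * c i)) →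
      ∑ i, u i * (B n).mulVec y i = 0}.Infinite := by
  classical
  obtain ⟨C₀, hC₀, hred⟩ := exists_lattice_reduction N
  set δ : ℝ := -(∑ i, c i + ∑ s, ∑ i, d s i) with hδ
  have hδ0 : 0 < δ := by linarith
  let An : ℕ → Matrix (Fin N) (Fin N) ℝ := fun n =>
    Matrix.diagonal (fun i => Real.exp (-(n * c i))) * (Λ * (B n).map (Int.cast : ℤ → ℝ))
  have hdetB : ∀ n, ((B n).map (Int.cast : ℤ → ℝ)).det = (((B n).det : ℤ) : ℝ) := fun n =>
    (Int.cast_det (B n)).symm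
  have hAdet : ∀ n, (An n).det = Real.exp (-(n * ∑ i, c i)) * (Λ.det * (((B n).det : ℤ) : ℝ)) := by
    intro n
    rw [Matrix.det_mul, Matrix.det_diagonal, ← Real.exp_sum, Matrix.det_mul, hdetB,
      Finset.sum_neg_distrib, ← Finset.mul_sum]
  have hAdet0 : ∀ n ∈ A, (An n).det ≠ 0 := fun n hn => by
    rw [hAdet]
    exact mul_ne_zero (Real.exp_pos _).ne' (mul_ne_zero hΛdet (by exact_mod_cast hBdet n hn))
  choose! U hU π r hr0 _ hrle hrprod hrlow using fun n (hn : n ∈ A) => hred (An n) (hAdet0 n hn)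
  let D : ℕ → Matrix (Fin N) (Fin N) ℤ := fun n => B n * U n
  have hDdet : ∀ n ∈ A, (D n).det ≠ 0 := fun n hn => by
    rw [Matrix.det_mul]; exact mul_ne_zero (hBdet n hn) (hU n hn).ne_zero
  have hAU : ∀ n i j, (An n * (U n).map (Int.cast : ℤ → ℝ)) i j =
      Real.exp (-(n * c i)) * (Λ * (D n).map (Int.cast : ℤ → ℝ)) i j := by
    intro n i j
    have h1 : (D n).map (Int.cast : ℤ → ℝ) =
        (B n).map (Int.cast : ℤ → ℝ) * (U n).map (Int.cast : ℤ → ℝ) :=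
      Matrix.map_mul (f := Int.castRingHom ℝ)
    rw [h1, Matrix.mul_assoc, Matrix.mul_assoc, Matrix.diagonal_mul]
  -- the size of the product of the minima
  obtain ⟨C₁, hC₁, hlowB⟩ := det_lower_bound v hv hprod L hL d
  have hsumlog : ∀ n ∈ A, ∑ k, Real.log (r n k) =
      -(n * ∑ i, c i) + Real.log |Λ.det| + Real.log |(((B n).det : ℤ) : ℝ)| := by
    intro n hn
    have hb : |(((B n).det : ℤ) : ℝ)| ≠ 0 := abs_ne_zero.2 (by exact_mod_cast hBdet n hn)
    rw [← Real.log_prod (fun k _ => (hr0 n hn k).ne'), hrprod n hn, hAdet, abs_mul, abs_mul,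
      abs_of_pos (Real.exp_pos _), Real.log_mul (Real.exp_pos _).ne'
        (mul_ne_zero (abs_ne_zero.2 hΛdet) hb), Real.log_exp,
      Real.log_mul (abs_ne_zero.2 hΛdet) hb, add_assoc]
  set P : ℝ := |Real.log (|Λ.det|)| + |Real.log C₁| + |Real.log C| with hP
  have hPn : ∀ n ∈ A, |∑ k, Real.log (r n k) - n * δ| ≤ P := by
    intro n hn
    have hb : 0 < |(((B n).det : ℤ) : ℝ)| := abs_pos.2 (by exact_mod_cast hBdet n hn)
    have h1 := Real.log_le_log (by positivity) (hlowB n (B n) (hBdet n hn) (hB n hn))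
    have h2 := Real.log_le_log hb (hdet n hn)
    have hC0 : 0 < C := by
      by_contra h
      have := (hdet n hn).trans (mul_nonpos_of_nonpos_of_nonneg (not_lt.1 h) (Real.exp_pos _).le)
      linarith
    rw [Real.log_mul hC₁.ne' (Real.exp_pos _).ne', Real.log_exp] at h1
    rw [Real.log_mul hC0.ne' (Real.exp_pos _).ne', Real.log_exp] at h2
    rw [hsumlog n hn, hδ, hP, abs_le]
    constructor <;>
    linarith [neg_abs_le (Real.log |Λ.det|), neg_abs_le (Real.log C₁), neg_abs_le (Real.log C),
      le_abs_self (Real.log |Λ.det|), le_abs_self (Real.log C₁), le_abs_self (Real.log C)]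
  obtain ⟨X, hX⟩ := exists_log_bound C₀ hC₀ Λ hΛdet c δ P
  -- pass to a subsequence
  have hA₁ : (A \ {0}).Infinite := hA.sdiff (Set.finite_singleton 0)
  obtain ⟨ϖ, hϖ⟩ := hA₁.exists_infinite_fiber π
  obtain ⟨γ, hγ⟩ := hϖ.exists_cluster (fun n k => Real.log (r n k) / n) X (by
    rintro n ⟨⟨hnA, hn0⟩, -⟩ k
    refine hX n (D n) (r n) (Nat.pos_of_ne_zero hn0) (hDdet n hnA) (hr0 n hnA) (fun i k => ?_)
      (hPn n hnA) k
    rw [← hAU]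
    have := hrle n hnA ((π n).symm i) k
    rw [Equiv.apply_symm_apply] at this
    exact this.trans (mul_le_mul_of_nonneg_left (min_le_right _ _) (by linarith)))
  have hγsum : ∑ k, γ k = δ := by
    refine eq_of_abs_sub_le_all fun ε hε => ?_
    obtain ⟨n0, hn0⟩ := exists_nat_gt (P / (ε / 2))
    obtain ⟨n, ⟨⟨⟨hnA, hnz⟩, -⟩, hnγ⟩, hnn⟩ := (hγ (ε / (2 * (N + 1))) (by positivity)).exists_gt n0
    have hn' : (0 : ℝ) < n := by exact_mod_cast Nat.pos_of_ne_zero hnz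
    have h1 : |∑ k, Real.log (r n k) / n - δ| ≤ ε / 2 := by
      have h2 : ∑ k, Real.log (r n k) / n - δ = (∑ k, Real.log (r n k) - n * δ) / n := by
        rw [← Finset.sum_div]; field_simp
      rw [h2, abs_div, abs_of_pos hn', div_le_iff₀ hn']
      refine (hPn n hnA).trans ?_
      rw [div_lt_iff₀ (by positivity)] at hn0
      have : (n0 : ℝ) < n := by exact_mod_cast hnn
      nlinarith
    have h2 : |∑ k, Real.log (r n k) / n - ∑ k, γ k| ≤ ε / 2 := by
      rw [← Finset.sum_sub_distrib]
      calc |∑ k, (Real.log (r n k) / n - γ k)| ≤ ∑ k : Fin N, ε / (2 * (N + 1)) :=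
            (Finset.abs_sum_le_sum_abs _ _).trans (Finset.sum_le_sum fun k _ => (hnγ k).le)
        _ = N * (ε / (2 * (N + 1))) := by simp
        _ ≤ ε / 2 := by
            rw [mul_div_assoc', div_le_div_iff₀ (by positivity) (by positivity)]
            nlinarith
    calc |∑ k, γ k - δ| = |(∑ k, Real.log (r n k) / n - δ) -
          (∑ k, Real.log (r n k) / n - ∑ k, γ k)| := by congr 1; ring
      _ ≤ _ := abs_sub _ _
      _ ≤ ε := by linarith
  obtain ⟨p, hp, J, g, hg, hJg, hgap⟩ := exists_gap γ (by rw [hγsum]; exact hδ0)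
  let PP : Set.powersetCard (Fin N) p → Prop := fun I => ∀ a, ϖ.symm (subEmb I a) ∈ J.1
  obtain ⟨I₁, hI₁⟩ : ∃ I, PP I := by
    refine ⟨⟨J.1.map ϖ.toEmbedding, (Finset.card_map _).trans J.2⟩, fun a => ?_⟩
    have := (Set.powersetCard.mem_range_ofFinEmbEquiv_symm_iff_mem
      (⟨J.1.map ϖ.toEmbedding, (Finset.card_map _).trans J.2⟩ : Set.powersetCard (Fin N) p) _).1
      ⟨a, rfl⟩
    obtain ⟨k, hk, hk'⟩ := Finset.mem_map.1 this
    have hk'' : ϖ k = subEmb _ a := hk'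
    rw [← hk'', Equiv.symm_apply_apply]
    exact hk
  set M : ℝ := (Fintype.card (Set.powersetCard (Fin N) p) : ℝ) with hM
  have hM1 : 1 ≤ M := by
    have : Nonempty (Set.powersetCard (Fin N) p) := ⟨J⟩
    rw [hM]
    exact_mod_cast (Fintype.card_pos : 0 < Fintype.card (Set.powersetCard (Fin N) p))
  set η₁ : ℝ := g / (2 * M) with hη₁
  set η : ℝ := η₁ / (p + 1) with hη
  have hη₁0 : 0 < η₁ := by positivity
  have hη0 : 0 < η := by positivity
  have hηη : (p + 1) * η = η₁ := by rw [hη]; field_simp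
  have hηg : η ≤ g / 2 := by
    have h1 : η ≤ η₁ := div_le_self hη₁0.le (by linarith [(Nat.cast_nonneg p : (0 : ℝ) ≤ p)])
    have h2 : η₁ ≤ g / 2 := by
      rw [hη₁]; exact div_le_div_of_nonneg_left hg.le two_pos (by linarith)
    linarith
  obtain ⟨n0, hn0⟩ := exists_nat_gt (max (Real.log (p.factorial * C₀ ^ p) / η) (Real.log C₀ / (g / 2)))
  have hA₄ := (hγ η hη0).sdiff (Set.finite_le_nat n0)
  set A₄ : Set ℕ := {n | n ∈ {n | n ∈ A \ {0} ∧ π n = ϖ} ∧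
    ∀ k, |Real.log (r n k) / n - γ k| < η} \ {n | n ≤ n0} with hA₄def
  have hA₄A : ∀ n ∈ A₄, n ∈ A := fun n hn => hn.1.1.1.1
  have hA₄π : ∀ n ∈ A₄, π n = ϖ := fun n hn => hn.1.1.2
  have hA₄0 : ∀ n ∈ A₄, (0 : ℝ) < n := fun n hn => by
    exact_mod_cast Nat.pos_of_ne_zero hn.1.1.1.2
  have hA₄n : ∀ n ∈ A₄, (n0 : ℝ) < n := fun n hn => by
    have : ¬ n ≤ n0 := hn.2
    exact_mod_cast not_le.1 this
  have hpC : ∀ n ∈ A₄, p.factorial * C₀ ^ p ≤ Real.exp (n * η) := fun n hn => by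
    have h1 := (le_max_left _ _).trans_lt (hn0.trans (hA₄n n hn))
    rw [div_lt_iff₀ hη0] at h1
    exact ((Real.log_lt_iff_lt_exp (by positivity)).1 h1).le
  have hrup : ∀ n ∈ A₄, ∀ k, r n k ≤ Real.exp (n * (γ k + η)) := fun n hn k => by
    have h1 := (abs_lt.1 (hn.1.2 k)).2
    rw [sub_lt_iff_lt_add', div_lt_iff₀ (hA₄0 n hn)] at h1
    exact ((Real.log_lt_iff_lt_exp (hr0 n (hA₄A n hn) k)).1 (by linarith)).le
  have hrlo : ∀ n ∈ A₄, ∀ k ∈ J.1, C₀ < r n k := fun n hn k hk => by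
    have h1 := (abs_lt.1 (hn.1.2 k)).1
    have h3 := (le_max_right _ _).trans_lt (hn0.trans (hA₄n n hn))
    rw [div_lt_iff₀ (by positivity)] at h3
    have h2 : g / 2 < Real.log (r n k) / n := by linarith [hJg k hk]
    rw [lt_div_iff₀ (hA₄0 n hn)] at h2
    exact (Real.log_lt_log_iff (by linarith) (hr0 n (hA₄A n hn) k)).1 (by linarith)
  have hent : ∀ n ∈ A₄, ∀ i j, |(Λ * (D n).map (Int.cast : ℤ → ℝ)) i j| ≤
      C₀ * Real.exp (n * c i) * min (r n (ϖ.symm i)) (r n j) := fun n hn i j => by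
    have h1 := hrle n (hA₄A n hn) (ϖ.symm i) j
    rw [hA₄π n hn, Equiv.apply_symm_apply, hAU, abs_mul, abs_of_pos (Real.exp_pos _),
      Real.exp_neg, inv_mul_le_iff₀ (Real.exp_pos _)] at h1
    linarith
  let v' : Option S → AbsoluteValue K ℝ := fun s => s.elim (NumberField.place φ) v
  let L' : Option S → Matrix (Set.powersetCard (Fin N) p) (Set.powersetCard (Fin N) p) K :=
    fun s => s.elim (compound p Λ₀) fun s => compound p (L s)
  let c' : Option S → Set.powersetCard (Fin N) p → ℝ := fun s I => s.elim
    (∑ a, (c (subEmb I a) + γ (ϖ.symm (subEmb I a))) + η₁ - if PP I then g else 0)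
    fun s => ∑ a, d s (subEmb I a)
  have hΛ₀det : Λ₀.det ≠ 0 := by
    intro h
    have h1 : φ.mapMatrix Λ₀ = Λ.map (algebraMap ℝ ℂ) := by
      ext i j; simpa using hΛ i j
    have h2 := congrArg Matrix.det h1
    rw [← RingHom.map_det, h, map_zero] at h2
    have h3 : (Λ.map (algebraMap ℝ ℂ)).det = algebraMap ℝ ℂ Λ.det :=
      (RingHom.map_det (algebraMap ℝ ℂ) Λ).symm
    rw [h3] at h2
    exact hΛdet (by simpa using h2.symm)
  have hc' : ∑ s, ∑ I, c' s I < 0 := by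
    rw [Fintype.sum_option]
    have h1 : ∑ I, c' none I = ((N - 1).choose (p - 1) : ℝ) * (∑ i, c i + ∑ k, γ k) + g / 2 -
        ∑ I, if PP I then g else 0 := by
      simp only [c', Option.elim_none, Finset.sum_sub_distrib, Finset.sum_add_distrib]
      have h2 := sum_powersetCard_sum hp (fun i => γ (ϖ.symm i))
      rw [Equiv.sum_comp ϖ.symm γ] at h2
      rw [sum_powersetCard_sum hp c, h2, Finset.sum_const, Finset.card_univ, nsmul_eq_mul, ← hM,
        hη₁]
      field_simp
    have h2 : ∑ s, ∑ I, c' (some s) I =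
        ((N - 1).choose (p - 1) : ℝ) * ∑ s, ∑ i, d s i := by
      rw [Finset.mul_sum]
      exact Finset.sum_congr rfl fun s _ => sum_powersetCard_sum hp (d s)
    have h3 : g ≤ ∑ I, if PP I then g else 0 := by
      have := Finset.single_le_sum (f := fun I => if PP I then g else 0) (s := Finset.univ)
        (fun I _ => by split_ifs <;> linarith) (Finset.mem_univ I₁)
      simpa [hI₁] using this
    rw [h1, h2, hγsum]
    have h4 : ((N - 1).choose (p - 1) : ℝ) * (∑ i, c i + δ) +
      ((N - 1).choose (p - 1) : ℝ) * ∑ s, ∑ i, d s i = 0 := by rw [hδ]; ring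
    linarith
  have hcast : ∀ (T : Matrix (Fin N) (Fin N) K) n I J', ∑ I', compound p T I I' *
      ((compound p (D n) I' J' : ℤ) : K) = compound p (T * (D n).map (Int.cast : ℤ → K)) I J' := by
    intro T n I J'
    have h1 : compound p ((D n).map (Int.cast : ℤ → K)) = (compound p (D n)).map (Int.cast : ℤ → K) :=
      compound_map (Int.castRingHom K) p (D n)
    rw [compound_mul p T, h1, Matrix.mul_apply]
    rfl
  obtain ⟨h, hh, hinf⟩ := exists_hyperplane_of_span' v' (fun z hz => by
      rw [Fintype.prod_option]
      have h1 : v' none (z : K) = |(z : ℝ)| := by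
        change ‖φ (z : K)‖ = _
        rw [map_intCast, Complex.norm_intCast]
      rw [h1]
      exact hprod z hz) J L' (fun s => by
      cases s with
      | none => exact compound_det_ne_zero p _ hΛ₀det
      | some s => exact compound_det_ne_zero p _ (hL s)) c' hc' A₄ hA₄
    (fun n J' I => compound p (D n) I J') (fun n hn => by
      have h1 := compound_det_ne_zero p ((D n).map (Int.cast : ℤ → ℚ)) (by
        have : ((D n).map (Int.cast : ℤ → ℚ)).det = (((D n).det : ℤ) : ℚ) :=
          (Int.cast_det (D n)).symm
        rw [this]
        exact_mod_cast hDdet n (hA₄A n hn))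
      rw [show compound p ((D n).map (Int.cast : ℤ → ℚ)) =
        (compound p (D n)).map (Int.cast : ℤ → ℚ) from compound_map (Int.castRingHom ℚ) p (D n)] at h1
      exact Matrix.linearIndependent_cols_of_det_ne_zero h1) (fun n hn s I J' hJ' => by
      cases s with
      | none =>
        have h1 : v' none (∑ I', L' none I I' * ((compound p (D n) I' J' : ℤ) : K)) =
            |compound p (Λ * (D n).map (Int.cast : ℤ → ℝ)) I J'| := by
          change ‖φ (∑ I', compound p Λ₀ I I' * ((compound p (D n) I' J' : ℤ) : K))‖ = _
          rw [hcast]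
          have h2 : φ (compound p (Λ₀ * (D n).map (Int.cast : ℤ → K)) I J') =
              ((compound p (Λ * (D n).map (Int.cast : ℤ → ℝ)) I J' : ℝ) : ℂ) := by
            have h3 := congrFun (congrFun (compound_map φ p (Λ₀ * (D n).map (Int.cast : ℤ → K))) I) J'
            have h4 := congrFun (congrFun (compound_map (algebraMap ℝ ℂ) p
              (Λ * (D n).map (Int.cast : ℤ → ℝ))) I) J'
            rw [Matrix.map_apply] at h3 h4
            refine h3.symm.trans (Eq.trans ?_ h4)
            congr 2
            ext i j
            simp [Matrix.mul_apply, hΛ]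
          rw [h2, Complex.norm_real, Real.norm_eq_abs]
        rw [h1]
        have hb : ∀ X : ℝ, |compound p (Λ * (D n).map (Int.cast : ℤ → ℝ)) I J'| ≤
            (p.factorial * C₀ ^ p) * Real.exp (n * X) → X + η ≤ c' none I →
            |compound p (Λ * (D n).map (Int.cast : ℤ → ℝ)) I J'| ≤ Real.exp (n * c' none I) := by
          intro X hX' hXc
          refine hX'.trans ((mul_le_mul_of_nonneg_right (hpC n hn) (Real.exp_pos _).le).trans ?_)
          rw [← Real.exp_add, Real.exp_le_exp, ← mul_add]
          exact mul_le_mul_of_nonneg_left (by linarith) (hA₄0 n hn).le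
        by_cases hI : PP I
        · refine hb _ (compound_abs_le_exp p _ c (fun k => γ k + η) (t := n) (C₀ := C₀)
            (fun i j => (hent n hn i j).trans ?_) I J') ?_
          · exact mul_le_mul_of_nonneg_left ((min_le_right _ _).trans (hrup n hn j)) (by positivity)
          · simp only [c', Option.elim_none, if_pos hI, Finset.sum_add_distrib, Finset.sum_const,
              Finset.card_univ, Fintype.card_fin, nsmul_eq_mul]
            rw [sum_comp_eq_of_forall_mem I J ϖ.symm hI γ, sum_subEmb J' γ]
            linarith [hgap J' hJ']
        · refine hb _ (compound_abs_le_exp p _ (fun i => c i + (γ (ϖ.symm i) + η)) (fun _ => 0)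
            (t := n) (C₀ := C₀) (fun i j => (hent n hn i j).trans ?_) I J') ?_
          · rw [mul_zero, Real.exp_zero, mul_one, mul_add, Real.exp_add, ← mul_assoc]
            exact mul_le_mul_of_nonneg_left ((min_le_left _ _).trans (hrup n hn _)) (by positivity)
          · simp only [c', Option.elim_none, if_neg hI, Finset.sum_add_distrib, Finset.sum_const,
              Finset.card_univ, Fintype.card_fin, nsmul_eq_mul]
            linarith
      | some s =>
        change v s (∑ I', compound p (L s) I I' * ((compound p (D n) I' J' : ℤ) : K)) ≤
          Real.exp (n * ∑ a, d s (subEmb I a))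
        rw [hcast, Finset.mul_sum, Real.exp_sum]
        refine (v s).det_le_of_nonarch (hv s) _ _ fun a b => ?_
        rw [Matrix.submatrix_apply]
        have h1 : (L s * (D n).map (Int.cast : ℤ → K)) (subEmb I a) (subEmb J' b) =
            ∑ j, (∑ k, L s (subEmb I a) k * ((B n k j : ℤ) : K)) * ((U n j (subEmb J' b) : ℤ) : K) := by
          have h2 : (D n).map (Int.cast : ℤ → K) =
              (B n).map (Int.cast : ℤ → K) * (U n).map (Int.cast : ℤ → K) :=
            Matrix.map_mul (f := Int.castRingHom K)
          rw [h2, ← Matrix.mul_assoc, Matrix.mul_apply]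
          rfl
        rw [h1]
        refine (v s).sum_le_of_nonarch (hv s) _ _ (Real.exp_pos _).le fun j _ => ?_
        rw [(v s).map_mul]
        exact (mul_le_of_le_one_right ((v s).nonneg _) ((v s).intCast_le_one (hv s) _)).trans
          (hB n (hA₄A n hn) s _ j))
  obtain ⟨u, hu, hul⟩ := exists_linear_form_of_alternating hp h hh
  refine ⟨u, hu, hinf.mono fun n hn => ⟨hA₄A n hn.1, fun y hy => ?_⟩⟩
  have hnA := hA₄A n hn.1
  set y' : Fin N → ℤ := (U n)⁻¹.mulVec y with hy'
  have hUy : (U n).mulVec y' = y := by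
    rw [hy', Matrix.mulVec_mulVec, Matrix.mul_nonsing_inv _ (hU n hnA), Matrix.one_mulVec]
  have hDy : (D n).mulVec y' = (B n).mulVec y := by
    rw [← Matrix.mulVec_mulVec, hUy]
  rw [← hDy]
  refine hul J (D n) (hDdet n hnA) hn.2 y' fun k hk => ?_
  by_contra hyk
  have h1 := hrlow n hnA y' k hyk
  have h2 : ‖(An n * (U n).map (Int.cast : ℤ → ℝ)).mulVec (fun j => (y' j : ℝ))‖ ≤ 1 := by
    refine (pi_norm_le_iff_of_nonneg zero_le_one).2 fun i => ?_
    have h3 : (An n * (U n).map (Int.cast : ℤ → ℝ)).mulVec (fun j => (y' j : ℝ)) i =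
        Real.exp (-(n * c i)) * ∑ j, Λ i j * (((B n).mulVec y j : ℤ) : ℝ) := by
      have h4 : ∀ T : Matrix (Fin N) (Fin N) ℤ, ∀ z : Fin N → ℤ,
          (T.map (Int.cast : ℤ → ℝ)).mulVec (fun j => (z j : ℝ)) =
            fun i => ((T.mulVec z i : ℤ) : ℝ) := fun T z => by
        ext i
        simp [Matrix.mulVec, dotProduct]
      rw [← Matrix.mulVec_mulVec, h4, hUy, ← Matrix.mulVec_mulVec, ← Matrix.mulVec_mulVec, h4,
        Matrix.mulVec_diagonal]
      rfl
    rw [h3, Real.norm_eq_abs, abs_mul, abs_of_pos (Real.exp_pos _), Real.exp_neg,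
      inv_mul_le_iff₀ (Real.exp_pos _), mul_one]
    exact hy i
  have h3 := hrlo n hn.1 k hk
  have h4 : r n k ≤ C₀ := h1.trans (mul_le_of_le_one_right (by linarith) h2)
  linarith

/-- A version of `exists_form_of_lattice_points` for arbitrary index types. -/
theorem exists_form_of_lattice_points' {K : Type*} [Field K] [NumberField K] (φ : K →+* ℂ)
    {S : Type} [Fintype S] (v : S → AbsoluteValue K ℝ) (hv : ∀ s, IsNonarchimedean (v s))
    (hprod : ∀ z : ℤ, z ≠ 0 → 1 ≤ |(z : ℝ)| * ∏ s, v s (z : K))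
    {R ι : Type*} [Fintype R] [Fintype ι] [DecidableEq ι] (hcard : Fintype.card R = Fintype.card ι)
    (Λ₀ : R → ι → K) (Λ : R → ι → ℝ) (hΛ : ∀ i j, φ (Λ₀ i j) = (Λ i j : ℂ))
    (hΛinj : ∀ y : ι → K, (∀ i, ∑ k, Λ₀ i k * y k = 0) → y = 0)
    (L : S → R → ι → K) (hL : ∀ s, ∀ y : ι → K, (∀ i, ∑ k, L s i k * y k = 0) → y = 0)
    (c : R → ℝ) (d : S → R → ℝ) (hc : ∑ i, c i + ∑ s, ∑ i, d s i < 0) (A : Set ℕ)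
    (hA : A.Infinite)
    (B : ℕ → Matrix ι ι ℤ) (hBdet : ∀ n ∈ A, (B n).det ≠ 0)
    (hB : ∀ n ∈ A, ∀ s i j, v s (∑ k, L s i k * (B n k j : ℤ)) ≤ Real.exp (n * d s i))
    (C : ℝ) (hdet : ∀ n ∈ A, |(((B n).det : ℤ) : ℝ)| ≤ C * Real.exp (-(n * ∑ s, ∑ i, d s i))) :
    ∃ u : ι → ℤ, u ≠ 0 ∧ {n | n ∈ A ∧ ∀ y : ι → ℤ,
      (∀ i, |∑ j, Λ i j * ((B n).mulVec y j : ℤ)| ≤ Real.exp (n * c i)) →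
      ∑ i, u i * (B n).mulVec y i = 0}.Infinite := by
  let e : Fin (Fintype.card ι) ≃ ι := (Fintype.equivFin ι).symm
  let f : Fin (Fintype.card ι) ≃ R := (Fintype.equivFinOfCardEq hcard).symm
  have hdet0 : ∀ M : R → ι → K, (∀ y : ι → K, (∀ i, ∑ k, M i k * y k = 0) → y = 0) →
      (Matrix.of fun i j => M (f i) (e j)).det ≠ 0 := by
    intro M hM hd
    obtain ⟨w, hw, hMw⟩ := Matrix.exists_mulVec_eq_zero_iff.2 hd
    refine hw ?_
    have h1 := hM (fun k => w (e.symm k)) fun i => by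
      have := congrFun hMw (f.symm i)
      rw [← Equiv.sum_comp e]
      simpa [Matrix.mulVec, dotProduct] using this
    ext k
    simpa using congrFun h1 (e k)
  have hΛdet : (Matrix.of fun i j => Λ (f i) (e j)).det ≠ 0 := by
    intro h
    have h1 : φ.mapMatrix (Matrix.of fun i j => Λ₀ (f i) (e j)) =
        (Matrix.of fun i j => Λ (f i) (e j)).map (algebraMap ℝ ℂ) := by
      ext i j; simpa using hΛ (f i) (e j)
    have h2 := congrArg Matrix.det h1
    have h3 : ((Matrix.of fun i j => Λ (f i) (e j)).map (algebraMap ℝ ℂ)).det =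
      algebraMap ℝ ℂ (Matrix.of fun i j => Λ (f i) (e j)).det :=
      (RingHom.map_det (algebraMap ℝ ℂ) _).symm
    rw [h3, h, map_zero, ← RingHom.map_det] at h2
    exact hdet0 Λ₀ hΛinj ((map_eq_zero φ).1 h2)
  have hsub : ∀ n, ((B n).submatrix e e).det = (B n).det := fun n =>
    Matrix.det_submatrix_equiv_self e (B n)
  have hds : ∀ s, ∑ i, d s (f i) = ∑ i, d s i := fun s => Equiv.sum_comp f (d s)
  have hmv : ∀ n y j, ((B n).submatrix e e).mulVec y j = (B n).mulVec (fun k => y (e.symm k)) (e j) := by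
    intro n y j
    rw [Matrix.submatrix_mulVec_equiv]
    rfl
  obtain ⟨u, hu, hinf⟩ := exists_form_of_lattice_points φ v hv hprod
    (Matrix.of fun i j => Λ₀ (f i) (e j)) (Matrix.of fun i j => Λ (f i) (e j))
    (fun i j => hΛ _ _) hΛdet (fun s => Matrix.of fun i j => L s (f i) (e j))
    (fun s => hdet0 _ (hL s)) (fun i => c (f i)) (fun s i => d s (f i))
    (by simpa only [hds, Equiv.sum_comp f c] using hc) A hA (fun n => (B n).submatrix e e)
    (fun n hn => by rw [hsub]; exact hBdet n hn)
    (fun n hn s i j => by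
      have := hB n hn s (f i) (e j)
      rw [← Equiv.sum_comp e] at this
      exact this) C (fun n hn => by simpa only [hsub, hds] using hdet n hn)
  refine ⟨fun k => u (e.symm k), fun h => hu ?_, hinf.mono fun n hn => ⟨hn.1, fun y hy => ?_⟩⟩
  · ext k
    simpa using congrFun h (e k)
  · have := hn.2 (fun k => y (e k)) fun i => by
      have := hy (f i)
      rw [← Equiv.sum_comp e] at this
      simpa [hmv] using this
    rw [← Equiv.sum_comp e]
    simpa [hmv] using this

/-- The extension of the `p`-adic absolute value to a number field. -/
lemma exists_padic_abs (K : Type*) [Field K] [NumberField K] (p : ℕ) [Fact p.Prime] :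
    ∃ v : AbsoluteValue K ℝ, IsNonarchimedean v ∧
      ∀ z : ℤ, z ≠ 0 → v (z : K) = ((p ^ z.natAbs.factorization p : ℕ) : ℝ)⁻¹ := by
  let ψ : K →ₐ[ℚ] PadicAlgCl p := IsAlgClosed.lift
  refine ⟨(NormedField.toAbsoluteValue (PadicAlgCl p)).comp ψ.toRingHom.injective, fun x y => ?_,
    fun z hz => ?_⟩
  · change ‖ψ (x + y)‖ ≤ max ‖ψ x‖ ‖ψ y‖
    rw [map_add]
    exact PadicAlgCl.isNonarchimedean p _ _
  · change ‖ψ (z : K)‖ = _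
    have h1 : ψ (z : K) = ((z : ℚ_[p]) : PadicAlgCl p) := by rw [map_intCast, map_intCast]
    have hp := (Fact.out : p.Prime)
    rw [h1, PadicAlgCl.norm_extends, Padic.norm_eq_zpow_neg_valuation (by exact_mod_cast hz),
      Padic.valuation_intCast, zpow_neg, zpow_natCast, Nat.factorization_def _ hp]
    push_cast
    rfl

/-- Finitely many non-archimedean absolute values which balance a given integer. -/
lemma exists_abs_family (K : Type*) [Field K] [NumberField K] (z₀ : ℤ) (hz₀ : z₀ ≠ 0) :
    ∃ (S : Type) (_ : Fintype S) (v : S → AbsoluteValue K ℝ), (∀ s, IsNonarchimedean (v s)) ∧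
      (∀ z : ℤ, z ≠ 0 → 1 ≤ |(z : ℝ)| * ∏ s, v s (z : K)) ∧
      |(z₀ : ℝ)| * ∏ s, v s (z₀ : K) = 1 := by
  classical
  let T := z₀.natAbs.primeFactors
  have hfact : ∀ p : T, Fact (p : ℕ).Prime := fun p => ⟨Nat.prime_of_mem_primeFactors p.2⟩
  choose v hv hvz using fun p : T => (exists_padic_abs K p)
  have hval : ∀ z : ℤ, z ≠ 0 → ∏ p : T, v p (z : K) =
      ((∏ p ∈ T, p ^ z.natAbs.factorization p : ℕ) : ℝ)⁻¹ := by
    intro z hz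
    rw [Finset.prod_congr rfl fun p _ => hvz p z hz, Finset.prod_inv_distrib, Nat.cast_prod]
    congr 1
    exact Finset.prod_coe_sort T fun p => ((p ^ z.natAbs.factorization p : ℕ) : ℝ)
  have habs : ∀ z : ℤ, |(z : ℝ)| = ((z.natAbs : ℕ) : ℝ) := fun z => by
    rw [← Int.cast_abs, Int.abs_eq_natAbs]; rfl
  refine ⟨T, inferInstance, v, hv, fun z hz => ?_, ?_⟩
  · have hle : ∏ p ∈ T, p ^ z.natAbs.factorization p ≤ z.natAbs := by
      conv_rhs => rw [← Nat.prod_factorization_pow_eq_self (Int.natAbs_ne_zero.2 hz)]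
      rw [Finsupp.prod, Nat.support_factorization]
      have h1 : ∏ p ∈ T, p ^ z.natAbs.factorization p =
          ∏ p ∈ T ∩ z.natAbs.primeFactors, p ^ z.natAbs.factorization p := by
        refine (Finset.prod_subset Finset.inter_subset_left fun p hp hpn => ?_).symm
        have : p ∉ z.natAbs.primeFactors := fun h => hpn (Finset.mem_inter.2 ⟨hp, h⟩)
        rw [← Nat.support_factorization, Finsupp.notMem_support_iff] at this
        rw [this, pow_zero]
      rw [h1]
      exact Finset.prod_le_prod_of_subset_of_one_le' Finset.inter_subset_right fun p hp _ =>
        Nat.one_le_pow _ _ (Nat.prime_of_mem_primeFactors hp).pos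
    have hpos : 0 < ∏ p ∈ T, p ^ z.natAbs.factorization p :=
      Finset.prod_pos fun p hp => pow_pos (Nat.prime_of_mem_primeFactors hp).pos _
    rw [hval z hz, habs, ← div_eq_mul_inv, one_le_div (by exact_mod_cast hpos)]
    exact_mod_cast hle
  · have h1 : ∏ p ∈ T, p ^ z₀.natAbs.factorization p = z₀.natAbs :=
      Nat.prod_factorization_pow_eq_self (Int.natAbs_ne_zero.2 hz₀)
    rw [hval z₀ hz₀, habs, h1, mul_inv_cancel₀]
    exact_mod_cast Int.natAbs_ne_zero.2 hz₀

end

noncomputable section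

open NumberField

lemma eq_zero_of_conj_sums {K : Type*} [Field K] [NumberField K] [IsGalois ℚ K]
    {β : Type*} [Fintype β] [DecidableEq β] (e : Module.Basis β ℚ K) (y : β → K)
    (h : ∀ σ : K ≃ₐ[ℚ] K, ∑ l, σ (e l) * y l = 0) : y = 0 := by
  ext k
  let e' := (Algebra.traceForm ℚ K).dualBasis (traceForm_nondegenerate ℚ K) e
  have h1 : ∑ σ : K ≃ₐ[ℚ] K, σ (e' k) * ∑ l, σ (e l) * y l = 0 :=
    Finset.sum_eq_zero fun σ _ => by rw [h σ, mul_zero]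
  have h2 : ∑ σ : K ≃ₐ[ℚ] K, σ (e' k) * ∑ l, σ (e l) * y l =
      ∑ l, algebraMap ℚ K (Algebra.trace ℚ K (e' k * e l)) * y l := by
    simp only [trace_eq_sum_automorphisms, Finset.mul_sum, Finset.sum_mul, map_mul]
    rw [Finset.sum_comm]
    exact Finset.sum_congr rfl fun l _ => Finset.sum_congr rfl fun σ _ => by ring
  have h3 : ∀ l, Algebra.trace ℚ K (e' k * e l) = if l = k then 1 else 0 := fun l =>
    LinearMap.BilinForm.apply_dualBasis_left (traceForm_nondegenerate ℚ K) e k l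
  rw [h2] at h1
  simpa [h3] using h1

/-- A rational linear relation between all multiples gives a relation over the field. -/
lemma exists_relation_of_coord_relation {K : Type*} [Field K] [NumberField K]
    {β I : Type*} [Fintype β] [DecidableEq β] [Fintype I] (e : Module.Basis β ℚ K)
    (u : β × I → ℚ) (hu : u ≠ 0) :
    ∃ η : I → K, η ≠ 0 ∧ ∀ x : I → K, (∀ l, ∑ q : β × I, u q * e.repr (x q.2 * e l) q.1 = 0) →
      ∑ k, η k * x k = 0 := by
  let e' := (Algebra.traceForm ℚ K).dualBasis (traceForm_nondegenerate ℚ K) e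
  let η : I → K := fun k => ∑ l, u (l, k) • e' l
  have htr : ∀ k x, Algebra.trace ℚ K (η k * x) = ∑ l, u (l, k) * e.repr x l := by
    intro k x
    simp only [η, Finset.sum_mul, map_sum, smul_mul_assoc, map_smul, smul_eq_mul]
    refine Finset.sum_congr rfl fun l _ => ?_
    congr 1
    conv_lhs => rw [← e.sum_repr x]
    rw [Finset.mul_sum, map_sum]
    have h3 : ∀ l', Algebra.trace ℚ K (e' l * e l') = if l' = l then 1 else 0 := fun l' =>
      LinearMap.BilinForm.apply_dualBasis_left (traceForm_nondegenerate ℚ K) e l l'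
    simp [h3]
  refine ⟨η, fun h => hu ?_, fun x hx => ?_⟩
  · ext ⟨l, k⟩
    have := htr k (e l)
    rw [h] at this
    simpa [Finsupp.single_apply] using this.symm
  · have h1 : ∀ l, Algebra.trace ℚ K ((∑ k, η k * x k) * e l) = 0 := fun l => by
      rw [← hx l, Fintype.sum_prod_type_right, Finset.sum_mul, map_sum]
      refine Finset.sum_congr rfl fun k _ => ?_
      rw [mul_assoc, htr]
    have h2 : ∀ z, Algebra.traceForm ℚ K (∑ k, η k * x k) z = 0 := by
      have : Algebra.traceForm ℚ K (∑ k, η k * x k) = 0 := e.ext fun l => by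
        rw [Algebra.traceForm_apply, h1]; rfl
      intro z; rw [this]; rfl
    exact (traceForm_nondegenerate ℚ K).1 _ h2

lemma AbsoluteValue.le_one_of_isIntegral {K : Type*} [Field K] (v : AbsoluteValue K ℝ)
    (hv : IsNonarchimedean v) {x : K} (hx : IsIntegral ℤ x) : v x ≤ 1 := by
  obtain ⟨P, hP, hPx⟩ := hx
  by_contra! h
  have h0 : P.natDegree ≠ 0 := fun h0 => by
    rw [hP.natDegree_eq_zero.1 h0] at hPx
    simp at hPx
  rw [hP.as_sum, Polynomial.eval₂_add, Polynomial.eval₂_X_pow, Polynomial.eval₂_finsetSum,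
    add_eq_zero_iff_eq_neg] at hPx
  have h1 := congrArg v hPx
  rw [v.map_neg, map_pow] at h1
  have h2 : v x ^ P.natDegree ≤ v x ^ (P.natDegree - 1) := by
    rw [h1]
    refine v.sum_le_of_nonarch hv _ _ (by positivity) fun i hi => ?_
    rw [Polynomial.eval₂_mul, Polynomial.eval₂_C, Polynomial.eval₂_X_pow, v.map_mul, map_pow]
    refine (mul_le_of_le_one_left (by positivity) (v.intCast_le_one hv _)).trans ?_
    exact pow_le_pow_right₀ h.le (by have := Finset.mem_range.1 hi; omega)
  exact absurd h2 (not_le.2 (pow_lt_pow_right₀ h (by omega)))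

/-- The subspace theorem for points with coordinates `g k ^ n * x n k`, with arbitrary linear forms
at the archimedean places and the coordinate forms at the other places. -/
theorem exists_relation_of_small_forms {K : Type*} [Field K] [NumberField K] [IsGalois ℚ K]
    (φ : K →+* ℂ) (j : K) (hj : φ j = Complex.I) (ρ : K ≃ₐ[ℚ] K)
    (hρ : ∀ x, φ (ρ x) = starRingEnd ℂ (φ x)) {I : Type*} [Fintype I] [DecidableEq I]
    (g : I → 𝓞 K) (hg : ∀ k, g k ≠ 0) (A : (K ≃ₐ[ℚ] K) → Matrix I I K)
    (hA : ∀ τ, (A τ).det ≠ 0) (hAρ : ∀ τ, A (ρ * τ) = A τ) (c : (K ≃ₐ[ℚ] K) → I → ℝ)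
    (hc : ∑ τ, ∑ i, c τ i < ∑ τ : K ≃ₐ[ℚ] K, ∑ i, Real.log ‖φ (τ (g i))‖)
    (T : Set ℕ) (hT : T.Infinite) (x : ℕ → I → 𝓞 K)
    (hx : ∀ n ∈ T, ∀ τ i, ‖φ (τ (∑ k, A τ i k * ((g k : K) ^ n * x n k)))‖ ≤
      Real.exp (n * c τ i)) :
    ∃ η : I → K, η ≠ 0 ∧ {n | n ∈ T ∧ ∑ k, η k * ((g k : K) ^ n * x n k) = 0}.Infinite := by
  classical
  let b := RingOfIntegers.basis K
  let β := Module.Free.ChooseBasisIndex ℤ (𝓞 K)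
  let e : Module.Basis β ℚ K := integralBasis K
  have he : ∀ l, e l = (b l : K) := fun l => integralBasis_apply K l
  have hrepr : ∀ (a : 𝓞 K) l, e.repr (a : K) l = ((b.repr a l : ℤ) : ℚ) := fun a l =>
    integralBasis_repr_apply K a l
  have hbsum : ∀ a : 𝓞 K, ∑ l, ((b.repr a l : ℤ) : K) * e l = a := fun a => by
    conv_rhs => rw [← b.sum_repr a]
    simp [he]
  let z₀ : ℤ := ∏ k, Algebra.norm ℤ (g k)
  have hz₀ : z₀ ≠ 0 := Finset.prod_ne_zero_iff.2 fun k _ => Algebra.norm_ne_zero_iff.2 (hg k)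
  have hz₀K : (z₀ : K) = ∏ τ : K ≃ₐ[ℚ] K, ∏ k, τ (g k) := by
    rw [Finset.prod_comm]
    simp only [z₀, Int.cast_prod]
    refine Finset.prod_congr rfl fun k _ => ?_
    rw [← Algebra.norm_eq_prod_automorphisms, ← Algebra.coe_norm_int]
    simp
  have hgK : ∀ (τ : K ≃ₐ[ℚ] K) k, τ (g k) ≠ 0 := fun τ k => by
    simpa using hg k
  have hz₀log : Real.log |(z₀ : ℝ)| = ∑ τ : K ≃ₐ[ℚ] K, ∑ i, Real.log ‖φ (τ (g i))‖ := by
    have h1 : |(z₀ : ℝ)| = ‖φ (z₀ : K)‖ := by rw [map_intCast, Complex.norm_intCast]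
    rw [h1, hz₀K, map_prod, norm_prod, Real.log_prod fun τ _ => ?_]
    · refine Finset.sum_congr rfl fun τ _ => ?_
      rw [map_prod, norm_prod, Real.log_prod fun k _ => ?_]
      simpa using hgK τ k
    · rw [norm_ne_zero_iff, map_ne_zero]
      exact Finset.prod_ne_zero_iff.2 fun k _ => hgK τ k
  obtain ⟨S, _, v, hv, hprod, hbal⟩ := exists_abs_family K z₀ hz₀
  let d : S → (K ≃ₐ[ℚ] K) × I → ℝ := fun s q => Real.log (v s (q.1 (g q.2)))
  have hd : ∑ s, ∑ q, d s q = -Real.log |(z₀ : ℝ)| := by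
    have h1 : ∀ s, ∑ q, d s q = Real.log (v s (z₀ : K)) := fun s => by
      rw [hz₀K, Fintype.sum_prod_type, map_prod, Real.log_prod fun τ _ => ?_]
      · refine Finset.sum_congr rfl fun τ _ => ?_
        rw [map_prod, Real.log_prod fun k _ => ?_]
        exact (v s).ne_zero (hgK τ k)
      · exact (v s).ne_zero (Finset.prod_ne_zero_iff.2 fun k _ => hgK τ k)
    have hz : (z₀ : K) ≠ 0 := by exact_mod_cast hz₀
    have h2 : ∏ s, v s (z₀ : K) ≠ 0 := Finset.prod_ne_zero_iff.2 fun s _ => (v s).ne_zero hz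
    rw [Finset.sum_congr rfl fun s _ => h1 s, ← Real.log_prod fun s _ => (v s).ne_zero hz]
    have h3 := congrArg Real.log hbal
    rw [Real.log_mul (by simpa using hz₀) h2, Real.log_one] at h3
    linarith
  have hcard : Fintype.card ((K ≃ₐ[ℚ] K) × I) = Fintype.card (β × I) := by
    rw [Fintype.card_prod, Fintype.card_prod, ← Nat.card_eq_fintype_card,
      IsGalois.card_aut_eq_finrank, Module.finrank_eq_card_basis e]
  let B : ℕ → Matrix (β × I) (β × I) ℤ := fun n =>
    Matrix.blockDiagonal fun k => Algebra.leftMulMatrix b (g k ^ n)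
  have hBdet : ∀ n, (B n).det = z₀ ^ n := fun n => by
    rw [Matrix.det_blockDiagonal]
    simp only [z₀, ← Finset.prod_pow]
    refine Finset.prod_congr rfl fun k _ => ?_
    rw [← Algebra.norm_eq_matrix_det, map_pow]
  let w : (K ≃ₐ[ℚ] K) → I → β × I → K := fun τ i q => τ (A τ i q.2 * e q.1)
  let Λ₀ : (K ≃ₐ[ℚ] K) × I → β × I → K := fun p q =>
    (1 - j) / 2 * w p.1 p.2 q + (1 + j) / 2 * ρ (w p.1 p.2 q)
  let Λ : (K ≃ₐ[ℚ] K) × I → β × I → ℝ := fun p q => (φ (w p.1 p.2 q)).re + (φ (w p.1 p.2 q)).im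
  have hΛ : ∀ p q, φ (Λ₀ p q) = (Λ p q : ℂ) := fun p q => by
    simp only [Λ₀, Λ, map_add, map_mul, map_div₀, map_sub, map_one, hj, hρ, map_ofNat]
    apply Complex.ext <;> simp <;> ring
  have hsumZ : ∀ (τ : K ≃ₐ[ℚ] K) i (y : β × I → K), ∑ q, w τ i q * y q =
      ∑ k, τ (A τ i k) * ∑ l, τ (e l) * y (l, k) := fun τ i y => by
    rw [Fintype.sum_prod_type_right]
    refine Finset.sum_congr rfl fun k _ => ?_
    rw [Finset.mul_sum]
    refine Finset.sum_congr rfl fun l _ => ?_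
    simp only [w, map_mul, mul_assoc]
  have hφinj := φ.injective
  have hjj : j * j = -1 := hφinj (by rw [map_mul, hj, map_neg, map_one, Complex.I_mul_I])
  have hρρ : ∀ a, ρ (ρ a) = a := fun a => hφinj (by rw [hρ, hρ, Complex.conj_conj])
  have hwρ : ∀ τ i q, ρ (w τ i q) = w (ρ * τ) i q := fun τ i q => by
    simp only [w, hAρ]; rfl
  have hΛinj : ∀ y : β × I → K, (∀ p, ∑ q, Λ₀ p q * y q = 0) → y = 0 := by
    intro y hy
    have hZ : ∀ τ i, ∑ q, w τ i q * y q = 0 := by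
      intro τ i
      have h1 : ∀ τ, (1 - j) / 2 * ∑ q, w τ i q * y q + (1 + j) / 2 * ∑ q, w (ρ * τ) i q * y q = 0 := by
        intro τ
        rw [← hy (τ, i), Finset.mul_sum, Finset.mul_sum, ← Finset.sum_add_distrib]
        refine Finset.sum_congr rfl fun q _ => ?_
        simp only [Λ₀, hwρ]
        ring
      have h2 := h1 τ
      have h3 := h1 (ρ * τ)
      have h4 : ρ * (ρ * τ) = τ := by ext a; simp [hρρ]
      rw [h4] at h3
      have hj0 : j ≠ 0 := fun h => by simp [h] at hjj
      have h5 : (2 * j) * ∑ q, w τ i q * y q = 0 := by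
        linear_combination (-(1 - j)) * h2 + (1 + j) * h3
      exact (mul_eq_zero.1 h5).resolve_left (mul_ne_zero two_ne_zero hj0)
    have hY : ∀ (τ : K ≃ₐ[ℚ] K) k, ∑ l, τ (e l) * y (l, k) = 0 := by
      intro τ
      by_contra hne
      push Not at hne
      obtain ⟨k, hk⟩ := hne
      have h1 : (τ.toRingHom.mapMatrix (A τ)).det ≠ 0 := by
        rw [← RingHom.map_det]
        simpa using hA τ
      refine h1 (Matrix.exists_mulVec_eq_zero_iff.1 ⟨fun k => ∑ l, τ (e l) * y (l, k), fun h =>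
        hk (congrFun h k), ?_⟩)
      ext i
      exact (hsumZ τ i y).symm.trans (hZ τ i)
    ext ⟨l, k⟩
    exact congrFun (eq_zero_of_conj_sums e (fun l => y (l, k)) fun σ => hY σ k) l
  let L : S → (K ≃ₐ[ℚ] K) × I → β × I → K := fun _ p q => if q.2 = p.2 then p.1 (e q.1) else 0
  have hLsum : ∀ s p (y : β × I → K), ∑ q, L s p q * y q = ∑ l, p.1 (e l) * y (l, p.2) := by
    intro s p y
    rw [Fintype.sum_prod_type]
    refine Finset.sum_congr rfl fun l _ => ?_
    simp [L]
  have hL : ∀ s, ∀ y : β × I → K, (∀ p, ∑ q, L s p q * y q = 0) → y = 0 := by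
    intro s y hy
    ext ⟨l, k⟩
    exact congrFun (eq_zero_of_conj_sums e (fun l => y (l, k)) fun σ => by
      rw [← hy (σ, k), hLsum s]) l
  set gap : ℝ := ∑ τ : K ≃ₐ[ℚ] K, ∑ i, Real.log ‖φ (τ (g i))‖ - ∑ τ, ∑ i, c τ i with hgap
  have hgap0 : 0 < gap := by linarith
  set δ : ℝ := gap / (2 * (Fintype.card ((K ≃ₐ[ℚ] K) × I) + 1)) with hδ
  have hδ0 : 0 < δ := by positivity
  let c' : (K ≃ₐ[ℚ] K) × I → ℝ := fun p => c p.1 p.2 + δ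
  have hc' : ∑ p, c' p + ∑ s, ∑ q, d s q < 0 := by
    rw [hd, hz₀log]
    simp only [c', Finset.sum_add_distrib, Finset.sum_const, Finset.card_univ, nsmul_eq_mul]
    rw [Fintype.sum_prod_type]
    have : Fintype.card ((K ≃ₐ[ℚ] K) × I) * δ < gap := by
      rw [hδ, mul_div_assoc', div_lt_iff₀ (by positivity)]
      nlinarith [(Nat.cast_nonneg _ : (0 : ℝ) ≤ Fintype.card ((K ≃ₐ[ℚ] K) × I))]
    linarith
  obtain ⟨E, hE⟩ := Finite.exists_le fun p : (K ≃ₐ[ℚ] K) × β => ‖φ (p.1 (e p.2))‖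
  obtain ⟨n0, hn0⟩ := exists_nat_gt (Real.log (2 * max E 1) / δ)
  have hT' := hT.sdiff (Set.finite_le_nat n0)
  have hlarge : ∀ n ∈ T \ {n | n ≤ n0}, 2 * max E 1 ≤ Real.exp (n * δ) := fun n hn => by
    have h1 : n0 < n := not_le.1 hn.2
    have h2 := hn0.trans (by exact_mod_cast h1 : (n0 : ℝ) < n)
    rw [div_lt_iff₀ hδ0] at h2
    exact ((Real.log_lt_iff_lt_exp (by positivity)).1 h2).le
  have hBcol : ∀ n s p (q : β × I), ∑ r, L s p r * ((B n r q : ℤ) : K) =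
      if p.2 = q.2 then p.1 ((g q.2 : K) ^ n * e q.1) else 0 := by
    intro n s p q
    rw [hLsum s]
    by_cases h : p.2 = q.2
    · rw [if_pos h]
      have h1 : ∀ l, B n (l, p.2) q = b.repr (g q.2 ^ n * b q.1) l := fun l => by
        simp only [B, Matrix.blockDiagonal_apply, Algebra.leftMulMatrix_eq_repr_mul, h,
          if_true]
      simp only [h1]
      have h2 := congrArg p.1 (hbsum (g q.2 ^ n * b q.1))
      rw [map_sum] at h2
      rw [he q.1]
      rw [show (g q.2 : K) ^ n * (b q.1 : K) = ((g q.2 ^ n * b q.1 : 𝓞 K) : K) by push_cast; rfl, ← h2]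
      refine Finset.sum_congr rfl fun l _ => ?_
      rw [map_mul p.1, map_intCast, mul_comm]
    · rw [if_neg h]
      refine Finset.sum_eq_zero fun l _ => ?_
      simp [B, Matrix.blockDiagonal_apply, h]
  have hvint : ∀ s (τ : K ≃ₐ[ℚ] K) l, v s (τ (e l)) ≤ 1 := fun s τ l => by
    refine (v s).le_one_of_isIntegral (hv s) ?_
    rw [he]
    exact (b l).isIntegral_coe.map (τ.toAlgHom.restrictScalars ℤ)
  obtain ⟨u, hu, hinf⟩ := exists_form_of_lattice_points' φ v hv hprod hcard Λ₀ Λ hΛ hΛinj L hL c' d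
    hc' _ hT' B (fun n _ => by rw [hBdet]; exact pow_ne_zero _ hz₀)
    (fun n _ s p q => by
      rw [hBcol n s]
      split_ifs with h
      · rw [map_mul, map_pow, (v s).map_mul, map_pow, ← h]
        refine (mul_le_of_le_one_right (pow_nonneg ((v s).nonneg _) _) (hvint s _ _)).trans_eq ?_
        rw [Real.exp_nat_mul, Real.exp_log ((v s).pos (hgK _ _))]
      · rw [(v s).map_zero]; exact (Real.exp_pos _).le) 1
    (fun n _ => by
      rw [hBdet, hd, mul_neg, neg_neg, one_mul, Real.exp_nat_mul,
        Real.exp_log (abs_pos.2 (by exact_mod_cast hz₀)), Int.cast_pow, abs_pow])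
  obtain ⟨η, hη, hηx⟩ := exists_relation_of_coord_relation e (fun q => (u q : ℚ)) fun h => hu (by
    ext q; simpa using congrFun h q)
  refine ⟨η, hη, hinf.mono fun n hn => ⟨hn.1.1, hηx _ fun l => ?_⟩⟩
  let y : β × I → ℤ := fun q => b.repr (x n q.2 * b l) q.1
  have hBy : ∀ q, (B n).mulVec y q = b.repr (g q.2 ^ n * (x n q.2 * b l)) q.1 := by
    intro q
    have h1 := congrFun (Algebra.leftMulMatrix_mulVec_repr b (g q.2 ^ n) (x n q.2 * b l)) q.1
    rw [← h1]
    simp only [Matrix.mulVec, dotProduct, B, y]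
    rw [Fintype.sum_prod_type]
    refine Finset.sum_congr rfl fun l' _ => ?_
    simp [Matrix.blockDiagonal_apply, Finset.sum_ite_eq, ite_mul]
  have hBy' : ∀ q : β × I, (((B n).mulVec y q : ℤ) : ℚ) =
      e.repr ((g q.2 : K) ^ n * (x n q.2 : K) * e l) q.1 := fun q => by
    rw [hBy, ← hrepr]
    congr 2
    push_cast
    rw [he]; ring
  have h1 := hn.2 y fun p => by
    have hW : ∑ q, w p.1 p.2 q * (((B n).mulVec y q : ℤ) : K) =
        p.1 (∑ k, A p.1 p.2 k * ((g k : K) ^ n * x n k)) * p.1 (e l) := by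
      rw [hsumZ, map_sum, Finset.sum_mul]
      refine Finset.sum_congr rfl fun k _ => ?_
      rw [map_mul, mul_assoc, ← map_mul]
      congr 1
      have h2 := congrArg p.1 (hbsum (g k ^ n * (x n k * b l)))
      rw [map_sum] at h2
      rw [he l]
      rw [show (g k : K) ^ n * (x n k : K) * (b l : K) = ((g k ^ n * (x n k * b l) : 𝓞 K) : K) by
        push_cast; ring, ← h2]
      refine Finset.sum_congr rfl fun l' _ => ?_
      rw [map_mul p.1, map_intCast, mul_comm, hBy]
    have hre : ∑ q, Λ p q * (((B n).mulVec y q : ℤ) : ℝ) =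
        (φ (∑ q, w p.1 p.2 q * (((B n).mulVec y q : ℤ) : K))).re +
        (φ (∑ q, w p.1 p.2 q * (((B n).mulVec y q : ℤ) : K))).im := by
      rw [map_sum, Complex.re_sum, Complex.im_sum, ← Finset.sum_add_distrib]
      refine Finset.sum_congr rfl fun q _ => ?_
      simp [Λ]
      ring
    rw [hre, hW, map_mul]
    set Z := φ (p.1 (∑ k, A p.1 p.2 k * ((g k : K) ^ n * x n k))) * φ (p.1 (e l)) with hZ
    have hZn : ‖Z‖ ≤ Real.exp (n * c p.1 p.2) * max E 1 := by
      rw [hZ, norm_mul]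
      exact mul_le_mul (hx n hn.1.1 _ _) ((hE (p.1, l)).trans (le_max_left _ _)) (norm_nonneg _)
        (Real.exp_pos _).le
    calc |Z.re + Z.im| ≤ |Z.re| + |Z.im| := abs_add_le _ _
      _ ≤ ‖Z‖ + ‖Z‖ := add_le_add (Complex.abs_re_le_norm _) (Complex.abs_im_le_norm _)
      _ ≤ Real.exp (n * c p.1 p.2) * (2 * max E 1) := by linarith
      _ ≤ Real.exp (n * c p.1 p.2) * Real.exp (n * δ) :=
        mul_le_mul_of_nonneg_left (hlarge n hn.1) (Real.exp_pos _).le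
      _ = Real.exp (n * c' p) := by rw [← Real.exp_add, ← mul_add]
  have h2 := congrArg (Int.cast : ℤ → ℚ) h1
  push_cast at h2
  rw [← h2]
  exact Finset.sum_congr rfl fun q _ => by rw [← hBy']

end

noncomputable section

open Polynomial

lemma padicNorm_pow_div_factorial_le (p : ℕ) [hp : Fact p.Prime] (hp2 : 2 < p) (b : ℤ) (k j : ℕ)
    (hj : 2 * k ≤ j) : padicNorm p ((p : ℚ) ^ j * b / j.factorial) ≤ ((p : ℚ)⁻¹) ^ k := by
  have hp0 : (p : ℚ) ≠ 0 := by exact_mod_cast hp.out.ne_zero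
  have hp1 : (1 : ℚ) ≤ p := by exact_mod_cast hp.out.one_le
  have hv : 2 * padicValNat p j.factorial ≤ j := by
    have h1 := sub_one_mul_padicValNat_factorial (p := p) j
    have h2 : 2 * padicValNat p j.factorial ≤ (p - 1) * padicValNat p j.factorial :=
      Nat.mul_le_mul_right _ (by omega)
    omega
  have hf : padicNorm p (j.factorial : ℚ) = ((p : ℚ)⁻¹) ^ padicValNat p j.factorial := by
    rw [padicNorm.eq_zpow_of_nonzero (by exact_mod_cast j.factorial_ne_zero), padicValRat.of_nat,
      zpow_neg, zpow_natCast, inv_pow]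
  have hpow : padicNorm p ((p : ℚ) ^ j) = ((p : ℚ)⁻¹) ^ j := by
    rw [IsAbsoluteValue.abv_pow (padicNorm p), padicNorm.padicNorm_p_of_prime]
  rw [padicNorm.div, padicNorm.mul, hpow, hf,
    div_le_iff₀ (by positivity), ← pow_add]
  calc ((p : ℚ)⁻¹) ^ j * padicNorm p b ≤ ((p : ℚ)⁻¹) ^ j * 1 :=
        mul_le_mul_of_nonneg_left (padicNorm.of_int b) (by positivity)
    _ ≤ _ := by
        rw [mul_one]
        exact pow_le_pow_of_le_one (by positivity) (inv_le_one_of_one_le₀ hp1) (by omega)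

/-- A convergent `p`-adic binomial series with infinitely many integer zeros vanishes. -/
lemma binomial_series_eq_zero (p : ℕ) [hp : Fact p.Prime] (hp2 : 2 < p) (b : ℕ → ℤ) (u : ℕ → ℤ)
    (hu : ∀ n, u n = ∑ j ∈ Finset.range (n + 1), (n.choose j : ℤ) * p ^ j * b j)
    (h : {n | u n = 0}.Infinite) (t : ℕ) : u t = 0 := by
  classical
  have key : ∀ k, padicNorm p (u t) ≤ ((p : ℚ)⁻¹) ^ k := by
    intro k
    obtain ⟨Z, hZ, hZk⟩ := h.exists_subset_card_eq (2 * k)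
    obtain ⟨m, hm⟩ : ∃ m, ∀ z ∈ insert t Z, z ≤ m := ⟨(insert t Z).sup id, fun z hz =>
      Finset.le_sup (f := id) hz⟩
    let c : ℕ → ℚ := fun j => (p : ℚ) ^ j * b j / j.factorial
    let Q : ℤ[X] := ∏ z ∈ Z, (X - C (z : ℤ))
    have hQ : Q.Monic := monic_prod_of_monic _ _ fun z _ => monic_X_sub_C _
    have hQdeg : Q.natDegree = 2 * k := by
      rw [natDegree_prod_of_monic _ _ fun z _ => monic_X_sub_C _]
      rw [Finset.sum_congr rfl fun z _ => natDegree_X_sub_C _]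
      simp [hZk]
    have hval : ∀ n ≤ m, (u n : ℚ) = ∑ j ∈ Finset.range (m + 1),
        c j * (((descPochhammer ℤ j).eval (n : ℤ) : ℤ) : ℚ) := by
      intro n hn
      rw [hu]
      push_cast
      rw [Finset.sum_subset (Finset.range_mono (by omega : n + 1 ≤ m + 1)) fun j _ hj => by
        rw [Nat.choose_eq_zero_of_lt (by simpa using hj)]; simp]
      refine Finset.sum_congr rfl fun j _ => ?_
      rw [descPochhammer_eval_eq_descFactorial, Nat.descFactorial_eq_factorial_mul_choose]
      have : (j.factorial : ℚ) ≠ 0 := by exact_mod_cast j.factorial_ne_zero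
      simp only [c]
      push_cast
      field_simp
    have hdiv : ∀ j (n : ℤ), (descPochhammer ℤ j).eval n =
        (descPochhammer ℤ j %ₘ Q).eval n + Q.eval n * (descPochhammer ℤ j /ₘ Q).eval n := by
      intro j n
      conv_lhs => rw [← modByMonic_add_div (descPochhammer ℤ j) Q]
      rw [eval_add, eval_mul]
    let R : ℚ[X] := ∑ j ∈ Finset.range (m + 1),
      C (c j) * (descPochhammer ℤ j %ₘ Q).map (Int.castRingHom ℚ)
    have hR : R = 0 := by
      by_cases hk : k = 0
      · have : Q = 1 := by
          rw [hk] at hQdeg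
          exact hQ.natDegree_eq_zero.1 hQdeg
        simp [R, this]
      refine eq_zero_of_natDegree_lt_card_of_eval_eq_zero' R (Z.map ⟨fun n : ℕ => (n : ℚ), Nat.cast_injective⟩) ?_ ?_
      · intro x hx
        obtain ⟨z, hz, rfl⟩ := Finset.mem_map.1 hx
        have h1 := hval z (hm z (Finset.mem_insert_of_mem hz))
        rw [show u z = 0 from hZ hz, Int.cast_zero] at h1
        have hQz : Q.eval (z : ℤ) = 0 := by
          rw [eval_prod]
          exact Finset.prod_eq_zero hz (by simp)
        simp only [hdiv, hQz, zero_mul, add_zero] at h1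
        simp only [R, eval_finsetSum, eval_mul, eval_C, Function.Embedding.coeFn_mk]
        rw [h1]
        refine Finset.sum_congr rfl fun j _ => ?_
        congr 1
        simp
      · rw [Finset.card_map, hZk]
        refine (natDegree_sum_le_of_forall_le _ _ (n := 2 * k - 1) fun j _ => ?_).trans_lt (by omega)
        refine (natDegree_C_mul_le _ _).trans ((natDegree_map_le).trans ?_)
        have := natDegree_modByMonic_lt (descPochhammer ℤ j) hQ (fun h => by
          rw [h, natDegree_one] at hQdeg; omega)
        omega
    have hut : (u t : ℚ) = ∑ j ∈ Finset.range (m + 1),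
        c j * ((Q.eval (t : ℤ) * (descPochhammer ℤ j /ₘ Q).eval (t : ℤ) : ℤ) : ℚ) := by
      rw [hval t (hm t (Finset.mem_insert_self _ _))]
      have h1 := congrArg (eval (t : ℚ)) hR
      simp only [R, eval_finsetSum, eval_mul, eval_C, eval_zero] at h1
      rw [← sub_eq_zero, ← Finset.sum_sub_distrib, ← h1]
      refine Finset.sum_congr rfl fun j _ => ?_
      have := eval_intCast_map (Int.castRingHom ℚ) (descPochhammer ℤ j %ₘ Q) t
      rw [hdiv]
      simp only [Int.cast_natCast, eq_intCast] at this
      rw [this]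
      push_cast
      ring
    rw [hut]
    refine padicNorm.sum_le' (fun j _ => ?_) (by positivity)
    by_cases hj : 2 * k ≤ j
    · rw [padicNorm.mul]
      exact (mul_le_of_le_one_right (padicNorm.nonneg _) (padicNorm.of_int _)).trans
        (padicNorm_pow_div_factorial_le p hp2 (b j) k j hj)
    · have h0 : descPochhammer ℤ j /ₘ Q = 0 := by
        rw [divByMonic_eq_zero_iff hQ]
        refine degree_lt_degree ?_
        rw [hQdeg, descPochhammer_natDegree]
        omega
      rw [h0]
      simp
  by_contra hne
  have hpos : 0 < padicNorm p (u t) :=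
    lt_of_le_of_ne (padicNorm.nonneg _) (Ne.symm (padicNorm.nonzero (by exact_mod_cast hne)))
  obtain ⟨k, hk⟩ := exists_pow_lt_of_lt_one hpos
    (inv_lt_one_of_one_lt₀ (by exact_mod_cast hp.out.one_lt : (1 : ℚ) < p))
  exact absurd (key k) (not_le.2 hk)

end

noncomputable section

open NumberField

lemma exists_pow_eq_one_add_mul {K : Type*} [Field K] [NumberField K] {I : Type*} [Fintype I]
    (g : I → 𝓞 K) (hg : ∀ i, g i ≠ 0) : ∃ p : ℕ, p.Prime ∧ 2 < p ∧ ∃ N : ℕ, 0 < N ∧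
      ∃ h : I → 𝓞 K, ∀ i, g i ^ N = 1 + (p : 𝓞 K) * h i := by
  classical
  let m : I → ℕ := fun i => Ideal.absNorm (Ideal.span {g i})
  have hm0 : ∀ i, m i ≠ 0 := fun i => by
    rw [Ne, Ideal.absNorm_eq_zero_iff, Ideal.span_singleton_eq_bot]
    exact hg i
  obtain ⟨p, hpm, hp⟩ := Nat.exists_infinite_primes (∏ i, m i + 3)
  have hcop : ∀ i, Nat.Coprime (m i) p := fun i => by
    refine ((Nat.Prime.coprime_iff_not_dvd hp).2 fun hd => ?_).symm
    have h1 : p ∣ ∏ i, m i := hd.trans (Finset.dvd_prod_of_mem _ (Finset.mem_univ i))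
    have := Nat.le_of_dvd (Nat.pos_of_ne_zero (Finset.prod_ne_zero_iff.2 fun i _ => hm0 i)) h1
    omega
  let J : Ideal (𝓞 K) := Ideal.span {(p : 𝓞 K)}
  have hfin : Finite (𝓞 K ⧸ J) := J.finiteQuotientOfFreeOfNeBot (by
    rw [Ne, Ideal.span_singleton_eq_bot]
    exact_mod_cast hp.ne_zero)
  have hunit : ∀ i, IsUnit (Ideal.Quotient.mk J (g i)) := fun i => by
    have h1 : g i ∣ (m i : 𝓞 K) := Ideal.mem_span_singleton.1 (Ideal.absNorm_mem _)
    have h2 : IsCoprime (g i) (p : 𝓞 K) := by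
      have h3 : IsCoprime ((m i : ℕ) : 𝓞 K) (p : 𝓞 K) := by
        have := (Nat.isCoprime_iff_coprime.2 (hcop i)).map (Int.castRingHom (𝓞 K))
        simpa using this
      exact h3.of_isCoprime_of_dvd_left h1
    obtain ⟨a, b, hab⟩ := h2
    refine IsUnit.of_mul_eq_one (Ideal.Quotient.mk J a) ?_
    rw [← map_mul, ← (Ideal.Quotient.mk J).map_one, Ideal.Quotient.eq, Ideal.mem_span_singleton]
    exact ⟨-b, by linear_combination hab⟩
  refine ⟨p, hp, by omega, Nat.card (𝓞 K ⧸ J)ˣ, Nat.card_pos, ?_⟩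
  have hex : ∀ i, ∃ h : 𝓞 K, g i ^ Nat.card (𝓞 K ⧸ J)ˣ = 1 + (p : 𝓞 K) * h := fun i => by
    obtain ⟨w, hw⟩ := hunit i
    have h1 : Ideal.Quotient.mk J (g i ^ Nat.card (𝓞 K ⧸ J)ˣ) = Ideal.Quotient.mk J 1 := by
      rw [map_pow, ← hw, ← Units.val_pow_eq_pow_val, pow_card_eq_one', Units.val_one, map_one]
    rw [Ideal.Quotient.eq, Ideal.mem_span_singleton] at h1
    obtain ⟨h, hh⟩ := h1
    exact ⟨h, by linear_combination hh⟩
  choose h hh using hex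
  exact ⟨h, hh⟩

/-- If an exponential sum has infinitely many zeros, it vanishes on an arithmetic progression. -/
lemma exists_progression_of_infinite_zeros {K : Type*} [Field K] [NumberField K] {I : Type*}
    [Fintype I] (g : I → 𝓞 K) (hg : ∀ i, g i ≠ 0) (κ : I → 𝓞 K)
    (hz : {n | ∑ i, κ i * g i ^ n = 0}.Infinite) :
    ∃ N a : ℕ, 0 < N ∧ ∀ k, ∑ i, κ i * g i ^ (a + N * k) = 0 := by
  classical
  obtain ⟨p, hp, hp2, N, hN, h, hh⟩ := exists_pow_eq_one_add_mul g hg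
  have : Fact p.Prime := ⟨hp⟩
  obtain ⟨a, ha⟩ := hz.exists_infinite_fiber (fun n => (⟨n % N, Nat.mod_lt _ hN⟩ : Fin N))
  refine ⟨N, a, hN, fun k => ?_⟩
  let b := RingOfIntegers.basis K
  let c : ℕ → 𝓞 K := fun j => ∑ i, κ i * g i ^ (a : ℕ) * h i ^ j
  have hsum : ∀ k, ∑ i, κ i * g i ^ ((a : ℕ) + N * k) =
      ∑ j ∈ Finset.range (k + 1), ((k.choose j : ℤ) * (p : ℤ) ^ j) • c j := by
    intro k
    simp only [c, Finset.smul_sum]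
    rw [Finset.sum_comm]
    refine Finset.sum_congr rfl fun i _ => ?_
    rw [pow_add, pow_mul, hh, add_comm 1, add_pow, ← mul_assoc, Finset.mul_sum]
    refine Finset.sum_congr rfl fun j _ => ?_
    rw [zsmul_eq_mul, mul_pow]
    push_cast
    ring
  refine b.ext_elem fun l => ?_
  rw [map_zero, Finsupp.zero_apply]
  refine binomial_series_eq_zero p hp2 (fun j => b.repr (c j) l)
    (fun k => b.repr (∑ i, κ i * g i ^ ((a : ℕ) + N * k)) l) (fun k => ?_) ?_ k
  · simp only [hsum, map_sum, Finsupp.coe_finsetSum, Finset.sum_apply, map_smul, Finsupp.smul_apply,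
      smul_eq_mul]
  · refine Set.Infinite.of_image (fun k => (a : ℕ) + N * k) (ha.mono ?_)
    rintro n ⟨hn, hna⟩
    have h1 : n % N = a := congrArg Fin.val hna
    refine ⟨n / N, ?_, ?_⟩
    · have h2 : (a : ℕ) + N * (n / N) = n := by rw [← h1]; exact Nat.mod_add_div n N
      have h3 : ∑ i, κ i * g i ^ n = 0 := hn
      simp only [Set.mem_ofPred_eq, h2, h3, map_zero, Finsupp.zero_apply]
    · change (a : ℕ) + N * (n / N) = n
      rw [← h1]; exact Nat.mod_add_div n N

/-- An exponential sum whose bases have no ratio a root of unity has only finitely many zeros. -/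
theorem eq_zero_of_infinite_zeros {K : Type*} [Field K] [NumberField K] {I : Type*}
    [Fintype I] (g : I → 𝓞 K) (hg : ∀ i, g i ≠ 0)
    (hinj : ∀ N : ℕ, 0 < N → Function.Injective fun i => g i ^ N) (κ : I → K)
    (hz : {n | ∑ i, κ i * (g i : K) ^ n = 0}.Infinite) : κ = 0 := by
  classical
  obtain ⟨D, hD, hDκ⟩ := exists_int_mul_isIntegral κ
  let κ' : I → 𝓞 K := fun i => ⟨(D : K) * κ i, hDκ i⟩
  obtain ⟨N, a, hN, hzero⟩ := exists_progression_of_infinite_zeros g hg κ' (hz.mono fun n hn => by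
    have hn' : ∑ i, κ i * (g i : K) ^ n = 0 := hn
    change ∑ i, κ' i * g i ^ n = 0
    apply RingOfIntegers.coe_injective
    rw [map_sum, map_zero, ← mul_zero (D : K), ← hn', Finset.mul_sum]
    refine Finset.sum_congr rfl fun i _ => ?_
    rw [map_mul, map_pow]
    exact mul_assoc _ _ _)
  let e := Fintype.equivFin I
  have hv := Matrix.eq_zero_of_forall_pow_sum_mul_pow_eq_zero (R := 𝓞 K)
    (f := fun j => g (e.symm j) ^ N) (v := fun j => κ' (e.symm j) * g (e.symm j) ^ a)
    ((hinj N hN).comp e.symm.injective) fun k => by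
      rw [← hzero k, ← Equiv.sum_comp e.symm]
      refine Finset.sum_congr rfl fun j _ => ?_
      rw [pow_add, pow_mul, mul_assoc]
  ext i
  have h1 := congrFun hv (e i)
  simp only [Equiv.symm_apply_apply, Pi.zero_apply] at h1
  have h2 := (mul_eq_zero.1 h1).resolve_right (pow_ne_zero _ (hg i))
  have h3 : (D : K) * κ i = 0 := congrArg (algebraMap (𝓞 K) K) h2
  exact (mul_eq_zero.1 h3).resolve_left (by exact_mod_cast hD)

theorem det_updateRow_one_ne_zero {K I : Type*} [Field K] [Fintype I] [DecidableEq I] (i₀ : I)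
    (r : I → K) (hr : r i₀ ≠ 0) : ((1 : Matrix I I K).updateRow i₀ r).det ≠ 0 := by
  intro h
  obtain ⟨v, hv, h0⟩ := Matrix.exists_mulVec_eq_zero_iff.2 h
  have h1 : ∀ i, i ≠ i₀ → v i = 0 := fun i hi => by
    have := congrFun h0 i
    simpa [Matrix.mulVec, dotProduct, Matrix.updateRow_ne hi, Matrix.one_apply] using this
  apply hv
  ext i
  by_cases hi : i = i₀
  · have := congrFun h0 i₀
    simp only [Matrix.mulVec, dotProduct, Matrix.updateRow_self, Pi.zero_apply] at this
    rw [Finset.sum_eq_single i₀ (fun k _ hk => by rw [h1 k hk, mul_zero]) (by simp)] at this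
    rw [hi]
    exact (mul_eq_zero.1 this).resolve_left hr
  · exact h1 i hi

/-- The subspace theorem when a single linear form is exceptionally small at the places in `H`
and all the other forms are coordinates. -/
theorem exists_relation_of_small_form {K : Type*} [Field K] [NumberField K] [IsGalois ℚ K]
    (φ : K →+* ℂ) (j : K) (hj : φ j = Complex.I) (ρ : K ≃ₐ[ℚ] K)
    (hρ : ∀ x, φ (ρ x) = starRingEnd ℂ (φ x)) {I : Type*} [Fintype I] [DecidableEq I]
    (g : I → 𝓞 K) (hg : ∀ k, g k ≠ 0) (i₀ : I) (H : Set (K ≃ₐ[ℚ] K)) (hH : H.Nonempty)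
    (hHρ : ∀ τ, ρ * τ ∈ H ↔ τ ∈ H) (r : (K ≃ₐ[ℚ] K) → I → K) (hr : ∀ τ, r τ i₀ ≠ 0)
    (hrρ : ∀ τ, r (ρ * τ) = r τ) (ε : ℝ) (hε : 0 < ε) (T : Set ℕ) (hT : T.Infinite)
    (x : ℕ → I → 𝓞 K)
    (hone : ∀ n ∈ T, ∀ τ i, ¬(τ ∈ H ∧ i = i₀) → ‖φ (τ (x n i))‖ ≤ 1)
    (hsmall : ∀ n ∈ T, ∀ τ ∈ H, ‖φ (τ (∑ k, r τ k * ((g k : K) ^ n * x n k)))‖ ≤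
      (‖φ (τ (g i₀))‖ * Real.exp (-ε)) ^ n) :
    ∃ η : I → K, η ≠ 0 ∧ {n | n ∈ T ∧ ∑ k, η k * ((g k : K) ^ n * x n k) = 0}.Infinite := by
  classical
  have hpos : ∀ τ : K ≃ₐ[ℚ] K, ∀ i, 0 < ‖φ (τ (g i))‖ := fun τ i => by
    rw [norm_pos_iff, map_ne_zero, map_ne_zero]
    exact fun h => hg i (RingOfIntegers.coe_injective (by simpa using h))
  refine exists_relation_of_small_forms φ j hj ρ hρ g hg
    (fun τ => if τ ∈ H then (1 : Matrix I I K).updateRow i₀ (r τ) else 1) (fun τ => ?_)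
    (fun τ => by simp only [hHρ, hrρ])
    (fun τ i => Real.log ‖φ (τ (g i))‖ - if τ ∈ H ∧ i = i₀ then ε else 0) ?_ T hT x ?_
  · split_ifs
    · exact det_updateRow_one_ne_zero _ _ (hr τ)
    · simp
  · obtain ⟨τ₀, hτ₀⟩ := hH
    have hle : ∀ τ : K ≃ₐ[ℚ] K, ∀ i, (Real.log ‖φ (τ (g i))‖ - if τ ∈ H ∧ i = i₀ then ε else 0) ≤
        Real.log ‖φ (τ (g i))‖ := fun τ i => by split_ifs <;> linarith
    refine Finset.sum_lt_sum (fun τ _ => Finset.sum_le_sum fun i _ => hle τ i)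
      ⟨τ₀, Finset.mem_univ _, Finset.sum_lt_sum (fun i _ => hle τ₀ i) ⟨i₀, Finset.mem_univ _, ?_⟩⟩
    rw [if_pos ⟨hτ₀, rfl⟩]
    linarith
  · intro n hn τ i
    by_cases hi : τ ∈ H ∧ i = i₀
    · obtain ⟨h1, rfl⟩ := hi
      simp only [Matrix.updateRow_self, h1, true_and, if_true]
      refine (hsmall n hn τ h1).trans (le_of_eq ?_)
      rw [Real.exp_nat_mul, sub_eq_add_neg, Real.exp_add, Real.exp_log (hpos τ i)]
    · have hrow : ∑ k, (if τ ∈ H then (1 : Matrix I I K).updateRow i₀ (r τ) else 1) i k *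
          ((g k : K) ^ n * x n k) = (g i : K) ^ n * x n i := by
        have : (if τ ∈ H then (1 : Matrix I I K).updateRow i₀ (r τ) else 1) i =
            (1 : Matrix I I K) i := by
          split_ifs with h1
          · exact Matrix.updateRow_ne fun h2 => hi ⟨h1, h2⟩
          · rfl
        simp [this, Matrix.one_apply]
      rw [hrow, if_neg hi, sub_zero, Real.exp_nat_mul, Real.exp_log (hpos τ i)]
      simp only [map_mul, map_pow, norm_mul, norm_pow]
      exact mul_le_of_le_one_right (by positivity) (hone n hn τ i hi)

/-- If `l * a ^ n + b` is exponentially close to an integer for infinitely many `n`, where no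
nontrivial ratio of two elements among `1` and the conjugates of `a` is a root of unity, then
`b` is rational. -/
theorem mem_range_of_near_integers {K : Type*} [Field K] [NumberField K] [IsGalois ℚ K]
    (φ : K →+* ℂ) (j : K) (hj : φ j = Complex.I) (ρ : K ≃ₐ[ℚ] K)
    (hρ : ∀ x, φ (ρ x) = starRingEnd ℂ (φ x)) (a b l : K) (ha : a ≠ 0) (haρ : ρ a = a)
    (hbρ : ρ b = b) (hlρ : ρ l = l)
    (hroot : ∀ N : ℕ, 0 < N → ∀ σ : K ≃ₐ[ℚ] K, σ a ^ N = a ^ N → σ a = a)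
    (hroot₁ : ∀ N : ℕ, 0 < N → a ^ N ≠ 1) (ε : ℝ) (hε : 0 < ε) (T : Set ℕ) (hT : T.Infinite)
    (m : ℕ → ℤ) (hm : ∀ n ∈ T, ‖φ (l * a ^ n + b - m n)‖ ≤ Real.exp (-ε) ^ n) :
    b ∈ Set.range (algebraMap ℚ K) := by
  classical
  by_contra hb
  let S : Finset K := insert 1 (Finset.univ.image fun σ : K ≃ₐ[ℚ] K => σ a)
  have hS : ∀ x, x ∈ S ↔ x = 1 ∨ ∃ σ : K ≃ₐ[ℚ] K, σ a = x := fun x => by simp [S]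
  have hSσ : ∀ σ : K ≃ₐ[ℚ] K, ∀ x ∈ S, σ x ∈ S := fun σ x hx => by
    rw [hS] at hx ⊢
    rcases hx with rfl | ⟨τ, rfl⟩
    · exact Or.inl (map_one σ)
    · exact Or.inr ⟨σ * τ, rfl⟩
  let o : S := ⟨1, (hS 1).2 (Or.inl rfl)⟩
  let al : (K ≃ₐ[ℚ] K) → S := fun τ => ⟨τ a, (hS _).2 (Or.inr ⟨τ, rfl⟩)⟩
  have hconj : ∀ N : ℕ, 0 < N → ∀ σ : K ≃ₐ[ℚ] K, σ a ^ N ≠ 1 := fun N hN σ h => by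
    rw [← map_pow, map_eq_one_iff σ σ.injective] at h
    exact hroot₁ N hN h
  have halo : ∀ τ, al τ ≠ o := fun τ h => hconj 1 one_pos τ (by
    rw [pow_one]; exact congrArg Subtype.val h)
  have hSinj : ∀ N : ℕ, 0 < N → ∀ x ∈ S, ∀ y ∈ S, x ^ N = y ^ N → x = y := by
    intro N hN x hx y hy hxy
    rw [hS] at hx hy
    rcases hx with rfl | ⟨σ, rfl⟩ <;> rcases hy with rfl | ⟨τ, rfl⟩
    · rfl
    · exact absurd (by rw [← hxy, one_pow]) (hconj N hN τ)
    · exact absurd (by rw [hxy, one_pow]) (hconj N hN σ)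
    · have h1 : (τ⁻¹ * σ) a ^ N = a ^ N := by
        have := congrArg (τ⁻¹ : K ≃ₐ[ℚ] K) hxy
        rw [map_pow, map_pow, ← AlgEquiv.mul_apply, ← AlgEquiv.mul_apply, inv_mul_cancel] at this
        exact this
      have h2 := congrArg τ (hroot N hN _ h1)
      rwa [← AlgEquiv.mul_apply, mul_inv_cancel_left] at h2
  have hS0 : ∀ x ∈ S, x ≠ 0 := fun x hx => by
    rcases (hS x).1 hx with rfl | ⟨σ, rfl⟩
    · exact one_ne_zero
    · exact (map_ne_zero σ).2 ha
  obtain ⟨D, hD, hDS⟩ := exists_int_mul_isIntegral (fun x : S => (x : K))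
  have hDK : (D : K) ≠ 0 := by exact_mod_cast hD
  let g : S → 𝓞 K := fun x => ⟨(D : K) * x, hDS x⟩
  have hgc : ∀ x, ((g x : 𝓞 K) : K) = (D : K) * x := fun x => rfl
  have hg : ∀ x, g x ≠ 0 := fun x h => by
    have : (D : K) * x = 0 := congrArg (algebraMap (𝓞 K) K) h
    exact mul_ne_zero hDK (hS0 x x.2) this
  have hinj : ∀ N : ℕ, 0 < N → Function.Injective fun x => g x ^ N := fun N hN x y hxy => by
    have h1 : ((D : K) * x) ^ N = ((D : K) * y) ^ N := by
      have := congrArg (algebraMap (𝓞 K) K) hxy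
      rwa [map_pow, map_pow] at this
    rw [mul_pow, mul_pow] at h1
    exact Subtype.ext (hSinj N hN x x.2 y y.2 (mul_left_cancel₀ (pow_ne_zero _ hDK) h1))
  have hDnorm : ∀ n (z : K), ‖φ z‖ ≤ Real.exp (-ε) ^ n →
      ‖φ ((D : K) ^ n * z)‖ ≤ (‖φ (D : K)‖ * Real.exp (-ε)) ^ n := fun n z hz => by
    rw [map_mul, map_pow, norm_mul, norm_pow, mul_pow]
    exact mul_le_mul_of_nonneg_left hz (by positivity)
  -- the nearest integers satisfy a linear relation with the powers of the conjugates
  obtain ⟨κ, T₁, hT₁, hT₁T, hκ⟩ : ∃ κ : S → K, ∃ T₁ : Set ℕ, T₁.Infinite ∧ T₁ ⊆ T ∧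
      ∀ n ∈ T₁, (m n : K) = ∑ x, κ x * (x : K) ^ n := by
    let g' : Option S → 𝓞 K := fun i => i.elim (D : 𝓞 K) g
    have hg' : ∀ i, g' i ≠ 0 := fun i => by
      cases i with
      | none => exact Int.cast_ne_zero.2 hD
      | some x => exact hg x
    obtain ⟨η, hη, hinf⟩ := exists_relation_of_small_form φ j hj ρ hρ g' hg' none Set.univ
      Set.univ_nonempty (fun τ => by simp)
      (fun τ i => i.elim (-1) fun x => (if x = al τ⁻¹ then (τ⁻¹ : K ≃ₐ[ℚ] K) l else 0) +
        if x = o then (τ⁻¹ : K ≃ₐ[ℚ] K) b else 0) (fun τ => by simp)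
      (fun τ => by
        have hi : ∀ z, ρ z = z → (ρ⁻¹ : K ≃ₐ[ℚ] K) z = z := fun z hz => by
          conv_lhs => rw [← hz, ← AlgEquiv.mul_apply, inv_mul_cancel]
          rfl
        have hal : al (ρ * τ)⁻¹ = al τ⁻¹ := Subtype.ext (by
          change (ρ * τ)⁻¹ a = τ⁻¹ a
          rw [mul_inv_rev, AlgEquiv.mul_apply, hi a haρ])
        ext i
        rw [hal, mul_inv_rev, AlgEquiv.mul_apply, AlgEquiv.mul_apply, hi l hlρ, hi b hbρ])
      ε hε T hT (fun n i => i.elim (m n : 𝓞 K) fun _ => 1)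
      (fun n _ τ i hi => by
        cases i with
        | none => simp at hi
        | some x => simp)
      (fun n hn τ _ => by
        have hcalc : τ (∑ k : Option S, (k.elim (-1) fun x =>
            (if x = al τ⁻¹ then (τ⁻¹ : K ≃ₐ[ℚ] K) l else 0) +
            if x = o then (τ⁻¹ : K ≃ₐ[ℚ] K) b else 0) * (((g' k : 𝓞 K) : K) ^ n *
            ((k.elim (m n : 𝓞 K) fun _ => 1 : 𝓞 K) : K))) =
            (D : K) ^ n * (l * a ^ n + b - m n) := by
          have hτ : ∀ z, τ ((τ⁻¹ : K ≃ₐ[ℚ] K) z) = z := fun z => by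
            rw [← AlgEquiv.mul_apply, mul_inv_cancel]; rfl
          have h1 : (((g' none : 𝓞 K)) : K) = D := map_intCast (algebraMap (𝓞 K) K) D
          have h2 : ∀ x, ((g' (some x) : 𝓞 K) : K) = D * x := fun x => rfl
          have h3 : ((al τ⁻¹ : S) : K) = (τ⁻¹ : K ≃ₐ[ℚ] K) a := rfl
          have h4 : ((o : S) : K) = 1 := rfl
          rw [Fintype.sum_option]
          simp only [Option.elim_none, Option.elim_some, h1, h2, add_mul, ite_mul, zero_mul,
            Finset.sum_add_distrib, Finset.sum_ite_eq', Finset.mem_univ, if_true, h3, h4, map_add,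
            map_mul, map_pow, map_neg, map_one, map_intCast, hτ, mul_one]
          ring
        rw [hcalc]
        have h1 : τ ((g' none : 𝓞 K) : K) = D := by
          have : (((g' none : 𝓞 K)) : K) = D := map_intCast (algebraMap (𝓞 K) K) D
          rw [this, map_intCast]
        rw [h1]
        exact hDnorm n _ (hm n hn))
    have hrel : ∀ n, ∑ k : Option S, η k * (((g' k : 𝓞 K) : K) ^ n *
        ((k.elim (m n : 𝓞 K) fun _ => 1 : 𝓞 K) : K)) = 0 →
        η none * (D ^ n * m n) + ∑ x, η (some x) * ((g x : 𝓞 K) : K) ^ n = 0 := fun n h => by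
      rw [Fintype.sum_option] at h
      have h1 : (((g' none : 𝓞 K)) : K) = D := map_intCast (algebraMap (𝓞 K) K) D
      have h2 : ∀ x, ((g' (some x) : 𝓞 K) : K) = (g x : 𝓞 K) := fun x => rfl
      simpa only [Option.elim_none, Option.elim_some, h1, h2, map_one, map_intCast, mul_one] using h
    have hη0 : η none ≠ 0 := fun h0 => by
      have := eq_zero_of_infinite_zeros g hg hinj (fun x => η (some x)) (hinf.mono fun n hn => by
        have := hrel n hn.2
        rwa [h0, zero_mul, zero_add] at this)
      refine hη (funext fun i => ?_)
      cases i with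
      | none => exact h0
      | some x => exact congrFun this x
    refine ⟨fun x => -η (some x) / η none, _, hinf, fun n hn => hn.1, fun n hn => ?_⟩
    have h1 := hrel n hn.2
    have h2 : ∑ x, η (some x) * ((g x : 𝓞 K) : K) ^ n =
        D ^ n * ∑ x : S, η (some x) * (x : K) ^ n := by
      rw [Finset.mul_sum]
      refine Finset.sum_congr rfl fun x _ => ?_
      rw [hgc, mul_pow]; ring
    rw [h2] at h1
    have h3 : η none * m n + ∑ x : S, η (some x) * (x : K) ^ n = 0 := by
      refine (mul_eq_zero.1 (?_ : (D : K) ^ n * _ = 0)).resolve_left (pow_ne_zero _ hDK)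
      rw [← h1]; ring
    have h4 : ∑ x : S, -η (some x) / η none * (x : K) ^ n =
        -(∑ x : S, η (some x) * (x : K) ^ n) / η none := by
      rw [← Finset.sum_neg_distrib, Finset.sum_div]
      exact Finset.sum_congr rfl fun x _ => by ring
    rw [h4, eq_div_iff hη0]
    linear_combination h3
  -- the coefficient of the constant term is fixed by the Galois group
  have hκo : κ o ∈ Set.range (algebraMap ℚ K) := by
    rw [IsGalois.mem_range_algebraMap_iff_fixed]
    intro σ
    let e : S ≃ S :=
      { toFun := fun x => ⟨σ x, hSσ σ x x.2⟩
        invFun := fun x => ⟨(σ⁻¹ : K ≃ₐ[ℚ] K) x, hSσ _ x x.2⟩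
        left_inv := fun x => Subtype.ext (σ.symm_apply_apply x)
        right_inv := fun x => Subtype.ext (σ.apply_symm_apply x) }
    have he : e o = o := Subtype.ext (map_one σ)
    have := eq_zero_of_infinite_zeros g hg hinj (fun y => κ y - σ (κ (e.symm y)))
      (hT₁.mono fun n hn => by
        have h1 := hκ n hn
        have h2 : (m n : K) = ∑ y : S, σ (κ (e.symm y)) * (y : K) ^ n := by
          rw [← Equiv.sum_comp e]
          have := congrArg σ h1
          rw [map_intCast, map_sum] at this
          rw [this]
          refine Finset.sum_congr rfl fun x _ => ?_
          rw [map_mul, map_pow, Equiv.symm_apply_apply]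
          rfl
        change ∑ y, (κ y - σ (κ (e.symm y))) * ((g y : 𝓞 K) : K) ^ n = 0
        have h3 : ∑ y, (κ y - σ (κ (e.symm y))) * ((g y : 𝓞 K) : K) ^ n =
            D ^ n * (∑ y : S, κ y * (y : K) ^ n - ∑ y : S, σ (κ (e.symm y)) * (y : K) ^ n) := by
          rw [← Finset.sum_sub_distrib, Finset.mul_sum]
          refine Finset.sum_congr rfl fun y _ => ?_
          rw [hgc, mul_pow]; ring
        rw [h3, ← h1, ← h2, sub_self, mul_zero])
    have h5 := congrFun this o
    have h6 : e.symm o = o := by rw [Equiv.symm_apply_eq, he]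
    simp only [h6, Pi.zero_apply] at h5
    exact (sub_eq_zero.1 h5).symm
  have hbκ : b - κ o ≠ 0 := fun h => hb (by rwa [sub_eq_zero.1 h])
  have hρρ : ρ * ρ = 1 := AlgEquiv.ext fun z => φ.injective (by
    rw [AlgEquiv.mul_apply, hρ, hρ, Complex.conj_conj]; rfl)
  obtain ⟨η, hη, hinf⟩ := exists_relation_of_small_form φ j hj ρ hρ g hg o {1, ρ}
    ⟨1, by simp⟩
    (fun τ => by
      simp only [Set.mem_insert_iff, Set.mem_singleton_iff, mul_eq_left]
      rw [or_comm, ← hρρ, mul_right_inj])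
    (fun _ x => (if x = al 1 then l else 0) + (if x = o then b else 0) - κ x)
    (fun _ => by
      simp only [if_neg (halo 1).symm, if_true, zero_add]
      exact hbκ)
    (fun _ => rfl) ε hε T₁ hT₁ (fun _ _ => 1) (fun _ _ τ i _ => by simp)
    (fun n hn τ hτ => by
      have hcalc : (∑ x : S, ((if x = al 1 then l else 0) + (if x = o then b else 0) - κ x) *
          (((g x : 𝓞 K) : K) ^ n * ((1 : 𝓞 K) : K))) = (D : K) ^ n * (l * a ^ n + b - m n) := by
        have h3 : ((al 1 : S) : K) = a := rfl
        have h4 : ((o : S) : K) = 1 := rfl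
        rw [hκ n hn]
        simp only [hgc, map_one, mul_one, sub_mul, add_mul, ite_mul, zero_mul,
          Finset.sum_sub_distrib, Finset.sum_add_distrib, Finset.sum_ite_eq', Finset.mem_univ,
          if_true, h3, h4, mul_pow, mul_sub, mul_add, one_pow, Finset.mul_sum]
        congr 1
        · ring
        · exact Finset.sum_congr rfl fun x _ => by ring
      have hnorm : ∀ z : K, ‖φ (τ z)‖ = ‖φ z‖ := fun z => by
        rcases hτ with rfl | rfl
        · rfl
        · rw [hρ, RCLike.norm_conj]
      rw [hcalc, hnorm, hnorm]
      have h4 : ((g o : 𝓞 K) : K) = D := by rw [hgc]; exact mul_one _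
      rw [h4]
      exact hDnorm n _ (hm n (hT₁T hn)))
  refine hη (eq_zero_of_infinite_zeros g hg hinj η (hinf.mono fun n hn => ?_))
  change ∑ i, η i * (g i : K) ^ n = 0
  simpa only [map_one, mul_one] using hn.2

theorem exists_pow_eq_of_pow_eq {G K : Type*} [Fintype G] [Monoid K] (f : G → K) (a : K) :
    ∃ M : ℕ, 0 < M ∧ ∀ σ : G, ∀ N : ℕ, 0 < N → f σ ^ N = a ^ N → f σ ^ M = a ^ M := by
  classical
  have h : ∀ σ : G, ∃ M : ℕ, 0 < M ∧ ∀ N : ℕ, 0 < N → f σ ^ N = a ^ N → f σ ^ M = a ^ M := by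
    intro σ
    by_cases hσ : ∃ N : ℕ, 0 < N ∧ f σ ^ N = a ^ N
    · obtain ⟨N, hN, h⟩ := hσ
      exact ⟨N, hN, fun _ _ _ => h⟩
    · exact ⟨1, one_pos, fun N hN h => absurd ⟨N, hN, h⟩ hσ⟩
  choose M hM h using h
  refine ⟨∏ σ, M σ, Finset.prod_pos fun σ _ => hM σ, fun σ N hN hσ => ?_⟩
  obtain ⟨d, hd⟩ := Finset.dvd_prod_of_mem M (Finset.mem_univ σ)
  rw [hd, pow_mul, pow_mul, h σ N hN hσ]

/-- If `l * a ^ n + b` is exponentially close to an integer for infinitely many `n`, where `a` is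
not a root of unity, then `b` is rational. -/
theorem mem_range_of_near_integers_of_pow_ne_one {K : Type*} [Field K] [NumberField K]
    [IsGalois ℚ K] (φ : K →+* ℂ) (j : K) (hj : φ j = Complex.I) (ρ : K ≃ₐ[ℚ] K)
    (hρ : ∀ x, φ (ρ x) = starRingEnd ℂ (φ x)) (a b l : K) (ha : a ≠ 0) (haρ : ρ a = a)
    (hbρ : ρ b = b) (hlρ : ρ l = l) (hroot₁ : ∀ N : ℕ, 0 < N → a ^ N ≠ 1) (ε : ℝ) (hε : 0 < ε)
    (T : Set ℕ) (hT : T.Infinite) (m : ℕ → ℤ)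
    (hm : ∀ n ∈ T, ‖φ (l * a ^ n + b - m n)‖ ≤ Real.exp (-ε) ^ n) :
    b ∈ Set.range (algebraMap ℚ K) := by
  obtain ⟨M, hM, hroot⟩ := exists_pow_eq_of_pow_eq (fun σ : K ≃ₐ[ℚ] K => σ a) a
  obtain ⟨r, hr⟩ := hT.exists_infinite_fiber
    (fun n => (⟨n % M, Nat.mod_lt n hM⟩ : Fin M))
  have hT' : {k : ℕ | (r : ℕ) + M * k ∈ T}.Infinite := by
    refine Set.Infinite.of_image (fun k => (r : ℕ) + M * k) (hr.mono ?_)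
    rintro n ⟨hn, hnr⟩
    have h1 : n % M = r := congrArg Fin.val hnr
    have h2 : (r : ℕ) + M * (n / M) = n := by rw [← h1]; exact Nat.mod_add_div n M
    exact ⟨n / M, by simpa only [Set.mem_ofPred_eq, h2] using hn, h2⟩
  refine mem_range_of_near_integers φ j hj ρ hρ (a ^ M) b (l * a ^ (r : ℕ)) (pow_ne_zero _ ha)
    (by rw [map_pow, haρ]) hbρ (by rw [map_mul, map_pow, haρ, hlρ])
    (fun N hN σ h => by
      rw [map_pow, ← pow_mul, ← pow_mul] at h
      rw [map_pow]
      exact hroot σ _ (Nat.mul_pos hM hN) h)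
    (fun N hN h => hroot₁ _ (Nat.mul_pos hM hN) (by rw [pow_mul, h]))
    (ε * M) (by positivity) _ hT' (fun k => m (r + M * k)) fun k hk => ?_
  have h1 := hm _ hk
  have h2 : l * a ^ (r : ℕ) * (a ^ M) ^ k = l * a ^ ((r : ℕ) + M * k) := by
    rw [pow_add, pow_mul]; ring
  rw [h2]
  refine h1.trans ?_
  rw [← Real.exp_nat_mul, ← Real.exp_nat_mul, Real.exp_le_exp]
  push_cast
  have : 0 ≤ ε * (r : ℕ) := by positivity
  linarith

theorem not_irrational_of_near_integers (α β l : ℝ) (hα : 1 < α) (hαalg : IsAlgebraic ℚ α)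
    (hβalg : IsAlgebraic ℚ β) (hlalg : IsAlgebraic ℚ l) (ε : ℝ) (hε : 0 < ε)
    (T : Set ℕ) (hT : T.Infinite) (m : ℕ → ℤ)
    (hm : ∀ n ∈ T, |l * α ^ n + β - m n| ≤ Real.exp (-ε) ^ n) : ¬Irrational β := by
  have hI : IsAlgebraic ℚ Complex.I :=
    ⟨Polynomial.X ^ 2 + 1, (Polynomial.monic_X_pow_add_C (1 : ℚ) two_ne_zero).ne_zero, by simp⟩
  have hreal : ∀ x : ℝ, IsAlgebraic ℚ x → IsAlgebraic ℚ (x : ℂ) := fun x hx =>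
    hx.algebraMap (A := ℂ)
  let f : Fin 4 → ℂ := ![(α : ℂ), β, l, Complex.I]
  have hf : ∀ i, IsAlgebraic ℚ (f i) := fun i => by
    fin_cases i
    exacts [hreal α hαalg, hreal β hβalg, hreal l hlalg, hI]
  let p : Polynomial ℚ := ∏ i, minpoly ℚ (f i)
  have hp : p ≠ 0 := Finset.prod_ne_zero_iff.2 fun i _ => minpoly.ne_zero (hf i).isIntegral
  let K : IntermediateField ℚ ℂ := IntermediateField.adjoin ℚ (p.rootSet ℂ)
  have hK : ∀ i, f i ∈ K := fun i => by
    refine IntermediateField.subset_adjoin ℚ _ ((Polynomial.mem_rootSet_of_ne hp).2 ?_)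
    rw [map_prod]
    exact Finset.prod_eq_zero (Finset.mem_univ i) (minpoly.aeval ℚ (f i))
  have : p.IsSplittingField ℚ K :=
    IntermediateField.adjoin_rootSet_isSplittingField (IsAlgClosed.splits _)
  have : FiniteDimensional ℚ K := Polynomial.IsSplittingField.finiteDimensional K p
  have : NumberField K := ⟨⟩
  have : Normal ℚ K := Normal.of_isSplittingField p
  have : IsGalois ℚ K := ⟨⟩
  let φ : K →+* ℂ := algebraMap K ℂ
  let c : ℂ ≃ₐ[ℚ] ℂ := Complex.conjAe.restrictScalars ℚ
  let ρ : K ≃ₐ[ℚ] K := c.restrictNormal K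
  have hρ : ∀ x, φ (ρ x) = starRingEnd ℂ (φ x) := fun x => c.restrictNormal_commutes K x
  have hρreal : ∀ (x : K) (y : ℝ), φ x = y → ρ x = x := fun x y hxy => φ.injective (by
    rw [hρ, hxy, Complex.conj_ofReal])
  let a : K := ⟨α, hK 0⟩
  let b : K := ⟨β, hK 1⟩
  let l' : K := ⟨l, hK 2⟩
  have hφa : φ a = (α : ℂ) := rfl
  have hφb : φ b = (β : ℂ) := rfl
  have hφl : φ l' = (l : ℂ) := rfl
  have h := mem_range_of_near_integers_of_pow_ne_one φ ⟨Complex.I, hK 3⟩ rfl ρ hρ a b l'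
    (fun h => by
      have h1 : (α : ℂ) = 0 := by rw [← hφa, h, map_zero]
      have h2 : α = 0 := by exact_mod_cast h1
      linarith) (hρreal a α hφa) (hρreal b β hφb) (hρreal l' l hφl)
    (fun N hN h => by
      have h1 : (α : ℂ) ^ N = 1 := by rw [← hφa, ← map_pow, h, map_one]
      have h2 : α ^ N = 1 := by exact_mod_cast h1
      exact (one_lt_pow₀ hα hN.ne').ne' h2) ε hε T hT m (fun n hn => by
      rw [map_sub, map_add, map_mul, map_pow, map_intCast, hφa, hφb, hφl]
      refine le_of_eq_of_le ?_ (hm n hn)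
      rw [← Real.norm_eq_abs, ← Complex.norm_real]
      push_cast
      rfl)
  obtain ⟨q, hq⟩ := h
  refine not_not.2 (⟨q, ?_⟩ : β ∈ Set.range ((↑) : ℚ → ℝ))
  have h1 : ((q : ℚ) : ℂ) = (β : ℂ) := by rw [← hφb, ← hq]; simp
  exact_mod_cast h1

end

/-- Let `α > 1` be a real number, `β` an irrational real algebraic number,
`λ` a nonzero real algebraic number and `ε > 0`. If there are infinitely many natural
numbers `n` with `‖λ·αⁿ + β‖ < 2^(−εn)`, then `α` is transcendental. -/
theorem stmt1 (α : ℝ) (hα : 1 < α)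
    (β : ℝ) (hβalg : IsAlgebraic ℚ β) (hβirr : Irrational β)
    (lam : ℝ) (hlam0 : lam ≠ 0) (hlamalg : IsAlgebraic ℚ lam)
    (ε : ℝ) (hε : 0 < ε)
    (h : {n : ℕ | distNearestInt (lam * α ^ n + β) < (2 : ℝ) ^ (-(ε * n))}.Infinite) :
    Transcendental ℚ α := by
  intro hαalg
  choose! m hm using fun n (hn : n ∈ {n : ℕ | distNearestInt (lam * α ^ n + β) <
    (2 : ℝ) ^ (-(ε * n))}) => exists_lt_of_ciInf_lt (f := fun k : ℤ => |lam * α ^ n + β - k|) hn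
  refine not_irrational_of_near_integers α β lam hα hαalg hβalg hlamalg (ε * Real.log 2)
    (mul_pos hε (Real.log_pos one_lt_two)) _ h m (fun n hn => ?_) hβirr
  refine (hm n hn).le.trans (le_of_eq ?_)
  rw [Real.rpow_def_of_pos two_pos, ← Real.exp_nat_mul]
  congr 1
  ring
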